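/- Let p ∈ (1,2] and p' = p/(p−1). There exists a constant γ_p > 0 such that for every g ∈ L^p[0,1], the maximal Fourier transform restricted to the real line satisfies ∫_{−∞}^{∞} ( 𝓕[g](x) )^{p'} dx ≤ γ_p · ‖g‖_{L^p[0,1]}^{p'} ; that is, 𝓕 maps L^p[0,1] boundedly into L^{p'}(ℝ). -/

import Mathlib

open MeasureTheory
open scoped ENNReal

/-- The "maximal" Fourier transform `𝓕[g](λ) = sup_{x ∈ [0,1]} |∫₀ˣ g(t) e^{iλt} dt|`. -/
noncomputable def maxFourier (g : ℝ → ℂ) (lam : ℂ) : ℝ :=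
  ⨆ x : Set.Icc (0:ℝ) 1, ‖∫ t in (0:ℝ)..(x : ℝ), g t * Complex.exp (Complex.I * lam * t)‖

/-- The `L^p`-norm of `g` on `[0,1]`. -/
noncomputable def lpNorm01 (p : ℝ) (g : ℝ → ℂ) : ℝ :=
  (∫ t in (0:ℝ)..1, ‖g t‖ ^ p) ^ (1 / p)

namespace Carleson

open FourierTransform
open scoped ContDiff ComplexConjugate

/-- The basic decay profile `1 / (1 + |u|)`. -/
noncomputable def decay (u : ℝ) : ℝ := (1 + |u|)⁻¹

lemma decay_pos (u : ℝ) : 0 < decay u := by unfold decay; positivity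

lemma decay_nonneg (u : ℝ) : 0 ≤ decay u := (decay_pos u).le

lemma decay_le_one (u : ℝ) : decay u ≤ 1 := by
  unfold decay
  exact inv_le_one_of_one_le₀ (by linarith [abs_nonneg u])

lemma decay_neg (u : ℝ) : decay (-u) = decay u := by simp [decay]

lemma decay_sub_comm (u v r : ℝ) : decay ((u - v) / r) = decay ((v - u) / r) := by
  rw [← decay_neg, ← neg_div, neg_sub]

lemma decay_anti {u v : ℝ} (h : |u| ≤ |v|) : decay v ≤ decay u := by
  unfold decay
  gcongr

lemma decay_mul_le (u v : ℝ) : decay u * decay v ≤ decay (u + v) := by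
  unfold decay
  rw [← mul_inv]
  gcongr
  nlinarith [abs_add_le u v, abs_nonneg u, abs_nonneg v, mul_nonneg (abs_nonneg u) (abs_nonneg v)]

lemma decay_mul_sub_le (x y z r : ℝ) :
    decay ((x - y) / r) * decay ((y - z) / r) ≤ decay ((x - z) / r) := by
  refine (decay_mul_le _ _).trans_eq ?_
  congr 1; ring

lemma decay_div_mono {r r' : ℝ} (hr : 0 < r') (h : r' ≤ r) (z : ℝ) :
    decay (z / r') ≤ decay (z / r) := by
  apply decay_anti
  rw [abs_div, abs_div, abs_of_pos hr, abs_of_pos (hr.trans_le h)]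
  gcongr

lemma decay_le_two_mul {x y c r : ℝ} (hr : 0 < r) (h : |y - c| ≤ r) :
    decay ((x - c) / r) ≤ 2 * decay ((x - y) / r) := by
  have h1 : (1:ℝ) / 2 ≤ decay ((c - y) / r) := by
    unfold decay
    rw [abs_div, abs_of_pos hr, abs_sub_comm, one_div]
    gcongr
    have : |y - c| / r ≤ 1 := by rw [div_le_one hr]; exact h
    linarith
  have h2 := decay_mul_sub_le x c y r
  nlinarith [decay_nonneg ((x - c) / r)]

lemma decay_pow_le_pow {m n : ℕ} (h : m ≤ n) (u : ℝ) : decay u ^ n ≤ decay u ^ m :=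
  pow_le_pow_of_le_one (decay_nonneg u) (decay_le_one u) h

@[fun_prop]
lemma continuous_decay : Continuous decay := by
  unfold decay
  exact Continuous.inv₀ (by fun_prop) (fun x => by positivity)

@[fun_prop]
lemma measurable_decay : Measurable decay := continuous_decay.measurable

lemma decay_sq_le (u : ℝ) : decay u ^ 2 ≤ (1 + u ^ 2)⁻¹ := by
  unfold decay
  rw [inv_pow]
  gcongr
  nlinarith [sq_abs u, abs_nonneg u]

lemma integrable_decay_pow {n : ℕ} (hn : 2 ≤ n) : Integrable (fun u => decay u ^ n) := by
  refine integrable_inv_one_add_sq.mono' (by fun_prop) (Filter.Eventually.of_forall fun u => ?_)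
  rw [Real.norm_of_nonneg (pow_nonneg (decay_nonneg u) n)]
  exact (decay_pow_le_pow hn u).trans (decay_sq_le u)

lemma integral_decay_pow_le {n : ℕ} (hn : 2 ≤ n) : ∫ u, decay u ^ n ≤ 4 := by
  calc ∫ u, decay u ^ n ≤ ∫ u : ℝ, (1 + u ^ 2)⁻¹ := by
        refine integral_mono (integrable_decay_pow hn) integrable_inv_one_add_sq fun u => ?_
        exact (decay_pow_le_pow hn u).trans (decay_sq_le u)
    _ = Real.pi := integral_univ_inv_one_add_sq
    _ ≤ 4 := Real.pi_le_four

lemma integrable_decay_scaled {n : ℕ} (hn : 2 ≤ n) {r : ℝ} (hr : 0 < r) (c : ℝ) :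
    Integrable (fun y => decay ((y - c) / r) ^ n) :=
  ((integrable_decay_pow hn).comp_div hr.ne').comp_sub_right c

lemma integrable_decay_scaled' {n : ℕ} (hn : 2 ≤ n) {r : ℝ} (hr : 0 < r) (c : ℝ) :
    Integrable (fun y => decay ((c - y) / r) ^ n) := by
  simpa only [decay_sub_comm] using integrable_decay_scaled hn hr c

lemma integral_decay_scaled_le {n : ℕ} (hn : 2 ≤ n) {r : ℝ} (hr : 0 < r) (c : ℝ) :
    ∫ y, decay ((y - c) / r) ^ n ≤ 4 * r := by
  rw [integral_sub_right_eq_self (fun y => decay (y / r) ^ n) c,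
    Measure.integral_comp_div (fun y => decay y ^ n) r, abs_of_pos hr, smul_eq_mul, mul_comm]
  gcongr
  exact integral_decay_pow_le hn

lemma integral_decay_scaled_le' {n : ℕ} (hn : 2 ≤ n) {r : ℝ} (hr : 0 < r) (c : ℝ) :
    ∫ y, decay ((c - y) / r) ^ n ≤ 4 * r := by
  simpa only [decay_sub_comm] using integral_decay_scaled_le hn hr c

lemma lintegral_decay_scaled_le {n : ℕ} (hn : 2 ≤ n) {r : ℝ} (hr : 0 < r) (c : ℝ) :
    ∫⁻ y, ENNReal.ofReal (decay ((y - c) / r) ^ n) ≤ ENNReal.ofReal (4 * r) := by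
  rw [← ofReal_integral_eq_lintegral_ofReal (integrable_decay_scaled hn hr c)
    (Filter.Eventually.of_forall fun y => pow_nonneg (decay_nonneg _) n)]
  exact ENNReal.ofReal_le_ofReal (integral_decay_scaled_le hn hr c)

lemma decay_pow_four_le_of_between {x y e r : ℝ} (hr : 0 < r)
    (h : (x ≤ e ∧ e ≤ y) ∨ (y ≤ e ∧ e ≤ x)) :
    decay ((x - y) / r) ^ 4 ≤ decay ((x - e) / r) ^ 2 * decay ((y - e) / r) ^ 2 := by
  have hx : decay ((x - y) / r) ≤ decay ((x - e) / r) := by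
    apply decay_anti
    rw [abs_div, abs_div]
    gcongr ?_ / _
    rcases h with h | h
    · rw [abs_of_nonpos (by linarith), abs_of_nonpos (by linarith)]; linarith
    · rw [abs_of_nonneg (by linarith), abs_of_nonneg (by linarith)]; linarith
  have hy : decay ((x - y) / r) ≤ decay ((y - e) / r) := by
    apply decay_anti
    rw [abs_div, abs_div]
    gcongr ?_ / _
    rcases h with h | h
    · rw [abs_of_nonneg (by linarith), abs_of_nonpos (by linarith)]; linarith
    · rw [abs_of_nonpos (by linarith), abs_of_nonneg (by linarith)]; linarith
  have h0 := decay_nonneg ((x - y) / r)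
  calc decay ((x - y) / r) ^ 4 = decay ((x - y) / r) ^ 2 * decay ((x - y) / r) ^ 2 := by ring
    _ ≤ _ := by gcongr

/-- Interaction of an interval with its complement at scale `r`. -/
lemma lintegral_lintegral_decay_compl_le {a b r : ℝ} (hr : 0 < r) :
    ∫⁻ x in Set.Ico a b, ∫⁻ y in (Set.Ico a b)ᶜ, ENNReal.ofReal (decay ((x - y) / r) ^ 4) ≤
      ENNReal.ofReal (32 * r ^ 2) := by
  have key : ∀ x ∈ Set.Ico a b, ∀ y ∈ (Set.Ico a b)ᶜ, ENNReal.ofReal (decay ((x - y) / r) ^ 4) ≤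
      ENNReal.ofReal (decay ((x - a) / r) ^ 2) * ENNReal.ofReal (decay ((y - a) / r) ^ 2) +
      ENNReal.ofReal (decay ((x - b) / r) ^ 2) * ENNReal.ofReal (decay ((y - b) / r) ^ 2) := by
    intro x hx y hy
    rw [← ENNReal.ofReal_mul (by positivity), ← ENNReal.ofReal_mul (by positivity)]
    rw [Set.mem_compl_iff, Set.mem_Ico, not_and_or, not_le, not_lt] at hy
    rcases hy with hy | hy
    · refine le_trans (ENNReal.ofReal_le_ofReal ?_) le_self_add
      exact decay_pow_four_le_of_between hr (Or.inr ⟨hy.le, hx.1⟩)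
    · refine le_trans (ENNReal.ofReal_le_ofReal ?_) le_add_self
      exact decay_pow_four_le_of_between hr (Or.inl ⟨hx.2.le, hy⟩)
  have I := fun e => lintegral_decay_scaled_le (n := 2) le_rfl hr e
  calc _ ≤ ∫⁻ x in Set.Ico a b, ∫⁻ y in (Set.Ico a b)ᶜ,
      (ENNReal.ofReal (decay ((x - a) / r) ^ 2) * ENNReal.ofReal (decay ((y - a) / r) ^ 2) +
      ENNReal.ofReal (decay ((x - b) / r) ^ 2) * ENNReal.ofReal (decay ((y - b) / r) ^ 2)) :=
        setLIntegral_mono' measurableSet_Ico fun x hx =>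
          setLIntegral_mono' measurableSet_Ico.compl fun y hy => key x hx y hy
    _ ≤ ∫⁻ x, ∫⁻ y, 
      (ENNReal.ofReal (decay ((x - a) / r) ^ 2) * ENNReal.ofReal (decay ((y - a) / r) ^ 2) +
      ENNReal.ofReal (decay ((x - b) / r) ^ 2) * ENNReal.ofReal (decay ((y - b) / r) ^ 2)) := by
        refine (setLIntegral_le_lintegral _ _).trans (lintegral_mono fun x => ?_)
        exact setLIntegral_le_lintegral _ _
    _ = (∫⁻ x, ENNReal.ofReal (decay ((x - a) / r) ^ 2)) *
          (∫⁻ x, ENNReal.ofReal (decay ((x - a) / r) ^ 2)) +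
        (∫⁻ x, ENNReal.ofReal (decay ((x - b) / r) ^ 2)) *
          (∫⁻ x, ENNReal.ofReal (decay ((x - b) / r) ^ 2)) := by
        rw [← lintegral_mul_const _ (by fun_prop), ← lintegral_mul_const _ (by fun_prop),
          ← lintegral_add_left (by fun_prop)]
        refine lintegral_congr fun x => ?_
        rw [lintegral_add_left (by fun_prop), lintegral_const_mul _ (by fun_prop),
          lintegral_const_mul _ (by fun_prop)]
    _ ≤ ENNReal.ofReal (4 * r) * ENNReal.ofReal (4 * r) +
        ENNReal.ofReal (4 * r) * ENNReal.ofReal (4 * r) := by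
        gcongr <;> exact I _
    _ = _ := by
        rw [← ENNReal.ofReal_mul (by positivity), ← ENNReal.ofReal_add (by positivity) (by positivity)]
        congr 1; ring

/-! ### Kernels -/

/-- Smooth compactly supported Fourier symbols. -/
structure Sym (φ : ℝ → ℂ) : Prop where
  contDiff : ContDiff ℝ ∞ φ
  hasCompactSupport : HasCompactSupport φ

/-- The Schwartz function associated with a symbol. -/
noncomputable def Sym.toSchwartz {φ : ℝ → ℂ} (h : Sym φ) : SchwartzMap ℝ ℂ :=
  h.hasCompactSupport.toSchwartzMap h.contDiff

lemma Sym.coe_toSchwartz {φ : ℝ → ℂ} (h : Sym φ) : (h.toSchwartz : ℝ → ℂ) = φ := rfl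

lemma Sym.mul {φ ψ : ℝ → ℂ} (h : Sym φ) (h' : Sym ψ) : Sym (fun t => φ t * ψ t) :=
  ⟨h.contDiff.mul h'.contDiff, h.hasCompactSupport.mul_right⟩

lemma Sym.comp_affine {φ : ℝ → ℂ} (h : Sym φ) {s : ℝ} (hs : s ≠ 0) (m : ℝ) :
    Sym (fun t => φ (s * t - m)) := by
  refine ⟨h.contDiff.comp (by fun_prop), ?_⟩
  have := h.hasCompactSupport.comp_homeomorph
    ((Homeomorph.mulLeft₀ s hs).trans (Homeomorph.subRight m))
  exact this

/-- The convolution kernel of the Fourier multiplier with symbol `φ`. -/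
noncomputable def ker (φ : ℝ → ℂ) (z : ℝ) : ℂ := 𝓕⁻ φ z

lemma ker_eq_coe {φ : ℝ → ℂ} (h : Sym φ) : ker φ = (𝓕⁻ h.toSchwartz : SchwartzMap ℝ ℂ) := by
  rw [SchwartzMap.fourierInv_coe]; rfl

lemma continuous_ker {φ : ℝ → ℂ} (h : Sym φ) : Continuous (ker φ) := by
  rw [ker_eq_coe h]; exact SchwartzMap.continuous _

lemma integrable_ker {φ : ℝ → ℂ} (h : Sym φ) : Integrable (ker φ) := by
  rw [ker_eq_coe h]; exact SchwartzMap.integrable _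

lemma ker_apply (φ : ℝ → ℂ) (z : ℝ) : ker φ z = ∫ v : ℝ, (Real.fourierChar (v * z) : ℂ) * φ v := by
  rw [ker, Real.fourierInv_eq]
  refine integral_congr_ae (Filter.Eventually.of_forall fun v => ?_)
  simp [Circle.smul_def, mul_comm]

lemma conj_fourierChar (x : ℝ) :
    conj (Real.fourierChar x : ℂ) = (Real.fourierChar (-x) : ℂ) := by
  rw [AddChar.map_neg_eq_inv, Circle.coe_inv_eq_conj]

lemma conj_ker {φ : ℝ → ℂ} (hφ : ∀ t, conj (φ t) = φ t) (z : ℝ) : conj (ker φ z) = ker φ (-z) := by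
  rw [ker_apply, ker_apply, ← integral_conj]
  congr 1
  ext v
  rw [map_mul, hφ, conj_fourierChar, mul_neg]

lemma ker_comp_affine (φ : ℝ → ℂ) {s : ℝ} (hs : 0 < s) (m z : ℝ) :
    ker (fun t => φ (s * t - m)) z =
      (s⁻¹ : ℝ) * ((Real.fourierChar (m * (z / s)) : ℂ) * ker φ (z / s)) := by
  rw [ker_apply, ker_apply]
  have h1 : (fun v : ℝ => (Real.fourierChar (v * z) : ℂ) * φ (s * v - m)) =
      fun v => (fun u : ℝ => (Real.fourierChar ((u + m) * (z / s)) : ℂ) * φ u) (s * v - m) := by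
    ext v
    simp only
    congr 3
    field_simp
    ring
  rw [h1]
  have h2 := Measure.integral_comp_mul_left
    (fun w => (fun u : ℝ => (Real.fourierChar ((u + m) * (z / s)) : ℂ) * φ u) (w - m)) s
  rw [h2, integral_sub_right_eq_self (fun u : ℝ => (Real.fourierChar ((u + m) * (z / s)) : ℂ) * φ u) m,
    abs_of_pos (inv_pos.mpr hs), Complex.real_smul]
  congr 1
  rw [← integral_const_mul]
  congr 1
  ext u
  rw [add_mul, AddChar.map_add_eq_mul, Circle.coe_mul]
  ring

lemma norm_fourierChar (x : ℝ) : ‖(Real.fourierChar x : ℂ)‖ = 1 := Circle.norm_coe _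

lemma exists_ker_decay {φ : ℝ → ℂ} (h : Sym φ) :
    ∃ C : ℝ, 0 < C ∧ (∀ z, ‖ker φ z‖ ≤ C * decay z ^ 20) ∧
      (∀ z, ‖deriv (ker φ) z‖ ≤ C * decay z ^ 20) := by
  set K : SchwartzMap ℝ ℂ := 𝓕⁻ h.toSchwartz with hK
  set C : ℝ := 2 ^ 20 * ((Finset.Iic (20, 1)).sup fun m => SchwartzMap.seminorm ℝ m.1 m.2) K with hC
  have key : ∀ n ≤ 1, ∀ z, ‖iteratedFDeriv ℝ n K z‖ ≤ (C + 1) * decay z ^ 20 := by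
    intro n hn z
    have := SchwartzMap.one_add_le_sup_seminorm_apply (𝕜 := ℝ) (m := (20, 1)) (k := 20) (n := n)
      le_rfl hn K z
    unfold decay
    rw [inv_pow, ← div_eq_mul_inv, le_div_iff₀ (by positivity), mul_comm]
    rw [Real.norm_eq_abs] at this
    simp only at this
    linarith
  have hC0 : 0 ≤ C := mul_nonneg (by positivity) (apply_nonneg _ _)
  refine ⟨C + 1, by positivity, fun z => ?_, fun z => ?_⟩
  · have := key 0 (by norm_num) z
    rwa [norm_iteratedFDeriv_zero, hK, ← ker_eq_coe h] at this
  · have := key 1 (by norm_num) z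
    rwa [norm_iteratedFDeriv_one, hK, ← ker_eq_coe h, ← norm_deriv_eq_norm_fderiv] at this

lemma differentiable_ker {φ : ℝ → ℂ} (h : Sym φ) : Differentiable ℝ (ker φ) := by
  rw [ker_eq_coe h]; exact SchwartzMap.differentiable _

lemma exists_norm_ker_affine_le {φ : ℝ → ℂ} (h : Sym φ) :
    ∃ C : ℝ, 0 < C ∧ (∀ s > 0, ∀ m z, ‖ker (fun t => φ (s * t - m)) z‖ ≤
        C * s⁻¹ * decay (z / s) ^ 20) ∧
      (∀ s > 0, ∀ m z z' ξ, |z - z'| ≤ s → |m - s * ξ| ≤ 1 →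
        ‖(Real.fourierChar (-(ξ * z)) : ℂ) * ker (fun t => φ (s * t - m)) z -
          (Real.fourierChar (-(ξ * z')) : ℂ) * ker (fun t => φ (s * t - m)) z'‖ ≤
        C * s⁻¹ * (|z - z'| / s) * decay (z' / s) ^ 20) := by
  obtain ⟨C, hC, h1, h2⟩ := exists_ker_decay h
  have A : ∀ s > 0, ∀ m z, ‖ker (fun t => φ (s * t - m)) z‖ ≤ C * s⁻¹ * decay (z / s) ^ 20 := by
    intro s hs m z
    rw [ker_comp_affine φ hs, norm_mul, norm_mul, norm_fourierChar, one_mul,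
      Complex.norm_real, Real.norm_of_nonneg (by positivity)]
    calc _ ≤ s⁻¹ * (C * decay (z / s) ^ 20) := by gcongr; exact h1 _
      _ = _ := by ring
  set C' := (2 * Real.pi + 1) * C * 2 ^ 20 with hC'
  have hpi := Real.pi_pos
  have hCC : C ≤ C' := by nlinarith
  refine ⟨C', by positivity, fun s hs m z => (A s hs m z).trans ?_, ?_⟩
  · have := decay_nonneg (z / s)
    gcongr
  intro s hs m z z' ξ hz hm
  set θ := m - s * ξ with hθ
  set M : ℝ → ℂ := fun u => (Real.fourierChar (θ * u) : ℂ) * ker φ u with hM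
  have e1 : ∀ z, (Real.fourierChar (-(ξ * z)) : ℂ) * ker (fun t => φ (s * t - m)) z =
      (s⁻¹ : ℝ) * M (z / s) := by
    intro z
    rw [ker_comp_affine φ hs, hM]
    have : Real.fourierChar (θ * (z / s)) =
        Real.fourierChar (-(ξ * z)) * Real.fourierChar (m * (z / s)) := by
      rw [← AddChar.map_add_eq_mul]
      congr 1
      rw [hθ]; field_simp; ring
    simp only [this, Circle.coe_mul]
    ring
  have hder : ∀ u, HasDerivAt M ((2 * Real.pi * Complex.I * θ * (Real.fourierChar (θ * u) : ℂ)) * ker φ u +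
      (Real.fourierChar (θ * u) : ℂ) * deriv (ker φ) u) u := by
    intro u
    refine HasDerivAt.mul ?_ (differentiable_ker h u).hasDerivAt
    have : HasDerivAt (fun u : ℝ => Complex.exp (((2 * Real.pi * θ : ℝ) : ℂ) * (u : ℂ) * Complex.I))
       (Complex.exp (((2 * Real.pi * θ : ℝ) : ℂ) * (u : ℂ) * Complex.I) *
        (((2 * Real.pi * θ : ℝ) : ℂ) * 1 * Complex.I)) u :=
      (((Complex.ofRealCLM.hasDerivAt (x := u)).const_mul _).mul_const _).cexp
    have e2 : ∀ u : ℝ, (Real.fourierChar (θ * u) : ℂ) =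
        Complex.exp (((2 * Real.pi * θ : ℝ) : ℂ) * (u : ℂ) * Complex.I) := by
      intro u; rw [Real.fourierChar_apply]; congr 1; push_cast; ring
    simp only [e2]
    refine this.congr_deriv ?_
    push_cast
    ring
  have hderb : ∀ u, ‖deriv M u‖ ≤ (2 * Real.pi + 1) * C * decay u ^ 20 := by
    intro u
    rw [(hder u).deriv]
    refine (norm_add_le _ _).trans ?_
    simp only [norm_mul, norm_fourierChar, Complex.norm_I, Complex.norm_real, mul_one, one_mul,
      Complex.norm_ofNat, Real.norm_of_nonneg hpi.le]
    have := decay_nonneg u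
    have t1 : 2 * Real.pi * ‖θ‖ * ‖ker φ u‖ ≤ 2 * Real.pi * 1 * (C * decay u ^ 20) := by
      gcongr
      · exact hm
      · exact h1 u
    have := h2 u
    linarith
  rw [e1, e1, ← mul_sub, norm_mul, Complex.norm_real, Real.norm_of_nonneg (by positivity)]
  have hzz : |z / s - z' / s| = |z - z'| / s := by rw [← sub_div, abs_div, abs_of_pos hs]
  have mv : ‖M (z / s) - M (z' / s)‖ ≤ (C' * decay (z' / s) ^ 20) * ‖z / s - z' / s‖ := by
    refine Convex.norm_image_sub_le_of_norm_deriv_le (s := segment ℝ (z' / s) (z / s))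
      (fun u _ => (hder u).differentiableAt) (fun u hu => ?_) (convex_segment _ _)
      (left_mem_segment _ _ _) (right_mem_segment _ _ _)
    refine (hderb u).trans ?_
    have hu' : |z' / s - u| ≤ 1 := by
      have h3 := norm_sub_le_of_mem_segment hu
      rw [Real.norm_eq_abs, Real.norm_eq_abs, hzz] at h3
      rw [abs_sub_comm]
      exact h3.trans (by rw [div_le_one hs]; exact hz)
    have h5 : decay u ≤ 2 * decay (z' / s) := by
      have := decay_le_two_mul (x := u) (y := z' / s) (c := u) (r := 1) one_pos hu'
      have h6 := decay_le_two_mul (x := 0) (y := z' / s) (c := u) (r := 1) one_pos hu'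
      simpa [decay_neg] using h6
    have hp : decay u ^ 20 ≤ (2 * decay (z' / s)) ^ 20 := by
      gcongr
      exact decay_nonneg u
    calc _ ≤ (2 * Real.pi + 1) * C * (2 * decay (z' / s)) ^ 20 := by gcongr
      _ = _ := by rw [mul_pow]; ring
  rw [Real.norm_eq_abs, hzz] at mv
  calc _ ≤ s⁻¹ * (C' * decay (z' / s) ^ 20 * (|z - z'| / s)) := by gcongr
    _ = _ := by ring

/-! ### Bounded integrable functions -/

/-- Bounded integrable functions. -/
structure Nice (f : ℝ → ℂ) : Prop where
  integrable : Integrable f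
  bdd : ∃ C, ∀ x, ‖f x‖ ≤ C

namespace Nice
variable {f g : ℝ → ℂ}

lemma aesm (hf : Nice f) : AEStronglyMeasurable f volume := hf.integrable.1

lemma zero : Nice (fun _ => 0) := ⟨integrable_zero _ _ _, 0, by simp⟩

lemma add (hf : Nice f) (hg : Nice g) : Nice (fun x => f x + g x) := by
  obtain ⟨C, hC⟩ := hf.bdd
  obtain ⟨D, hD⟩ := hg.bdd
  exact ⟨hf.integrable.add hg.integrable, C + D, fun x =>
    (norm_add_le _ _).trans (add_le_add (hC x) (hD x))⟩

lemma sum {ι : Type*} {s : Finset ι} {F : ι → ℝ → ℂ} (h : ∀ i ∈ s, Nice (F i)) :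
    Nice (fun x => ∑ i ∈ s, F i x) := by
  classical
  induction s using Finset.induction_on with
  | empty => simpa using zero
  | insert i s hi ih =>
    simp only [Finset.sum_insert hi]
    exact (h i (Finset.mem_insert_self i s)).add
      (ih fun j hj => h j (Finset.mem_insert_of_mem hj))

lemma bdd_mul (hf : Nice f) (hg : AEStronglyMeasurable g volume) {C : ℝ} (hC : ∀ x, ‖g x‖ ≤ C) :
    Nice (fun x => g x * f x) := by
  obtain ⟨D, hD⟩ := hf.bdd
  refine ⟨hf.integrable.bdd_mul hg (Filter.Eventually.of_forall hC), C * D, fun x => ?_⟩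
  rw [norm_mul]
  exact mul_le_mul (hC x) (hD x) (norm_nonneg _) ((norm_nonneg _).trans (hC x))

lemma mul (hf : Nice f) (hg : Nice g) : Nice (fun x => f x * g x) :=
  hg.bdd_mul hf.aesm hf.bdd.choose_spec

lemma const_mul (hf : Nice f) (c : ℂ) : Nice (fun x => c * f x) :=
  hf.bdd_mul aestronglyMeasurable_const (fun _ => le_rfl)

lemma indicator (hf : Nice f) {s : Set ℝ} (hs : MeasurableSet s) : Nice (s.indicator f) := by
  obtain ⟨D, hD⟩ := hf.bdd
  exact ⟨hf.integrable.indicator hs, D, fun x => (norm_indicator_le_norm_self f x).trans (hD x)⟩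

lemma star (hf : Nice f) : Nice (fun x => conj (f x)) := by
  obtain ⟨D, hD⟩ := hf.bdd
  exact ⟨Complex.conjLIE.toContinuousLinearEquiv.toContinuousLinearMap.integrable_comp
    hf.integrable, D, fun x => by simpa using hD x⟩

lemma integrable_mul_conj (hf : Nice f) (hg : Nice g) :
    Integrable (fun x => f x * (starRingEnd ℂ) (g x)) := (hf.mul hg.star).integrable

lemma integrable_norm_mul (hf : Nice f) (hg : Nice g) : Integrable (fun x => ‖f x‖ * ‖g x‖) := by
  simpa using (hf.mul hg).integrable.norm

lemma integrable_sq (hf : Nice f) : Integrable (fun x => ‖f x‖ ^ 2) := by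
  simpa [sq] using hf.integrable_norm_mul hf

lemma integrable_sq_mul (hf : Nice f) {w : ℝ → ℝ} (hw : Continuous w) {C : ℝ} (hC : ∀ x, |w x| ≤ C) :
    Integrable (fun x => ‖f x‖ ^ 2 * w x) := by
  simpa [mul_comm] using hf.integrable_sq.bdd_mul hw.aestronglyMeasurable
    (Filter.Eventually.of_forall hC)

end Nice

/-- The sesquilinear pairing `∫ f \bar g`. -/
noncomputable def ip (f g : ℝ → ℂ) : ℂ := ∫ x, f x * conj (g x)

/-- The square of the `L²` norm. -/
noncomputable def nsq (f : ℝ → ℂ) : ℝ := ∫ x, ‖f x‖ ^ 2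

lemma nsq_nonneg (f : ℝ → ℂ) : 0 ≤ nsq f := integral_nonneg fun _ => by positivity

lemma ip_self (f : ℝ → ℂ) : ip f f = nsq f := by
  rw [ip, nsq, ← integral_complex_ofReal]
  congr 1; ext x
  rw [Complex.mul_conj, Complex.normSq_eq_norm_sq]

lemma conj_ip (f g : ℝ → ℂ) : conj (ip f g) = ip g f := by
  rw [ip, ip, ← integral_conj]
  congr 1; ext x
  simp [mul_comm]

lemma norm_ip_comm (f g : ℝ → ℂ) : ‖ip f g‖ = ‖ip g f‖ := by
  rw [← conj_ip, RCLike.norm_conj]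

lemma ip_sum_left {ι : Type*} {s : Finset ι} {F : ι → ℝ → ℂ} {g : ℝ → ℂ}
    (h : ∀ i ∈ s, Nice (F i)) (hg : Nice g) :
    ip (fun x => ∑ i ∈ s, F i x) g = ∑ i ∈ s, ip (F i) g := by
  simp only [ip, Finset.sum_mul]
  exact integral_finsetSum _ fun i hi => (h i hi).integrable_mul_conj hg

lemma ip_sum_right {ι : Type*} {s : Finset ι} {F : ι → ℝ → ℂ} {g : ℝ → ℂ}
    (h : ∀ i ∈ s, Nice (F i)) (hg : Nice g) :
    ip g (fun x => ∑ i ∈ s, F i x) = ∑ i ∈ s, ip g (F i) := by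
  simp only [ip, map_sum, Finset.mul_sum]
  exact integral_finsetSum _ fun i hi => hg.integrable_mul_conj (h i hi)

lemma nsq_sum_le {ι : Type*} {s : Finset ι} {F : ι → ℝ → ℂ} (h : ∀ i ∈ s, Nice (F i)) :
    nsq (fun x => ∑ i ∈ s, F i x) ≤ ∑ i ∈ s, ∑ j ∈ s, ‖ip (F i) (F j)‖ := by
  have h1 : (nsq (fun x => ∑ i ∈ s, F i x) : ℂ) = ∑ i ∈ s, ∑ j ∈ s, ip (F i) (F j) := by
    rw [← ip_self, ip_sum_left h (Nice.sum h)]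
    exact Finset.sum_congr rfl fun i hi => ip_sum_right h (h i hi)
  calc nsq (fun x => ∑ i ∈ s, F i x) = ‖(nsq (fun x => ∑ i ∈ s, F i x) : ℂ)‖ := by
        rw [Complex.norm_real, Real.norm_of_nonneg (nsq_nonneg _)]
    _ ≤ _ := by
        rw [h1]
        exact (norm_sum_le _ _).trans (Finset.sum_le_sum fun i _ => norm_sum_le _ _)

lemma sq_integral_mul_le {α : Type*} [MeasurableSpace α] {μ : Measure α} {u v : α → ℝ}
    (hu : Integrable (fun x => u x ^ 2) μ) (hv : Integrable (fun x => v x ^ 2) μ)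
    (huv : Integrable (fun x => u x * v x) μ) :
    (∫ x, u x * v x ∂μ) ^ 2 ≤ (∫ x, u x ^ 2 ∂μ) * ∫ x, v x ^ 2 ∂μ := by
  have h : ∀ t : ℝ, 0 ≤ (∫ x, u x ^ 2 ∂μ) * (t * t) + (2 * ∫ x, u x * v x ∂μ) * t +
      ∫ x, v x ^ 2 ∂μ := by
    intro t
    have : 0 ≤ ∫ x, (u x * t + v x) ^ 2 ∂μ := integral_nonneg fun _ => sq_nonneg _
    have e : ∀ x, (u x * t + v x) ^ 2 = (u x ^ 2 * (t * t) + (u x * v x) * (2 * t)) + v x ^ 2 := by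
      intro x; ring
    simp only [e] at this
    have hi : Integrable (fun x => u x ^ 2 * (t * t) + (u x * v x) * (2 * t)) μ :=
      (hu.mul_const _).add (huv.mul_const _)
    rw [integral_add hi hv,
      integral_add (hu.mul_const _) (huv.mul_const _), integral_mul_const, integral_mul_const] at this
    linarith
  have := discrim_le_zero h
  rw [discrim] at this
  nlinarith

lemma sq_norm_ip_le {f g : ℝ → ℂ} (hf : Nice f) (hg : Nice g) :
    ‖ip f g‖ ^ 2 ≤ nsq f * nsq g := by
  refine le_trans ?_ (sq_integral_mul_le (u := fun x => ‖f x‖) (v := fun x => ‖g x‖)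
    hf.integrable_sq hg.integrable_sq (hf.integrable_norm_mul hg))
  gcongr
  exact (norm_integral_le_integral_norm _).trans_eq (by simp)

/-! ### Fourier multipliers -/

/-- The Fourier multiplier with symbol `φ`. -/
noncomputable def op (φ : ℝ → ℂ) (f : ℝ → ℂ) (x : ℝ) : ℂ := ∫ y, ker φ (x - y) * f y

lemma exists_ker_bound {φ : ℝ → ℂ} (h : Sym φ) : ∃ C, ∀ z, ‖ker φ z‖ ≤ C := by
  obtain ⟨C, h0, h1, -⟩ := exists_ker_decay h
  refine ⟨C, fun z => (h1 z).trans ?_⟩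
  exact mul_le_of_le_one_right h0.le (pow_le_one₀ (decay_nonneg z) (decay_le_one z))

lemma integrable_op_integrand {φ f : ℝ → ℂ} (h : Sym φ) (hf : Integrable f) (x : ℝ) :
    Integrable (fun y => ker φ (x - y) * f y) := by
  obtain ⟨C, hC⟩ := exists_ker_bound h
  refine hf.bdd_mul ?_ (Filter.Eventually.of_forall fun y => hC _)
  exact ((continuous_ker h).comp (by fun_prop)).aestronglyMeasurable

lemma continuous_op {φ f : ℝ → ℂ} (h : Sym φ) (hf : Integrable f) : Continuous (op φ f) := by
  obtain ⟨C, hC⟩ := exists_ker_bound h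
  refine continuous_of_dominated (bound := fun y => C * ‖f y‖) (fun x => ?_) (fun x => ?_) ?_ ?_
  · exact (integrable_op_integrand h hf x).1
  · exact Filter.Eventually.of_forall fun y => by
      rw [norm_mul]; gcongr; exact hC _
  · exact hf.norm.const_mul C
  · exact Filter.Eventually.of_forall fun y =>
      ((continuous_ker h).comp (by fun_prop)).mul continuous_const

lemma integrable_op_prod {φ f : ℝ → ℂ} (h : Sym φ) (hf : Integrable f) :
    Integrable (fun p : ℝ × ℝ => ker φ (p.1 - p.2) * f p.2) (volume.prod volume) := by
  have := hf.convolution_integrand (ContinuousLinearMap.mul ℂ ℂ) (integrable_ker h)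
    (μ := volume) (ν := volume)
  simpa [mul_comm] using this

lemma Nice.op {φ f : ℝ → ℂ} (h : Sym φ) (hf : Nice f) : Nice (op φ f) := by
  refine ⟨(integrable_op_prod h hf.integrable).integral_prod_left, ?_⟩
  obtain ⟨D, hD⟩ := hf.bdd
  refine ⟨(∫ y, ‖ker φ y‖) * D, fun x => ?_⟩
  have hi := (integrable_ker h).norm
  calc ‖Carleson.op φ f x‖ ≤ ∫ y, ‖ker φ (x - y)‖ * D := by
        refine norm_integral_le_of_norm_le ((hi.comp_sub_left x).mul_const D)
          (Filter.Eventually.of_forall fun y => ?_)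
        rw [norm_mul]; gcongr; exact hD y
    _ = _ := by rw [integral_mul_const, integral_sub_left_eq_self (fun y => ‖ker φ y‖)]

lemma op_sum {ι : Type*} {s : Finset ι} {F : ι → ℝ → ℂ} {φ : ℝ → ℂ} (h : Sym φ)
    (hF : ∀ i ∈ s, Nice (F i)) :
    op φ (fun x => ∑ i ∈ s, F i x) = fun x => ∑ i ∈ s, op φ (F i) x := by
  ext x
  simp only [op, Finset.mul_sum]
  exact integral_finsetSum _ fun i hi => integrable_op_integrand h (hF i hi).integrable x

lemma op_add {f g φ : ℝ → ℂ} (h : Sym φ) (hf : Nice f) (hg : Nice g) :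
    op φ (fun x => f x + g x) = fun x => op φ f x + op φ g x := by
  ext x
  simp only [op, mul_add]
  exact integral_add (integrable_op_integrand h hf.integrable x)
    (integrable_op_integrand h hg.integrable x)

lemma op_const_mul (φ f : ℝ → ℂ) (c : ℂ) : op φ (fun x => c * f x) = fun x => c * op φ f x := by
  ext x
  simp only [op]
  rw [← integral_const_mul]
  congr 1; ext y; ring

lemma op_zero_symbol (f : ℝ → ℂ) : op (fun _ => 0) f = fun _ => 0 := by
  ext x
  simp [op, ker_apply]

open scoped Convolution in
lemma ker_mul {φ ψ : ℝ → ℂ} (h : Sym φ) (h' : Sym ψ) (x z : ℝ) :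
    ∫ y, ker φ (x - y) * ker ψ (y - z) = ker (fun t => φ t * ψ t) (x - z) := by
  set K : SchwartzMap ℝ ℂ := 𝓕⁻ h.toSchwartz with hK
  set L : SchwartzMap ℝ ℂ := 𝓕⁻ h'.toSchwartz with hL
  have e1 : SchwartzMap.convolution (ContinuousLinearMap.mul ℂ ℂ) L K =
      𝓕⁻ (h.mul h').toSchwartz := by
    apply_fun (fun f => 𝓕 f)
    · simp only [SchwartzMap.fourier_convolution, hK, hL, FourierTransform.fourier_fourierInv_eq]
      ext t
      simp [SchwartzMap.pairing, Sym.coe_toSchwartz]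
    · intro a b hab
      simpa using congrArg (fun f => 𝓕⁻ f) hab
  have e2 := SchwartzMap.convolution_apply (ContinuousLinearMap.mul ℂ ℂ) L K (x - z)
  rw [e1, ← ker_eq_coe, convolution] at e2
  rw [e2, hK, hL, ← ker_eq_coe, ← ker_eq_coe,
    ← integral_sub_right_eq_self (fun t => ((ContinuousLinearMap.mul ℂ ℂ) (ker ψ t))
      (ker φ (x - z - t))) z]
  congr 1; ext y
  simp only [ContinuousLinearMap.mul_apply']
  rw [mul_comm]
  congr 2
  ring

lemma op_op {φ ψ f : ℝ → ℂ} (h : Sym φ) (h' : Sym ψ) (hf : Nice f) :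
    op φ (op ψ f) = op (fun t => φ t * ψ t) f := by
  ext x
  obtain ⟨C, hC⟩ := exists_ker_bound h
  simp only [op, ← integral_const_mul]
  rw [integral_integral_swap]
  · congr 1; ext z
    simp only [← mul_assoc]
    rw [integral_mul_const, ker_mul h h']
  · have := (integrable_op_prod h' hf.integrable).bdd_mul (c := C)
      (f := fun p : ℝ × ℝ => ker φ (x - p.1))
      ((continuous_ker h).comp (by fun_prop)).aestronglyMeasurable
      (Filter.Eventually.of_forall fun p => hC _)
    exact this

lemma op_op_eq_zero {φ ψ f : ℝ → ℂ} (h : Sym φ) (h' : Sym ψ) (hf : Nice f)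
    (h0 : ∀ t, φ t * ψ t = 0) : op φ (op ψ f) = fun _ => 0 := by
  rw [op_op h h' hf, funext h0, op_zero_symbol]

lemma op_op_eq_right {φ ψ f : ℝ → ℂ} (h : Sym φ) (h' : Sym ψ) (hf : Nice f)
    (h0 : ∀ t, φ t * ψ t = ψ t) : op φ (op ψ f) = op ψ f := by
  rw [op_op h h' hf, funext h0]

lemma ip_op {φ f g : ℝ → ℂ} (h : Sym φ) (hr : ∀ t, conj (φ t) = φ t) (hf : Nice f) (hg : Nice g) :
    ip (op φ f) g = ip f (op φ g) := by
  obtain ⟨C, hC⟩ := exists_ker_bound h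
  simp only [ip, op]
  have e1 : ∀ x, (∫ y, ker φ (x - y) * f y) * conj (g x) =
      ∫ y, ker φ (x - y) * f y * conj (g x) := fun x => (integral_mul_const _ _).symm
  have e2 : ∀ x, f x * conj (∫ y, ker φ (x - y) * g y) =
      ∫ y, ker φ (y - x) * f x * conj (g y) := by
    intro x
    rw [← integral_conj, ← integral_const_mul]
    congr 1; ext y
    rw [map_mul, conj_ker hr, neg_sub]
    ring
  simp only [e1, e2]
  refine integral_integral_swap ?_
  obtain ⟨D, hD⟩ := hg.bdd
  have := (integrable_op_prod h hf.integrable).bdd_mul (c := D)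
      (f := fun p : ℝ × ℝ => conj (g p.1))
      (hg.star.aesm.comp_fst)
      (Filter.Eventually.of_forall fun p => by simpa using hD p.1)
  refine this.congr (Filter.Eventually.of_forall fun p => ?_)
  simp only [Function.uncurry]
  ring

/-! ### Pointwise bounds for scaled multipliers -/

/-- The symbol `φ` moved to the frequency interval of length `1/s` with index `m`. -/
def sc (φ : ℝ → ℂ) (s m : ℝ) : ℝ → ℂ := fun t => φ (s * t - m)

lemma Sym.sc {φ : ℝ → ℂ} (h : Sym φ) {s : ℝ} (hs : 0 < s) (m : ℝ) : Sym (sc φ s m) :=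
  h.comp_affine hs.ne' m

lemma integrable_decay_mul {n : ℕ} {f : ℝ → ℂ} (hf : Integrable f) (y s : ℝ) :
    Integrable (fun z => decay ((y - z) / s) ^ n * ‖f z‖) := by
  refine hf.norm.bdd_mul (c := 1) (by fun_prop) (Filter.Eventually.of_forall fun z => ?_)
  rw [Real.norm_of_nonneg (pow_nonneg (decay_nonneg _) _)]
  exact pow_le_one₀ (decay_nonneg _) (decay_le_one _)

lemma exists_norm_op_le {φ : ℝ → ℂ} (h : Sym φ) :
    ∃ C : ℝ, 0 < C ∧ (∀ s > 0, ∀ m, ∀ f, Nice f → ∀ y, ‖op (sc φ s m) f y‖ ≤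
        C * s⁻¹ * ∫ z, decay ((y - z) / s) ^ 20 * ‖f z‖) ∧
      (∀ s > 0, ∀ m ξ, |m - s * ξ| ≤ 1 → ∀ f, Nice f → ∀ y y', |y - y'| ≤ s →
        ‖(Real.fourierChar (-(ξ * y)) : ℂ) * op (sc φ s m) f y -
          (Real.fourierChar (-(ξ * y')) : ℂ) * op (sc φ s m) f y'‖ ≤
        C * s⁻¹ * (|y - y'| / s) * ∫ z, decay ((y' - z) / s) ^ 20 * ‖f z‖) := by
  obtain ⟨C, hC, h1, h2⟩ := exists_norm_ker_affine_le h
  refine ⟨C, hC, fun s hs m f hf y => ?_, fun s hs m ξ hm f hf y y' hy => ?_⟩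
  · rw [← integral_const_mul]
    refine norm_integral_le_of_norm_le ((integrable_decay_mul hf.integrable y s).const_mul _)
      (Filter.Eventually.of_forall fun z => ?_)
    rw [norm_mul, ← mul_assoc]
    gcongr
    exact h1 s hs m _
  · have e : ∀ y, (Real.fourierChar (-(ξ * y)) : ℂ) * op (sc φ s m) f y =
        ∫ z, (Real.fourierChar (-(ξ * (y - z))) : ℂ) * ker (sc φ s m) (y - z) *
          ((Real.fourierChar (-(ξ * z)) : ℂ) * f z) := by
      intro y
      rw [op, ← integral_const_mul]
      congr 1; ext z
      rw [show -(ξ * y) = -(ξ * (y - z)) + -(ξ * z) by ring, AddChar.map_add_eq_mul, Circle.coe_mul]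
      ring
    have hi : ∀ y, Integrable fun z => (Real.fourierChar (-(ξ * (y - z))) : ℂ) *
        ker (sc φ s m) (y - z) * ((Real.fourierChar (-(ξ * z)) : ℂ) * f z) := by
      intro y
      have := (integrable_op_integrand (h.sc hs m) hf.integrable y).const_mul
        (Real.fourierChar (-(ξ * y)) : ℂ)
      refine this.congr (Filter.Eventually.of_forall fun z => ?_)
      simp only
      rw [show -(ξ * y) = -(ξ * (y - z)) + -(ξ * z) by ring, AddChar.map_add_eq_mul, Circle.coe_mul]
      ring
    rw [e, e, ← integral_sub (hi y) (hi y'), ← integral_const_mul]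
    refine norm_integral_le_of_norm_le ((integrable_decay_mul hf.integrable y' s).const_mul _)
      (Filter.Eventually.of_forall fun z => ?_)
    rw [← sub_mul, norm_mul, norm_mul, norm_fourierChar, one_mul, ← mul_assoc]
    gcongr
    have := h2 s hs m (y - z) (y' - z) ξ (by simpa using hy) hm
    rwa [show y - z - (y' - z) = y - y' by ring] at this

lemma integral_decay_mul_le {f : ℝ → ℂ} {M c s : ℝ} (hs : 0 < s) (hM : 0 ≤ M)
    (hb : ∀ z, ‖f z‖ ≤ M * decay ((z - c) / s) ^ 6) (hf : Integrable f) (y : ℝ) :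
    ∫ z, decay ((y - z) / s) ^ 20 * ‖f z‖ ≤ 4 * s * M * decay ((y - c) / s) ^ 6 := by
  have hp : ∀ z, decay ((y - z) / s) ^ 20 * ‖f z‖ ≤
      decay ((y - z) / s) ^ 2 * (M * decay ((y - c) / s) ^ 6) := by
    intro z
    have a := decay_nonneg ((y - z) / s)
    have b := decay_nonneg ((z - c) / s)
    have d := decay_mul_sub_le y z c s
    calc decay ((y - z) / s) ^ 20 * ‖f z‖
        ≤ decay ((y - z) / s) ^ 8 * (M * decay ((z - c) / s) ^ 6) := by
          gcongr ?_ * ?_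
          · exact decay_pow_le_pow (by norm_num) _
          · exact hb z
      _ = decay ((y - z) / s) ^ 2 * (M * (decay ((y - z) / s) * decay ((z - c) / s)) ^ 6) := by ring
      _ ≤ _ := by gcongr
  calc _ ≤ ∫ z, decay ((y - z) / s) ^ 2 * (M * decay ((y - c) / s) ^ 6) :=
        integral_mono (integrable_decay_mul hf y s)
          ((integrable_decay_scaled' le_rfl hs y).mul_const _) hp
    _ ≤ 4 * s * (M * decay ((y - c) / s) ^ 6) := by
        rw [integral_mul_const]
        have := decay_nonneg ((y - c) / s)
        gcongr
        exact integral_decay_scaled_le' le_rfl hs y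
    _ = _ := by ring

/-! ### The bump functions -/

/-- The mother symbol, supported in the left half of the unit interval. -/
noncomputable def psiBump : ContDiffBump (1 / 4 : ℝ) := ⟨1 / 16, 1 / 8, by norm_num, by norm_num⟩

/-- A bump equal to one on the support of the mother symbol. -/
noncomputable def psiTBump : ContDiffBump (1 / 4 : ℝ) := ⟨1 / 8, 3 / 16, by norm_num, by norm_num⟩

/-- A bump equal to one on the unit interval. -/
noncomputable def lamBump : ContDiffBump (1 / 2 : ℝ) := ⟨1 / 2, 5 / 8, by norm_num, by norm_num⟩

/-- A bump function as a symbol. -/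
noncomputable def bsym {c : ℝ} (b : ContDiffBump c) : ℝ → ℂ := fun t => (b t : ℂ)

lemma sym_bsym {c : ℝ} (b : ContDiffBump c) : Sym (bsym b) := by
  refine ⟨Complex.ofRealCLM.contDiff.comp b.contDiff, ?_⟩
  exact b.hasCompactSupport.comp_left (g := fun x : ℝ => (x : ℂ)) (by simp)

lemma conj_bsym {c : ℝ} (b : ContDiffBump c) (t : ℝ) : conj (bsym b t) = bsym b t :=
  Complex.conj_ofReal _

noncomputable abbrev psi : ℝ → ℂ := bsym psiBump
noncomputable abbrev psiT : ℝ → ℂ := bsym psiTBump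
noncomputable abbrev lam : ℝ → ℂ := bsym lamBump

lemma bsym_eq_zero {c : ℝ} (b : ContDiffBump c) {t : ℝ} (h : b.rOut ≤ |t - c|) : bsym b t = 0 := by
  rw [bsym, b.zero_of_le_dist (by rwa [Real.dist_eq]), Complex.ofReal_zero]

lemma bsym_eq_one {c : ℝ} (b : ContDiffBump c) {t : ℝ} (h : |t - c| ≤ b.rIn) : bsym b t = 1 := by
  rw [bsym, b.one_of_mem_closedBall (by rwa [Metric.mem_closedBall, Real.dist_eq]),
    Complex.ofReal_one]

lemma psi_ne_zero {t : ℝ} (h : psi t ≠ 0) : 1 / 8 < t ∧ t < 3 / 8 := by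
  by_contra h'
  refine h (bsym_eq_zero _ ?_)
  change (1 / 8 : ℝ) ≤ _
  contrapose! h'
  rw [abs_lt] at h'
  constructor <;> linarith [h'.1, h'.2]

lemma psiT_ne_zero {t : ℝ} (h : psiT t ≠ 0) : 1 / 16 < t ∧ t < 7 / 16 := by
  by_contra h'
  refine h (bsym_eq_zero _ ?_)
  change (3 / 16 : ℝ) ≤ _
  contrapose! h'
  rw [abs_lt] at h'
  constructor <;> linarith [h'.1, h'.2]

lemma lam_ne_zero {t : ℝ} (h : lam t ≠ 0) : -(1 / 8) < t ∧ t < 9 / 8 := by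
  by_contra h'
  refine h (bsym_eq_zero _ ?_)
  change (5 / 8 : ℝ) ≤ _
  contrapose! h'
  rw [abs_lt] at h'
  constructor <;> linarith [h'.1, h'.2]

lemma psiT_eq_one {t : ℝ} (h : 1 / 8 ≤ t ∧ t ≤ 3 / 8) : psiT t = 1 := by
  apply bsym_eq_one
  change _ ≤ (1 / 8 : ℝ)
  rw [abs_le]
  constructor <;> linarith [h.1, h.2]

lemma lam_eq_one {t : ℝ} (h : 0 ≤ t ∧ t ≤ 1) : lam t = 1 := by
  apply bsym_eq_one
  change _ ≤ (1 / 2 : ℝ)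
  rw [abs_le]
  constructor <;> linarith [h.1, h.2]

lemma psiT_mul_psi (t : ℝ) : psiT t * psi t = psi t := by
  by_cases h : psi t = 0
  · rw [h, mul_zero]
  · have := psi_ne_zero h
    rw [psiT_eq_one ⟨this.1.le, this.2.le⟩, one_mul]

/-! ### Dyadic indices -/

/-- The index of the dyadic interval of scale `2 ^ k` containing `x`. -/
noncomputable def dy (k : ℤ) (x : ℝ) : ℤ := ⌊x / (2:ℝ) ^ k⌋

lemma two_zpow_pos (k : ℤ) : (0:ℝ) < 2 ^ k := by positivity

lemma dy_eq_iff {k n : ℤ} {x : ℝ} : dy k x = n ↔ 2 ^ k * (n:ℝ) ≤ x ∧ x < 2 ^ k * ((n:ℝ) + 1) := by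
  have := two_zpow_pos k
  rw [dy, Int.floor_eq_iff, le_div_iff₀ this, div_lt_iff₀ this]
  constructor <;> intro h <;> constructor <;> linarith [h.1, h.2]

lemma measurable_dy (k : ℤ) : Measurable (dy k) := Int.measurable_floor.comp (by fun_prop)

lemma dy_add_one (k : ℤ) (x : ℝ) : dy (k + 1) x = dy k x / 2 := by
  have h2 := two_zpow_pos k
  obtain ⟨h1, h3⟩ := dy_eq_iff.1 (rfl : dy k x = dy k x)
  rw [dy_eq_iff, zpow_add_one₀ two_ne_zero]
  set n := dy k x
  have a : 2 * (n / 2) ≤ n := by omega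
  have b : n + 1 ≤ 2 * (n / 2 + 1) := by omega
  have a' : (2:ℝ) * ((n / 2 : ℤ) : ℝ) ≤ n := by exact_mod_cast a
  have b' : (n : ℝ) + 1 ≤ 2 * (((n / 2 : ℤ) : ℝ) + 1) := by exact_mod_cast b
  constructor <;> nlinarith

lemma dy_congr {k k' : ℤ} (h : k ≤ k') {x y : ℝ} (hxy : dy k x = dy k y) : dy k' x = dy k' y := by
  induction k', h using Int.leInduction with
  | base => exact hxy
  | succ j hj ih => rw [dy_add_one, dy_add_one, ih]

/-! ### Tiles -/

/-- A tile: scale, spatial index and frequency index. -/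
@[ext] structure Tile where
  k : ℤ
  n : ℤ
  m : ℤ

noncomputable instance : DecidableEq Tile := Classical.decEq _

namespace Tile

/-- Length of the spatial interval. -/
noncomputable def r (P : Tile) : ℝ := 2 ^ P.k

/-- Left endpoint of the spatial interval. -/
noncomputable def c (P : Tile) : ℝ := 2 ^ P.k * P.n

/-- Left endpoint of the frequency interval. -/
noncomputable def fc (P : Tile) : ℝ := 2 ^ (-P.k) * P.m

/-- The spatial interval. -/
def I (P : Tile) : Set ℝ := {x | dy P.k x = P.n}

/-- The frequency interval contains `ξ`. -/
def om (P : Tile) (ξ : ℝ) : Prop := dy (-P.k) ξ = P.m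

/-- The right half of the frequency interval contains `ξ`. -/
def om2 (P : Tile) (ξ : ℝ) : Prop := dy (-P.k - 1) ξ = 2 * P.m + 1

/-- The spatial interval is contained in the dyadic interval of scale `k` and index `n`. -/
def sub (P : Tile) (k n : ℤ) : Prop := P.k ≤ k ∧ dy k P.c = n

/-- The order on tiles. -/
def le (P P' : Tile) : Prop := P.sub P'.k P'.n ∧ P.om P'.fc

lemma r_pos (P : Tile) : 0 < P.r := two_zpow_pos _

lemma mem_I {P : Tile} {x : ℝ} : x ∈ P.I ↔ dy P.k x = P.n := Iff.rfl

lemma I_eq (P : Tile) : P.I = Set.Ico P.c (P.c + P.r) := by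
  ext x
  rw [mem_I, dy_eq_iff, Set.mem_Ico, c, r, mul_add, mul_one]

lemma c_mem_I (P : Tile) : P.c ∈ P.I := by
  rw [I_eq]; exact ⟨le_rfl, by linarith [P.r_pos]⟩

lemma dy_c (P : Tile) : dy P.k P.c = P.n := P.c_mem_I

lemma om_fc (P : Tile) : P.om P.fc := by
  rw [om, dy_eq_iff, fc]
  have := two_zpow_pos (-P.k)
  constructor <;> nlinarith

lemma measurableSet_I (P : Tile) : MeasurableSet P.I := by rw [I_eq]; exact measurableSet_Ico

lemma volume_I (P : Tile) : volume P.I = ENNReal.ofReal P.r := by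
  rw [I_eq, Real.volume_Ico]; congr 1; ring

lemma volume_real_I (P : Tile) : volume.real P.I = P.r := by
  rw [Measure.real, volume_I, ENNReal.toReal_ofReal P.r_pos.le]

lemma abs_sub_c_le {P : Tile} {x : ℝ} (hx : x ∈ P.I) : |x - P.c| ≤ P.r := by
  rw [I_eq] at hx
  rw [abs_of_nonneg] <;> linarith [hx.1, hx.2]

lemma om_of_om2 {P : Tile} {ξ : ℝ} (h : P.om2 ξ) : P.om ξ := by
  have := dy_add_one (-P.k - 1) ξ
  rw [sub_add_cancel, h] at this
  rw [om, this]; omega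

lemma om_iff {P : Tile} {ξ : ℝ} : P.om ξ ↔ 0 ≤ P.r * ξ - P.m ∧ P.r * ξ - P.m < 1 := by
  have h := two_zpow_pos P.k
  rw [om, dy_eq_iff, zpow_neg, r, inv_mul_le_iff₀ h, ← div_eq_inv_mul, lt_div_iff₀ h]
  constructor <;> intro h <;> constructor <;> linarith [h.1, h.2]

lemma om2_iff {P : Tile} {ξ : ℝ} : P.om2 ξ ↔ 1 / 2 ≤ P.r * ξ - P.m ∧ P.r * ξ - P.m < 1 := by
  have h := two_zpow_pos P.k
  have e : (2:ℝ) ^ (-P.k - 1) = (2 * P.r)⁻¹ := by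
    rw [zpow_sub_one₀ two_ne_zero, zpow_neg, r, mul_inv, mul_comm]
  have h' : 0 < 2 * P.r := by have := P.r_pos; positivity
  rw [om2, dy_eq_iff, e, inv_mul_le_iff₀ h', ← div_eq_inv_mul, lt_div_iff₀ h']
  push_cast
  constructor <;> intro h <;> constructor <;> linarith [h.1, h.2]

lemma sub_refl (P : Tile) : P.sub P.k P.n := ⟨le_rfl, P.dy_c⟩

lemma sub.mem {P : Tile} {k n : ℤ} (h : P.sub k n) {x : ℝ} (hx : x ∈ P.I) : dy k x = n := by
  rw [← h.2]
  exact dy_congr h.1 (by rw [P.dy_c]; exact hx)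

lemma sub_of_mem {P : Tile} {k n : ℤ} (hk : P.k ≤ k) {x : ℝ} (hx : x ∈ P.I) (h : dy k x = n) :
    P.sub k n := by
  refine ⟨hk, ?_⟩
  rw [← h]
  exact dy_congr hk (by rw [P.dy_c]; exact hx.symm)

lemma sub.subset {P P' : Tile} (h : P.sub P'.k P'.n) : P.I ⊆ P'.I := fun _ hx => h.mem hx

lemma om_of_om {P P' : Tile} (hk : P.k ≤ P'.k) {ξ η : ℝ} (h1 : P.om ξ) (h2 : P'.om ξ)
    (h3 : P'.om η) : P.om η := by
  rw [om] at *
  rw [← h1]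
  exact dy_congr (k := -P'.k) (by omega) (h3.trans h2.symm)

lemma om2_of_om2 {P P' : Tile} (hk : P.k < P'.k) {ξ η : ℝ} (h1 : P.om2 ξ) (h2 : P'.om ξ)
    (h3 : P'.om η) : P.om2 η := by
  rw [om] at h2 h3
  rw [om2] at *
  rw [← h1]
  exact dy_congr (k := -P'.k) (by omega) (h3.trans h2.symm)

lemma le_of {P P' : Tile} (hk : P.k ≤ P'.k) {x ξ : ℝ} (hx : x ∈ P.I) (hx' : x ∈ P'.I)
    (h : P.om ξ) (h' : P'.om ξ) : P.le P' :=
  ⟨sub_of_mem hk hx hx', om_of_om hk h h' P'.om_fc⟩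

lemma le.om {P P' : Tile} (h : P.le P') {ξ : ℝ} (h' : P'.om ξ) : P.om ξ :=
  om_of_om h.1.1 h.2 P'.om_fc h'

lemma le_refl (P : Tile) : P.le P := ⟨P.sub_refl, P.om_fc⟩

lemma le.trans {P P' P'' : Tile} (h : P.le P') (h' : P'.le P'') : P.le P'' :=
  ⟨sub_of_mem (h.1.1.trans h'.1.1) P.c_mem_I (h'.1.mem (h.1.mem P.c_mem_I)), h.om h'.2⟩

lemma le_antisymm_of_k {P P' : Tile} (h : P.le P') (hk : P'.k ≤ P.k) : P = P' := by
  have e : P.k = P'.k := _root_.le_antisymm h.1.1 hk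
  ext
  · exact e
  · rw [← h.1.2, ← e, P.dy_c]
  · have h1 := h.2
    have h2 := P'.om_fc
    rw [om] at h1 h2
    rw [← h1, ← h2, e]

lemma disjoint_or_sub (P P' : Tile) (hk : P.k ≤ P'.k) : Disjoint P.I P'.I ∨ P.sub P'.k P'.n := by
  by_cases h : Disjoint P.I P'.I
  · exact Or.inl h
  · obtain ⟨x, hx, hx'⟩ := Set.not_disjoint_iff.1 h
    exact Or.inr (sub_of_mem hk hx hx')

/-- The spatial weight adapted to the tile. -/
noncomputable def W (P : Tile) (x : ℝ) : ℝ := decay ((x - P.c) / P.r) ^ 12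

/-- The frequency projection adapted to the tile. -/
noncomputable def A (P : Tile) (f : ℝ → ℂ) : ℝ → ℂ := op (sc psi P.r P.m) f

/-- The local energy of `f` on the tile. -/
noncomputable def s (P : Tile) (f : ℝ → ℂ) : ℝ := ∫ x, ‖P.A f x‖ ^ 2 * P.W x

/-- The wave packet of `f` on the tile. -/
noncomputable def G (P : Tile) (f : ℝ → ℂ) : ℝ → ℂ := P.A (fun x => P.W x * P.A f x)

/-- The normalized coefficient of `f` on the tile. -/
noncomputable def γ (P : Tile) (f : ℝ → ℂ) : ℝ := √(P.s f / P.r)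

variable {f : ℝ → ℂ}

lemma W_nonneg (P : Tile) (x : ℝ) : 0 ≤ P.W x := pow_nonneg (decay_nonneg _) _

lemma W_le_one (P : Tile) (x : ℝ) : P.W x ≤ 1 := pow_le_one₀ (decay_nonneg _) (decay_le_one _)

lemma continuous_W (P : Tile) : Continuous P.W := by unfold W; fun_prop

lemma sym_psi (P : Tile) : Sym (sc psi P.r P.m) := (sym_bsym _).sc P.r_pos _

lemma nice_A (P : Tile) (hf : Nice f) : Nice (P.A f) := hf.op P.sym_psi

lemma nice_WA (P : Tile) (hf : Nice f) : Nice (fun x => P.W x * P.A f x) := by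
  refine (P.nice_A hf).bdd_mul (C := 1) ?_ fun x => ?_
  · exact (Complex.continuous_ofReal.comp P.continuous_W).aestronglyMeasurable
  · rw [Complex.norm_real, Real.norm_of_nonneg (P.W_nonneg x)]; exact P.W_le_one x

lemma nice_G (P : Tile) (hf : Nice f) : Nice (P.G f) := P.nice_A (P.nice_WA hf)

lemma s_nonneg (P : Tile) (f : ℝ → ℂ) : 0 ≤ P.s f :=
  integral_nonneg fun x => mul_nonneg (by positivity) (P.W_nonneg x)

lemma γ_nonneg (P : Tile) (f : ℝ → ℂ) : 0 ≤ P.γ f := Real.sqrt_nonneg _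

lemma sq_γ_mul (P : Tile) (f : ℝ → ℂ) : P.γ f ^ 2 * P.r = P.s f := by
  rw [γ, Real.sq_sqrt (div_nonneg (P.s_nonneg f) P.r_pos.le), div_mul_cancel₀ _ P.r_pos.ne']

lemma ip_A (P : Tile) {g : ℝ → ℂ} (hf : Nice f) (hg : Nice g) : ip (P.A f) g = ip f (P.A g) :=
  ip_op P.sym_psi (fun _ => conj_bsym _ _) hf hg

lemma ip_G (P : Tile) (hf : Nice f) : ip f (P.G f) = P.s f := by
  rw [G, ← P.ip_A hf (P.nice_WA hf), ip, s, ← integral_complex_ofReal]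
  congr 1; ext x
  rw [map_mul, Complex.conj_ofReal, mul_left_comm, Complex.mul_conj, Complex.normSq_eq_norm_sq]
  push_cast; ring

lemma tilde_A (P : Tile) (hf : Nice f) : op (sc psiT P.r P.m) (P.A f) = P.A f :=
  op_op_eq_right ((sym_bsym _).sc P.r_pos _) P.sym_psi hf fun _ => psiT_mul_psi _

lemma integrable_sA (P : Tile) (hf : Nice f) : Integrable (fun x => ‖P.A f x‖ ^ 2 * P.W x) :=
  (P.nice_A hf).integrable_sq_mul P.continuous_W (C := 1) fun x => by
    rw [abs_of_nonneg (P.W_nonneg x)]; exact P.W_le_one x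

end Tile

lemma exists_norm_A_le : ∃ C : ℝ, 0 < C ∧ ∀ (P : Tile) (f : ℝ → ℂ), Nice f → ∀ y,
    ‖P.A f y‖ * decay ((y - P.c) / P.r) ^ 6 ≤ C * P.γ f := by
  obtain ⟨C, hC, h1, -⟩ := exists_norm_op_le (sym_bsym psiTBump)
  refine ⟨2 * C, by positivity, fun P f hf y => ?_⟩
  have hr := P.r_pos
  have hA := P.nice_A hf
  set g := P.A f with hg
  have e := h1 P.r hr P.m g hA y
  rw [P.tilde_A hf] at e
  set u : ℝ → ℝ := fun z => decay ((y - z) / P.r) ^ 14 with hu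
  set v : ℝ → ℝ := fun z => ‖g z‖ * decay ((z - P.c) / P.r) ^ 6 with hv
  have hvc : Integrable (fun z => ‖g z‖ * decay ((z - P.c) / P.r) ^ 6) := by
    have := integrable_decay_mul (n := 6) hA.integrable P.c P.r
    simpa only [decay_sub_comm, mul_comm] using this
  have huv : Integrable (fun z => u z * v z) := by
    refine hvc.bdd_mul (c := 1) (by fun_prop) (Filter.Eventually.of_forall fun z => ?_)
    rw [Real.norm_of_nonneg (pow_nonneg (decay_nonneg _) _)]
    exact pow_le_one₀ (decay_nonneg _) (decay_le_one _)
  have hu2 : Integrable (fun z => u z ^ 2) := by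
    simp only [hu, ← pow_mul]; exact integrable_decay_scaled' (by norm_num) hr y
  have hv2e : (fun z => v z ^ 2) = fun z => ‖g z‖ ^ 2 * P.W z := by
    ext z; simp only [hv, Tile.W]; ring
  have hv2 : Integrable (fun z => v z ^ 2) := by
    rw [hv2e]; exact P.integrable_sA hf
  have CS := sq_integral_mul_le hu2 hv2 huv
  have b1 : ∫ z, u z ^ 2 ≤ 4 * P.r := by
    simp only [hu, ← pow_mul]; exact integral_decay_scaled_le' (by norm_num) hr y
  have b2 : ∫ z, v z ^ 2 = P.γ f ^ 2 * P.r := by rw [hv2e, P.sq_γ_mul]; rfl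
  rw [b2] at CS
  have hγ := P.γ_nonneg f
  have b3 : ∫ z, u z * v z ≤ 2 * P.γ f * P.r := by
    refine abs_le_of_sq_le_sq' ?_ (by positivity) |>.2
    nlinarith [mul_le_mul_of_nonneg_right b1 (show 0 ≤ P.γ f ^ 2 * P.r by positivity)]
  have b4 : (∫ z, decay ((y - z) / P.r) ^ 20 * ‖g z‖) * decay ((y - P.c) / P.r) ^ 6 ≤
      ∫ z, u z * v z := by
    rw [← integral_mul_const]
    refine integral_mono ((integrable_decay_mul hA.integrable y P.r).mul_const _) huv fun z => ?_
    have h2 : decay ((y - z) / P.r) * decay ((y - P.c) / P.r) ≤ decay ((z - P.c) / P.r) := by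
      rw [decay_sub_comm y z]; exact decay_mul_sub_le _ _ _ _
    have a := decay_nonneg ((y - z) / P.r)
    have b := decay_nonneg ((y - P.c) / P.r)
    calc _ = decay ((y - z) / P.r) ^ 14 * (‖g z‖ *
        (decay ((y - z) / P.r) * decay ((y - P.c) / P.r)) ^ 6) := by ring
      _ ≤ decay ((y - z) / P.r) ^ 14 * (‖g z‖ * decay ((z - P.c) / P.r) ^ 6) := by gcongr
  calc ‖g y‖ * decay ((y - P.c) / P.r) ^ 6
      ≤ (C * P.r⁻¹ * ∫ z, decay ((y - z) / P.r) ^ 20 * ‖g z‖) * decay ((y - P.c) / P.r) ^ 6 := by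
        have := decay_nonneg ((y - P.c) / P.r)
        gcongr
    _ = C * P.r⁻¹ * ((∫ z, decay ((y - z) / P.r) ^ 20 * ‖g z‖) * decay ((y - P.c) / P.r) ^ 6) := by
        ring
    _ ≤ C * P.r⁻¹ * (2 * P.γ f * P.r) :=
        mul_le_mul_of_nonneg_left (b4.trans b3) (by positivity)
    _ = _ := by field_simp

lemma exists_norm_G_le : ∃ C : ℝ, 0 < C ∧ ∀ (P : Tile) (f : ℝ → ℂ), Nice f →
    (∀ y, ‖P.G f y‖ ≤ C * P.γ f * decay ((y - P.c) / P.r) ^ 6) ∧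
    ∀ ξ, P.om ξ → ∀ y y', |y - y'| ≤ P.r →
      ‖(Real.fourierChar (-(ξ * y)) : ℂ) * P.G f y -
        (Real.fourierChar (-(ξ * y')) : ℂ) * P.G f y'‖ ≤
      C * P.γ f * (|y - y'| / P.r) * decay ((y' - P.c) / P.r) ^ 6 := by
  obtain ⟨C, hC, hA⟩ := exists_norm_A_le
  obtain ⟨D, hD, h1, h2⟩ := exists_norm_op_le (sym_bsym psiBump)
  refine ⟨D * 4 * C, by positivity, fun P f hf => ?_⟩
  have hr := P.r_pos
  have hγ := P.γ_nonneg f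
  have hb : ∀ z, ‖P.W z * P.A f z‖ ≤ C * P.γ f * decay ((z - P.c) / P.r) ^ 6 := by
    intro z
    rw [norm_mul, Complex.norm_real, Real.norm_of_nonneg (P.W_nonneg z), Tile.W]
    have := decay_nonneg ((z - P.c) / P.r)
    calc _ = ‖P.A f z‖ * decay ((z - P.c) / P.r) ^ 6 * decay ((z - P.c) / P.r) ^ 6 := by ring
      _ ≤ _ := mul_le_mul_of_nonneg_right (hA P f hf z) (by positivity)
  have hI := fun y => integral_decay_mul_le hr (by positivity) hb (P.nice_WA hf).integrable y
  refine ⟨fun y => (h1 P.r hr P.m _ (P.nice_WA hf) y).trans ?_, fun ξ hξ y y' hy => ?_⟩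
  · calc _ ≤ D * P.r⁻¹ * (4 * P.r * (C * P.γ f) * decay ((y - P.c) / P.r) ^ 6) := by
          gcongr; exact hI y
      _ = _ := by field_simp
  · have hm : |P.m - P.r * ξ| ≤ 1 := by
      rw [Tile.om_iff] at hξ
      rw [abs_le]; constructor <;> linarith [hξ.1, hξ.2]
    refine (h2 P.r hr P.m ξ hm _ (P.nice_WA hf) y y' hy).trans ?_
    calc _ ≤ D * P.r⁻¹ * (|y - y'| / P.r) *
          (4 * P.r * (C * P.γ f) * decay ((y' - P.c) / P.r) ^ 6) := by
          gcongr; exact hI y'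
      _ = _ := by field_simp

/-! ### Almost orthogonality -/

lemma measurableSet_biUnion_I (S : Finset Tile) : MeasurableSet (⋃ P ∈ S, P.I) :=
  S.measurableSet_biUnion fun P _ => P.measurableSet_I

lemma sum_decay_le_integral {S : Finset Tile} {r : ℝ} (hr : 0 < r) (hS : ∀ P ∈ S, P.r ≤ r)
    (hd : (S : Set Tile).PairwiseDisjoint Tile.I) {q : ℕ} (hq : 2 ≤ q) (x : ℝ) :
    ∑ P ∈ S, P.r * decay ((x - P.c) / r) ^ q ≤
      2 ^ q * ∫ y in ⋃ P ∈ S, P.I, decay ((x - y) / r) ^ q := by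
  have hi := integrable_decay_scaled' hq hr x
  rw [integral_biUnion_finset S (fun P _ => P.measurableSet_I) hd
    (fun P _ => hi.integrableOn), Finset.mul_sum]
  refine Finset.sum_le_sum fun P hP => ?_
  rw [← P.volume_real_I, ← smul_eq_mul, ← setIntegral_const, ← integral_const_mul]
  refine setIntegral_mono_on ?_ (hi.const_mul _).integrableOn P.measurableSet_I fun y hy => ?_
  · exact integrableOn_const (by rw [P.volume_I]; exact ENNReal.ofReal_ne_top)
  · rw [← mul_pow]
    have := decay_le_two_mul (x := x) hr ((Tile.abs_sub_c_le hy).trans (hS P hP))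
    have := decay_nonneg ((x - P.c) / r)
    gcongr

lemma sum_decay_le {S : Finset Tile} {r : ℝ} (hr : 0 < r) (hS : ∀ P ∈ S, P.r ≤ r)
    (hd : (S : Set Tile).PairwiseDisjoint Tile.I) {q : ℕ} (hq : 2 ≤ q) (x : ℝ) :
    ∑ P ∈ S, P.r * decay ((x - P.c) / r) ^ q ≤ 2 ^ q * (4 * r) := by
  refine (sum_decay_le_integral hr hS hd hq x).trans ?_
  gcongr
  refine le_trans ?_ (integral_decay_scaled_le' hq hr x)
  exact setIntegral_le_integral (integrable_decay_scaled' hq hr x)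
    (Filter.Eventually.of_forall fun y => pow_nonneg (decay_nonneg _) _)

lemma norm_ip_le_of_decay {F F' : ℝ → ℂ} {γ γ' c c' r r' : ℝ} (hr' : 0 < r') (hrr : r' ≤ r)
    (hγ : 0 ≤ γ) (hγ' : 0 ≤ γ')
    (hF : ∀ y, ‖F y‖ ≤ γ * decay ((y - c) / r) ^ 6)
    (hF' : ∀ y, ‖F' y‖ ≤ γ' * decay ((y - c') / r') ^ 6) :
    ‖ip F F'‖ ≤ 4 * γ * γ' * r' * decay ((c - c') / r) ^ 4 := by
  have h0 := decay_nonneg ((c - c') / r)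
  calc ‖ip F F'‖ ≤ ∫ y, γ * γ' * decay ((c - c') / r) ^ 4 * decay ((y - c') / r') ^ 2 := by
        refine norm_integral_le_of_norm_le ((integrable_decay_scaled le_rfl hr' c').const_mul _)
          (Filter.Eventually.of_forall fun y => ?_)
        rw [norm_mul, RCLike.norm_conj]
        have a := decay_nonneg ((y - c) / r)
        have b := decay_nonneg ((y - c') / r')
        have d : decay ((y - c') / r') ≤ decay ((y - c') / r) := decay_div_mono hr' hrr _
        have e : decay ((c - y) / r) * decay ((y - c') / r) ≤ _ := decay_mul_sub_le c y c' r
        rw [decay_sub_comm c y] at e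
        have ab := mul_nonneg a (decay_nonneg ((y - c') / r))
        calc ‖F y‖ * ‖F' y‖ ≤ (γ * decay ((y - c) / r) ^ 6) * (γ' * decay ((y - c') / r') ^ 6) := by
              gcongr
              · exact hF y
              · exact hF' y
          _ ≤ (γ * decay ((y - c) / r) ^ 4) * (γ' * decay ((y - c') / r') ^ 6) := by
              gcongr ?_ * _
              gcongr ?_ * ?_
              exact decay_pow_le_pow (by norm_num) _
          _ = γ * γ' * (decay ((y - c) / r) * decay ((y - c') / r')) ^ 4 *
                decay ((y - c') / r') ^ 2 := by ring
          _ ≤ γ * γ' * (decay ((y - c) / r) * decay ((y - c') / r)) ^ 4 *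
                decay ((y - c') / r') ^ 2 := by gcongr
          _ ≤ _ := by gcongr
    _ = γ * γ' * decay ((c - c') / r) ^ 4 * ∫ y, decay ((y - c') / r') ^ 2 := integral_const_mul _ _
    _ ≤ γ * γ' * decay ((c - c') / r) ^ 4 * (4 * r') := by
        gcongr; exact integral_decay_scaled_le le_rfl hr' c'
    _ = _ := by ring

lemma pairwiseDisjoint_of_k {S : Finset Tile} {k m : ℤ} (h : ∀ P ∈ S, P.k = k ∧ P.m = m) :
    (S : Set Tile).PairwiseDisjoint Tile.I := by
  intro P hP Q hQ hne
  refine Set.disjoint_left.2 fun x hx hx' => hne ?_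
  have a := h P hP
  have b := h Q hQ
  rw [Tile.mem_I] at hx hx'
  ext
  · rw [a.1, b.1]
  · rw [← hx, ← hx', a.1, b.1]
  · rw [a.2, b.2]

/-- The part of the Gram matrix coming from tiles with the same frequency interval. -/
lemma sum_sum_ip_same_le (S : Finset Tile) {F : Tile → ℝ → ℂ} {γ : Tile → ℝ}
    (hγ : ∀ P ∈ S, 0 ≤ γ P)
    (hF : ∀ P ∈ S, ∀ y, ‖F P y‖ ≤ γ P * decay ((y - P.c) / P.r) ^ 6) :
    ∑ P ∈ S, ∑ Q ∈ S with Q.k = P.k ∧ Q.m = P.m, ‖ip (F P) (F Q)‖ ≤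
      256 * ∑ P ∈ S, γ P ^ 2 * P.r := by
  have h1 : ∀ P ∈ S, ∀ Q ∈ S.filter (fun Q => Q.k = P.k ∧ Q.m = P.m), ‖ip (F P) (F Q)‖ ≤
      2 * γ P ^ 2 * (Q.r * decay ((P.c - Q.c) / P.r) ^ 4) +
      2 * γ Q ^ 2 * (P.r * decay ((Q.c - P.c) / Q.r) ^ 4) := by
    intro P hP Q hQ
    rw [Finset.mem_filter] at hQ
    have hr : Q.r = P.r := by rw [Tile.r, Tile.r, hQ.2.1]
    have := norm_ip_le_of_decay Q.r_pos hr.le (hγ P hP) (hγ Q hQ.1) (hF P hP) (hF Q hQ.1)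
    refine this.trans ?_
    rw [decay_sub_comm Q.c, hr]
    have e : 0 ≤ P.r * decay ((P.c - Q.c) / P.r) ^ 4 :=
      mul_nonneg P.r_pos.le (pow_nonneg (decay_nonneg _) _)
    nlinarith [mul_nonneg (sq_nonneg (γ P - γ Q)) e]
  have h2 : ∀ P ∈ S, ∑ Q ∈ S with Q.k = P.k ∧ Q.m = P.m, Q.r * decay ((P.c - Q.c) / P.r) ^ 4 ≤
      64 * P.r := by
    intro P hP
    refine (sum_decay_le P.r_pos (fun Q hQ => ?_) (pairwiseDisjoint_of_k (k := P.k) (m := P.m)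
      fun Q hQ => ?_) (by norm_num) P.c).trans_eq (by ring)
    · rw [Finset.mem_filter] at hQ; rw [Tile.r, Tile.r, hQ.2.1]
    · rw [Finset.mem_filter] at hQ; exact hQ.2
  have h3 : ∑ P ∈ S, ∑ Q ∈ S with Q.k = P.k ∧ Q.m = P.m,
      2 * γ P ^ 2 * (Q.r * decay ((P.c - Q.c) / P.r) ^ 4) ≤ 128 * ∑ P ∈ S, γ P ^ 2 * P.r := by
    rw [Finset.mul_sum]
    refine Finset.sum_le_sum fun P hP => ?_
    rw [← Finset.mul_sum]
    calc _ ≤ 2 * γ P ^ 2 * (64 * P.r) := by gcongr; exact h2 P hP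
      _ = _ := by ring
  have h4 : ∑ P ∈ S, ∑ Q ∈ S with Q.k = P.k ∧ Q.m = P.m,
      2 * γ Q ^ 2 * (P.r * decay ((Q.c - P.c) / Q.r) ^ 4) =
      ∑ P ∈ S, ∑ Q ∈ S with Q.k = P.k ∧ Q.m = P.m,
      2 * γ P ^ 2 * (Q.r * decay ((P.c - Q.c) / P.r) ^ 4) := by
    simp only [Finset.sum_filter]
    rw [Finset.sum_comm]
    simp only [eq_comm]
  calc _ ≤ ∑ P ∈ S, ∑ Q ∈ S with Q.k = P.k ∧ Q.m = P.m,
        (2 * γ P ^ 2 * (Q.r * decay ((P.c - Q.c) / P.r) ^ 4) +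
      2 * γ Q ^ 2 * (P.r * decay ((Q.c - P.c) / Q.r) ^ 4)) :=
        Finset.sum_le_sum fun P hP => Finset.sum_le_sum fun Q hQ => h1 P hP Q hQ
    _ ≤ _ := by
        simp only [Finset.sum_add_distrib]
        rw [h4]
        linarith

lemma nsq_sum_le_of_orthogonal (S : Finset Tile) {F : Tile → ℝ → ℂ} {γ : Tile → ℝ}
    (hγ : ∀ P ∈ S, 0 ≤ γ P) (hn : ∀ P ∈ S, Nice (F P))
    (hF : ∀ P ∈ S, ∀ y, ‖F P y‖ ≤ γ P * decay ((y - P.c) / P.r) ^ 6)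
    (ho : ∀ P ∈ S, ∀ Q ∈ S, ¬ (Q.k = P.k ∧ Q.m = P.m) → ip (F P) (F Q) = 0) :
    nsq (fun x => ∑ P ∈ S, F P x) ≤ 256 * ∑ P ∈ S, γ P ^ 2 * P.r := by
  refine (nsq_sum_le hn).trans (le_trans (le_of_eq ?_) (sum_sum_ip_same_le S hγ hF))
  refine Finset.sum_congr rfl fun P hP => ?_
  rw [Finset.sum_filter]
  refine Finset.sum_congr rfl fun Q hQ => ?_
  split_ifs with h
  · rfl
  · rw [ho P hP Q hQ h, norm_zero]

/-- Wave packets of the same frequency-separated family are orthogonal. -/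
lemma ip_op_eq_zero {φ ψ f g : ℝ → ℂ} (h : Sym φ) (h' : Sym ψ) (hr : ∀ t, conj (φ t) = φ t)
    (hf : Nice f) (hg : Nice g) (h0 : ∀ t, φ t * ψ t = 0) : ip (op φ f) (op ψ g) = 0 := by
  rw [ip_op h hr hf (hg.op h'), op_op_eq_zero h h' hg h0, ip]
  simp

/-! ### Geometric sums -/

lemma sum_two_zpow_le (K : Finset ℤ) {k₁ : ℤ} (h : ∀ k ∈ K, k ≤ k₁) :
    ∑ k ∈ K, (2:ℝ) ^ k ≤ 2 ^ (k₁ + 1) := by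
  have e : ∀ k ∈ K, (2:ℝ) ^ k = 2 ^ k₁ * (1 / 2) ^ (k₁ - k).toNat := by
    intro k hk
    rw [one_div, inv_pow, ← zpow_natCast, Int.toNat_of_nonneg (by linarith [h k hk]), ← zpow_neg,
      ← zpow_add₀ two_ne_zero]
    congr 1; ring
  rw [Finset.sum_congr rfl e, ← Finset.mul_sum, zpow_add_one₀ two_ne_zero]
  gcongr
  have inj : Set.InjOn (fun k => (k₁ - k).toNat) (K : Set ℤ) := by
    intro a ha b hb hab
    have := h a ha; have := h b hb
    simp only at hab
    omega
  rw [← Finset.sum_image (f := fun n => (1 / 2 : ℝ) ^ n) inj]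
  exact (summable_geometric_two.sum_le_tsum _ fun _ _ => by positivity).trans_eq tsum_geometric_two

lemma sum_two_zpow_neg_le (K : Finset ℤ) {k₁ : ℤ} (h : ∀ k ∈ K, k₁ ≤ k) :
    ∑ k ∈ K, (2:ℝ) ^ (-k) ≤ 2 ^ (-k₁ + 1) := by
  rw [← Finset.sum_image (f := fun k => (2:ℝ) ^ k) (s := K) (g := fun k => -k)
    neg_injective.injOn]
  refine sum_two_zpow_le _ fun k hk => ?_
  obtain ⟨j, hj, rfl⟩ := Finset.mem_image.1 hk
  linarith [h j hj]

lemma sum_min_zpow_le (K : Finset ℤ) {ρ : ℝ} (hρ : 0 < ρ) :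
    ∑ k ∈ K, min (2 ^ k / ρ) (ρ / 2 ^ k) ≤ 4 := by
  obtain ⟨k₀, h1, h2⟩ := exists_mem_Ico_zpow hρ (one_lt_two (α := ℝ))
  rw [← Finset.sum_filter_add_sum_filter_not K (fun k => k ≤ k₀)]
  have a : ∑ k ∈ K with k ≤ k₀, min (2 ^ k / ρ) (ρ / 2 ^ k) ≤ 2 := by
    calc _ ≤ ∑ k ∈ K with k ≤ k₀, (2:ℝ) ^ k / ρ := Finset.sum_le_sum fun k _ => min_le_left _ _
      _ ≤ 2 ^ (k₀ + 1) / ρ := by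
        rw [← Finset.sum_div]
        gcongr
        exact sum_two_zpow_le _ fun k hk => (Finset.mem_filter.1 hk).2
      _ ≤ 2 := by
        rw [div_le_iff₀ hρ, zpow_add_one₀ two_ne_zero]; linarith
  have b : ∑ k ∈ K with ¬ k ≤ k₀, min (2 ^ k / ρ) (ρ / 2 ^ k) ≤ 2 := by
    calc _ ≤ ∑ k ∈ K with ¬ k ≤ k₀, ρ * (2:ℝ) ^ (-k) := Finset.sum_le_sum fun k _ => by
          rw [zpow_neg, ← div_eq_mul_inv]; exact min_le_right _ _
      _ ≤ ρ * 2 ^ (-(k₀ + 1) + 1) := by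
        rw [← Finset.mul_sum]
        gcongr
        exact sum_two_zpow_neg_le _ fun k hk => by
          have := (Finset.mem_filter.1 hk).2; omega
      _ ≤ 2 := by
        rw [show -(k₀ + 1) + 1 = -k₀ by ring, zpow_neg, ← div_eq_mul_inv,
          div_le_iff₀ (by positivity)]
        rw [zpow_add_one₀ two_ne_zero] at h2
        linarith
  linarith

/-! ### Distance to a family of tiles -/

/-- Distance from `y` to the family `S`, taking scales into account. -/
noncomputable def dist' (S : Finset Tile) (hS : S.Nonempty) (y : ℝ) : ℝ :=
  S.inf' hS fun P => P.r + |y - P.c|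

section dist'
variable {S : Finset Tile} (hS : S.Nonempty)

lemma dist'_le {P : Tile} (hP : P ∈ S) (y : ℝ) : dist' S hS y ≤ P.r + |y - P.c| :=
  Finset.inf'_le _ hP

lemma exists_dist'_eq (y : ℝ) : ∃ P ∈ S, dist' S hS y = P.r + |y - P.c| :=
  S.exists_mem_eq_inf' hS _

lemma dist'_pos (y : ℝ) : 0 < dist' S hS y := by
  obtain ⟨P, -, h⟩ := exists_dist'_eq hS y
  rw [h]; linarith [P.r_pos, abs_nonneg (y - P.c)]

lemma dist'_le_add (y y' : ℝ) : dist' S hS y ≤ dist' S hS y' + |y - y'| := by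
  obtain ⟨P, hP, h⟩ := exists_dist'_eq hS y'
  rw [h]
  have := dist'_le hS hP y
  have := abs_sub_le y y' P.c
  linarith

lemma continuous_dist' : Continuous (dist' S hS) := by
  unfold dist'
  exact Continuous.finset_inf'_apply hS fun P _ => by fun_prop

end dist'

/-- The tile `P` contains a point at which all averages of `f` are at most `L`. -/
def Good (L : ℝ) (f : ℝ → ℂ) (P : Tile) : Prop :=
  ∃ x ∈ P.I, ∀ R > 0, ∫ y in Metric.ball x R, ‖f y‖ ≤ L * R

lemma integral_norm_mul_le_of_good {S : Finset Tile} (hS : S.Nonempty) {f : ℝ → ℂ} {L : ℝ}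
    (hL : 0 ≤ L) (hf : Nice f) (hg : ∀ P ∈ S, Good L f P) {v w : ℝ → ℝ}
    (hw : Continuous w) (hv0 : ∀ y, 0 ≤ v y) (hw0 : ∀ y, 0 ≤ w y) (hwi : Integrable w)
    (hfv : Integrable fun y => ‖f y‖ * v y)
    (h : ∀ y y', |y - y'| ≤ dist' S hS y / 4 → v y ≤ w y') :
    ∫ y, ‖f y‖ * v y ≤ 5 * L * ∫ y, w y := by
  set ρ := dist' S hS with hρ
  have hρ0 : ∀ y, 0 < ρ y := dist'_pos hS
  have hρc : Continuous ρ := continuous_dist' hS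
  set B : Set (ℝ × ℝ) := {p | |p.1 - p.2| < ρ p.1 / 4} with hB
  have hBm : MeasurableSet B := by
    apply (isOpen_lt _ _).measurableSet
    · fun_prop
    · exact (hρc.comp continuous_fst).div_const 4
  have s1 : ∀ y, ENNReal.ofReal (v y) ≤
      ∫⁻ y', B.indicator (fun p => ENNReal.ofReal (2 / ρ p.1 * w p.2)) (y, y') := by
    intro y
    have e : ∀ y', B.indicator (fun p => ENNReal.ofReal (2 / ρ p.1 * w p.2)) (y, y') =
        (Metric.ball y (ρ y / 4)).indicator (fun y' => ENNReal.ofReal (2 / ρ y * w y')) y' := by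
      intro y'
      simp only [Set.indicator, hB, Set.mem_ofPred_eq, Metric.mem_ball, Real.dist_eq]
      rw [abs_sub_comm]
    simp only [e]
    rw [lintegral_indicator measurableSet_ball]
    calc ENNReal.ofReal (v y) = ENNReal.ofReal (2 / ρ y * v y) * volume (Metric.ball y (ρ y / 4)) := by
          rw [Real.volume_ball, ← ENNReal.ofReal_mul (mul_nonneg (by have := hρ0 y; positivity) (hv0 y))]
          congr 1
          have := (hρ0 y).ne'
          field_simp; norm_num
      _ = ∫⁻ y' in Metric.ball y (ρ y / 4), ENNReal.ofReal (2 / ρ y * v y) := by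
          rw [setLIntegral_const]
      _ ≤ _ := by
          refine setLIntegral_mono' measurableSet_ball fun y' hy' => ?_
          rw [Metric.mem_ball, Real.dist_eq] at hy'
          have := hρ0 y
          gcongr
          exact h y y' (by rw [abs_sub_comm]; exact hy'.le)
  have s2 : ∀ y', ∫⁻ y, ENNReal.ofReal ‖f y‖ *
      B.indicator (fun p => ENNReal.ofReal (2 / ρ p.1 * w p.2)) (y, y') ≤
      ENNReal.ofReal (5 * L * w y') := by
    intro y'
    obtain ⟨P, hP, hPe⟩ := exists_dist'_eq hS y'
    obtain ⟨x, hx, hxR⟩ := hg P hP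
    have hr0 := hρ0 y'
    have hR := hxR (2 * ρ y') (by positivity)
    calc _ ≤ ∫⁻ y, (Metric.ball x (2 * ρ y')).indicator
          (fun y => ENNReal.ofReal (5 / 2 / ρ y' * w y') * ENNReal.ofReal ‖f y‖) y := by
          refine lintegral_mono fun y => ?_
          by_cases hy : (y, y') ∈ B
          · have hy2 : |y - y'| < ρ y / 4 := hy
            have a1 : ρ y ≤ ρ y' + |y - y'| := dist'_le_add hS y y'
            have a2 : ρ y' ≤ ρ y + |y - y'| := by
              rw [abs_sub_comm]; exact dist'_le_add hS y' y
            have a3 := Tile.abs_sub_c_le hx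
            have hm : y ∈ Metric.ball x (2 * ρ y') := by
              rw [Metric.mem_ball, Real.dist_eq]
              have := abs_sub_le y y' x
              have := abs_sub_le y' P.c x
              rw [abs_sub_comm P.c x] at this
              have : ρ y' = P.r + |y' - P.c| := hPe
              linarith
            rw [Set.indicator_of_mem hy, Set.indicator_of_mem hm, mul_comm]
            simp only
            gcongr ?_ * _
            apply ENNReal.ofReal_le_ofReal
            have := hw0 y'
            gcongr ?_ * _
            have := hρ0 y
            rw [div_le_div_iff₀ (by positivity) (by positivity)]
            linarith
          · rw [Set.indicator_of_notMem hy, mul_zero]; exact zero_le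
      _ = ENNReal.ofReal (5 / 2 / ρ y' * w y') *
          ENNReal.ofReal (∫ y in Metric.ball x (2 * ρ y'), ‖f y‖) := by
          rw [lintegral_indicator measurableSet_ball, lintegral_const_mul' _ _ ENNReal.ofReal_ne_top,
            ofReal_integral_eq_lintegral_ofReal hf.integrable.norm.integrableOn
              (Filter.Eventually.of_forall fun _ => norm_nonneg _)]
      _ ≤ ENNReal.ofReal (5 / 2 / ρ y' * w y') * ENNReal.ofReal (L * (2 * ρ y')) := by gcongr
      _ = _ := by
          have := hw0 y'
          rw [← ENNReal.ofReal_mul (by positivity)]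
          congr 1
          field_simp
  have hwnn : 0 ≤ 5 * L * ∫ y, w y := by
    have : 0 ≤ ∫ y, w y := integral_nonneg fun y => hw0 y
    positivity
  rw [← ENNReal.ofReal_le_ofReal_iff hwnn, ofReal_integral_eq_lintegral_ofReal hfv
    (Filter.Eventually.of_forall fun y => mul_nonneg (norm_nonneg _) (hv0 y)),
    ENNReal.ofReal_mul (by positivity), ofReal_integral_eq_lintegral_ofReal hwi
    (Filter.Eventually.of_forall hw0)]
  have hBi : Measurable (B.indicator fun p => ENNReal.ofReal (2 / ρ p.1 * w p.2)) := by
    refine Measurable.indicator ?_ hBm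
    have := hρc.measurable; have := hw.measurable
    fun_prop
  calc _ ≤ ∫⁻ y, ∫⁻ y', ENNReal.ofReal ‖f y‖ *
        B.indicator (fun p => ENNReal.ofReal (2 / ρ p.1 * w p.2)) (y, y') := by
        refine lintegral_mono fun y => ?_
        rw [lintegral_const_mul' _ _ ENNReal.ofReal_ne_top, ENNReal.ofReal_mul (norm_nonneg _)]
        gcongr
        exact s1 y
    _ = ∫⁻ y', ∫⁻ y, ENNReal.ofReal ‖f y‖ *
        B.indicator (fun p => ENNReal.ofReal (2 / ρ p.1 * w p.2)) (y, y') := by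
        refine lintegral_lintegral_swap ?_
        refine AEMeasurable.mul ?_ hBi.aemeasurable
        exact (hf.aesm.norm.comp_fst (ν := volume)).aemeasurable.ennreal_ofReal
    _ ≤ ∫⁻ y', ENNReal.ofReal (5 * L * w y') := lintegral_mono s2
    _ = _ := by
        rw [← lintegral_const_mul' _ _ ENNReal.ofReal_ne_top]
        refine lintegral_congr fun y => ?_
        rw [← ENNReal.ofReal_mul (by positivity)]

/-! ### The size lemma -/

open Classical in
/-- The energies of all overlapping trees in `𝔓` are at most `σ²`. -/
def IsSize (f : ℝ → ℂ) (𝔓 : Finset Tile) (σ : ℝ) : Prop :=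
  ∀ (k n : ℤ) (ξ : ℝ), ∑ P ∈ 𝔓 with P.sub k n ∧ P.om2 ξ, P.s f ≤ σ ^ 2 * 2 ^ k

lemma Tile.sub.abs_c_sub_le {P : Tile} {k n : ℤ} (h : P.sub k n) : |P.c - 2 ^ k * n| ≤ 2 ^ k := by
  have h1 := dy_eq_iff.1 h.2
  have := two_zpow_pos k
  rw [abs_le]; constructor <;> nlinarith [h1.1, h1.2]

lemma Tile.eq_of_om {P Q : Tile} {ξ : ℝ} (hP : P.om ξ) (hQ : Q.om ξ) (hk : Q.k = P.k) :
    Q.m = P.m := by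
  rw [Tile.om] at hP hQ
  rw [← hP, ← hQ, hk]

/-- The weight controlling the oscillation of the wave packet of `P` at the scale of `S`. -/
noncomputable def oscWeight (S : Finset Tile) (hS : S.Nonempty) (P : Tile) (y : ℝ) : ℝ :=
  min 1 (dist' S hS y / P.r) * decay ((y - P.c) / P.r) ^ 6

section oscWeight
variable {S : Finset Tile} (hS : S.Nonempty)

lemma oscWeight_nonneg (P : Tile) (y : ℝ) : 0 ≤ oscWeight S hS P y :=
  mul_nonneg (le_min zero_le_one (div_nonneg (dist'_pos hS y).le P.r_pos.le))
    (pow_nonneg (decay_nonneg _) _)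

lemma continuous_oscWeight (P : Tile) : Continuous (oscWeight S hS P) := by
  have := continuous_dist' hS
  unfold oscWeight
  fun_prop

lemma oscWeight_le (P : Tile) (y : ℝ) : oscWeight S hS P y ≤ decay ((y - P.c) / P.r) ^ 2 := by
  calc _ ≤ 1 * decay ((y - P.c) / P.r) ^ 6 :=
        mul_le_mul_of_nonneg_right (min_le_left _ _) (pow_nonneg (decay_nonneg _) _)
    _ ≤ _ := by rw [one_mul]; exact decay_pow_le_pow (by norm_num) _

lemma integrable_oscWeight (P : Tile) : Integrable (oscWeight S hS P) := by
  refine (integrable_decay_scaled le_rfl P.r_pos P.c).mono'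
    (continuous_oscWeight hS P).aestronglyMeasurable (Filter.Eventually.of_forall fun y => ?_)
  rw [Real.norm_of_nonneg (oscWeight_nonneg hS P y)]
  exact oscWeight_le hS P y

lemma integral_oscWeight_le (P : Tile) : ∫ y, oscWeight S hS P y ≤ 4 * P.r :=
  (integral_mono (integrable_oscWeight hS P) (integrable_decay_scaled le_rfl P.r_pos P.c)
    (oscWeight_le hS P)).trans (integral_decay_scaled_le le_rfl P.r_pos P.c)

lemma decay_le_div_dist' {P : Tile} (hP : P ∈ S) (y : ℝ) :
    decay ((y - P.c) / P.r) ≤ P.r / dist' S hS y := by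
  have hr := P.r_pos
  rw [decay, abs_div, abs_of_pos hr, show 1 + |y - P.c| / P.r = (P.r + |y - P.c|) / P.r by field_simp,
    inv_div]
  exact div_le_div_of_nonneg_left hr.le (dist'_pos hS y) (dist'_le hS hP y)

variable {k n : ℤ}

lemma abs_sub_le_dist' (hk : ∀ P ∈ S, P.sub k n) (y : ℝ) : |y - 2 ^ k * n| ≤ dist' S hS y + 2 ^ k := by
  obtain ⟨P, hP, h⟩ := exists_dist'_eq hS y
  have := (hk P hP).abs_c_sub_le
  have := abs_sub_le y P.c (2 ^ k * n)
  rw [h]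
  linarith [P.r_pos]

lemma min_div_dist'_le (hk : ∀ P ∈ S, P.sub k n) (y : ℝ) :
    min 1 (2 ^ k / dist' S hS y) ≤ 3 * decay ((y - 2 ^ k * n) / 2 ^ k) := by
  have hr := two_zpow_pos k
  have h := abs_sub_le_dist' hS hk y
  have h0 := dist'_pos hS y
  set a := |y - 2 ^ k * n| with ha
  have ha0 : 0 ≤ a := abs_nonneg _
  rw [decay, abs_div, abs_of_pos hr, ← ha, show 1 + a / 2 ^ k = (2 ^ k + a) / 2 ^ k by field_simp,
    inv_div, mul_div_assoc']
  by_cases h2 : a ≤ 2 * 2 ^ k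
  · refine (min_le_left _ _).trans ?_
    rw [le_div_iff₀ (by positivity)]; linarith
  · refine (min_le_right _ _).trans ?_
    rw [div_le_div_iff₀ h0 (by positivity)]
    nlinarith

lemma sum_oscWeight_le (hk : ∀ P ∈ S, P.sub k n) {ξ : ℝ} (hξ : ∀ P ∈ S, P.om ξ) (y : ℝ) :
    ∑ P ∈ S, oscWeight S hS P y ≤ 1152 * decay ((y - 2 ^ k * n) / 2 ^ k) ^ 2 := by
  set ρ := dist' S hS y with hρ
  have h0 : 0 < ρ := dist'_pos hS y
  have hd := decay_nonneg ((y - 2 ^ k * n) / 2 ^ k)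
  rw [← Finset.sum_fiberwise_of_maps_to (g := Tile.k) (t := S.image Tile.k)
    fun P hP => Finset.mem_image_of_mem _ hP]
  calc _ ≤ ∑ j ∈ S.image Tile.k, 288 * decay ((y - 2 ^ k * n) / 2 ^ k) ^ 2 *
        min (2 ^ j / ρ) (ρ / 2 ^ j) := by
        refine Finset.sum_le_sum fun j hj => ?_
        obtain ⟨Q, hQ, rfl⟩ := Finset.mem_image.1 hj
        have hjk : (2:ℝ) ^ Q.k ≤ 2 ^ k := zpow_le_zpow_right₀ one_le_two (hk Q hQ).1
        have hj0 := two_zpow_pos Q.k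
        have hm : min 1 (ρ / 2 ^ Q.k) * min 1 (2 ^ Q.k / ρ) = min (2 ^ Q.k / ρ) (ρ / 2 ^ Q.k) := by
          rcases le_total ρ (2 ^ Q.k) with h | h
          · have a1 : ρ / 2 ^ Q.k ≤ 1 := (div_le_one hj0).2 h
            have a2 : 1 ≤ 2 ^ Q.k / ρ := (one_le_div h0).2 h
            rw [min_eq_right a1, min_eq_left a2, min_eq_right (a1.trans a2), mul_one]
          · have a1 : 1 ≤ ρ / 2 ^ Q.k := (one_le_div hj0).2 h
            have a2 : 2 ^ Q.k / ρ ≤ 1 := (div_le_one h0).2 h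
            rw [min_eq_right a2, min_eq_left a1, min_eq_left (a2.trans a1), one_mul]
        have hsum : ∑ P ∈ S with P.k = Q.k, decay ((y - P.c) / 2 ^ Q.k) ^ 3 ≤ 32 := by
          have := sum_decay_le (S := S.filter fun P => P.k = Q.k) (r := 2 ^ Q.k) hj0
            (fun P hP => by rw [Tile.r, (Finset.mem_filter.1 hP).2])
            (pairwiseDisjoint_of_k (k := Q.k) (m := Q.m) fun P hP => ⟨(Finset.mem_filter.1 hP).2,
              Tile.eq_of_om (hξ Q hQ) (hξ P (Finset.mem_filter.1 hP).1) (Finset.mem_filter.1 hP).2⟩)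
            (show 2 ≤ 3 by norm_num) y
          have e : ∑ P ∈ S with P.k = Q.k, P.r * decay ((y - P.c) / 2 ^ Q.k) ^ 3 =
              2 ^ Q.k * ∑ P ∈ S with P.k = Q.k, decay ((y - P.c) / 2 ^ Q.k) ^ 3 := by
            rw [Finset.mul_sum]
            refine Finset.sum_congr rfl fun P hP => ?_
            rw [Tile.r, (Finset.mem_filter.1 hP).2]
          rw [e] at this
          nlinarith
        have hb : min 1 (2 ^ Q.k / ρ) ≤ 3 * decay ((y - 2 ^ k * n) / 2 ^ k) :=
          le_trans (by gcongr) (min_div_dist'_le hS hk y)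
        have hb0 : 0 ≤ min 1 (2 ^ Q.k / ρ) := by positivity
        have hc0 : 0 ≤ min 1 (ρ / 2 ^ Q.k) := by positivity
        have hterm : ∀ P ∈ S.filter (fun P => P.k = Q.k), oscWeight S hS P y ≤
            min 1 (ρ / 2 ^ Q.k) * min 1 (2 ^ Q.k / ρ) ^ 3 * decay ((y - P.c) / 2 ^ Q.k) ^ 3 := by
          intro P hP
          obtain ⟨hP, hPk⟩ := Finset.mem_filter.1 hP
          have hr : P.r = 2 ^ Q.k := by rw [Tile.r, hPk]
          have h1 : decay ((y - P.c) / 2 ^ Q.k) ≤ min 1 (2 ^ Q.k / ρ) := by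
            refine le_min (decay_le_one _) ?_
            rw [← hr]; exact decay_le_div_dist' hS hP y
          rw [oscWeight, hr, mul_assoc]
          refine mul_le_mul_of_nonneg_left ?_ hc0
          have h2 := decay_nonneg ((y - P.c) / 2 ^ Q.k)
          calc _ = decay ((y - P.c) / 2 ^ Q.k) ^ 3 * decay ((y - P.c) / 2 ^ Q.k) ^ 3 := by ring
            _ ≤ _ := by gcongr
        calc _ ≤ _ := Finset.sum_le_sum hterm
          _ = min 1 (ρ / 2 ^ Q.k) * min 1 (2 ^ Q.k / ρ) ^ 3 *
              ∑ P ∈ S with P.k = Q.k, decay ((y - P.c) / 2 ^ Q.k) ^ 3 := by rw [Finset.mul_sum]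
          _ ≤ min 1 (ρ / 2 ^ Q.k) * min 1 (2 ^ Q.k / ρ) ^ 3 * 32 := by gcongr
          _ = 32 * min 1 (2 ^ Q.k / ρ) ^ 2 * (min 1 (ρ / 2 ^ Q.k) * min 1 (2 ^ Q.k / ρ)) := by ring
          _ ≤ 32 * (3 * decay ((y - 2 ^ k * n) / 2 ^ k)) ^ 2 *
              (min 1 (ρ / 2 ^ Q.k) * min 1 (2 ^ Q.k / ρ)) := by gcongr
          _ = _ := by rw [hm]; ring
    _ ≤ 288 * decay ((y - 2 ^ k * n) / 2 ^ k) ^ 2 * 4 := by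
        rw [← Finset.mul_sum]
        gcongr
        exact sum_min_zpow_le _ h0
    _ = _ := by ring

end oscWeight

lemma ip_G_G_eq_zero {P Q : Tile} {f : ℝ → ℂ} {ξ : ℝ} (hf : Nice f) (hP : P.om2 ξ) (hQ : Q.om2 ξ)
    (h : ¬ (Q.k = P.k ∧ Q.m = P.m)) : ip (P.G f) (Q.G f) = 0 := by
  refine ip_op_eq_zero P.sym_psi Q.sym_psi (fun _ => conj_bsym _ _) (P.nice_WA hf) (Q.nice_WA hf) ?_
  have key : ∀ {P Q : Tile}, P.k < Q.k → P.om2 ξ → Q.om2 ξ → ∀ t,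
      sc psi P.r P.m t * sc psi Q.r Q.m t = 0 := by
    intro P Q hk hP hQ t
    by_contra h0
    obtain ⟨h1, h2⟩ := mul_ne_zero_iff.1 h0
    have a1 := psi_ne_zero h1
    have a2 := psi_ne_zero h2
    have hQt : Q.om t := Tile.om_iff.2 ⟨by linarith, by linarith⟩
    have := (Tile.om2_iff.1 (Tile.om2_of_om2 hk hP (Tile.om_of_om2 hQ) hQt)).1
    linarith
  rcases lt_trichotomy P.k Q.k with hk | hk | hk
  · exact key hk hP hQ
  · exact absurd ⟨hk.symm, Tile.eq_of_om (Tile.om_of_om2 hP) (Tile.om_of_om2 hQ) hk.symm⟩ h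
  · intro t
    rw [mul_comm]; exact key hk hQ hP t

section oscillation
variable {S : Finset Tile} (hS : S.Nonempty) {f : ℝ → ℂ} {C ξ : ℝ}

lemma norm_sum_G_le (hC : 0 ≤ C) (hξ : ∀ P ∈ S, P.om ξ)
    (h1 : ∀ P ∈ S, ∀ y, ‖P.G f y‖ ≤ C * P.γ f * decay ((y - P.c) / P.r) ^ 6)
    (h2 : ∀ P ∈ S, ∀ ξ, P.om ξ → ∀ y y', |y - y'| ≤ P.r →
      ‖(Real.fourierChar (-(ξ * y)) : ℂ) * P.G f y -
        (Real.fourierChar (-(ξ * y')) : ℂ) * P.G f y'‖ ≤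
      C * P.γ f * (|y - y'| / P.r) * decay ((y' - P.c) / P.r) ^ 6)
    {y y' : ℝ} (hy : |y - y'| ≤ dist' S hS y / 4) :
    ‖∑ P ∈ S, P.G f y‖ ≤ ‖∑ P ∈ S, P.G f y'‖ + 13 * C * ∑ P ∈ S, P.γ f * oscWeight S hS P y' := by
  have hd : |y - y'| ≤ dist' S hS y' / 3 := by
    have := dist'_le_add hS y y'; linarith
  have hterm : ∀ P ∈ S, ‖(Real.fourierChar (-(ξ * y)) : ℂ) * P.G f y -
        (Real.fourierChar (-(ξ * y')) : ℂ) * P.G f y'‖ ≤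
      13 * C * (P.γ f * oscWeight S hS P y') := by
    intro P hP
    have hr := P.r_pos
    have hγ := P.γ_nonneg f
    have hρ := dist'_pos hS y'
    have hdec := decay_nonneg ((y' - P.c) / P.r)
    by_cases hyr : |y - y'| ≤ P.r
    · refine (h2 P hP ξ (hξ P hP) y y' hyr).trans ?_
      have : |y - y'| / P.r ≤ min 1 (dist' S hS y' / P.r) := by
        refine le_min ((div_le_one hr).2 hyr) ?_
        gcongr; linarith
      calc _ ≤ C * P.γ f * min 1 (dist' S hS y' / P.r) * decay ((y' - P.c) / P.r) ^ 6 := by gcongr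
        _ = 1 * (C * (P.γ f * oscWeight S hS P y')) := by rw [oscWeight]; ring
        _ ≤ 13 * (C * (P.γ f * oscWeight S hS P y')) := by
          have := oscWeight_nonneg hS P y'
          gcongr; norm_num
        _ = _ := by ring
    · push Not at hyr
      have e : oscWeight S hS P y' = decay ((y' - P.c) / P.r) ^ 6 := by
        rw [oscWeight, min_eq_left, one_mul]
        rw [one_le_div hr]; linarith
      have hdd : decay ((y - P.c) / P.r) ≤ 3 / 2 * decay ((y' - P.c) / P.r) := by
        have a1 := dist'_le hS hP y'
        have a2 : |y' - P.c| ≤ |y - y'| + |y - P.c| := by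
          have := abs_sub_le y' y P.c
          rwa [abs_sub_comm y' y] at this
        have b := abs_nonneg (y - P.c)
        have b' := abs_nonneg (y' - P.c)
        rw [decay, decay, abs_div, abs_div, abs_of_pos hr,
          show 1 + |y - P.c| / P.r = (P.r + |y - P.c|) / P.r by field_simp,
          show 1 + |y' - P.c| / P.r = (P.r + |y' - P.c|) / P.r by field_simp, inv_div, inv_div,
          mul_div_assoc', div_le_div_iff₀ (by positivity) (by positivity)]
        nlinarith
      have hp : decay ((y - P.c) / P.r) ^ 6 ≤ 12 * decay ((y' - P.c) / P.r) ^ 6 := by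
        calc _ ≤ (3 / 2 * decay ((y' - P.c) / P.r)) ^ 6 :=
              pow_le_pow_left₀ (decay_nonneg _) hdd 6
          _ = (3 / 2) ^ 6 * decay ((y' - P.c) / P.r) ^ 6 := by ring
          _ ≤ _ := by gcongr; norm_num
      calc _ ≤ ‖P.G f y‖ + ‖P.G f y'‖ := by
            refine (norm_sub_le _ _).trans ?_
            rw [norm_mul, norm_mul, norm_fourierChar, norm_fourierChar, one_mul, one_mul]
        _ ≤ C * P.γ f * (12 * decay ((y' - P.c) / P.r) ^ 6) +
            C * P.γ f * decay ((y' - P.c) / P.r) ^ 6 := by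
            refine add_le_add ((h1 P hP y).trans ?_) (h1 P hP y')
            gcongr
        _ = _ := by rw [e]; ring
  have hn : ∀ z, ‖∑ P ∈ S, P.G f z‖ = ‖∑ P ∈ S, (Real.fourierChar (-(ξ * z)) : ℂ) * P.G f z‖ := by
    intro z
    rw [← Finset.mul_sum, norm_mul, norm_fourierChar, one_mul]
  rw [hn y, hn y', ← sub_le_iff_le_add', Finset.mul_sum]
  refine (norm_sub_norm_le _ _).trans ?_
  rw [← Finset.sum_sub_distrib]
  exact (norm_sum_le _ _).trans (Finset.sum_le_sum hterm)

variable {k n : ℤ}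

lemma norm_sum_G_le_far (hk : ∀ P ∈ S, P.sub k n)
    (h1 : ∀ P ∈ S, ∀ y, ‖P.G f y‖ ≤ C * P.γ f * decay ((y - P.c) / P.r) ^ 6)
    {y : ℝ} (hy : 2 * 2 ^ k ≤ |y - 2 ^ k * n|) :
    ‖∑ P ∈ S, P.G f y‖ ≤ C * ∑ P ∈ S, P.γ f * oscWeight S hS P y := by
  rw [Finset.mul_sum]
  refine (norm_sum_le _ _).trans (Finset.sum_le_sum fun P hP => (h1 P hP y).trans_eq ?_)
  rw [oscWeight, min_eq_left, one_mul, mul_assoc]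
  rw [one_le_div P.r_pos]
  have := abs_sub_le_dist' hS hk y
  have : P.r ≤ 2 ^ k := zpow_le_zpow_right₀ one_le_two (hk P hP).1
  linarith

end oscillation

lemma integral_linear_three {u v w : ℝ → ℝ} (hu : Integrable u) (hv : Integrable v)
    (hw : Integrable w) (a b c : ℝ) : ∫ y, (a * u y + b * v y + c * w y) =
      a * (∫ y, u y) + b * (∫ y, v y) + c * ∫ y, w y := by
  have h : Integrable fun y => a * u y + b * v y := (hu.const_mul a).add (hv.const_mul b)
  rw [integral_add h (hw.const_mul c), integral_add (hu.const_mul a) (hv.const_mul b),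
    integral_const_mul, integral_const_mul, integral_const_mul]

/-- If all tiles are good for `f` then the size of `f` is controlled. -/
lemma exists_isSize_of_good : ∃ C : ℝ, 0 < C ∧ ∀ (f : ℝ → ℂ), Nice f → ∀ (𝔓 : Finset Tile) (L : ℝ),
    0 ≤ L → (∀ P ∈ 𝔓, Good L f P) → IsSize f 𝔓 (C * L) := by
  obtain ⟨C, hC, hG⟩ := exists_norm_G_le
  set K : ℝ := 5 * (128 * C ^ 2 + 32256 * C + 18) with hK
  have hK0 : 0 < K := by positivity
  refine ⟨2 * K, by positivity, fun f hf 𝔓 L hL hgood k n ξ => ?_⟩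
  classical
  set S := 𝔓.filter fun P => P.sub k n ∧ P.om2 ξ with hSdef
  have hr := two_zpow_pos k
  have hA0 : 0 ≤ ∑ P ∈ S, P.s f := Finset.sum_nonneg fun P _ => P.s_nonneg f
  have hgoal : (∀ t > 0, ∑ P ∈ S, P.s f ≤ L * K * (t * (∑ P ∈ S, P.s f) + 2 ^ k / t)) →
      ∑ P ∈ S, P.s f ≤ (2 * K * L) ^ 2 * 2 ^ k := by
    intro h
    rcases hL.eq_or_lt with rfl | hL
    · have := h 1 one_pos
      simp only [zero_mul] at this
      simpa using this
    · have := h (1 / (2 * (L * K))) (by positivity)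
      have e : L * K * (1 / (2 * (L * K)) * (∑ P ∈ S, P.s f) + 2 ^ k / (1 / (2 * (L * K)))) =
          (∑ P ∈ S, P.s f) / 2 + 2 * (K * L) ^ 2 * 2 ^ k := by field_simp
      rw [e] at this
      nlinarith
  have goal_eq : ∑ P ∈ 𝔓 with P.sub k n ∧ P.om2 ξ, P.s f = ∑ P ∈ S, P.s f := by
    rw [hSdef]
  rw [goal_eq]
  refine hgoal fun t ht => ?_
  rcases S.eq_empty_or_nonempty with hS | hS
  · rw [hS]; simp only [Finset.sum_empty]; positivity
  have hSm : ∀ P ∈ S, P ∈ 𝔓 ∧ P.sub k n ∧ P.om2 ξ := fun P hP => by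
    simpa [hSdef] using hP
  have hSs : ∀ P ∈ S, P.sub k n := fun P hP => (hSm P hP).2.1
  have hSξ : ∀ P ∈ S, P.om ξ := fun P hP => Tile.om_of_om2 (hSm P hP).2.2
  have hg1 : ∀ P ∈ S, ∀ y, ‖P.G f y‖ ≤ C * P.γ f * decay ((y - P.c) / P.r) ^ 6 :=
    fun P _ => (hG P f hf).1
  have hg2 := fun (P : Tile) (_ : P ∈ S) => (hG P f hf).2
  have hnG : ∀ P ∈ S, Nice (P.G f) := fun P _ => P.nice_G hf
  set H : ℝ → ℂ := fun y => ∑ P ∈ S, P.G f y with hH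
  have hHn : Nice H := Nice.sum hnG
  set E : ℝ → ℝ := fun y => ∑ P ∈ S, P.γ f * oscWeight S hS P y with hE
  have hE0 : ∀ y, 0 ≤ E y := fun y =>
    Finset.sum_nonneg fun P _ => mul_nonneg (P.γ_nonneg f) (oscWeight_nonneg hS P y)
  have hEc : Continuous E := continuous_finsetSum _ fun P _ =>
    (continuous_oscWeight hS P).const_mul _
  have hEi : Integrable E := integrable_finsetSum _ fun P _ => (integrable_oscWeight hS P).const_mul _
  have hHc : Continuous H := continuous_finsetSum _ fun P _ =>
    continuous_op P.sym_psi (P.nice_WA hf).integrable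
  have hnsq : nsq H ≤ 256 * C ^ 2 * ∑ P ∈ S, P.s f := by
    refine (nsq_sum_le_of_orthogonal S (γ := fun P => C * P.γ f)
      (fun P _ => mul_nonneg hC.le (P.γ_nonneg f)) hnG hg1 fun P hP Q hQ h =>
        ip_G_G_eq_zero hf (hSm P hP).2.2 (hSm Q hQ).2.2 h).trans_eq ?_
    rw [mul_assoc, Finset.mul_sum (a := C ^ 2)]
    congr 1
    refine Finset.sum_congr rfl fun P _ => ?_
    rw [mul_pow, mul_assoc, P.sq_γ_mul]
  have hA : ∑ P ∈ S, P.s f ≤ ∫ y, ‖f y‖ * ‖H y‖ := by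
    have e : ((∑ P ∈ S, P.s f : ℝ) : ℂ) = ip f H := by
      rw [hH, ip_sum_right hnG hf, Complex.ofReal_sum]
      exact Finset.sum_congr rfl fun P _ => (P.ip_G hf).symm
    have e2 : ∑ P ∈ S, P.s f = ‖ip f H‖ := by
      rw [← e, Complex.norm_real, Real.norm_of_nonneg hA0]
    rw [e2, ip]
    refine (norm_integral_le_integral_norm _).trans_eq ?_
    simp
  have hAV := integral_norm_mul_le_of_good hS hL hf (fun P hP => hgood P (hSm P hP).1)
    (v := fun y => ‖H y‖) (w := fun y => ‖H y‖ + 13 * C * E y) (by fun_prop)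
    (fun y => norm_nonneg _) (fun y => by have := hE0 y; positivity)
    (hHn.integrable.norm.add (hEi.const_mul _)) (hf.integrable_norm_mul hHn)
    fun y y' h => norm_sum_G_le hS hC.le hSξ hg1 hg2 h
  set D : ℝ → ℝ := fun y => decay ((y - 2 ^ k * n) / 2 ^ k) ^ 2 with hD
  have hDi : Integrable D := integrable_decay_scaled le_rfl hr _
  have hD4 : ∫ y, D y ≤ 4 * 2 ^ k := integral_decay_scaled_le le_rfl hr _
  set B : ℝ → ℝ := fun y => ∑ P ∈ S, P.γ f ^ 2 * oscWeight S hS P y with hB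
  have hBi : Integrable B := integrable_finsetSum _ fun P _ => (integrable_oscWeight hS P).const_mul _
  have hB4 : ∫ y, B y ≤ 4 * ∑ P ∈ S, P.s f := by
    rw [hB, integral_finsetSum _ fun P _ => (integrable_oscWeight hS P).const_mul _, Finset.mul_sum]
    refine Finset.sum_le_sum fun P _ => ?_
    rw [integral_const_mul, ← P.sq_γ_mul f]
    have := integral_oscWeight_le hS P
    nlinarith [sq_nonneg (P.γ f)]
  have hEB : ∀ y, E y ≤ (t * B y + 1152 * D y / t) / 2 := by
    intro y
    have h1 := sum_oscWeight_le hS hSs hSξ y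
    have h2 : 1152 * D y / t ≥ (∑ P ∈ S, oscWeight S hS P y) / t := by gcongr
    refine le_trans ?_ (show (t * B y + (∑ P ∈ S, oscWeight S hS P y) / t) / 2 ≤ _ by gcongr)
    rw [hE, hB, Finset.mul_sum, Finset.sum_div, ← Finset.sum_add_distrib, Finset.sum_div]
    refine Finset.sum_le_sum fun P _ => ?_
    have h3 := oscWeight_nonneg hS P y
    have h4 : 2 * P.γ f ≤ t * P.γ f ^ 2 + 1 / t := by
      have : t * P.γ f ^ 2 + 1 / t - 2 * P.γ f = (t * P.γ f - 1) ^ 2 / t := by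
        field_simp; ring
      have : 0 ≤ (t * P.γ f - 1) ^ 2 / t := by positivity
      linarith
    have : (t * (P.γ f ^ 2 * oscWeight S hS P y) + oscWeight S hS P y / t) / 2 =
      (t * P.γ f ^ 2 + 1 / t) * oscWeight S hS P y / 2 := by ring
    rw [this]
    nlinarith
  have hHle : ∀ y, ‖H y‖ ≤ (t * ‖H y‖ ^ 2 + 9 * D y / t) / 2 + C * E y := by
    intro y
    have hD0 : 0 ≤ D y := pow_nonneg (decay_nonneg _) _
    by_cases hy : 2 * 2 ^ k ≤ |y - 2 ^ k * n|
    · have := norm_sum_G_le_far hS hSs hg1 hy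
      have h0 : 0 ≤ (t * ‖H y‖ ^ 2 + 9 * D y / t) / 2 := by positivity
      linarith
    · push Not at hy
      have h9 : 1 ≤ 9 * D y := by
        have : 1 ≤ 3 * decay ((y - 2 ^ k * n) / 2 ^ k) := by
          rw [decay, abs_div, abs_of_pos hr, ← div_eq_mul_inv, one_le_div (by positivity)]
          have : |y - 2 ^ k * n| / 2 ^ k ≤ 2 := by rw [div_le_iff₀ hr]; exact hy.le
          linarith
        simp only [hD]
        nlinarith
      have h4 : 2 * ‖H y‖ ≤ t * ‖H y‖ ^ 2 + 1 / t := by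
        have : t * ‖H y‖ ^ 2 + 1 / t - 2 * ‖H y‖ = (t * ‖H y‖ - 1) ^ 2 / t := by
          field_simp; ring
        have : 0 ≤ (t * ‖H y‖ - 1) ^ 2 / t := by positivity
        linarith
      have h5 : 1 / t ≤ 9 * D y / t := by gcongr
      have := mul_nonneg hC.le (hE0 y)
      linarith
  have hw : ∫ y, (‖H y‖ + 13 * C * E y) ≤
      ∫ y, (t / 2 * ‖H y‖ ^ 2 + 7 * C * t * B y + (9 / 2 + 8064 * C) / t * D y) := by
    refine integral_mono (hHn.integrable.norm.add (hEi.const_mul _))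
      (((hHn.integrable_sq.const_mul _).add (hBi.const_mul _)).add (hDi.const_mul _)) fun y => ?_
    have h1 := hHle y
    have h2 := hEB y
    calc _ ≤ (t * ‖H y‖ ^ 2 + 9 * D y / t) / 2 + 14 * C * E y := by linarith
      _ ≤ (t * ‖H y‖ ^ 2 + 9 * D y / t) / 2 + 14 * C * ((t * B y + 1152 * D y / t) / 2) := by gcongr
      _ = _ := by ring
  rw [integral_linear_three hHn.integrable_sq hBi hDi] at hw
  calc _ ≤ _ := hA
    _ ≤ _ := hAV
    _ ≤ 5 * L * (t / 2 * (256 * C ^ 2 * ∑ P ∈ S, P.s f) + 7 * C * t * (4 * ∑ P ∈ S, P.s f) +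
        (9 / 2 + 8064 * C) / t * (4 * 2 ^ k)) := by
      gcongr
      refine hw.trans ?_
      have : ∫ y, ‖H y‖ ^ 2 ≤ 256 * C ^ 2 * ∑ P ∈ S, P.s f := hnsq
      gcongr
    _ = L * (5 * (128 * C ^ 2 + 28 * C)) * (t * ∑ P ∈ S, P.s f) +
        L * (5 * (32256 * C + 18)) * (2 ^ k / t) := by ring
    _ ≤ L * K * (t * ∑ P ∈ S, P.s f) + L * K * (2 ^ k / t) := by
      have a1 : 5 * (128 * C ^ 2 + 28 * C) ≤ K := by rw [hK]; nlinarith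
      have a2 : 5 * (32256 * C + 18) ≤ K := by rw [hK]; nlinarith
      gcongr
    _ = _ := by ring

/-! ### The energy lemma -/

/-- The dyadic interval of scale `k` and index `n`. -/
def dyI (k n : ℤ) : Set ℝ := {x | dy k x = n}

lemma dyI_eq (k n : ℤ) : dyI k n = Set.Ico ((2:ℝ) ^ k * n) (2 ^ k * n + 2 ^ k) :=
  (Tile.mk k n 0).I_eq

lemma measurableSet_dyI (k n : ℤ) : MeasurableSet (dyI k n) := by
  rw [dyI_eq]; exact measurableSet_Ico

lemma Tile.sub.subset_dyI {P : Tile} {k n : ℤ} (h : P.sub k n) : P.I ⊆ dyI k n := fun _ hx => h.mem hx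

lemma mul_lintegral_decay_le {P : Tile} {r : ℝ} (hr : P.r ≤ r) {J : Set ℝ} (hJ : MeasurableSet J) :
    ENNReal.ofReal P.r * ∫⁻ y in J, ENNReal.ofReal (decay ((P.c - y) / r) ^ 4) ≤
      16 * ∫⁻ x in P.I, ∫⁻ y in J, ENNReal.ofReal (decay ((x - y) / r) ^ 4) := by
  rw [← P.volume_I, mul_comm, ← setLIntegral_const,
    ← lintegral_const_mul' _ _ (by norm_num)]
  refine setLIntegral_mono' P.measurableSet_I fun x hx => ?_
  rw [← lintegral_const_mul' _ _ (by norm_num)]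
  refine setLIntegral_mono' hJ fun y _ => ?_
  rw [show (16 : ℝ≥0∞) = ENNReal.ofReal (2 ^ 4) by norm_num,
    ← ENNReal.ofReal_mul (by norm_num), ← mul_pow]
  have h := decay_le_two_mul (x := y) (P.r_pos.trans_le hr) ((Tile.abs_sub_c_le hx).trans hr)
  rw [decay_sub_comm, decay_sub_comm y] at h
  exact ENNReal.ofReal_le_ofReal (pow_le_pow_left₀ (decay_nonneg _) h 4)

lemma sum_lintegral_compl_le_of_k {S : Finset Tile} {k n j m : ℤ} (hS : ∀ P ∈ S, P.sub k n)
    (hj : ∀ P ∈ S, P.k = j ∧ P.m = m) :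
    ∑ P ∈ S, ∫⁻ y in (dyI k n)ᶜ, ENNReal.ofReal (decay ((P.c - y) / P.r) ^ 4) ≤
      ENNReal.ofReal (512 * 2 ^ j) := by
  have hj0 := two_zpow_pos j
  have h1 : ENNReal.ofReal (2 ^ j) *
      ∑ P ∈ S, ∫⁻ y in (dyI k n)ᶜ, ENNReal.ofReal (decay ((P.c - y) / P.r) ^ 4) ≤
      ENNReal.ofReal (2 ^ j) * ENNReal.ofReal (512 * 2 ^ j) := by
    calc _ ≤ ∑ P ∈ S, 16 * ∫⁻ x in P.I, ∫⁻ y in (dyI k n)ᶜ,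
          ENNReal.ofReal (decay ((x - y) / 2 ^ j) ^ 4) := by
          rw [Finset.mul_sum]
          refine Finset.sum_le_sum fun P hP => ?_
          have := mul_lintegral_decay_le (P := P) le_rfl (measurableSet_dyI k n).compl
          rwa [Tile.r, (hj P hP).1] at this ⊢
      _ = 16 * ∫⁻ x in ⋃ P ∈ S, P.I, ∫⁻ y in (dyI k n)ᶜ,
          ENNReal.ofReal (decay ((x - y) / 2 ^ j) ^ 4) := by
          rw [← Finset.mul_sum, lintegral_biUnion_finset (pairwiseDisjoint_of_k hj)
            fun P _ => P.measurableSet_I]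
      _ ≤ 16 * ∫⁻ x in dyI k n, ∫⁻ y in (dyI k n)ᶜ,
          ENNReal.ofReal (decay ((x - y) / 2 ^ j) ^ 4) := by
          gcongr
          exact Set.iUnion₂_subset fun P hP => (hS P hP).subset_dyI
      _ ≤ 16 * ENNReal.ofReal (32 * (2 ^ j) ^ 2) := by
          gcongr
          rw [dyI_eq]
          exact lintegral_lintegral_decay_compl_le hj0
      _ = _ := by
          rw [show (16 : ℝ≥0∞) = ENNReal.ofReal 16 by norm_num,
            ← ENNReal.ofReal_mul (by norm_num), ← ENNReal.ofReal_mul hj0.le]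
          congr 1; ring
  rwa [ENNReal.mul_le_mul_iff_right (by simpa using hj0) ENNReal.ofReal_ne_top] at h1

lemma integrable_decay_center (c : ℝ) {r : ℝ} (hr : 0 < r) :
    Integrable fun y => decay ((c - y) / r) ^ 4 := integrable_decay_scaled' (by norm_num) hr c

lemma sum_integral_compl_le {S : Finset Tile} {k n : ℤ} {ξ : ℝ} (hS : ∀ P ∈ S, P.sub k n)
    (hξ : ∀ P ∈ S, P.om ξ) :
    ∑ P ∈ S, ∫ y in (dyI k n)ᶜ, decay ((P.c - y) / P.r) ^ 4 ≤ 1024 * 2 ^ k := by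
  have hk0 := two_zpow_pos k
  rw [← ENNReal.ofReal_le_ofReal_iff (by positivity), ENNReal.ofReal_sum_of_nonneg
    fun P _ => integral_nonneg fun y => pow_nonneg (decay_nonneg _) _]
  calc _ = ∑ P ∈ S, ∫⁻ y in (dyI k n)ᶜ, ENNReal.ofReal (decay ((P.c - y) / P.r) ^ 4) :=
        Finset.sum_congr rfl fun P _ => ofReal_integral_eq_lintegral_ofReal
          (integrable_decay_center _ P.r_pos).integrableOn
          (Filter.Eventually.of_forall fun y => pow_nonneg (decay_nonneg _) _)
    _ = ∑ j ∈ S.image Tile.k, ∑ P ∈ S with P.k = j,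
        ∫⁻ y in (dyI k n)ᶜ, ENNReal.ofReal (decay ((P.c - y) / P.r) ^ 4) :=
        (Finset.sum_fiberwise_of_maps_to (fun P hP => Finset.mem_image_of_mem _ hP) _).symm
    _ ≤ ∑ j ∈ S.image Tile.k, ENNReal.ofReal (512 * 2 ^ j) := by
        refine Finset.sum_le_sum fun j _ => sum_lintegral_compl_le_of_k (m := dy (-j) ξ)
          (fun P hP => hS P (Finset.mem_filter.1 hP).1) fun P hP' => ?_
        obtain ⟨hP, rfl⟩ := Finset.mem_filter.1 hP'
        exact ⟨rfl, (hξ P hP).symm⟩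
    _ = ENNReal.ofReal (512 * ∑ j ∈ S.image Tile.k, 2 ^ j) := by
        rw [← ENNReal.ofReal_sum_of_nonneg fun j _ => by positivity, Finset.mul_sum]
    _ ≤ _ := by
        apply ENNReal.ofReal_le_ofReal
        have : ∑ j ∈ S.image Tile.k, (2:ℝ) ^ j ≤ 2 ^ (k + 1) := sum_two_zpow_le _ fun j hj => by
          obtain ⟨P, hP, rfl⟩ := Finset.mem_image.1 hj
          exact (hS P hP).1
        rw [zpow_add_one₀ two_ne_zero] at this
        linarith

/-- A tree top together with a selected overlapping tree. -/
structure Top where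
  /-- scale of the top interval -/
  k : ℤ
  /-- index of the top interval -/
  n : ℤ
  /-- top frequency -/
  ξ : ℝ
  /-- the selected tiles -/
  S : Finset Tile

/-- The tile `P` lies under the top `T`. -/
def Top.D (T : Top) (P : Tile) : Prop := P.sub T.k T.n ∧ P.om T.ξ

open Classical in
lemma Tile.om2_max_left {S : Finset Tile} (hS : S.Nonempty) {ξ : ℝ} (h : ∀ P ∈ S, P.om2 ξ) :
    ∃ Q ∈ S, (∀ P ∈ S, P.om2 (Q.fc + (2 * Q.r)⁻¹)) ∧ Q.fc + (2 * Q.r)⁻¹ ≤ ξ := by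
  obtain ⟨Q, hQ, hmax⟩ := S.exists_max_image (fun Q => Q.fc + (2 * Q.r)⁻¹) hS
  have e : ∀ P : Tile, P.r * (P.fc + (2 * P.r)⁻¹) = P.m + 1 / 2 := by
    intro P
    have h1 := P.r_pos.ne'
    have h2 : P.r * P.fc = P.m := by
      rw [Tile.r, Tile.fc, ← mul_assoc, ← zpow_add₀ two_ne_zero]; simp
    rw [mul_add, h2]; field_simp
  have hle : ∀ P ∈ S, P.fc + (2 * P.r)⁻¹ ≤ ξ := by
    intro P hP
    have := (Tile.om2_iff.1 (h P hP)).1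
    have h2 := e P
    exact le_of_mul_le_mul_left (by linarith) P.r_pos
  refine ⟨Q, hQ, fun P hP => Tile.om2_iff.2 ⟨?_, ?_⟩, hle Q hQ⟩
  · have := mul_le_mul_of_nonneg_left (hmax P hP) P.r_pos.le
    rw [e P] at this; linarith
  · have := mul_le_mul_of_nonneg_left (hle Q hQ) P.r_pos.le
    linarith [(Tile.om2_iff.1 (h P hP)).2]

open Classical in
/-- The overlapping tree with the given data has large energy. -/
def Heavy (f : ℝ → ℂ) (𝔓 : Finset Tile) (σ : ℝ) (k n : ℤ) (ξ : ℝ) : Prop :=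
  σ ^ 2 * 2 ^ k < ∑ P ∈ 𝔓 with P.sub k n ∧ P.om2 ξ, P.s f

lemma isSize_iff {f : ℝ → ℂ} {𝔓 : Finset Tile} {σ : ℝ} :
    IsSize f 𝔓 σ ↔ ∀ k n ξ, ¬ Heavy f 𝔓 σ k n ξ := by
  simp only [IsSize, Heavy, not_lt]

lemma Heavy.mono {f : ℝ → ℂ} {𝔓 𝔓' : Finset Tile} {σ : ℝ} {k n : ℤ} {ξ : ℝ}
    (h : Heavy f 𝔓 σ k n ξ) (hs : 𝔓 ⊆ 𝔓') : Heavy f 𝔓' σ k n ξ := by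
  classical
  exact lt_of_lt_of_le h (Finset.sum_le_sum_of_subset_of_nonneg (Finset.filter_subset_filter _ hs)
    fun P _ _ => P.s_nonneg f)

open Classical in
lemma Heavy.nonempty {f : ℝ → ℂ} {𝔓 : Finset Tile} {σ : ℝ} {k n : ℤ} {ξ : ℝ}
    (h : Heavy f 𝔓 σ k n ξ) : (𝔓.filter fun P => P.sub k n ∧ P.om2 ξ).Nonempty := by
  by_contra h0
  rw [Finset.not_nonempty_iff_eq_empty] at h0
  rw [Heavy, h0, Finset.sum_empty] at h
  exact absurd h (not_lt.2 (by positivity))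

lemma Heavy.exists_left {f : ℝ → ℂ} {𝔓 : Finset Tile} {σ : ℝ} {k n : ℤ} {ξ : ℝ}
    (h : Heavy f 𝔓 σ k n ξ) :
    ∃ Q ∈ 𝔓, Heavy f 𝔓 σ k n (Q.fc + (2 * Q.r)⁻¹) ∧ Q.fc + (2 * Q.r)⁻¹ ≤ ξ := by
  classical
  obtain ⟨Q, hQ, hom, hle⟩ := Tile.om2_max_left h.nonempty fun P hP => (Finset.mem_filter.1 hP).2.2
  refine ⟨Q, (Finset.mem_filter.1 hQ).1, lt_of_lt_of_le h ?_, hle⟩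
  refine Finset.sum_le_sum_of_subset_of_nonneg (fun P hP => ?_) fun P _ _ => P.s_nonneg f
  obtain ⟨h1, h2, -⟩ := Finset.mem_filter.1 hP
  exact Finset.mem_filter.2 ⟨h1, h2, hom P hP⟩

/-- The minimal top frequency among heavy trees. -/
lemma exists_minimal_heavy {f : ℝ → ℂ} {𝔓 : Finset Tile} {σ : ℝ} (h : ¬ IsSize f 𝔓 σ) :
    ∃ k n ξ, Heavy f 𝔓 σ k n ξ ∧ ∀ k' n' ξ', Heavy f 𝔓 σ k' n' ξ' → ξ ≤ ξ' := by
  classical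
  rw [isSize_iff] at h
  push Not at h
  obtain ⟨k, n, ξ, h⟩ := h
  obtain ⟨Q, hQ, hh, -⟩ := h.exists_left
  obtain ⟨Q₀, hQ₀, hmin⟩ := (𝔓.filter fun Q => ∃ k n, Heavy f 𝔓 σ k n (Q.fc + (2 * Q.r)⁻¹)).exists_min_image
    (fun Q => Q.fc + (2 * Q.r)⁻¹) ⟨Q, Finset.mem_filter.2 ⟨hQ, k, n, hh⟩⟩
  obtain ⟨-, k₀, n₀, h₀⟩ := Finset.mem_filter.1 hQ₀
  refine ⟨k₀, n₀, _, h₀, fun k' n' ξ' h' => ?_⟩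
  obtain ⟨Q', hQ', hh', hle⟩ := h'.exists_left
  exact (hmin Q' (Finset.mem_filter.2 ⟨hQ', k', n', hh'⟩)).trans hle

open Classical in
lemma exists_tops (f : ℝ → ℂ) (σ : ℝ) (𝔓 : Finset Tile) : ∃ 𝔗 : Finset Top,
    (∀ T ∈ 𝔗, T.S ⊆ 𝔓 ∧ (∀ P ∈ T.S, P.sub T.k T.n ∧ P.om2 T.ξ) ∧
      σ ^ 2 * 2 ^ T.k < ∑ P ∈ T.S, P.s f) ∧
    (𝔗 : Set Top).PairwiseDisjoint Top.S ∧
    (∀ T ∈ 𝔗, ∀ T' ∈ 𝔗, T.ξ < T'.ξ → ∀ P ∈ T'.S, ¬ T.D P) ∧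
    IsSize f (𝔓.filter fun P => ∀ T ∈ 𝔗, ¬ T.D P) σ := by
  suffices H : ∃ 𝔗 : Finset Top, (∀ T ∈ 𝔗, T.S = 𝔓.filter (fun P => P ∈ T.S) ∧
      (∀ P ∈ T.S, P.sub T.k T.n ∧ P.om2 T.ξ) ∧ σ ^ 2 * 2 ^ T.k < ∑ P ∈ T.S, P.s f) ∧
      (∀ T ∈ 𝔗, ∀ T' ∈ 𝔗, T ≠ T' → Disjoint T.S T'.S) ∧
      (∀ T ∈ 𝔗, ∀ T' ∈ 𝔗, T.ξ < T'.ξ → ∀ P ∈ T'.S, ¬ T.D P) ∧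
      IsSize f (𝔓.filter fun P => ∀ T ∈ 𝔗, ¬ T.D P) σ by
    obtain ⟨𝔗, h1, h2, h3, h4⟩ := H
    refine ⟨𝔗, fun T hT => ⟨?_, (h1 T hT).2⟩, h2, h3, h4⟩
    rw [(h1 T hT).1]; exact Finset.filter_subset _ _
  induction 𝔓 using Finset.strongInduction with
  | H 𝔓 ih =>
  by_cases hsz : IsSize f 𝔓 σ
  · refine ⟨∅, by simp, by simp, by simp, by simpa using hsz⟩
  obtain ⟨k, n, ξ, hh, hmin⟩ := exists_minimal_heavy hsz
  set T₀ : Top := ⟨k, n, ξ, 𝔓.filter fun P => P.sub k n ∧ P.om2 ξ⟩ with hT₀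
  have hD : ∀ P ∈ T₀.S, T₀.D P := fun P hP => by
    obtain ⟨-, h1, h2⟩ := Finset.mem_filter.1 hP
    exact ⟨h1, Tile.om_of_om2 h2⟩
  obtain ⟨Q, hQ⟩ : T₀.S.Nonempty := hh.nonempty
  have hss : (𝔓.filter fun P => ¬ T₀.D P) ⊂ 𝔓 := by
    refine Finset.filter_ssubset.2 ⟨Q, (Finset.mem_filter.1 hQ).1, ?_⟩
    exact fun h => h (hD Q hQ)
  obtain ⟨𝔗, h1, h2, h3, h4⟩ := ih _ hss
  have hmem : ∀ T ∈ 𝔗, ∀ P ∈ T.S, P ∈ 𝔓 ∧ ¬ T₀.D P := by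
    intro T hT P hP
    rw [(h1 T hT).1] at hP
    exact Finset.mem_filter.1 (Finset.mem_filter.1 hP).1
  have hdisj : ∀ T ∈ 𝔗, Disjoint T₀.S T.S := by
    intro T hT
    rw [Finset.disjoint_left]
    exact fun P hP hP' => (hmem T hT P hP').2 (hD P hP)
  refine ⟨insert T₀ 𝔗, fun T hT => ?_, fun T hT T' hT' hne => ?_, fun T hT T' hT' hlt P hP => ?_, ?_⟩
  · rcases Finset.mem_insert.1 hT with rfl | hT
    · refine ⟨?_, fun P hP => (Finset.mem_filter.1 hP).2, hh⟩
      ext P; simp [hT₀]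
    · refine ⟨?_, (h1 T hT).2⟩
      ext P
      rw [Finset.mem_filter]
      exact ⟨fun h => ⟨(hmem T hT P h).1, h⟩, fun h => h.2⟩
  · rcases Finset.mem_insert.1 hT with rfl | hT <;> rcases Finset.mem_insert.1 hT' with rfl | hT'
    · exact absurd rfl hne
    · exact hdisj T' hT'
    · exact (hdisj T hT).symm
    · exact h2 T hT T' hT' hne
  · rcases Finset.mem_insert.1 hT with rfl | hT <;> rcases Finset.mem_insert.1 hT' with rfl | hT'
    · exact absurd hlt (lt_irrefl _)
    · exact (hmem T' hT' P hP).2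
    · refine absurd (hmin T.k T.n T.ξ ?_) (not_le.2 hlt)
      refine lt_of_lt_of_le (h1 T hT).2.2 (Finset.sum_le_sum_of_subset_of_nonneg (fun P hP => ?_)
        fun P _ _ => P.s_nonneg f)
      exact Finset.mem_filter.2 ⟨(hmem T hT P hP).1, (h1 T hT).2.1 P hP⟩
    · exact h3 T hT T' hT' hlt P hP
  · convert h4 using 1
    rw [Finset.filter_filter]
    refine Finset.filter_congr fun P _ => ?_
    simp

lemma Tile.freq_nested {P Q : Tile} {f : ℝ → ℂ} (hf : Nice f) (h : ip (P.G f) (Q.G f) ≠ 0)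
    (hk : Q.k ≤ P.k) (hne : ¬ (Q.k = P.k ∧ Q.m = P.m)) :
    Q.k < P.k ∧ ∀ η, P.om η → Q.om η ∧ ¬ Q.om2 η := by
  obtain ⟨t, ht⟩ : ∃ t, sc psi P.r P.m t * sc psi Q.r Q.m t ≠ 0 := by
    by_contra! h0
    exact h (ip_op_eq_zero P.sym_psi Q.sym_psi (fun _ => conj_bsym _ _) (P.nice_WA hf)
      (Q.nice_WA hf) h0)
  obtain ⟨h1, h2⟩ := mul_ne_zero_iff.1 ht
  have a1 := psi_ne_zero h1
  have a2 := psi_ne_zero h2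
  have hP : P.om t := Tile.om_iff.2 ⟨by linarith, by linarith⟩
  have hQ : Q.om t := Tile.om_iff.2 ⟨by linarith, by linarith⟩
  have hlt : Q.k < P.k := lt_of_le_of_ne hk fun h => hne ⟨h, Tile.eq_of_om hP hQ h⟩
  refine ⟨hlt, fun η hη => ⟨Tile.om_of_om hk hQ hP hη, fun h2 => ?_⟩⟩
  have := (Tile.om2_iff.1 (Tile.om2_of_om2 hlt h2 hη hP)).1
  linarith

lemma Tile.lt_of_om2 {Q : Tile} {η ξ : ℝ} (h1 : Q.om η) (h2 : ¬ Q.om2 η) (h3 : Q.om2 ξ) : η < ξ := by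
  rw [Tile.om_iff] at h1
  rw [Tile.om2_iff] at h2 h3
  have : Q.r * η - Q.m < 1 / 2 := by
    by_contra! h; exact h2 ⟨h, h1.2⟩
  exact lt_of_mul_lt_mul_left (by linarith [h3.1]) Q.r_pos.le

lemma γ_le_of_isSize {f : ℝ → ℂ} {𝔓 : Finset Tile} {σ : ℝ} (h : IsSize f 𝔓 σ) (hσ : 0 ≤ σ)
    {P : Tile} (hP : P ∈ 𝔓) : P.γ f ≤ σ := by
  classical
  have hr := P.r_pos
  have h2 : P.r * P.fc = P.m := by
    rw [Tile.r, Tile.fc, ← mul_assoc, ← zpow_add₀ two_ne_zero]; simp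
  have hom : P.om2 (P.fc + (2 * P.r)⁻¹) := by
    rw [Tile.om2_iff, mul_add, h2, show P.r * (2 * P.r)⁻¹ = 1 / 2 by field_simp]
    constructor <;> linarith
  have h1 : P.s f ≤ σ ^ 2 * P.r := by
    refine le_trans ?_ (h P.k P.n (P.fc + (2 * P.r)⁻¹))
    have hm : P ∈ 𝔓.filter fun Q => Q.sub P.k P.n ∧ Q.om2 (P.fc + (2 * P.r)⁻¹) :=
      Finset.mem_filter.2 ⟨hP, P.sub_refl, hom⟩
    convert Finset.single_le_sum (f := fun Q => Q.s f) (fun Q _ => Q.s_nonneg f) hm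
  rw [← P.sq_γ_mul f] at h1
  exact le_of_sq_le_sq (le_of_mul_le_mul_right h1 hr) hσ

section selection
variable {f : ℝ → ℂ} {𝔗 : Finset Top}

open Classical in
/-- The selected tiles of smaller scale interacting with `P`. -/
noncomputable def interacting (𝔗 : Finset Top) (P : Tile) : Finset Tile :=
  (𝔗.biUnion Top.S).filter fun Q => Q.k < P.k ∧ ∀ η, P.om η → Q.om η ∧ ¬ Q.om2 η

lemma disjoint_of_interacting
    (h1 : ∀ T ∈ 𝔗, ∀ P ∈ T.S, P.sub T.k T.n ∧ P.om2 T.ξ)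
    (h2 : ∀ T ∈ 𝔗, ∀ T' ∈ 𝔗, T.ξ < T'.ξ → ∀ P ∈ T'.S, ¬ T.D P)
    {T : Top} (hT : T ∈ 𝔗) {P : Tile} (hP : P ∈ T.S) {Q : Tile}
    (hQ : Q ∈ interacting 𝔗 P) : Disjoint Q.I (dyI T.k T.n) := by
  classical
  obtain ⟨hQ1, hk, hη⟩ := Finset.mem_filter.1 hQ
  obtain ⟨T', hT', hQT'⟩ := Finset.mem_biUnion.1 hQ1
  obtain ⟨hPs, hPξ⟩ := h1 T hT P hP
  obtain ⟨hom, hom2⟩ := hη T.ξ (Tile.om_of_om2 hPξ)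
  have hD := h2 T hT T' hT' (Tile.lt_of_om2 hom hom2 (h1 T' hT' Q hQT').2) Q hQT'
  rw [Set.disjoint_left]
  exact fun x hx hx' => hD ⟨Tile.sub_of_mem (hk.le.trans hPs.1) hx hx', hom⟩

lemma pairwiseDisjoint_interacting
    (h1 : ∀ T ∈ 𝔗, ∀ P ∈ T.S, P.sub T.k T.n ∧ P.om2 T.ξ)
    (h2 : ∀ T ∈ 𝔗, ∀ T' ∈ 𝔗, T.ξ < T'.ξ → ∀ P ∈ T'.S, ¬ T.D P)
    {P : Tile} :
    (interacting 𝔗 P : Set Tile).PairwiseDisjoint Tile.I := by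
  classical
  have key : ∀ Q ∈ interacting 𝔗 P, ∀ Q' ∈ interacting 𝔗 P, Q.k ≤ Q'.k → Q ≠ Q' →
      Disjoint Q.I Q'.I := by
    intro Q hQ Q' hQ' hk hne
    obtain ⟨hQ1, -, hη⟩ := Finset.mem_filter.1 hQ
    obtain ⟨hQ1', -, hη'⟩ := Finset.mem_filter.1 hQ'
    obtain ⟨T, hT, hQT⟩ := Finset.mem_biUnion.1 hQ1
    obtain ⟨T', hT', hQT'⟩ := Finset.mem_biUnion.1 hQ1'
    obtain ⟨a1, a2⟩ := hη P.fc P.om_fc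
    obtain ⟨b1, b2⟩ := hη' P.fc P.om_fc
    rw [Set.disjoint_left]
    intro x hx hx'
    have hlt : Q.k < Q'.k := by
      refine lt_of_le_of_ne hk fun h => hne ?_
      have hm := Tile.eq_of_om b1 a1 h
      have hn : Q.n = Q'.n := by rw [← Tile.mem_I.1 hx, ← Tile.mem_I.1 hx', h]
      exact Tile.ext h hn hm
    obtain ⟨c1, c2⟩ := h1 T' hT' Q' hQT'
    have hom : Q.om T'.ξ := Tile.om_of_om hk a1 b1 (Tile.om_of_om2 c2)
    have hom2 : ¬ Q.om2 T'.ξ := fun h => a2 (Tile.om2_of_om2 hlt h (Tile.om_of_om2 c2) b1)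
    exact h2 T' hT' T hT (Tile.lt_of_om2 hom hom2 (h1 T hT Q hQT).2) Q hQT
      ⟨Tile.sub_of_mem (hk.trans c1.1) hx (c1.mem hx'), hom⟩
  intro Q hQ Q' hQ' hne
  rcases le_total Q.k Q'.k with h | h
  · exact key Q hQ Q' hQ' h hne
  · exact (key Q' hQ' Q hQ h hne.symm).symm

lemma sum_sum_interacting_le
    (h1 : ∀ T ∈ 𝔗, ∀ P ∈ T.S, P.sub T.k T.n ∧ P.om2 T.ξ)
    (h2 : ∀ T ∈ 𝔗, ∀ T' ∈ 𝔗, T.ξ < T'.ξ → ∀ P ∈ T'.S, ¬ T.D P)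
    {C σ : ℝ} (hC : 0 ≤ C) (hσ : 0 ≤ σ)
    (hγ : ∀ T ∈ 𝔗, ∀ P ∈ T.S, P.γ f ≤ 2 * σ)
    (hG : ∀ (P : Tile) y, ‖P.G f y‖ ≤ C * P.γ f * decay ((y - P.c) / P.r) ^ 6)
    {T : Top} (hT : T ∈ 𝔗) :
    ∑ P ∈ T.S, ∑ Q ∈ interacting 𝔗 P, ‖ip (P.G f) (Q.G f)‖ ≤
      262144 * C ^ 2 * σ ^ 2 * 2 ^ T.k := by
  classical
  calc _ ≤ ∑ P ∈ T.S, 256 * C ^ 2 * σ ^ 2 * ∫ y in (dyI T.k T.n)ᶜ, decay ((P.c - y) / P.r) ^ 4 := by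
        refine Finset.sum_le_sum fun P hP => ?_
        have hQk : ∀ Q ∈ interacting 𝔗 P, Q.r ≤ P.r := fun Q hQ =>
          zpow_le_zpow_right₀ one_le_two (Finset.mem_filter.1 hQ).2.1.le
        calc _ ≤ ∑ Q ∈ interacting 𝔗 P, 16 * C ^ 2 * σ ^ 2 *
              (Q.r * decay ((P.c - Q.c) / P.r) ^ 4) := by
              refine Finset.sum_le_sum fun Q hQ => ?_
              obtain ⟨T', hT', hQT'⟩ := Finset.mem_biUnion.1 (Finset.mem_filter.1 hQ).1
              have hγP := P.γ_nonneg f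
              have hγQ := Q.γ_nonneg f
              refine (norm_ip_le_of_decay Q.r_pos (hQk Q hQ) (mul_nonneg hC hγP)
                (mul_nonneg hC hγQ) (hG P) (hG Q)).trans ?_
              have d := Q.r_pos
              have e := decay_nonneg ((P.c - Q.c) / P.r)
              have h : P.γ f * Q.γ f ≤ 2 * σ * (2 * σ) :=
                mul_le_mul (hγ T hT P hP) (hγ T' hT' Q hQT') hγQ (by positivity)
              calc _ = 4 * C ^ 2 * (P.γ f * Q.γ f) * (Q.r * decay ((P.c - Q.c) / P.r) ^ 4) := by ring
                _ ≤ 4 * C ^ 2 * (2 * σ * (2 * σ)) * (Q.r * decay ((P.c - Q.c) / P.r) ^ 4) := by gcongr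
                _ = _ := by ring
          _ ≤ 16 * C ^ 2 * σ ^ 2 * (2 ^ 4 * ∫ y in ⋃ Q ∈ interacting 𝔗 P, Q.I,
                decay ((P.c - y) / P.r) ^ 4) := by
              rw [← Finset.mul_sum]
              gcongr
              exact sum_decay_le_integral P.r_pos hQk (pairwiseDisjoint_interacting h1 h2)
                (by norm_num) P.c
          _ ≤ 16 * C ^ 2 * σ ^ 2 * (2 ^ 4 * ∫ y in (dyI T.k T.n)ᶜ, decay ((P.c - y) / P.r) ^ 4) := by
              gcongr 16 * C ^ 2 * σ ^ 2 * (2 ^ 4 * ?_)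
              refine setIntegral_mono_set (integrable_decay_center _ P.r_pos).integrableOn
                (Filter.Eventually.of_forall fun y => pow_nonneg (decay_nonneg _) _) ?_
              refine LE.le.eventuallyLE (Set.iUnion₂_subset fun Q hQ => ?_)
              exact Set.subset_compl_iff_disjoint_right.2 (disjoint_of_interacting h1 h2 hT hP hQ)
          _ = _ := by ring
    _ ≤ 256 * C ^ 2 * σ ^ 2 * (1024 * 2 ^ T.k) := by
        rw [← Finset.mul_sum]
        gcongr
        exact sum_integral_compl_le (fun P hP => (h1 T hT P hP).1)
          fun P hP => Tile.om_of_om2 (h1 T hT P hP).2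
    _ = _ := by ring

end selection

/-- The energy lemma. -/
lemma exists_energy : ∃ C : ℝ, 0 < C ∧ ∀ (f : ℝ → ℂ), Nice f → ∀ (𝔓 : Finset Tile) (σ : ℝ),
    0 < σ → IsSize f 𝔓 (2 * σ) → ∃ 𝔗 : Finset Top, σ ^ 2 * ∑ T ∈ 𝔗, 2 ^ T.k ≤ C * nsq f ∧
      ∀ 𝔓' ⊆ 𝔓, (∀ P ∈ 𝔓', ∀ T ∈ 𝔗, ¬ T.D P) → IsSize f 𝔓' σ := by
  classical
  obtain ⟨C, hC, hG⟩ := exists_norm_G_le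
  refine ⟨524544 * C ^ 2, by positivity, fun f hf 𝔓 σ hσ hsz => ?_⟩
  obtain ⟨𝔗, h1, hd, h2, h3⟩ := exists_tops f σ 𝔓
  refine ⟨𝔗, ?_, fun 𝔓' hs hD => ?_⟩
  swap
  · rw [isSize_iff] at h3 ⊢
    exact fun k n ξ h => h3 k n ξ (h.mono fun P hP => Finset.mem_filter.2 ⟨hs hP, hD P hP⟩)
  have h1' : ∀ T ∈ 𝔗, ∀ P ∈ T.S, P.sub T.k T.n ∧ P.om2 T.ξ := fun T hT => (h1 T hT).2.1
  set 𝔔 := 𝔗.biUnion Top.S with h𝔔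
  set A := ∑ P ∈ 𝔔, P.s f with hA
  have hA0 : 0 ≤ A := Finset.sum_nonneg fun P _ => P.s_nonneg f
  have hAT : A = ∑ T ∈ 𝔗, ∑ P ∈ T.S, P.s f := Finset.sum_biUnion hd
  have hσA : σ ^ 2 * ∑ T ∈ 𝔗, 2 ^ T.k ≤ A := by
    rw [hAT, Finset.mul_sum]
    exact Finset.sum_le_sum fun T hT => (h1 T hT).2.2.le
  refine hσA.trans ?_
  have hG1 : ∀ (P : Tile) y, ‖P.G f y‖ ≤ C * P.γ f * decay ((y - P.c) / P.r) ^ 6 :=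
    fun P => (hG P f hf).1
  have hγ : ∀ T ∈ 𝔗, ∀ P ∈ T.S, P.γ f ≤ 2 * σ := fun T hT P hP =>
    γ_le_of_isSize hsz (by positivity) ((h1 T hT).1 hP)
  have hnG : ∀ P ∈ 𝔔, Nice (P.G f) := fun P _ => P.nice_G hf
  have hint : ∑ P ∈ 𝔔, ∑ Q ∈ interacting 𝔗 P, ‖ip (P.G f) (Q.G f)‖ ≤ 262144 * C ^ 2 * A := by
    rw [h𝔔, Finset.sum_biUnion hd]
    calc _ ≤ ∑ T ∈ 𝔗, 262144 * C ^ 2 * σ ^ 2 * 2 ^ T.k :=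
          Finset.sum_le_sum fun T hT => sum_sum_interacting_le h1' h2 hC.le hσ.le hγ hG1 hT
      _ = 262144 * C ^ 2 * (σ ^ 2 * ∑ T ∈ 𝔗, 2 ^ T.k) := by
          rw [← Finset.mul_sum]; ring
      _ ≤ _ := by gcongr
  have hgram : ∑ P ∈ 𝔔, ∑ Q ∈ 𝔔, ‖ip (P.G f) (Q.G f)‖ ≤ 524544 * C ^ 2 * A := by
    have hpt : ∀ P ∈ 𝔔, ∀ Q ∈ 𝔔, ‖ip (P.G f) (Q.G f)‖ ≤
        (if Q.k = P.k ∧ Q.m = P.m then ‖ip (P.G f) (Q.G f)‖ else 0) +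
        (if Q ∈ interacting 𝔗 P then ‖ip (P.G f) (Q.G f)‖ else 0) +
        (if P ∈ interacting 𝔗 Q then ‖ip (Q.G f) (P.G f)‖ else 0) := by
      intro P hP Q hQ
      have n0 := norm_nonneg (ip (P.G f) (Q.G f))
      rw [norm_ip_comm (Q.G f)]
      by_cases hs : Q.k = P.k ∧ Q.m = P.m
      · rw [if_pos hs]; split_ifs <;> linarith
      by_cases h0 : ip (P.G f) (Q.G f) = 0
      · simp [h0]
      rcases le_total Q.k P.k with hk | hk
      · have : Q ∈ interacting 𝔗 P := Finset.mem_filter.2 ⟨hQ, Tile.freq_nested hf h0 hk hs⟩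
        rw [if_pos this]; split_ifs <;> linarith
      · have h0' : ip (Q.G f) (P.G f) ≠ 0 := by
          rw [← norm_ne_zero_iff, norm_ip_comm, norm_ne_zero_iff]; exact h0
        have : P ∈ interacting 𝔗 Q := Finset.mem_filter.2
          ⟨hP, Tile.freq_nested hf h0' hk fun h => hs ⟨h.1.symm, h.2.symm⟩⟩
        rw [if_pos this]; split_ifs <;> linarith
    refine (Finset.sum_le_sum fun P hP => Finset.sum_le_sum fun Q hQ => hpt P hP Q hQ).trans ?_
    simp only [Finset.sum_add_distrib]
    have e1 : ∑ P ∈ 𝔔, ∑ Q ∈ 𝔔,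
        (if Q.k = P.k ∧ Q.m = P.m then ‖ip (P.G f) (Q.G f)‖ else 0) ≤ 256 * C ^ 2 * A := by
      simp only [← Finset.sum_filter]
      refine (sum_sum_ip_same_le 𝔔 (γ := fun P => C * P.γ f)
        (fun P _ => mul_nonneg hC.le (P.γ_nonneg f)) fun P _ => hG1 P).trans_eq ?_
      rw [mul_assoc, hA, Finset.mul_sum (a := C ^ 2)]
      congr 1
      refine Finset.sum_congr rfl fun P _ => ?_
      rw [mul_pow, mul_assoc, P.sq_γ_mul]
    have hsub : ∀ P, 𝔔.filter (fun Q => Q ∈ interacting 𝔗 P) = interacting 𝔗 P := by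
      intro P
      ext Q
      rw [Finset.mem_filter]
      exact ⟨fun h => h.2, fun h => ⟨(Finset.mem_filter.1 h).1, h⟩⟩
    have e2 : ∑ P ∈ 𝔔, ∑ Q ∈ 𝔔,
        (if Q ∈ interacting 𝔗 P then ‖ip (P.G f) (Q.G f)‖ else 0) ≤ 262144 * C ^ 2 * A := by
      simp only [← Finset.sum_filter, hsub]
      exact hint
    have e3 : ∑ P ∈ 𝔔, ∑ Q ∈ 𝔔,
        (if P ∈ interacting 𝔗 Q then ‖ip (Q.G f) (P.G f)‖ else 0) ≤ 262144 * C ^ 2 * A := by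
      rw [Finset.sum_comm]; exact e2
    linarith
  have hn := (nsq_sum_le hnG).trans hgram
  have hip : ((A : ℝ) : ℂ) = ip f (fun y => ∑ P ∈ 𝔔, P.G f y) := by
    rw [ip_sum_right hnG hf, hA, Complex.ofReal_sum]
    exact Finset.sum_congr rfl fun P _ => (P.ip_G hf).symm
  have hsq := sq_norm_ip_le hf (Nice.sum hnG)
  rw [← hip, Complex.norm_real, Real.norm_of_nonneg hA0] at hsq
  have hf0 := nsq_nonneg f
  have : A ^ 2 ≤ nsq f * (524544 * C ^ 2 * A) := hsq.trans (by gcongr)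
  rcases hA0.eq_or_lt with h | h
  · rw [← h]; positivity
  · nlinarith

/-! ### Trees -/

/-- Convexity of a set of tiles with respect to the tile order. -/
def Convx (𝔓 : Finset Tile) : Prop :=
  ∀ P ∈ 𝔓, ∀ P'' ∈ 𝔓, ∀ P' : Tile, P.le P' → P'.le P'' → P' ∈ 𝔓

/-- The tile of scale `k` over the point `x` at the frequency `ξ`. -/
noncomputable def tt (ξ : ℝ) (k : ℤ) (x : ℝ) : Tile := ⟨k, dy k x, dy (-k) ξ⟩

lemma mem_tt (ξ : ℝ) (k : ℤ) (x : ℝ) : x ∈ (tt ξ k x).I := rfl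

lemma om_tt (ξ : ℝ) (k : ℤ) (x : ℝ) : (tt ξ k x).om ξ := rfl

lemma Tile.eq_tt {P : Tile} {ξ x : ℝ} (h : P.om ξ) (hx : x ∈ P.I) : P = tt ξ P.k x :=
  Tile.ext rfl hx.symm h.symm

lemma tt_le {ξ : ℝ} {k k' : ℤ} (h : k ≤ k') (x : ℝ) : (tt ξ k x).le (tt ξ k' x) :=
  Tile.le_of h (mem_tt ξ k x) (mem_tt ξ k' x) (om_tt ξ k x) (om_tt ξ k' x)

lemma Convx.tt_mem {𝔔 : Finset Tile} (h : Convx 𝔔) {ξ x : ℝ} {k l k' : ℤ} (hk : tt ξ k x ∈ 𝔔)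
    (hk' : tt ξ k' x ∈ 𝔔) (h1 : k ≤ l) (h2 : l ≤ k') : tt ξ l x ∈ 𝔔 :=
  h _ hk _ hk' _ (tt_le h1 x) (tt_le h2 x)

/-- A convex tree with frequency `ξ` and top tile `T`. -/
structure IsTree (𝔔 : Finset Tile) (ξ : ℝ) (T : Tile) : Prop where
  convx : Convx 𝔔
  om : ∀ P ∈ 𝔔, P.om ξ
  mem : T ∈ 𝔔
  sub : ∀ P ∈ 𝔔, P.sub T.k T.n

open Classical in
/-- The maximal tiles at the frequency `ξ` strictly below the tree. -/
noncomputable def kids (ξ : ℝ) (𝔔 : Finset Tile) : Finset Tile :=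
  (𝔔.biUnion fun P => {⟨P.k - 1, 2 * P.n, dy (-(P.k - 1)) ξ⟩,
    ⟨P.k - 1, 2 * P.n + 1, dy (-(P.k - 1)) ξ⟩}).filter (· ∉ 𝔔)

/-- The union of the spatial intervals of the tiles of scale `k`. -/
def lev (ξ : ℝ) (𝔔 : Finset Tile) (k : ℤ) : Set ℝ := {x | tt ξ k x ∈ 𝔔}

namespace IsTree
variable {𝔔 : Finset Tile} {ξ : ℝ} {T : Tile}

lemma mem_kids (h : IsTree 𝔔 ξ T) {J : Tile} {x : ℝ} (hx : x ∈ J.I) :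
    J ∈ kids ξ 𝔔 ↔ J = tt ξ J.k x ∧ J ∉ 𝔔 ∧ tt ξ (J.k + 1) x ∈ 𝔔 := by
  classical
  rw [kids, Finset.mem_filter, Finset.mem_biUnion]
  have hn : dy (J.k + 1) x = J.n / 2 := by rw [dy_add_one, Tile.mem_I.1 hx]
  constructor
  · rintro ⟨⟨P, hP, hJ⟩, hn'⟩
    rw [Finset.mem_insert, Finset.mem_singleton] at hJ
    have e1 : J.k = P.k - 1 := by rcases hJ with h | h <;> rw [h]
    have e2 : J.n / 2 = P.n := by rcases hJ with h | h <;> rw [h] <;> simp only <;> omega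
    have e3 : J.m = dy (-(P.k - 1)) ξ := by rcases hJ with h | h <;> rw [h]
    refine ⟨Tile.ext rfl hx.symm (by rw [e3, ← e1]; rfl), hn', ?_⟩
    convert hP using 1
    refine Tile.ext ?_ ?_ ?_
    · simp only [tt]; omega
    · simp only [tt]; rw [hn, e2]
    · simp only [tt]; rw [show -(J.k + 1) = -P.k by omega]; exact h.om P hP
  · rintro ⟨e, hn', hp⟩
    refine ⟨⟨_, hp, ?_⟩, hn'⟩
    have e3 : J.m = dy (-J.k) ξ := congrArg Tile.m e
    rw [Finset.mem_insert, Finset.mem_singleton]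
    simp only [tt, add_sub_cancel_right, hn]
    rcases Int.emod_two_eq_zero_or_one J.n with hh | hh
    · left; exact Tile.ext rfl (by simp only; omega) e3
    · right; exact Tile.ext rfl (by simp only; omega) e3

lemma k_le (h : IsTree 𝔔 ξ T) {k : ℤ} {x : ℝ} (hk : tt ξ k x ∈ 𝔔) : k ≤ T.k ∧ x ∈ T.I :=
  ⟨(h.sub _ hk).1, (h.sub _ hk).mem (mem_tt ξ k x)⟩

lemma tt_top (h : IsTree 𝔔 ξ T) {x : ℝ} (hx : x ∈ T.I) : tt ξ T.k x = T := (Tile.eq_tt (h.om T h.mem) hx).symm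

lemma tt_mem_iff (h : IsTree 𝔔 ξ T) {J : Tile} (hJ : J ∈ kids ξ 𝔔) {x : ℝ} (hx : x ∈ J.I) {k : ℤ} :
    tt ξ k x ∈ 𝔔 ↔ J.k + 1 ≤ k ∧ k ≤ T.k := by
  obtain ⟨e, h1, h2⟩ := (h.mem_kids hx).1 hJ
  constructor
  · intro hk
    refine ⟨?_, (h.k_le hk).1⟩
    by_contra! hlt
    exact h1 (e ▸ h.convx.tt_mem hk h2 (by omega) (by omega))
  · rintro ⟨a, b⟩
    refine h.convx.tt_mem h2 ?_ a b
    rw [h.tt_top (h.k_le h2).2]; exact h.mem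

lemma exists_kid (h : IsTree 𝔔 ξ T) {x : ℝ} (hx : x ∈ T.I) {j : ℤ} (hj : tt ξ j x ∉ 𝔔) (hjT : j ≤ T.k) :
    ∃ J ∈ kids ξ 𝔔, x ∈ J.I ∧ j ≤ J.k := by
  obtain ⟨d, hd⟩ : ∃ d : ℕ, T.k = j + d := ⟨(T.k - j).toNat, by omega⟩
  have hex : ∃ i : ℕ, tt ξ (j + i) x ∈ 𝔔 := ⟨d, by rw [← hd, h.tt_top hx]; exact h.mem⟩
  classical
  have h1 := Nat.find_spec hex
  have h0 : Nat.find hex ≠ 0 := by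
    intro h0; rw [h0] at h1; simp at h1; exact hj h1
  have h2 := Nat.find_min hex (m := Nat.find hex - 1) (by omega)
  set i := Nat.find hex
  refine ⟨tt ξ (j + (i - 1 : ℕ)) x, (h.mem_kids (mem_tt _ _ _)).2 ⟨rfl, h2, ?_⟩, mem_tt _ _ _, ?_⟩
  · convert h1 using 2; simp only [tt]; omega
  · simp only [tt]; omega

lemma exists_kid_of_mem (h : IsTree 𝔔 ξ T) {P : Tile} (hP : P ∈ 𝔔) {x : ℝ} (hx : x ∈ P.I) :
    ∃ J ∈ kids ξ 𝔔, x ∈ J.I := by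
  obtain ⟨Q, hQ, hmin⟩ := 𝔔.exists_min_image Tile.k ⟨P, hP⟩
  obtain ⟨J, hJ, hxJ, -⟩ := h.exists_kid (x := x) (j := Q.k - 1) ((h.sub P hP).mem hx) (fun hm => by
    have := hmin _ hm
    simp only [tt] at this; omega) (by have := (h.sub Q hQ).1; omega)
  exact ⟨J, hJ, hxJ⟩

lemma kids_disjoint (h : IsTree 𝔔 ξ T) : (kids ξ 𝔔 : Set Tile).PairwiseDisjoint Tile.I := by
  intro J hJ J' hJ' hne
  refine Set.disjoint_left.2 fun x hx hx' => hne ?_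
  have e : J.k = J'.k := by
    have h1 := fun k => h.tt_mem_iff hJ hx (k := k)
    have h2 := fun k => h.tt_mem_iff hJ' hx' (k := k)
    have a := (h1 (J.k + 1)).1 ((h.mem_kids hx).1 hJ).2.2
    have b := (h2 (J'.k + 1)).1 ((h.mem_kids hx').1 hJ').2.2
    have c := (h1 (J'.k + 1)).1 ((h.mem_kids hx').1 hJ').2.2
    have d := (h2 (J.k + 1)).1 ((h.mem_kids hx).1 hJ).2.2
    omega
  rw [((h.mem_kids hx).1 hJ).1, ((h.mem_kids hx').1 hJ').1, e]

lemma kid_k_lt (h : IsTree 𝔔 ξ T) {J : Tile} (hJ : J ∈ kids ξ 𝔔) : J.k + 1 ≤ T.k :=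
  (h.k_le ((h.mem_kids J.c_mem_I).1 hJ).2.2).1

lemma kid_subset (h : IsTree 𝔔 ξ T) {J : Tile} (hJ : J ∈ kids ξ 𝔔) : J.I ⊆ T.I := fun _ hx =>
  (h.k_le ((h.mem_kids hx).1 hJ).2.2).2

lemma sum_kids_r_le (h : IsTree 𝔔 ξ T) : ∑ J ∈ kids ξ 𝔔, J.r ≤ T.r := by
  rw [← T.volume_real_I, Finset.sum_congr rfl fun J _ => J.volume_real_I.symm,
    ← measureReal_biUnion_finset h.kids_disjoint (fun J _ => J.measurableSet_I)
      fun J _ => by rw [J.volume_I]; exact ENNReal.ofReal_ne_top]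
  exact measureReal_mono (Set.iUnion₂_subset fun J hJ => h.kid_subset hJ)
    (by rw [T.volume_I]; exact ENNReal.ofReal_ne_top)

lemma lev_eq (h : IsTree 𝔔 ξ T) (k : ℤ) : lev ξ 𝔔 k = ⋃ P ∈ 𝔔.filter (·.k = k), P.I := by
  ext x
  simp only [lev, Set.mem_ofPred_eq, Set.mem_iUnion, Finset.mem_filter, exists_prop]
  constructor
  · exact fun hx => ⟨_, ⟨hx, rfl⟩, mem_tt _ _ _⟩
  · rintro ⟨P, ⟨hP, rfl⟩, hx⟩
    rwa [← Tile.eq_tt (h.om P hP) hx]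

lemma measurableSet_lev (h : IsTree 𝔔 ξ T) (k : ℤ) : MeasurableSet (lev ξ 𝔔 k) := by
  rw [h.lev_eq]; exact measurableSet_biUnion_I _

lemma lev_subset (h : IsTree 𝔔 ξ T) (k : ℤ) : lev ξ 𝔔 k ⊆ T.I := fun _ hx => (h.k_le hx).2

lemma kid_subset_lev (h : IsTree 𝔔 ξ T) {J : Tile} (hJ : J ∈ kids ξ 𝔔) {k : ℤ} (h1 : J.k + 1 ≤ k) (h2 : k ≤ T.k) :
    J.I ⊆ lev ξ 𝔔 k := fun _ hx => (h.tt_mem_iff hJ hx).2 ⟨h1, h2⟩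

lemma kid_subset_lev_compl (h : IsTree 𝔔 ξ T) {J : Tile} (hJ : J ∈ kids ξ 𝔔) {k : ℤ} (h1 : k ≤ J.k) :
    lev ξ 𝔔 k ⊆ J.Iᶜ := fun x hx hxJ => by
  have := ((h.tt_mem_iff hJ hxJ).1 hx).1
  omega

lemma lev_compl_subset (h : IsTree 𝔔 ξ T) {k : ℤ} (hk : k ≤ T.k) :
    (lev ξ 𝔔 k)ᶜ ⊆ T.Iᶜ ∪ ⋃ J ∈ (kids ξ 𝔔).filter (fun J => k ≤ J.k), J.I := by
  intro x hx
  by_cases hxT : x ∈ T.I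
  · obtain ⟨J, hJ, hxJ, hj⟩ := h.exists_kid hxT hx hk
    exact Or.inr (Set.mem_biUnion (Finset.mem_filter.2 ⟨hJ, hj⟩) hxJ)
  · exact Or.inl hxT

end IsTree

lemma measurable_decay_sub (r : ℝ) :
    Measurable fun p : ℝ × ℝ => ENNReal.ofReal (decay ((p.1 - p.2) / r) ^ 4) := by
  have := measurable_decay
  fun_prop

namespace IsTree
variable {𝔔 : Finset Tile} {ξ : ℝ} {T : Tile}

lemma lintegral_lev_compl_le (h : IsTree 𝔔 ξ T) {k : ℤ} (hk : k ≤ T.k) :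
    ∫⁻ x in lev ξ 𝔔 k, ∫⁻ y in (lev ξ 𝔔 k)ᶜ, ENNReal.ofReal (decay ((x - y) / 2 ^ k) ^ 4) ≤
      ENNReal.ofReal (32 * (2 ^ k) ^ 2 * (1 + ((kids ξ 𝔔).filter (fun J => k ≤ J.k)).card)) := by
  have hk0 := two_zpow_pos k
  set S := (kids ξ 𝔔).filter (fun J => k ≤ J.k) with hS
  set D : ℝ → ℝ → ℝ≥0∞ := fun x y => ENNReal.ofReal (decay ((x - y) / 2 ^ k) ^ 4) with hD
  have hDc : ∀ x y, D x y = D y x := fun x y => by simp only [hD]; rw [decay_sub_comm]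
  have hDm : Measurable (Function.uncurry D) := measurable_decay_sub _
  have hDm1 : ∀ s : Set ℝ, Measurable fun x => ∫⁻ y in s, D x y := fun s =>
    hDm.lintegral_prod_right'
  have e1 : ∫⁻ x in T.I, ∫⁻ y in T.Iᶜ, D x y ≤ ENNReal.ofReal (32 * (2 ^ k) ^ 2) := by
    rw [T.I_eq]; exact lintegral_lintegral_decay_compl_le hk0
  have e2 : ∀ J ∈ S, ∫⁻ x in J.Iᶜ, ∫⁻ y in J.I, D x y ≤ ENNReal.ofReal (32 * (2 ^ k) ^ 2) := by
    intro J _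
    rw [lintegral_lintegral_swap hDm.aemeasurable]
    simp only [hDc]
    rw [J.I_eq]; exact lintegral_lintegral_decay_compl_le hk0
  calc _ ≤ ∫⁻ x in lev ξ 𝔔 k, (∫⁻ y in T.Iᶜ, D x y) + ∑ J ∈ S, ∫⁻ y in J.I, D x y := by
        refine lintegral_mono fun x => ?_
        refine (lintegral_mono_set (h.lev_compl_subset hk)).trans ?_
        refine (lintegral_union_le _ _ _).trans ?_
        gcongr
        exact (lintegral_biUnion_finset (h.kids_disjoint.subset (Finset.coe_subset.2
          (Finset.filter_subset _ _))) (fun J _ => J.measurableSet_I) _).le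
    _ = (∫⁻ x in lev ξ 𝔔 k, ∫⁻ y in T.Iᶜ, D x y) +
          ∑ J ∈ S, ∫⁻ x in lev ξ 𝔔 k, ∫⁻ y in J.I, D x y := by
        rw [lintegral_add_left (hDm1 _), lintegral_finsetSum _ fun J _ => hDm1 _]
    _ ≤ ENNReal.ofReal (32 * (2 ^ k) ^ 2) + ∑ J ∈ S, ENNReal.ofReal (32 * (2 ^ k) ^ 2) := by
        gcongr with J hJ
        · exact (lintegral_mono_set (h.lev_subset k)).trans e1
        · exact (lintegral_mono_set (h.kid_subset_lev_compl (Finset.mem_filter.1 hJ).1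
            (Finset.mem_filter.1 hJ).2)).trans (e2 J hJ)
    _ = _ := by
        rw [Finset.sum_const, nsmul_eq_mul, ← ENNReal.ofReal_natCast,
          ← ENNReal.ofReal_mul (by positivity), ← ENNReal.ofReal_add (by positivity) (by positivity)]
        congr 1; ring

lemma sum_kids_mul_integral_le (h : IsTree 𝔔 ξ T) {k : ℤ} (hk : k ≤ T.k) :
    ∑ J ∈ kids ξ 𝔔 with J.k + 1 ≤ k,
      J.r * ∫ y in (lev ξ 𝔔 k)ᶜ, decay ((J.c - y) / 2 ^ k) ^ 4 ≤
      512 * (2 ^ k) ^ 2 * (1 + ((kids ξ 𝔔).filter (fun J => k ≤ J.k)).card) := by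
  have hk0 := two_zpow_pos k
  have hn : ∀ J : Tile, 0 ≤ ∫ y in (lev ξ 𝔔 k)ᶜ, decay ((J.c - y) / 2 ^ k) ^ 4 := fun J =>
    integral_nonneg fun y => pow_nonneg (decay_nonneg _) _
  rw [← ENNReal.ofReal_le_ofReal_iff (by positivity), ENNReal.ofReal_sum_of_nonneg
    fun J _ => mul_nonneg J.r_pos.le (hn J)]
  have hd := h.kids_disjoint.subset (Finset.coe_subset.2
    (Finset.filter_subset (fun J => J.k + 1 ≤ k) _))
  calc _ ≤ ∑ J ∈ kids ξ 𝔔 with J.k + 1 ≤ k, 16 * ∫⁻ x in J.I, ∫⁻ y in (lev ξ 𝔔 k)ᶜ,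
          ENNReal.ofReal (decay ((x - y) / 2 ^ k) ^ 4) := by
        refine Finset.sum_le_sum fun J hJ => ?_
        rw [ENNReal.ofReal_mul J.r_pos.le, ofReal_integral_eq_lintegral_ofReal
          (integrable_decay_center _ hk0).integrableOn
          (Filter.Eventually.of_forall fun y => pow_nonneg (decay_nonneg _) _)]
        refine mul_lintegral_decay_le (zpow_le_zpow_right₀ one_le_two ?_) (h.measurableSet_lev k).compl
        have := (Finset.mem_filter.1 hJ).2
        omega
    _ = 16 * ∫⁻ x in ⋃ J ∈ (kids ξ 𝔔).filter (fun J => J.k + 1 ≤ k), J.I, ∫⁻ y in (lev ξ 𝔔 k)ᶜ,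
          ENNReal.ofReal (decay ((x - y) / 2 ^ k) ^ 4) := by
        rw [← Finset.mul_sum, lintegral_biUnion_finset hd fun P _ => P.measurableSet_I]
    _ ≤ 16 * ENNReal.ofReal (32 * (2 ^ k) ^ 2 *
          (1 + ((kids ξ 𝔔).filter (fun J => k ≤ J.k)).card)) := by
        gcongr
        refine (lintegral_mono_set (Set.iUnion₂_subset fun J hJ => ?_)).trans
          (h.lintegral_lev_compl_le hk)
        exact h.kid_subset_lev (Finset.mem_filter.1 hJ).1 (Finset.mem_filter.1 hJ).2 hk
    _ = _ := by
        rw [show (16 : ℝ≥0∞) = ENNReal.ofReal 16 by norm_num, ← ENNReal.ofReal_mul (by norm_num)]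
        congr 1; ring

lemma sum_kids_mul_error_le (h : IsTree 𝔔 ξ T) :
    ∑ J ∈ kids ξ 𝔔, J.r * ∑ k ∈ Finset.Icc (J.k + 1) T.k,
      (2 ^ k)⁻¹ * ∫ y in (lev ξ 𝔔 k)ᶜ, decay ((J.c - y) / 2 ^ k) ^ 4 ≤ 2048 * T.r := by
  classical
  obtain ⟨k₀, hk₀⟩ : ∃ k₀ : ℤ, ∀ J ∈ kids ξ 𝔔, k₀ ≤ J.k + 1 := by
    rcases (kids ξ 𝔔).eq_empty_or_nonempty with he | hne
    · exact ⟨0, by simp [he]⟩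
    · obtain ⟨Q, _, hmin⟩ := (kids ξ 𝔔).exists_min_image Tile.k hne
      exact ⟨Q.k, fun J hJ => by have := hmin J hJ; omega⟩
  set K := Finset.Icc k₀ T.k
  set X : Tile → ℤ → ℝ := fun J k => ∫ y in (lev ξ 𝔔 k)ᶜ, decay ((J.c - y) / 2 ^ k) ^ 4 with hX
  have e1 : ∀ J ∈ kids ξ 𝔔, J.r * ∑ k ∈ Finset.Icc (J.k + 1) T.k, (2 ^ k)⁻¹ * X J k =
      ∑ k ∈ K, if J.k + 1 ≤ k then (2 ^ k)⁻¹ * (J.r * X J k) else 0 := by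
    intro J hJ
    rw [← Finset.sum_filter, Finset.mul_sum]
    have : Finset.Icc (J.k + 1) T.k = K.filter (fun k => J.k + 1 ≤ k) := by
      ext k
      simp only [K, Finset.mem_Icc, Finset.mem_filter]
      have := hk₀ J hJ
      omega
    rw [this]
    exact Finset.sum_congr rfl fun k _ => by ring
  rw [Finset.sum_congr rfl e1, Finset.sum_comm]
  have hKsum := sum_two_zpow_le K (k₁ := T.k) fun k hk => (Finset.mem_Icc.1 hk).2
  calc _ ≤ ∑ k ∈ K, 512 * (2 ^ k * (1 + ∑ J ∈ kids ξ 𝔔, if k ≤ J.k then 1 else 0) : ℝ) := by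
        refine Finset.sum_le_sum fun k hk => ?_
        have hk0 := two_zpow_pos k
        rw [← Finset.sum_filter, ← Finset.mul_sum, inv_mul_le_iff₀ hk0]
        refine (h.sum_kids_mul_integral_le (Finset.mem_Icc.1 hk).2).trans_eq ?_
        rw [← Finset.sum_filter, Finset.sum_const, nsmul_eq_mul, mul_one]
        ring
    _ = 512 * (∑ k ∈ K, 2 ^ k + ∑ J ∈ kids ξ 𝔔, ∑ k ∈ K, if k ≤ J.k then (2:ℝ) ^ k else 0) := by
        rw [← Finset.mul_sum, Finset.sum_comm (s := kids ξ 𝔔), ← Finset.sum_add_distrib]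
        congr 1
        refine Finset.sum_congr rfl fun k _ => ?_
        rw [mul_add, mul_one, Finset.mul_sum]
        simp
    _ ≤ 512 * (2 ^ (T.k + 1) + ∑ J ∈ kids ξ 𝔔, 2 * J.r) := by
        gcongr with J hJ
        rw [← Finset.sum_filter]
        refine (sum_two_zpow_le _ (k₁ := J.k) fun k hk => (Finset.mem_filter.1 hk).2).trans_eq ?_
        rw [zpow_add_one₀ two_ne_zero, Tile.r, mul_comm]
    _ ≤ _ := by
        rw [← Finset.mul_sum, zpow_add_one₀ two_ne_zero]
        have := h.sum_kids_r_le
        rw [Tile.r] at *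
        linarith

end IsTree

/-! ### Maximal averages over disjoint tiles -/

section averages
variable {S : Finset Tile} {κ : Tile → ℤ}

/-- The averaging kernel of scale `κ J` centred at `J`. -/
noncomputable def avg (κ : Tile → ℤ) (J : Tile) (y : ℝ) : ℂ :=
  ((J.r / 2 ^ κ J * decay ((y - J.c) / 2 ^ κ J) ^ 6 : ℝ) : ℂ)

lemma avg_nonneg (κ : Tile → ℤ) (J : Tile) (y : ℝ) :
    0 ≤ J.r / 2 ^ κ J * decay ((y - J.c) / 2 ^ κ J) ^ 6 := by
  have := J.r_pos
  have := decay_nonneg ((y - J.c) / 2 ^ κ J)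
  positivity

lemma norm_avg (κ : Tile → ℤ) (J : Tile) (y : ℝ) :
    ‖avg κ J y‖ = J.r / 2 ^ κ J * decay ((y - J.c) / 2 ^ κ J) ^ 6 := by
  rw [avg, Complex.norm_real, Real.norm_of_nonneg (avg_nonneg κ J y)]

lemma nice_avg (κ : Tile → ℤ) (J : Tile) : Nice (avg κ J) := by
  have h0 := two_zpow_pos (κ J)
  refine ⟨((integrable_decay_scaled (by norm_num) h0 J.c).const_mul _).ofReal, J.r / 2 ^ κ J,
    fun y => ?_⟩
  rw [norm_avg]
  have := J.r_pos
  exact mul_le_of_le_one_right (by positivity) (pow_le_one₀ (decay_nonneg _) (decay_le_one _))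

lemma nsq_sum_avg_le (hd : (S : Set Tile).PairwiseDisjoint Tile.I) (hκ : ∀ J ∈ S, J.k ≤ κ J) :
    nsq (fun y => ∑ J ∈ S, avg κ J y) ≤ 512 * ∑ J ∈ S, J.r := by
  classical
  have key : ∀ J ∈ S, ∀ J' ∈ S, κ J' ≤ κ J → ‖ip (avg κ J) (avg κ J')‖ ≤
      4 * (J.r / 2 ^ κ J) * (J'.r * decay ((J.c - J'.c) / 2 ^ κ J) ^ 4) := by
    intro J _ J' _ hk
    have h0 := two_zpow_pos (κ J)
    have h0' := two_zpow_pos (κ J')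
    have a := J.r_pos
    have a' := J'.r_pos
    refine (norm_ip_le_of_decay (γ := J.r / 2 ^ κ J) (γ' := J'.r / 2 ^ κ J') h0'
      (zpow_le_zpow_right₀ one_le_two hk) (by positivity) (by positivity)
      (fun y => (norm_avg κ J y).le) fun y => (norm_avg κ J' y).le).trans_eq ?_
    field_simp
  have hone : ∑ J ∈ S, ∑ J' ∈ S with κ J' ≤ κ J, ‖ip (avg κ J) (avg κ J')‖ ≤
      256 * ∑ J ∈ S, J.r := by
    rw [Finset.mul_sum]
    refine Finset.sum_le_sum fun J hJ => ?_
    have h0 := two_zpow_pos (κ J)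
    have a := J.r_pos
    calc _ ≤ ∑ J' ∈ S with κ J' ≤ κ J,
          4 * (J.r / 2 ^ κ J) * (J'.r * decay ((J.c - J'.c) / 2 ^ κ J) ^ 4) :=
          Finset.sum_le_sum fun J' hJ' => key J hJ J' (Finset.mem_filter.1 hJ').1
            (Finset.mem_filter.1 hJ').2
      _ ≤ 4 * (J.r / 2 ^ κ J) * (2 ^ 4 * (4 * 2 ^ κ J)) := by
          rw [← Finset.mul_sum]
          gcongr
          refine sum_decay_le h0 (fun J' hJ' => zpow_le_zpow_right₀ one_le_two ?_)
            (hd.subset (Finset.coe_subset.2 (Finset.filter_subset _ _))) (by norm_num) _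
          exact (hκ J' (Finset.mem_filter.1 hJ').1).trans (Finset.mem_filter.1 hJ').2
      _ = _ := by field_simp; norm_num
  refine (nsq_sum_le fun J _ => nice_avg κ J).trans ?_
  calc _ ≤ ∑ J ∈ S, ∑ J' ∈ S, ((if κ J' ≤ κ J then ‖ip (avg κ J) (avg κ J')‖ else 0) +
        (if κ J ≤ κ J' then ‖ip (avg κ J') (avg κ J)‖ else 0)) := by
        refine Finset.sum_le_sum fun J _ => Finset.sum_le_sum fun J' _ => ?_
        have n0 := norm_nonneg (ip (avg κ J) (avg κ J'))
        rw [norm_ip_comm (avg κ J')]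
        rcases le_total (κ J') (κ J) with hh | hh
        · rw [if_pos hh]; split_ifs <;> linarith
        · rw [if_pos hh]; split_ifs <;> linarith
    _ ≤ 256 * ∑ J ∈ S, J.r + 256 * ∑ J ∈ S, J.r := by
        simp only [Finset.sum_add_distrib]
        rw [Finset.sum_comm (f := fun J J' => if κ J ≤ κ J' then _ else _)]
        simp only [← Finset.sum_filter]
        exact add_le_add hone hone
    _ = _ := by ring

lemma sq_sum_avg_le (hd : (S : Set Tile).PairwiseDisjoint Tile.I) (hκ : ∀ J ∈ S, J.k ≤ κ J)
    {F : ℝ → ℂ} (hF : Nice F) :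
    (∑ J ∈ S, J.r * ((2 ^ κ J)⁻¹ * ∫ y, decay ((J.c - y) / 2 ^ κ J) ^ 6 * ‖F y‖)) ^ 2 ≤
      512 * (∑ J ∈ S, J.r) * nsq F := by
  have hF' : Nice fun y => (‖F y‖ : ℂ) := by
    obtain ⟨C, hC⟩ := hF.bdd
    exact ⟨hF.integrable.norm.ofReal, C, fun y => by simpa using hC y⟩
  have hV : Nice fun y => ∑ J ∈ S, avg κ J y := Nice.sum fun J _ => nice_avg κ J
  have h1 := sq_norm_ip_le hV hF'
  have h2 : nsq (fun y => (‖F y‖ : ℂ)) = nsq F := by simp [nsq]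
  have h3 : ip (fun y => ∑ J ∈ S, avg κ J y) (fun y => (‖F y‖ : ℂ)) =
      ((∑ J ∈ S, J.r * ((2 ^ κ J)⁻¹ * ∫ y, decay ((J.c - y) / 2 ^ κ J) ^ 6 * ‖F y‖) : ℝ) : ℂ) := by
    rw [ip_sum_left (fun J _ => nice_avg κ J) hF', Complex.ofReal_sum]
    refine Finset.sum_congr rfl fun J _ => ?_
    rw [← mul_assoc, ← integral_const_mul, ip, ← integral_complex_ofReal]
    congr 1; ext y
    rw [avg, Complex.conj_ofReal, decay_sub_comm y, div_eq_mul_inv]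
    push_cast; ring
  rw [h3, Complex.norm_real, Real.norm_eq_abs, sq_abs, h2] at h1
  exact h1.trans (mul_le_mul_of_nonneg_right (nsq_sum_avg_le hd hκ) (nsq_nonneg _))

end averages

/-! ### The square function of a tree -/

/-- The localized wave packet projection. -/
noncomputable def Tile.B (P : Tile) (f : ℝ → ℂ) : ℝ → ℂ :=
  op (sc psiT P.r P.m) (P.I.indicator (P.A f))

lemma Tile.sym_psiT (P : Tile) : Sym (sc psiT P.r P.m) := (sym_bsym _).sc P.r_pos _

lemma Tile.nice_IA (P : Tile) {f : ℝ → ℂ} (hf : Nice f) : Nice (P.I.indicator (P.A f)) :=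
  (P.nice_A hf).indicator P.measurableSet_I

lemma Tile.nice_B (P : Tile) {f : ℝ → ℂ} (hf : Nice f) : Nice (P.B f) := (P.nice_IA hf).op P.sym_psiT

lemma exists_norm_A_le_on : ∃ C : ℝ, 0 < C ∧ ∀ (P : Tile) (f : ℝ → ℂ), Nice f → ∀ y ∈ P.I,
    ‖P.A f y‖ ≤ C * P.γ f := by
  obtain ⟨C, hC, h⟩ := exists_norm_A_le
  refine ⟨64 * C, by positivity, fun P f hf y hy => ?_⟩
  have h1 := h P f hf y
  have h2 := decay_le_two_mul (x := y) P.r_pos (show |y - P.c| ≤ P.r from Tile.abs_sub_c_le hy)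
  have h3 : (1:ℝ) / 2 ≤ decay ((y - P.c) / P.r) := by
    have h4 := decay_le_two_mul (x := P.c) (y := y) (c := P.c) P.r_pos (Tile.abs_sub_c_le hy)
    rw [decay_sub_comm P.c y] at h4
    simp [decay] at h4 ⊢
    linarith
  have h5 : ((1:ℝ) / 2) ^ 6 ≤ decay ((y - P.c) / P.r) ^ 6 := by gcongr
  have h6 := mul_le_mul_of_nonneg_left h5 (norm_nonneg (P.A f y))
  norm_num at h6
  linarith

lemma exists_norm_B_le : ∃ C : ℝ, 0 < C ∧ ∀ (P : Tile) (f : ℝ → ℂ), Nice f → ∀ y,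
    ‖P.B f y‖ ≤ C * P.γ f * decay ((y - P.c) / P.r) ^ 6 := by
  obtain ⟨C, hC, h⟩ := exists_norm_A_le_on
  obtain ⟨D, hD, h1, -⟩ := exists_norm_op_le (sym_bsym psiTBump)
  refine ⟨D * (4 * (64 * C)), by positivity, fun P f hf y => ?_⟩
  have hr := P.r_pos
  have hγ := P.γ_nonneg f
  have hb : ∀ z, ‖P.I.indicator (P.A f) z‖ ≤ 64 * C * P.γ f * decay ((z - P.c) / P.r) ^ 6 := by
    intro z
    have hd := decay_nonneg ((z - P.c) / P.r)
    by_cases hz : z ∈ P.I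
    · rw [Set.indicator_of_mem hz]
      have h4 := decay_le_two_mul (x := P.c) (y := z) (c := P.c) P.r_pos (Tile.abs_sub_c_le hz)
      rw [decay_sub_comm P.c z] at h4
      have h3 : (1:ℝ) / 2 ≤ decay ((z - P.c) / P.r) := by
        simp [decay] at h4 ⊢
        linarith
      have h5 : ((1:ℝ) / 2) ^ 6 ≤ decay ((z - P.c) / P.r) ^ 6 := by gcongr
      have h6 := mul_le_mul_of_nonneg_left h5 (mul_nonneg hC.le hγ)
      norm_num at h6
      linarith [h P f hf z hz]
    · rw [Set.indicator_of_notMem hz]; simp only [norm_zero]; positivity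
  calc ‖P.B f y‖ ≤ _ := h1 P.r hr P.m _ (P.nice_IA hf) y
    _ ≤ D * P.r⁻¹ * (4 * P.r * (64 * C * P.γ f) * decay ((y - P.c) / P.r) ^ 6) := by
        gcongr
        exact integral_decay_mul_le hr (by positivity) hb (P.nice_IA hf).integrable y
    _ = _ := by field_simp

open Classical in
/-- The tiles of a tree having the tree frequency in the right half of their frequency interval. -/
noncomputable def upr (ξ : ℝ) (𝔔 : Finset Tile) : Finset Tile := 𝔔.filter (·.om2 ξ)

lemma mem_upr {ξ : ℝ} {𝔔 : Finset Tile} {P : Tile} : P ∈ upr ξ 𝔔 ↔ P ∈ 𝔔 ∧ P.om2 ξ := by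
  classical
  exact Finset.mem_filter

/-- The square function of a tree. -/
noncomputable def treeF (ξ : ℝ) (𝔔 : Finset Tile) (f : ℝ → ℂ) (x : ℝ) : ℂ :=
  ∑ P ∈ upr ξ 𝔔, P.B f x

lemma nice_treeF {ξ : ℝ} {𝔔 : Finset Tile} {f : ℝ → ℂ} (hf : Nice f) : Nice (treeF ξ 𝔔 f) :=
  Nice.sum fun P _ => P.nice_B hf

lemma psiT_lam_gap {P Q : Tile} (hk : P.k < Q.k) {ξ t : ℝ} (hP : P.om2 ξ) (hQ : Q.om2 ξ)
    (h1 : psiT (P.r * t - P.m) ≠ 0) (h2 : lam (Q.r * t - Q.m) ≠ 0) : False := by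
  have a := (psiT_ne_zero h1).2
  have b := (lam_ne_zero h2).1
  have hr := P.r_pos
  have hr' := Q.r_pos
  set e := (Q.m : ℝ) / Q.r with he
  have hem : Q.r * e = Q.m := by rw [he]; field_simp
  have he : Q.om e := by rw [Tile.om_iff, hem]; constructor <;> linarith
  have h3 := (Tile.om2_iff.1 (Tile.om2_of_om2 hk hP (Tile.om_of_om2 hQ) he)).1
  have h4 : 2 * P.r ≤ Q.r := by
    have : (2:ℝ) ^ (P.k + 1) ≤ 2 ^ Q.k := zpow_le_zpow_right₀ one_le_two (by omega)
    rw [zpow_add_one₀ two_ne_zero] at this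
    rw [Tile.r, Tile.r]; linarith
  have h5 : Q.r * (e - t) < 1 / 8 := by rw [mul_sub, hem]; linarith
  have h6 : 1 / 16 < P.r * (e - t) := by rw [mul_sub]; linarith
  nlinarith

lemma lam_psiT_eq {P Q : Tile} (hk : Q.k ≤ P.k) {ξ : ℝ} (hP : P.om2 ξ) (hQ : Q.om2 ξ) (t : ℝ) :
    sc lam Q.r Q.m t * sc psiT P.r P.m t = sc psiT P.r P.m t := by
  by_cases h0 : sc psiT P.r P.m t = 0
  · rw [h0, mul_zero]
  have h1 := psiT_ne_zero h0
  have h2 : P.om t := Tile.om_iff.2 ⟨by linarith, by linarith⟩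
  have h3 := Tile.om_iff.1 (Tile.om_of_om hk (Tile.om_of_om2 hQ) (Tile.om_of_om2 hP) h2)
  rw [sc, lam_eq_one ⟨h3.1, h3.2.le⟩, one_mul]

lemma op_lam_treeF {ξ : ℝ} {𝔔 : Finset Tile} {f : ℝ → ℂ} (hf : Nice f) {Q : Tile} (hQ : Q.om2 ξ) :
    op (sc lam Q.r Q.m) (treeF ξ 𝔔 f) = fun x => ∑ P ∈ upr ξ 𝔔 with Q.k ≤ P.k, P.B f x := by
  have hs : Sym (sc lam Q.r Q.m) := (sym_bsym _).sc Q.r_pos _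
  have := op_sum hs (s := upr ξ 𝔔) (F := fun P => P.B f) fun P _ => P.nice_B hf
  rw [show treeF ξ 𝔔 f = fun x => ∑ P ∈ upr ξ 𝔔, P.B f x from rfl, this]
  ext x
  rw [Finset.sum_filter]
  refine Finset.sum_congr rfl fun P hP => ?_
  split_ifs with hk
  · rw [Tile.B, op_op_eq_right hs P.sym_psiT (P.nice_IA hf) (lam_psiT_eq hk (mem_upr.1 hP).2 hQ)]
  · rw [Tile.B, op_op_eq_zero hs P.sym_psiT (P.nice_IA hf)]
    intro t
    by_contra h0
    obtain ⟨h1, h2⟩ := mul_ne_zero_iff.1 h0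
    exact psiT_lam_gap (by omega) (mem_upr.1 hP).2 hQ h2 h1

lemma exists_nsq_treeF_le : ∃ C : ℝ, 0 < C ∧ ∀ (f : ℝ → ℂ), Nice f → ∀ (𝔔 : Finset Tile) (ξ σ : ℝ)
    (T : Tile), IsTree 𝔔 ξ T → IsSize f 𝔔 σ → nsq (treeF ξ 𝔔 f) ≤ C * σ ^ 2 * T.r := by
  classical
  obtain ⟨C, hC, h⟩ := exists_norm_B_le
  refine ⟨256 * C ^ 2, by positivity, fun f hf 𝔔 ξ σ T hT hσ => ?_⟩
  have h1 := nsq_sum_le_of_orthogonal (upr ξ 𝔔) (F := fun P => P.B f) (γ := fun P => C * P.γ f)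
    (fun P _ => mul_nonneg hC.le (P.γ_nonneg f)) (fun P _ => P.nice_B hf)
    (fun P _ => h P f hf) ?_
  · refine h1.trans ?_
    rw [mul_assoc, mul_assoc]
    gcongr 256 * ?_
    calc _ = C ^ 2 * ∑ P ∈ upr ξ 𝔔, P.s f := by
          rw [Finset.mul_sum]
          exact Finset.sum_congr rfl fun P _ => by rw [mul_pow, mul_assoc, P.sq_γ_mul]
      _ ≤ _ := by
          gcongr
          refine le_trans (Finset.sum_le_sum_of_subset_of_nonneg (fun P hP => ?_)
            fun P _ _ => P.s_nonneg f) (hσ T.k T.n ξ)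
          obtain ⟨a, b⟩ := mem_upr.1 hP
          exact Finset.mem_filter.2 ⟨a, hT.sub P a, b⟩
  · intro P hP Q hQ hne
    obtain ⟨a, b⟩ := mem_upr.1 hP
    obtain ⟨a', b'⟩ := mem_upr.1 hQ
    have hk : Q.k ≠ P.k := fun hk => hne ⟨hk, Tile.eq_of_om (hT.om P a) (hT.om Q a') hk⟩
    refine ip_op_eq_zero P.sym_psiT Q.sym_psiT (fun t => conj_bsym _ _) (P.nice_IA hf)
      (Q.nice_IA hf) fun t => ?_
    by_contra h0
    obtain ⟨h1, h2⟩ := mul_ne_zero_iff.1 h0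
    have toLam : ∀ Q : Tile, sc psiT Q.r Q.m t ≠ 0 → lam (Q.r * t - Q.m) ≠ 0 := fun Q hQ => by
      have := psiT_ne_zero hQ
      rw [lam_eq_one ⟨by linarith, by linarith⟩]; exact one_ne_zero
    rcases lt_or_gt_of_ne hk with hh | hh
    · exact psiT_lam_gap hh b' b h2 (toLam P h1)
    · exact psiT_lam_gap hh b b' h1 (toLam Q h2)

/-! ### The model operator on a tree -/

open Classical in
/-- The tiles active at the point `x` for the choice function `N`. -/
noncomputable def act (N : ℝ → ℝ) (𝔓 : Finset Tile) (x : ℝ) : Finset Tile :=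
  𝔓.filter fun P => x ∈ P.I ∧ P.om2 (N x)

lemma mem_act {N : ℝ → ℝ} {𝔓 : Finset Tile} {x : ℝ} {P : Tile} :
    P ∈ act N 𝔓 x ↔ P ∈ 𝔓 ∧ x ∈ P.I ∧ P.om2 (N x) := by
  classical
  exact Finset.mem_filter

/-- The linearized model operator. -/
noncomputable def model (N : ℝ → ℝ) (𝔓 : Finset Tile) (f : ℝ → ℂ) (x : ℝ) : ℂ :=
  ∑ P ∈ act N 𝔓 x, P.A f x

lemma exists_norm_op_indicator_le : ∃ C : ℝ, 0 < C ∧ ∀ (P : Tile) (f : ℝ → ℂ), Nice f →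
    ∀ U : Set ℝ, MeasurableSet U → ∀ x c, x ∈ P.I → |x - c| ≤ P.r →
    ‖op (sc psiT P.r P.m) (U.indicator (P.A f)) x‖ ≤
      C * P.γ f * (P.r⁻¹ * ∫ y in U, decay ((c - y) / P.r) ^ 4) := by
  obtain ⟨C, hC, h⟩ := exists_norm_A_le
  obtain ⟨D, hD, h1, -⟩ := exists_norm_op_le (sym_bsym psiTBump)
  refine ⟨D * (1024 * C), by positivity, fun P f hf U hU x c hx hc => ?_⟩
  have hr := P.r_pos
  have hγ := P.γ_nonneg f
  have hn : Nice (U.indicator (P.A f)) := (P.nice_A hf).indicator hU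
  have hp : ∀ z, decay ((x - z) / P.r) ^ 20 * ‖U.indicator (P.A f) z‖ ≤
      U.indicator (fun z => 1024 * C * P.γ f * decay ((c - z) / P.r) ^ 4) z := by
    intro z
    by_cases hz : z ∈ U
    · rw [Set.indicator_of_mem hz, Set.indicator_of_mem hz]
      have a := decay_nonneg ((x - z) / P.r)
      have b := decay_le_two_mul (x := z) (y := P.c) (c := x) hr
        (by rw [abs_sub_comm]; exact Tile.abs_sub_c_le hx)
      rw [decay_sub_comm] at b
      have d := decay_le_two_mul (x := z) (y := c) (c := x) hr (by rwa [abs_sub_comm])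
      rw [decay_sub_comm, decay_sub_comm z] at d
      have b0 := decay_nonneg ((z - P.c) / P.r)
      have d0 := decay_nonneg ((c - z) / P.r)
      calc decay ((x - z) / P.r) ^ 20 * ‖P.A f z‖
          ≤ decay ((x - z) / P.r) ^ 10 * ‖P.A f z‖ := by
            gcongr ?_ * _
            exact decay_pow_le_pow (by norm_num) _
        _ = decay ((x - z) / P.r) ^ 4 * (‖P.A f z‖ * decay ((x - z) / P.r) ^ 6) := by ring
        _ ≤ (2 * decay ((c - z) / P.r)) ^ 4 *
            (‖P.A f z‖ * (2 * decay ((z - P.c) / P.r)) ^ 6) := by gcongr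
        _ = 1024 * (‖P.A f z‖ * decay ((z - P.c) / P.r) ^ 6) * decay ((c - z) / P.r) ^ 4 := by ring
        _ ≤ 1024 * (C * P.γ f) * decay ((c - z) / P.r) ^ 4 := by
            gcongr 1024 * ?_ * _
            exact h P f hf z
        _ = _ := by ring
    · rw [Set.indicator_of_notMem hz, Set.indicator_of_notMem hz]; simp
  calc _ ≤ _ := h1 P.r hr P.m _ hn x
    _ ≤ D * P.r⁻¹ * ∫ z, U.indicator (fun z => 1024 * C * P.γ f * decay ((c - z) / P.r) ^ 4) z := by
        gcongr
        · exact integrable_decay_mul hn.integrable x P.r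
        · exact ((integrable_decay_center c hr).const_mul _).indicator hU
        · exact fun z => hp z
    _ = _ := by
        rw [integral_indicator hU, integral_const_mul]; ring

lemma Tile.om2_congr {P Q : Tile} (hk : P.k = Q.k) (hm : P.m = Q.m) {ξ : ℝ} : P.om2 ξ ↔ Q.om2 ξ := by
  rw [Tile.om2, Tile.om2, hk, hm]

namespace IsTree
variable {𝔔 : Finset Tile} {ξ : ℝ} {T : Tile}

lemma m_eq (h : IsTree 𝔔 ξ T) {P Q : Tile} (hP : P ∈ 𝔔) (hQ : Q ∈ 𝔔) (hk : P.k = Q.k) : P.m = Q.m :=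
  Tile.eq_of_om (h.om Q hQ) (h.om P hP) hk

lemma sum_B_eq (h : IsTree 𝔔 ξ T) {f : ℝ → ℂ} (hf : Nice f) {P : Tile} (hP : P ∈ 𝔔) (hP2 : P.om2 ξ) (x : ℝ) :
    op (sc psiT P.r P.m) ((lev ξ 𝔔 P.k).indicator (P.A f)) x =
      ∑ Q ∈ upr ξ 𝔔 with Q.k = P.k, Q.B f x := by
  classical
  have e1 : (upr ξ 𝔔).filter (fun Q => Q.k = P.k) = 𝔔.filter (fun Q => Q.k = P.k) := by
    ext Q
    simp only [Finset.mem_filter, mem_upr]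
    exact ⟨fun hh => ⟨hh.1.1, hh.2⟩, fun hh => ⟨⟨hh.1, (Tile.om2_congr hh.2
      (h.m_eq hh.1 hP hh.2)).2 hP2⟩, hh.2⟩⟩
  have e2 : (lev ξ 𝔔 P.k).indicator (P.A f) =
      fun y => ∑ Q ∈ 𝔔 with Q.k = P.k, Q.I.indicator (P.A f) y := by
    ext y
    rw [h.lev_eq, Finset.indicator_biUnion_apply]
    exact pairwiseDisjoint_of_k fun Q hQ => ⟨(Finset.mem_filter.1 hQ).2,
      h.m_eq (Finset.mem_filter.1 hQ).1 hP (Finset.mem_filter.1 hQ).2⟩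
  rw [e1, e2, op_sum P.sym_psiT fun Q _ => (P.nice_A hf).indicator Q.measurableSet_I]
  refine Finset.sum_congr rfl fun Q hQ => ?_
  obtain ⟨a, b⟩ := Finset.mem_filter.1 hQ
  have hm := h.m_eq a hP b
  rw [Tile.B, Tile.A, Tile.A, Tile.r, Tile.r, b, hm]

end IsTree

lemma exists_norm_sum_B_le : ∃ C : ℝ, 0 < C ∧ ∀ (f : ℝ → ℂ), Nice f → ∀ (𝔔 : Finset Tile) (ξ : ℝ)
    (T : Tile), IsTree 𝔔 ξ T → ∀ J ∈ kids ξ 𝔔, ∀ M, 0 ≤ M →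
    (∀ k ∈ Finset.Icc (J.k + 1) T.k,
      (2 ^ k)⁻¹ * ∫ y, decay ((J.c - y) / 2 ^ k) ^ 6 * ‖treeF ξ 𝔔 f y‖ ≤ M) →
    ∀ x ∈ J.I, ∀ j, J.k + 1 ≤ j → ‖∑ Q ∈ upr ξ 𝔔 with j ≤ Q.k, Q.B f x‖ ≤ C * M := by
  obtain ⟨D, hD, h1, -⟩ := exists_norm_op_le (sym_bsym lamBump)
  refine ⟨64 * D, by positivity, fun f hf 𝔔 ξ T hT J hJ M hM h x hx j hj => ?_⟩
  classical
  rcases ((upr ξ 𝔔).filter (fun Q => j ≤ Q.k)).eq_empty_or_nonempty with he | hne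
  · rw [he]; simp only [Finset.sum_empty, norm_zero]; positivity
  obtain ⟨Q, hQ, hmin⟩ := Finset.exists_min_image _ Tile.k hne
  obtain ⟨hQ1, hQj⟩ := Finset.mem_filter.1 hQ
  obtain ⟨hQ2, hQo⟩ := mem_upr.1 hQ1
  have hr := Q.r_pos
  have e : (upr ξ 𝔔).filter (fun P => j ≤ P.k) = (upr ξ 𝔔).filter (fun P => Q.k ≤ P.k) := by
    ext P
    simp only [Finset.mem_filter]
    exact ⟨fun hh => ⟨hh.1, hmin P (Finset.mem_filter.2 hh)⟩, fun hh => ⟨hh.1, hQj.trans hh.2⟩⟩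
  have e2 := congrFun (op_lam_treeF (𝔔 := 𝔔) hf hQo) x
  rw [e, ← e2]
  have hn : Nice (treeF ξ 𝔔 f) := nice_treeF hf
  have hJr : J.r ≤ Q.r := zpow_le_zpow_right₀ one_le_two (by omega)
  calc _ ≤ _ := h1 Q.r hr Q.m _ hn x
    _ ≤ D * Q.r⁻¹ * ∫ z, 64 * (decay ((J.c - z) / Q.r) ^ 6 * ‖treeF ξ 𝔔 f z‖) := by
        gcongr
        · exact integrable_decay_mul hn.integrable x Q.r
        · exact (integrable_decay_mul hn.integrable J.c Q.r).const_mul _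
        · intro z
          have d := decay_le_two_mul (x := z) (y := J.c) (c := x) hr
            (by rw [abs_sub_comm]; exact (Tile.abs_sub_c_le hx).trans hJr)
          rw [decay_sub_comm, decay_sub_comm z] at d
          have d0 := decay_nonneg ((x - z) / Q.r)
          simp only
          calc _ ≤ decay ((x - z) / Q.r) ^ 6 * ‖treeF ξ 𝔔 f z‖ := by
                gcongr ?_ * _
                exact decay_pow_le_pow (by norm_num) _
            _ ≤ (2 * decay ((J.c - z) / Q.r)) ^ 6 * ‖treeF ξ 𝔔 f z‖ := by gcongr
            _ = _ := by ring
    _ = 64 * D * ((2 ^ Q.k)⁻¹ * ∫ z, decay ((J.c - z) / 2 ^ Q.k) ^ 6 * ‖treeF ξ 𝔔 f z‖) := by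
        rw [integral_const_mul, Tile.r]; ring
    _ ≤ _ := by
        gcongr
        exact h Q.k (Finset.mem_Icc.2 ⟨hj.trans hQj, (hT.sub Q hQ2).1⟩)

lemma exists_norm_model_le : ∃ C : ℝ, 0 < C ∧ ∀ (f : ℝ → ℂ), Nice f → ∀ (𝔔 : Finset Tile) (ξ : ℝ)
    (T : Tile) (N : ℝ → ℝ) (σ : ℝ), IsTree 𝔔 ξ T → 0 ≤ σ → IsSize f 𝔔 σ →
    ∀ J ∈ kids ξ 𝔔, ∀ M, 0 ≤ M →
    (∀ k ∈ Finset.Icc (J.k + 1) T.k,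
      (2 ^ k)⁻¹ * ∫ y, decay ((J.c - y) / 2 ^ k) ^ 6 * ‖treeF ξ 𝔔 f y‖ ≤ M) →
    ∀ x ∈ J.I, ‖model N 𝔔 f x‖ ≤ C * (σ + M + σ * ∑ k ∈ Finset.Icc (J.k + 1) T.k,
      (2 ^ k)⁻¹ * ∫ y in (lev ξ 𝔔 k)ᶜ, decay ((J.c - y) / 2 ^ k) ^ 4) := by
  classical
  obtain ⟨C₁, hC₁, h₁⟩ := exists_norm_A_le_on
  obtain ⟨C₂, hC₂, h₂⟩ := exists_norm_sum_B_le
  obtain ⟨C₃, hC₃, h₃⟩ := exists_norm_op_indicator_le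
  refine ⟨C₁ + 2 * C₂ + C₃, by positivity, fun f hf 𝔔 ξ T N σ hT hσ hsz J hJ M hM hMJ x hx => ?_⟩
  set Er := ∑ k ∈ Finset.Icc (J.k + 1) T.k,
    (2 ^ k)⁻¹ * ∫ y in (lev ξ 𝔔 k)ᶜ, decay ((J.c - y) / 2 ^ k) ^ 4 with hEr
  have hterm : ∀ k : ℤ, 0 ≤ ((2:ℝ) ^ k)⁻¹ * ∫ y in (lev ξ 𝔔 k)ᶜ, decay ((J.c - y) / 2 ^ k) ^ 4 :=
    fun k => mul_nonneg (inv_nonneg.2 (two_zpow_pos k).le)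
      (integral_nonneg fun y => pow_nonneg (decay_nonneg _) _)
  have hEr0 : 0 ≤ Er := Finset.sum_nonneg fun k _ => hterm k
  have hinj : ∀ P ∈ 𝔔, x ∈ P.I → ∀ Q ∈ 𝔔, x ∈ Q.I → P.k = Q.k → P = Q := by
    intro P hP hxP Q hQ hxQ hk
    rw [Tile.eq_tt (hT.om P hP) hxP, Tile.eq_tt (hT.om Q hQ) hxQ, hk]
  have hJk : ∀ P ∈ 𝔔, x ∈ P.I → J.k + 1 ≤ P.k ∧ P.k ≤ T.k := by
    intro P hP hxP
    refine (hT.tt_mem_iff hJ hx).1 ?_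
    rwa [← Tile.eq_tt (hT.om P hP) hxP]
  set Z₁ := (act N 𝔔 x).filter (fun P => ¬ P.om2 ξ) with hZ₁
  set Z := (act N 𝔔 x).filter (fun P => P.om2 ξ) with hZ
  have hsplit : model N 𝔔 f x = ∑ P ∈ Z, P.A f x + ∑ P ∈ Z₁, P.A f x :=
    (Finset.sum_filter_add_sum_filter_not _ _ _).symm
  have hb₁ : ‖∑ P ∈ Z₁, P.A f x‖ ≤ C₁ * σ := by
    have hcard : Z₁.card ≤ 1 := by
      refine Finset.card_le_one.2 ?_
      have key : ∀ P ∈ Z₁, ∀ Q ∈ Z₁, ¬ P.k < Q.k := by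
        intro P hP Q hQ hlt
        obtain ⟨hP1, hP2⟩ := Finset.mem_filter.1 hP
        obtain ⟨hQ1, hQ2⟩ := Finset.mem_filter.1 hQ
        obtain ⟨a, b, c⟩ := mem_act.1 hP1
        obtain ⟨a', b', c'⟩ := mem_act.1 hQ1
        exact hP2 (Tile.om2_of_om2 hlt c (Tile.om_of_om2 c') (hT.om Q a'))
      intro P hP Q hQ
      have e := le_antisymm (not_lt.1 (key Q hQ P hP)) (not_lt.1 (key P hP Q hQ))
      obtain ⟨a, b, c⟩ := mem_act.1 (Finset.mem_filter.1 hP).1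
      obtain ⟨a', b', c'⟩ := mem_act.1 (Finset.mem_filter.1 hQ).1
      exact hinj P a b Q a' b' e
    refine (norm_sum_le _ _).trans ((Finset.sum_le_card_nsmul _ _ (C₁ * σ) fun P hP => ?_).trans ?_)
    · obtain ⟨a, b, c⟩ := mem_act.1 (Finset.mem_filter.1 hP).1
      exact (h₁ P f hf x b).trans (by gcongr; exact γ_le_of_isSize hsz hσ a)
    · rw [nsmul_eq_mul]
      have : (Z₁.card : ℝ) ≤ 1 := by exact_mod_cast hcard
      exact mul_le_of_le_one_left (by positivity) this
  have hZmem : ∀ P ∈ Z, P ∈ 𝔔 ∧ x ∈ P.I ∧ P.om2 (N x) ∧ P.om2 ξ := by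
    intro P hP
    obtain ⟨hP1, hP2⟩ := Finset.mem_filter.1 hP
    obtain ⟨a, b, c⟩ := mem_act.1 hP1
    exact ⟨a, b, c, hP2⟩
  have hdec : ∑ P ∈ Z, P.A f x =
      ∑ P ∈ Z, ∑ Q ∈ upr ξ 𝔔 with Q.k = P.k, Q.B f x +
      ∑ P ∈ Z, op (sc psiT P.r P.m) ((lev ξ 𝔔 P.k)ᶜ.indicator (P.A f)) x := by
    rw [← Finset.sum_add_distrib]
    refine Finset.sum_congr rfl fun P hP => ?_
    obtain ⟨a, b, c, d⟩ := hZmem P hP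
    have hm := hT.measurableSet_lev P.k
    rw [← hT.sum_B_eq hf a d]
    have e := congrFun (op_add P.sym_psiT ((P.nice_A hf).indicator hm)
      ((P.nice_A hf).indicator hm.compl)) x
    rw [← e]
    conv_lhs => rw [← P.tilde_A hf]
    congr 1
    ext y
    exact (Set.indicator_self_add_compl_apply _ _ _).symm
  have hmain : ‖∑ P ∈ Z, ∑ Q ∈ upr ξ 𝔔 with Q.k = P.k, Q.B f x‖ ≤ 2 * C₂ * M := by
    rcases Z.eq_empty_or_nonempty with he | hne
    · rw [he]; simp only [Finset.sum_empty, norm_zero]; positivity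
    obtain ⟨P, hP, hmax⟩ := Finset.exists_max_image _ Tile.k hne
    obtain ⟨a, b, c, d⟩ := hZmem P hP
    have e1 : ∑ P ∈ Z, ∑ Q ∈ upr ξ 𝔔 with Q.k = P.k, Q.B f x =
        ∑ Q ∈ upr ξ 𝔔 with J.k + 1 ≤ Q.k ∧ Q.k ≤ P.k, Q.B f x := by
      rw [← Finset.sum_biUnion]
      · refine Finset.sum_congr ?_ fun _ _ => rfl
        ext Q
        simp only [Finset.mem_biUnion, Finset.mem_filter]
        constructor
        · rintro ⟨P', hP', hQ, hk⟩
          obtain ⟨a', b', -, -⟩ := hZmem P' hP'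
          exact ⟨hQ, hk ▸ (hJk P' a' b').1, hk ▸ hmax P' hP'⟩
        · rintro ⟨hQ, hk1, hk2⟩
          obtain ⟨hQ1, hQ2⟩ := mem_upr.1 hQ
          have hmem : tt ξ Q.k x ∈ 𝔔 :=
            (hT.tt_mem_iff hJ hx).2 ⟨hk1, (hT.sub Q hQ1).1⟩
          have h2 : (tt ξ Q.k x).om2 ξ := (Tile.om2_congr (P := tt ξ Q.k x) (Q := Q) rfl (hT.m_eq hmem hQ1 rfl)).2 hQ2
          refine ⟨tt ξ Q.k x, Finset.mem_filter.2 ⟨mem_act.2 ⟨hmem, mem_tt _ _ _, ?_⟩, h2⟩, hQ, rfl⟩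
          rcases hk2.lt_or_eq with hlt | heq
          · exact Tile.om2_of_om2 (P := tt ξ Q.k x) hlt h2 (Tile.om_of_om2 d) (Tile.om_of_om2 c)
          · rwa [hinj _ hmem (mem_tt _ _ _) P a b heq]
      · intro P' hP' P'' hP'' hne'
        refine Finset.disjoint_left.2 fun Q hQ hQ' => hne' ?_
        obtain ⟨a', b', -, -⟩ := hZmem P' hP'
        obtain ⟨a'', b'', -, -⟩ := hZmem P'' hP''
        exact hinj P' a' b' P'' a'' b''
          ((Finset.mem_filter.1 hQ).2.symm.trans (Finset.mem_filter.1 hQ').2)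
    have e2 : ∑ Q ∈ upr ξ 𝔔 with J.k + 1 ≤ Q.k ∧ Q.k ≤ P.k, Q.B f x =
        ∑ Q ∈ upr ξ 𝔔 with J.k + 1 ≤ Q.k, Q.B f x -
        ∑ Q ∈ upr ξ 𝔔 with P.k + 1 ≤ Q.k, Q.B f x := by
      have hk := (hJk P a b).1
      rw [eq_sub_iff_add_eq, Finset.sum_filter, Finset.sum_filter, Finset.sum_filter,
        ← Finset.sum_add_distrib]
      refine Finset.sum_congr rfl fun Q _ => ?_
      split_ifs <;> first | omega | simp
    rw [e1, e2]
    refine (norm_sub_le _ _).trans ?_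
    have b1 := h₂ f hf 𝔔 ξ T hT J hJ M hM hMJ x hx (J.k + 1) le_rfl
    have b2 := h₂ f hf 𝔔 ξ T hT J hJ M hM hMJ x hx (P.k + 1) (by have := (hJk P a b).1; omega)
    linarith
  have herr : ‖∑ P ∈ Z, op (sc psiT P.r P.m) ((lev ξ 𝔔 P.k)ᶜ.indicator (P.A f)) x‖ ≤
      C₃ * σ * Er := by
    refine (norm_sum_le _ _).trans ?_
    calc _ ≤ ∑ P ∈ Z, C₃ * σ *
          ((2 ^ P.k)⁻¹ * ∫ y in (lev ξ 𝔔 P.k)ᶜ, decay ((J.c - y) / 2 ^ P.k) ^ 4) := by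
          refine Finset.sum_le_sum fun P hP => ?_
          obtain ⟨a, b, -, -⟩ := hZmem P hP
          refine (h₃ P f hf _ (hT.measurableSet_lev P.k).compl x J.c b ?_).trans ?_
          · refine (Tile.abs_sub_c_le hx).trans (zpow_le_zpow_right₀ one_le_two ?_)
            have := (hJk P a b).1
            omega
          · exact mul_le_mul_of_nonneg_right (mul_le_mul_of_nonneg_left
              (γ_le_of_isSize hsz hσ a) hC₃.le) (hterm P.k)
      _ ≤ _ := by
          rw [← Finset.mul_sum]
          gcongr
          rw [← Finset.sum_image (s := Z) (g := Tile.k) (f := fun k : ℤ => ((2:ℝ) ^ k)⁻¹ *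
            ∫ y in (lev ξ 𝔔 k)ᶜ, decay ((J.c - y) / 2 ^ k) ^ 4)]
          · refine Finset.sum_le_sum_of_subset_of_nonneg (fun k hk => ?_) fun k _ _ => hterm k
            obtain ⟨P, hP, rfl⟩ := Finset.mem_image.1 hk
            obtain ⟨a, b, -, -⟩ := hZmem P hP
            exact Finset.mem_Icc.2 (hJk P a b)
          · intro P hP Q hQ hk
            obtain ⟨a, b, -, -⟩ := hZmem P hP
            obtain ⟨a', b', -, -⟩ := hZmem Q hQ
            exact hinj P a b Q a' b' hk
  rw [hsplit, hdec]
  calc _ ≤ 2 * C₂ * M + C₃ * σ * Er + C₁ * σ :=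
        (norm_add_le _ _).trans (add_le_add ((norm_add_le _ _).trans (add_le_add hmain herr)) hb₁)
    _ ≤ _ := by
        have a1 : 0 ≤ C₁ * M := by positivity
        have a2 : 0 ≤ C₁ * (σ * Er) := by positivity
        have a3 : 0 ≤ C₂ * σ := by positivity
        have a4 : 0 ≤ C₂ * (σ * Er) := by positivity
        have a5 : 0 ≤ C₃ * σ := by positivity
        have a6 : 0 ≤ C₃ * M := by positivity
        nlinarith

/-! ### The mass and the tree estimate -/

/-- The part of the spatial interval on which the choice function lies in the frequency interval. -/
def Tile.V (N : ℝ → ℝ) (P : Tile) : Set ℝ := {x | x ∈ P.I ∧ P.om (N x)}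

/-- All tiles of the family have mass at most `μ`. -/
def IsMass (E : Set ℝ) (N : ℝ → ℝ) (𝔓 : Finset Tile) (μ : ℝ) : Prop :=
  ∀ P ∈ 𝔓, ∀ P' : Tile, P.le P' → volume.real (E ∩ P'.V N) ≤ μ * P'.r

lemma IsMass.mono {E : Set ℝ} {N : ℝ → ℝ} {𝔓 𝔓' : Finset Tile} {μ : ℝ} (h : IsMass E N 𝔓 μ)
    (h' : 𝔓' ⊆ 𝔓) : IsMass E N 𝔓' μ := fun P hP => h P (h' hP)

lemma IsSize.mono {f : ℝ → ℂ} {𝔓 𝔓' : Finset Tile} {σ : ℝ} (h : IsSize f 𝔓 σ)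
    (h' : 𝔓' ⊆ 𝔓) : IsSize f 𝔓' σ := by
  classical
  intro k n ξ
  refine le_trans (Finset.sum_le_sum_of_subset_of_nonneg ?_ fun P _ _ => P.s_nonneg f) (h k n ξ)
  exact Finset.filter_subset_filter _ h'

lemma measurable_dy_comp {N : ℝ → ℝ} (hN : Measurable N) (k : ℤ) : Measurable fun x => dy k (N x) :=
  (measurable_dy k).comp hN

lemma Tile.measurableSet_V {N : ℝ → ℝ} (hN : Measurable N) (P : Tile) : MeasurableSet (P.V N) :=
  P.measurableSet_I.inter (measurable_dy_comp hN _ (measurableSet_singleton P.m))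

lemma Tile.measurableSet_om2 {N : ℝ → ℝ} (hN : Measurable N) (P : Tile) :
    MeasurableSet {x | P.om2 (N x)} :=
  measurable_dy_comp hN _ (measurableSet_singleton _)

lemma Tile.V_subset {N : ℝ → ℝ} (P : Tile) : P.V N ⊆ P.I := fun _ h => h.1

lemma Tile.volume_I_ne_top (P : Tile) : volume P.I ≠ ⊤ := by
  rw [P.volume_I]; exact ENNReal.ofReal_ne_top

lemma model_eq_sum (N : ℝ → ℝ) (𝔓 : Finset Tile) (f : ℝ → ℂ) :
    model N 𝔓 f = fun x => ∑ P ∈ 𝔓, (P.I ∩ {x | P.om2 (N x)}).indicator (P.A f) x := by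
  classical
  ext x
  rw [model, act, Finset.sum_filter]
  refine Finset.sum_congr rfl fun P _ => ?_
  by_cases h : x ∈ P.I ∧ P.om2 (N x)
  · rw [if_pos h, Set.indicator_of_mem (show x ∈ P.I ∩ {x | P.om2 (N x)} from h)]
  · rw [if_neg h, Set.indicator_of_notMem (show x ∉ P.I ∩ {x | P.om2 (N x)} from h)]

lemma nice_model {N : ℝ → ℝ} (hN : Measurable N) (𝔓 : Finset Tile) {f : ℝ → ℂ} (hf : Nice f) :
    Nice (model N 𝔓 f) := by
  rw [model_eq_sum]
  exact Nice.sum fun P _ => (P.nice_A hf).indicator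
    (P.measurableSet_I.inter (P.measurableSet_om2 hN))

/-- The integral of the model operator over `E`. -/
noncomputable def Λ (E : Set ℝ) (N : ℝ → ℝ) (f : ℝ → ℂ) (𝔓 : Finset Tile) : ℝ :=
  ∫ x in E, ‖model N 𝔓 f x‖

lemma exists_tree_estimate : ∃ C : ℝ, 0 < C ∧ ∀ (f : ℝ → ℂ), Nice f → ∀ (𝔔 : Finset Tile) (ξ : ℝ)
    (T : Tile) (N : ℝ → ℝ) (E : Set ℝ) (σ μ : ℝ), Measurable N → IsTree 𝔔 ξ T → 0 ≤ σ → 0 ≤ μ →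
    IsSize f 𝔔 σ → IsMass E N 𝔔 μ → Λ E N f 𝔔 ≤ C * σ * μ * T.r := by
  classical
  obtain ⟨C₁, hC₁, h₁⟩ := exists_norm_model_le
  obtain ⟨C₂, hC₂, h₂⟩ := exists_nsq_treeF_le
  refine ⟨2 * C₁ * (2049 + (512 * C₂ + 1)), by positivity,
    fun f hf 𝔔 ξ T N E σ μ hN hT hσ hμ hsz hms => ?_⟩
  have hr := T.r_pos
  set a : Tile → ℤ → ℝ := fun J k =>
    (2 ^ k)⁻¹ * ∫ y, decay ((J.c - y) / 2 ^ k) ^ 6 * ‖treeF ξ 𝔔 f y‖ with ha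
  have ha0 : ∀ J k, 0 ≤ a J k := fun J k => mul_nonneg (inv_nonneg.2 (two_zpow_pos k).le)
    (integral_nonneg fun y => mul_nonneg (pow_nonneg (decay_nonneg _) _) (norm_nonneg _))
  have hmax : ∀ J, ∃ κ : ℤ, J ∈ kids ξ 𝔔 → J.k ≤ κ ∧ ∀ k ∈ Finset.Icc (J.k + 1) T.k,
      a J k ≤ a J κ := by
    intro J
    by_cases hJ : J ∈ kids ξ 𝔔
    · obtain ⟨κ, h1, h2⟩ := Finset.exists_max_image (Finset.Icc (J.k + 1) T.k) (a J)
        ⟨_, Finset.mem_Icc.2 ⟨le_rfl, hT.kid_k_lt hJ⟩⟩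
      exact ⟨κ, fun _ => ⟨by have := (Finset.mem_Icc.1 h1).1; omega, h2⟩⟩
    · exact ⟨0, fun h => absurd h hJ⟩
  choose κ hκ using hmax
  set er : Tile → ℝ := fun J => ∑ k ∈ Finset.Icc (J.k + 1) T.k,
    (2 ^ k)⁻¹ * ∫ y in (lev ξ 𝔔 k)ᶜ, decay ((J.c - y) / 2 ^ k) ^ 4 with her
  have her0 : ∀ J, 0 ≤ er J := fun J => Finset.sum_nonneg fun k _ =>
    mul_nonneg (inv_nonneg.2 (two_zpow_pos k).le)
      (integral_nonneg fun y => pow_nonneg (decay_nonneg _) _)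
  set b : Tile → ℝ := fun J => C₁ * (σ + a J (κ J) + σ * er J) with hb
  have hb0 : ∀ J, 0 ≤ b J := fun J => by
    have := ha0 J (κ J)
    have := her0 J
    positivity
  set par : Tile → Tile := fun J => tt ξ (J.k + 1) J.c with hpar
  have hpw : ∀ x, ‖model N 𝔔 f x‖ ≤ ∑ J ∈ kids ξ 𝔔, ((par J).V N).indicator (fun _ => b J) x := by
    intro x
    have h0 : ∀ J ∈ kids ξ 𝔔, 0 ≤ ((par J).V N).indicator (fun _ => b J) x :=
      fun J _ => Set.indicator_nonneg (fun _ _ => hb0 J) x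
    rcases (act N 𝔔 x).eq_empty_or_nonempty with he | ⟨P, hP⟩
    · rw [model, he, Finset.sum_empty, norm_zero]
      exact Finset.sum_nonneg h0
    · obtain ⟨hP1, hxP, hP2⟩ := mem_act.1 hP
      obtain ⟨J, hJ, hxJ⟩ := hT.exists_kid_of_mem hP1 hxP
      refine le_trans ?_ (Finset.single_le_sum h0 hJ)
      have hk : J.k + 1 ≤ P.k := by
        refine ((hT.tt_mem_iff hJ hxJ).1 ?_).1
        rwa [← Tile.eq_tt (hT.om P hP1) hxP]
      have hV : x ∈ (par J).V N := by
        refine ⟨?_, Tile.om_of_om hk (om_tt _ _ _) (hT.om P hP1) (Tile.om_of_om2 hP2)⟩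
        change dy (J.k + 1) x = dy (J.k + 1) J.c
        rw [dy_add_one, dy_add_one, Tile.mem_I.1 hxJ, J.dy_c]
      rw [Set.indicator_of_mem hV]
      exact h₁ f hf 𝔔 ξ T N σ hT hσ hsz J hJ _ (ha0 J (κ J)) (hκ J hJ).2 x hxJ
  have hint : Λ E N f 𝔔 ≤ ∑ J ∈ kids ξ 𝔔, b J * (2 * μ * J.r) := by
    have hi : ∀ J ∈ kids ξ 𝔔, Integrable (((par J).V N).indicator (fun _ => b J))
        (volume.restrict E) := fun J _ => ((integrable_indicator_iff ((par J).measurableSet_V hN)).2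
        (integrableOn_const (measure_ne_top_of_subset (par J).V_subset (par J).volume_I_ne_top))).restrict
    calc Λ E N f 𝔔 ≤ ∫ x in E, ∑ J ∈ kids ξ 𝔔, ((par J).V N).indicator (fun _ => b J) x :=
          integral_mono (nice_model hN 𝔔 hf).integrable.norm.restrict (integrable_finsetSum _ hi) hpw
      _ = ∑ J ∈ kids ξ 𝔔, b J * volume.real (E ∩ (par J).V N) := by
          rw [integral_finsetSum _ hi]
          refine Finset.sum_congr rfl fun J _ => ?_
          rw [integral_indicator_const _ ((par J).measurableSet_V hN), smul_eq_mul, mul_comm,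
            measureReal_restrict_apply ((par J).measurableSet_V hN), Set.inter_comm]
      _ ≤ _ := by
          refine Finset.sum_le_sum fun J hJ => mul_le_mul_of_nonneg_left ?_ (hb0 J)
          have h3 := hms (par J) ((hT.mem_kids J.c_mem_I).1 hJ).2.2 (par J) (Tile.le_refl _)
          refine h3.trans (le_of_eq ?_)
          change μ * (2:ℝ) ^ (J.k + 1) = 2 * μ * 2 ^ J.k
          rw [zpow_add_one₀ two_ne_zero]; ring
  have hS := hT.sum_kids_r_le
  have hS0 : 0 ≤ ∑ J ∈ kids ξ 𝔔, J.r := Finset.sum_nonneg fun J _ => J.r_pos.le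
  have h4 : ∑ J ∈ kids ξ 𝔔, J.r * a J (κ J) ≤ (512 * C₂ + 1) * σ * T.r := by
    have h5 := sq_sum_avg_le hT.kids_disjoint (fun J hJ => (hκ J hJ).1) (nice_treeF (ξ := ξ) (𝔔 := 𝔔) hf)
    have h6 := h₂ f hf 𝔔 ξ σ T hT hsz
    refine abs_le_of_sq_le_sq' ?_ (by positivity) |>.2
    calc _ ≤ _ := h5
      _ ≤ 512 * T.r * (C₂ * σ ^ 2 * T.r) := by
          gcongr
          exact nsq_nonneg _
      _ ≤ _ := by
          have : 0 ≤ (σ * T.r) ^ 2 := by positivity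
          nlinarith [sq_nonneg (512 * C₂), mul_nonneg (add_nonneg (add_nonneg (sq_nonneg (512*C₂)) (mul_nonneg (by norm_num : (0:ℝ) ≤ 512) hC₂.le)) zero_le_one) this]
  have h7 := hT.sum_kids_mul_error_le
  calc _ ≤ _ := hint
    _ = 2 * C₁ * μ * (σ * (∑ J ∈ kids ξ 𝔔, J.r) + ∑ J ∈ kids ξ 𝔔, J.r * a J (κ J) +
        σ * ∑ J ∈ kids ξ 𝔔, J.r * er J) := by
        simp only [Finset.mul_sum, ← Finset.sum_add_distrib]
        exact Finset.sum_congr rfl fun J _ => by simp only [hb]; ring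
    _ ≤ 2 * C₁ * μ * (σ * T.r + (512 * C₂ + 1) * σ * T.r + σ * (2048 * T.r)) := by
        gcongr
    _ = _ := by ring

/-! ### Forests -/

lemma Λ_filter_le {E : Set ℝ} {N : ℝ → ℝ} (hN : Measurable N) {f : ℝ → ℂ} (hf : Nice f)
    (𝔓 : Finset Tile) (p : Tile → Prop) [DecidablePred p] :
    Λ E N f 𝔓 ≤ Λ E N f (𝔓.filter p) + Λ E N f (𝔓.filter fun P => ¬ p P) := by
  classical
  have e : ∀ x, model N 𝔓 f x = model N (𝔓.filter p) f x + model N (𝔓.filter fun P => ¬ p P) f x := by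
    intro x
    simp only [model_eq_sum]
    exact (Finset.sum_filter_add_sum_filter_not _ _ _).symm
  have h1 := (nice_model hN (𝔓.filter p) hf).integrable.norm.restrict (s := E)
  have h2 := (nice_model hN (𝔓.filter fun P => ¬ p P) hf).integrable.norm.restrict (s := E)
  rw [Λ, Λ, Λ, ← integral_add h1 h2]
  refine integral_mono (nice_model hN 𝔓 hf).integrable.norm.restrict (h1.add h2) fun x => ?_
  simp only [e x]
  exact norm_add_le _ _

lemma Λ_empty (E : Set ℝ) (N : ℝ → ℝ) (f : ℝ → ℂ) : Λ E N f ∅ = 0 := by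
  simp [Λ, model_eq_sum]

lemma Tile.le.sub {P P' : Tile} (h : P.le P') {k n : ℤ} (h' : P'.sub k n) : P.sub k n :=
  sub_of_mem (h.1.1.trans h'.1) P.c_mem_I (h'.mem (h.1.mem P.c_mem_I))

/-- Removing a family that is closed downwards preserves convexity of both parts. -/
lemma Convx.filter {𝔓 : Finset Tile} (h : Convx 𝔓) (p : Tile → Prop) [DecidablePred p]
    (hp : ∀ P P', P.le P' → p P' → p P) :
    Convx (𝔓.filter p) ∧ Convx (𝔓.filter fun P => ¬ p P) := by
  constructor
  · intro P hP P'' hP'' P' h1 h2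
    exact Finset.mem_filter.2 ⟨h P (Finset.mem_filter.1 hP).1 P'' (Finset.mem_filter.1 hP'').1 P' h1 h2,
      hp _ _ h2 (Finset.mem_filter.1 hP'').2⟩
  · intro P hP P'' hP'' P' h1 h2
    exact Finset.mem_filter.2 ⟨h P (Finset.mem_filter.1 hP).1 P'' (Finset.mem_filter.1 hP'').1 P' h1 h2,
      fun h3 => (Finset.mem_filter.1 hP).2 (hp _ _ h1 h3)⟩

lemma Top.D.of_le {T : Top} {P P' : Tile} (h : P.le P') (h' : T.D P') : T.D P :=
  ⟨h.sub h'.1, h.om h'.2⟩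

lemma exists_Λ_le_union : ∃ C : ℝ, 0 < C ∧ ∀ (f : ℝ → ℂ), Nice f → ∀ (ξ : ℝ)
    (N : ℝ → ℝ) (E : Set ℝ) (σ μ : ℝ), Measurable N → 0 ≤ σ → 0 ≤ μ → ∀ (𝔔 : Finset Tile),
    Convx 𝔔 → (∀ P ∈ 𝔔, P.om ξ) → IsSize f 𝔔 σ → IsMass E N 𝔔 μ →
    Λ E N f 𝔔 ≤ C * σ * μ * volume.real (⋃ P ∈ 𝔔, P.I) := by
  classical
  obtain ⟨C, hC, h⟩ := exists_tree_estimate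
  refine ⟨C, hC, fun f hf ξ N E σ μ hN hσ hμ 𝔔 => ?_⟩
  induction 𝔔 using Finset.strongInduction with
  | H 𝔔 ih =>
    intro hcv hom hsz hms
    rcases 𝔔.eq_empty_or_nonempty with rfl | hne
    · simp [Λ_empty]
    obtain ⟨P, hP, hmax⟩ := Finset.exists_max_image 𝔔 Tile.k hne
    set p : Tile → Prop := fun Q => Q.sub P.k P.n with hp
    have hcv' := hcv.filter p fun Q Q' hQ hQ' => hQ.sub hQ'
    have hPp : P ∈ 𝔔.filter p := Finset.mem_filter.2 ⟨hP, P.sub_refl⟩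
    have hT : IsTree (𝔔.filter p) ξ P := ⟨hcv'.1, fun Q hQ => hom Q (Finset.mem_filter.1 hQ).1, hPp,
      fun Q hQ => (Finset.mem_filter.1 hQ).2⟩
    have hs1 : 𝔔.filter p ⊆ 𝔔 := Finset.filter_subset _ _
    have hs2 : (𝔔.filter fun Q => ¬ p Q) ⊆ 𝔔 := Finset.filter_subset _ _
    have h1 := h f hf _ ξ P N E σ μ hN hT hσ hμ (hsz.mono hs1) (hms.mono hs1)
    have h2 := ih _ (Finset.filter_ssubset.2 ⟨P, hP, fun h => h P.sub_refl⟩) hcv'.2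
      (fun Q hQ => hom Q (hs2 hQ)) (hsz.mono hs2) (hms.mono hs2)
    have hfin : volume (⋃ Q ∈ 𝔔, Q.I) ≠ ⊤ :=
      ((measure_biUnion_finset_le _ _).trans_lt (ENNReal.sum_lt_top.2 fun Q _ =>
        lt_top_iff_ne_top.2 Q.volume_I_ne_top)).ne
    have hd : Disjoint P.I (⋃ Q ∈ 𝔔.filter fun Q => ¬ p Q, Q.I) := by
      refine Set.disjoint_iUnion₂_right.2 fun Q hQ => ?_
      obtain ⟨a, b⟩ := Finset.mem_filter.1 hQ
      exact ((Q.disjoint_or_sub P (hmax Q a)).resolve_right b).symm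
    have hv : P.r + volume.real (⋃ Q ∈ 𝔔.filter fun Q => ¬ p Q, Q.I) ≤ volume.real (⋃ Q ∈ 𝔔, Q.I) := by
      rw [← P.volume_real_I, ← measureReal_union hd (measurableSet_biUnion_I _) P.volume_I_ne_top
        (measure_ne_top_of_subset (Set.biUnion_subset_biUnion_left hs2) hfin)]
      exact measureReal_mono (Set.union_subset (Set.subset_biUnion_of_mem (u := Tile.I) hP)
        (Set.biUnion_subset_biUnion_left hs2)) hfin
    calc _ ≤ _ := Λ_filter_le hN hf 𝔔 p
      _ ≤ C * σ * μ * (P.r + volume.real (⋃ Q ∈ 𝔔.filter fun Q => ¬ p Q, Q.I)) := by linarith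
      _ ≤ _ := by gcongr

open Classical in
/-- The tiles of the family under none of the given tops. -/
noncomputable def rest {ι : Type*} (𝔓 : Finset Tile) (S : Finset ι) (T : ι → Top) : Finset Tile :=
  𝔓.filter fun P => ∀ i ∈ S, ¬ (T i).D P

lemma mem_rest {ι : Type*} {𝔓 : Finset Tile} {S : Finset ι} {T : ι → Top} {P : Tile} :
    P ∈ rest 𝔓 S T ↔ P ∈ 𝔓 ∧ ∀ i ∈ S, ¬ (T i).D P := by
  classical
  exact Finset.mem_filter

lemma rest_subset {ι : Type*} (𝔓 : Finset Tile) (S : Finset ι) (T : ι → Top) : rest 𝔓 S T ⊆ 𝔓 :=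
  fun _ h => (mem_rest.1 h).1

lemma Convx.rest {ι : Type*} {𝔓 : Finset Tile} (h : Convx 𝔓) (S : Finset ι) (T : ι → Top) :
    Convx (rest 𝔓 S T) := by
  intro P hP P'' hP'' P' h1 h2
  rw [mem_rest] at hP hP'' ⊢
  exact ⟨h P hP.1 P'' hP''.1 P' h1 h2, fun i hi h3 => hP.2 i hi (h3.of_le h1)⟩

lemma exists_forest_estimate : ∃ C : ℝ, 0 < C ∧ ∀ (f : ℝ → ℂ), Nice f →
    ∀ (N : ℝ → ℝ) (E : Set ℝ) (σ μ : ℝ), Measurable N → 0 ≤ σ → 0 ≤ μ → ∀ (𝔓 : Finset Tile),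
    Convx 𝔓 → IsSize f 𝔓 σ → IsMass E N 𝔓 μ → ∀ {ι : Type} (S : Finset ι) (T : ι → Top),
    Λ E N f 𝔓 ≤ C * σ * μ * ∑ i ∈ S, 2 ^ (T i).k + Λ E N f (rest 𝔓 S T) := by
  classical
  obtain ⟨C, hC, h⟩ := exists_Λ_le_union
  refine ⟨C, hC, fun f hf N E σ μ hN hσ hμ 𝔓 hcv hsz hms ι S T => ?_⟩
  induction S using Finset.induction_on with
  | empty =>
    have : rest 𝔓 (∅ : Finset ι) T = 𝔓 := by ext P; simp [mem_rest]
    simp [this]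
  | insert i S hi ih =>
    have hs := rest_subset 𝔓 S T
    have hcv' := (hcv.rest S T).filter (T i).D fun P P' h1 h2 => h2.of_le h1
    have e : (rest 𝔓 S T).filter (fun P => ¬ (T i).D P) = rest 𝔓 (insert i S) T := by
      ext P
      rw [Finset.mem_filter, mem_rest, mem_rest, Finset.forall_mem_insert]
      tauto
    have h1 := Λ_filter_le (E := E) hN hf (rest 𝔓 S T) (T i).D
    rw [e] at h1
    have hs' : (rest 𝔓 S T).filter (T i).D ⊆ 𝔓 := (Finset.filter_subset _ _).trans hs
    have h2 := h f hf (T i).ξ N E σ μ hN hσ hμ _ hcv'.1 (fun P hP => (Finset.mem_filter.1 hP).2.2)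
      (hsz.mono hs') (hms.mono hs')
    have h3 : volume.real (⋃ P ∈ (rest 𝔓 S T).filter (T i).D, P.I) ≤ 2 ^ (T i).k := by
      have h4 := (Tile.mk (T i).k (T i).n 0).volume_real_I
      rw [Tile.r] at h4
      rw [← h4]
      refine measureReal_mono (Set.iUnion₂_subset fun P hP => ?_) (Tile.volume_I_ne_top _)
      exact fun x hx => (Finset.mem_filter.1 hP).2.1.mem hx
    rw [Finset.sum_insert hi, mul_add]
    have h5 := mul_le_mul_of_nonneg_left h3 (show 0 ≤ C * σ * μ by positivity)
    linarith

/-- The mass decomposition. -/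
lemma exists_mass_tops {N : ℝ → ℝ} (hN : Measurable N) {E : Set ℝ} (hE : MeasurableSet E)
    (hE' : volume E ≠ ⊤) {μ : ℝ} (hμ : 0 < μ) (𝔓 : Finset Tile) :
    ∃ (S : Finset Tile) (T : Tile → Top), μ * ∑ i ∈ S, 2 ^ (T i).k ≤ volume.real E ∧
      IsMass E N (rest 𝔓 S T) μ := by
  classical
  set heavy : Tile → Prop := fun P' => μ * P'.r < volume.real (E ∩ P'.V N) with hheavy
  have hex : ∀ P : Tile, ∃ P' : Tile, (∃ Q, P.le Q ∧ heavy Q) →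
      P.le P' ∧ heavy P' ∧ ∀ Q, P.le Q → heavy Q → Q.k ≤ P'.k := by
    intro P
    by_cases hP : ∃ Q, P.le Q ∧ heavy Q
    · obtain ⟨b, hb⟩ : ∃ b : ℕ, volume.real E / μ < 2 ^ b := pow_unbounded_of_one_lt _ one_lt_two
      obtain ⟨k, ⟨P', h1, h2, rfl⟩, h3⟩ := Int.exists_greatest_of_bdd
        (P := fun k => ∃ Q : Tile, P.le Q ∧ heavy Q ∧ Q.k = k) ⟨b, by
          rintro _ ⟨Q, -, hQ, rfl⟩
          by_contra! hlt
          have a1 : (2:ℝ) ^ b ≤ Q.r := by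
            rw [← zpow_natCast]; exact zpow_le_zpow_right₀ one_le_two hlt.le
          have a2 : volume.real (E ∩ Q.V N) ≤ volume.real E :=
            measureReal_mono Set.inter_subset_left hE'
          rw [div_lt_iff₀ hμ] at hb
          have a3 : μ * Q.r < volume.real (E ∩ Q.V N) := hQ
          nlinarith⟩
        (by obtain ⟨Q, hQ, hQ'⟩ := hP; exact ⟨Q.k, Q, hQ, hQ', rfl⟩)
      exact ⟨P', fun _ => ⟨h1, h2, fun Q hQ hQ' => h3 _ ⟨Q, hQ, hQ', rfl⟩⟩⟩
    · exact ⟨P, fun h => absurd h hP⟩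
  choose H hH using hex
  set bad := 𝔓.filter fun P => ∃ Q, P.le Q ∧ heavy Q with hbad
  have hbad' : ∀ P ∈ bad, _ := fun P hP => hH P (Finset.mem_filter.1 hP).2
  refine ⟨bad.image H, fun Q => ⟨Q.k, Q.n, Q.fc, ∅⟩, ?_, ?_⟩
  · have key : ∀ P ∈ bad, ∀ Q ∈ bad, (H P).k ≤ (H Q).k → ∀ x, x ∈ (H P).V N → x ∈ (H Q).V N →
        H P = H Q := by
      intro P hP Q hQ hk x hx hx'
      have hle := Tile.le_of hk hx.1 hx'.1 hx.2 hx'.2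
      exact Tile.le_antisymm_of_k hle ((hbad' P hP).2.2 _ ((hbad' P hP).1.trans hle) (hbad' Q hQ).2.1)
    have hd : ((bad.image H : Finset Tile) : Set Tile).PairwiseDisjoint fun Q => E ∩ Q.V N := by
      intro Q hQ Q' hQ' hne
      obtain ⟨P, hP, rfl⟩ := Finset.mem_image.1 (Finset.mem_coe.1 hQ)
      obtain ⟨P', hP', rfl⟩ := Finset.mem_image.1 (Finset.mem_coe.1 hQ')
      refine Set.disjoint_left.2 fun x hx hx' => hne ?_
      rcases le_total (H P).k (H P').k with hk | hk
      · exact key P hP P' hP' hk x hx.2 hx'.2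
      · exact (key P' hP' P hP hk x hx'.2 hx.2).symm
    rw [Finset.mul_sum]
    calc _ ≤ ∑ Q ∈ bad.image H, volume.real (E ∩ Q.V N) := by
          refine Finset.sum_le_sum fun Q hQ => ?_
          obtain ⟨P, hP, rfl⟩ := Finset.mem_image.1 hQ
          exact (hbad' P hP).2.1.le
      _ = volume.real (⋃ Q ∈ bad.image H, E ∩ Q.V N) :=
          (measureReal_biUnion_finset hd (fun Q _ => hE.inter (Q.measurableSet_V hN))
            fun Q _ => measure_ne_top_of_subset Set.inter_subset_left hE').symm
      _ ≤ _ := measureReal_mono (Set.iUnion₂_subset fun _ _ => Set.inter_subset_left) hE'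
  · intro P hP P' hle
    by_contra! hlt
    have hPb : P ∈ bad := Finset.mem_filter.2 ⟨(mem_rest.1 hP).1, P', hle, hlt⟩
    exact (mem_rest.1 hP).2 (H P) (Finset.mem_image_of_mem H hPb) (hbad' P hPb).1

/-! ### Iterating the mass and size decompositions -/

lemma exists_Λ_le_sum : ∃ C : ℝ, 0 < C ∧ ∀ (f : ℝ → ℂ), Nice f → ∀ (N : ℝ → ℝ), Measurable N →
    ∀ (E : Set ℝ) (𝔓 : Finset Tile) (σ : ℝ), 0 ≤ σ → IsSize f 𝔓 σ →
    Λ E N f 𝔓 ≤ C * σ * ∑ P ∈ 𝔓, P.r := by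
  obtain ⟨C, hC, h⟩ := exists_norm_A_le_on
  refine ⟨C, hC, fun f hf N hN E 𝔓 σ hσ hsz => ?_⟩
  have hi : ∀ P ∈ 𝔓, Integrable (P.I.indicator fun _ => C * σ) := fun P _ =>
    (integrable_indicator_iff P.measurableSet_I).2 (integrableOn_const P.volume_I_ne_top)
  have hs : Integrable fun x => ∑ P ∈ 𝔓, P.I.indicator (fun _ => C * σ) x := integrable_finsetSum _ hi
  have h0 : ∀ x, 0 ≤ ∑ P ∈ 𝔓, P.I.indicator (fun _ => C * σ) x := fun x =>
    Finset.sum_nonneg fun P _ => Set.indicator_nonneg (fun _ _ => by positivity) x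
  calc Λ E N f 𝔓 ≤ ∫ x in E, ∑ P ∈ 𝔓, P.I.indicator (fun _ => C * σ) x := by
        refine integral_mono (nice_model hN 𝔓 hf).integrable.norm.restrict hs.restrict fun x => ?_
        simp only [model_eq_sum]
        refine (norm_sum_le _ _).trans (Finset.sum_le_sum fun P hP => ?_)
        rw [norm_indicator_eq_indicator_norm]
        by_cases hx : x ∈ P.I
        · rw [Set.indicator_of_mem hx]
          refine (Set.indicator_le_self' (fun _ _ => norm_nonneg _) x).trans ?_
          exact (h P f hf x hx).trans (mul_le_mul_of_nonneg_left (γ_le_of_isSize hsz hσ hP) hC.le)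
        · rw [Set.indicator_of_notMem hx, Set.indicator_of_notMem fun hh => hx hh.1]
    _ ≤ ∫ x, ∑ P ∈ 𝔓, P.I.indicator (fun _ => C * σ) x :=
        setIntegral_le_integral hs (Filter.Eventually.of_forall h0)
    _ = _ := by
        rw [integral_finsetSum _ hi, Finset.mul_sum]
        refine Finset.sum_congr rfl fun P _ => ?_
        rw [integral_indicator_const _ P.measurableSet_I, P.volume_real_I, smul_eq_mul, mul_comm]

lemma exists_mass_step : ∃ C : ℝ, 0 < C ∧ ∀ (f : ℝ → ℂ), Nice f → ∀ (N : ℝ → ℝ), Measurable N →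
    ∀ (E : Set ℝ), MeasurableSet E → volume E ≠ ⊤ → ∀ (𝔓 : Finset Tile) (σ μ : ℝ), 0 ≤ σ → 0 < μ →
    Convx 𝔓 → IsSize f 𝔓 σ → IsMass E N 𝔓 (2 * μ) →
    ∃ 𝔓' ⊆ 𝔓, Convx 𝔓' ∧ IsMass E N 𝔓' μ ∧ Λ E N f 𝔓 ≤ C * σ * volume.real E + Λ E N f 𝔓' := by
  obtain ⟨C, hC, h⟩ := exists_forest_estimate
  refine ⟨2 * C, by positivity, fun f hf N hN E hE hE' 𝔓 σ μ hσ hμ hcv hsz hms => ?_⟩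
  obtain ⟨S, T, h1, h2⟩ := exists_mass_tops hN hE hE' hμ 𝔓
  refine ⟨_, rest_subset 𝔓 S T, hcv.rest S T, h2, ?_⟩
  have h3 := h f hf N E σ (2 * μ) hN hσ (by positivity) 𝔓 hcv hsz hms S T
  have h4 := mul_le_mul_of_nonneg_left h1 (show 0 ≤ 2 * C * σ by positivity)
  linarith

lemma exists_size_step : ∃ C : ℝ, 0 < C ∧ ∀ (f : ℝ → ℂ), Nice f → ∀ (N : ℝ → ℝ), Measurable N →
    ∀ (E : Set ℝ) (𝔓 : Finset Tile) (σ μ : ℝ), 0 < σ → 0 ≤ μ →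
    Convx 𝔓 → IsSize f 𝔓 (2 * σ) → IsMass E N 𝔓 μ →
    ∃ 𝔓' ⊆ 𝔓, Convx 𝔓' ∧ IsSize f 𝔓' σ ∧ Λ E N f 𝔓 ≤ C * (nsq f * μ / σ) + Λ E N f 𝔓' := by
  obtain ⟨C, hC, h⟩ := exists_forest_estimate
  obtain ⟨C', hC', h'⟩ := exists_energy
  refine ⟨2 * C * C', by positivity, fun f hf N hN E 𝔓 σ μ hσ hμ hcv hsz hms => ?_⟩
  obtain ⟨𝔗, h1, h2⟩ := h' f hf 𝔓 σ hσ hsz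
  refine ⟨_, rest_subset 𝔓 𝔗 id, hcv.rest 𝔗 id, h2 _ (rest_subset _ _ _) fun P hP => (mem_rest.1 hP).2, ?_⟩
  have h3 := h f hf N E (2 * σ) μ hN (by positivity) hμ 𝔓 hcv hsz hms 𝔗 id
  refine h3.trans (add_le_add_left ?_ _)
  have h4 : C * (2 * σ) * μ * ∑ i ∈ 𝔗, 2 ^ (id i).k =
      2 * C * μ / σ * (σ ^ 2 * ∑ T ∈ 𝔗, 2 ^ T.k) := by
    simp only [id]; field_simp
  rw [h4]
  calc _ ≤ 2 * C * μ / σ * (C' * nsq f) := mul_le_mul_of_nonneg_left h1 (by positivity)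
    _ = _ := by ring

lemma exists_step : ∃ C : ℝ, 0 < C ∧ ∀ (f : ℝ → ℂ), Nice f → ∀ (N : ℝ → ℝ), Measurable N →
    ∀ (E : Set ℝ), MeasurableSet E → volume E ≠ ⊤ → ∀ (𝔓 : Finset Tile) (σ μ : ℝ), 0 < σ → 0 < μ →
    Convx 𝔓 → IsSize f 𝔓 σ → IsMass E N 𝔓 μ →
    ∃ 𝔓' ⊆ 𝔓, Convx 𝔓' ∧ IsSize f 𝔓' (σ / 2) ∧ IsMass E N 𝔓' (μ / 4) ∧
      Λ E N f 𝔓 ≤ C * (nsq f * μ / σ + σ * volume.real E) + Λ E N f 𝔓' := by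
  obtain ⟨C, hC, h⟩ := exists_mass_step
  obtain ⟨C', hC', h'⟩ := exists_size_step
  refine ⟨2 * C' + C, by positivity, fun f hf N hN E hE hE' 𝔓 σ μ hσ hμ hcv hsz hms => ?_⟩
  obtain ⟨P₁, a1, a2, a3, a4⟩ := h' f hf N hN E 𝔓 (σ / 2) μ (by positivity) hμ.le hcv
    (by rwa [mul_div_cancel₀ _ two_ne_zero]) hms
  obtain ⟨P₂, b1, b2, b3, b4⟩ := h f hf N hN E hE hE' P₁ (σ / 2) (μ / 2) (by positivity)
    (by positivity) a2 a3 (by rw [mul_div_cancel₀ _ two_ne_zero]; exact hms.mono a1)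
  obtain ⟨P₃, c1, c2, c3, c4⟩ := h f hf N hN E hE hE' P₂ (σ / 2) (μ / 4) (by positivity)
    (by positivity) b2 (a3.mono b1) (by convert b3 using 1; ring)
  refine ⟨P₃, (c1.trans b1).trans a1, c2, a3.mono (c1.trans b1), c3, ?_⟩
  have e : C' * (nsq f * μ / (σ / 2)) = 2 * C' * (nsq f * μ / σ) := by field_simp
  have h1 : 0 ≤ C * (nsq f * μ / σ) := by
    have := nsq_nonneg f
    positivity
  have h2 : 0 ≤ C' * (σ * volume.real E) := by positivity
  nlinarith

lemma exists_Λ_le_of_size_mass : ∃ C : ℝ, 0 < C ∧ ∀ (f : ℝ → ℂ), Nice f → ∀ (N : ℝ → ℝ),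
    Measurable N → ∀ (E : Set ℝ), MeasurableSet E → volume E ≠ ⊤ → ∀ (𝔓 : Finset Tile) (σ μ : ℝ),
    0 < σ → 0 < μ → Convx 𝔓 → IsSize f 𝔓 σ → IsMass E N 𝔓 μ →
    Λ E N f 𝔓 ≤ C * (nsq f * μ / σ + σ * volume.real E) := by
  obtain ⟨C, hC, h⟩ := exists_step
  obtain ⟨C', hC', h'⟩ := exists_Λ_le_sum
  refine ⟨2 * C, by positivity, fun f hf N hN E hE hE' 𝔓 σ μ hσ hμ hcv hsz hms => ?_⟩
  have key : ∀ n : ℕ, ∀ (𝔓 : Finset Tile) (σ μ : ℝ), 0 < σ → 0 < μ → Convx 𝔓 → IsSize f 𝔓 σ →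
      IsMass E N 𝔓 μ → Λ E N f 𝔓 ≤ 2 * C * (nsq f * μ / σ + σ * volume.real E) +
        C' * σ * (∑ P ∈ 𝔓, P.r) * (1 / 2) ^ n := by
    intro n
    have hD := nsq_nonneg f
    induction n with
    | zero =>
      intro 𝔓 σ μ hσ hμ hcv hsz hms
      have h1 := h' f hf N hN E 𝔓 σ hσ.le hsz
      have h2 : 0 ≤ 2 * C * (nsq f * μ / σ + σ * volume.real E) := by positivity
      rw [pow_zero, mul_one]
      linarith
    | succ n ih =>
      intro 𝔓 σ μ hσ hμ hcv hsz hms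
      obtain ⟨𝔓', h1, h2, h3, h4, h5⟩ := h f hf N hN E hE hE' 𝔓 σ μ hσ hμ hcv hsz hms
      have h6 := ih 𝔓' (σ / 2) (μ / 4) (by positivity) (by positivity) h2 h3 h4
      have h7 : ∑ P ∈ 𝔓', P.r ≤ ∑ P ∈ 𝔓, P.r :=
        Finset.sum_le_sum_of_subset_of_nonneg h1 fun P _ _ => P.r_pos.le
      have h8 := mul_le_mul_of_nonneg_left h7 (show 0 ≤ C' * (σ / 2) * (1 / 2) ^ n by positivity)
      have e : nsq f * (μ / 4) / (σ / 2) = nsq f * μ / σ / 2 := by field_simp; norm_num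
      rw [e] at h6
      rw [pow_succ]
      linarith
  have hl : Filter.Tendsto (fun n : ℕ => 2 * C * (nsq f * μ / σ + σ * volume.real E) +
        C' * σ * (∑ P ∈ 𝔓, P.r) * (1 / 2) ^ n) Filter.atTop
        (nhds (2 * C * (nsq f * μ / σ + σ * volume.real E) + C' * σ * (∑ P ∈ 𝔓, P.r) * 0)) :=
    ((tendsto_pow_atTop_nhds_zero_of_lt_one (by norm_num) (by norm_num)).const_mul _).const_add _
  rw [mul_zero, add_zero] at hl
  exact ge_of_tendsto' hl fun n => key n 𝔓 σ μ hσ hμ hcv hsz hms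

lemma isMass_one {N : ℝ → ℝ} (E : Set ℝ) (𝔓 : Finset Tile) : IsMass E N 𝔓 1 := by
  intro P _ P' _
  rw [one_mul, ← P'.volume_real_I]
  exact measureReal_mono (Set.inter_subset_right.trans P'.V_subset) P'.volume_I_ne_top

/-- The main estimate for families of good tiles. -/
lemma exists_Λ_le_of_good : ∃ C : ℝ, 0 < C ∧ ∀ (f : ℝ → ℂ), Nice f → ∀ (N : ℝ → ℝ),
    Measurable N → ∀ (E : Set ℝ), MeasurableSet E → volume E ≠ ⊤ → ∀ (𝔓 : Finset Tile) (L : ℝ) (j : ℕ),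
    0 < L → Convx 𝔓 → (∀ P ∈ 𝔓, Good L f P) → nsq f ≤ 2 ^ j * L ^ 2 * volume.real E →
    Λ E N f 𝔓 ≤ C * (j + 1) * L * volume.real E := by
  obtain ⟨C₁, hC₁, h₁⟩ := exists_isSize_of_good
  obtain ⟨C₂, hC₂, h₂⟩ := exists_mass_step
  obtain ⟨C₃, hC₃, h₃⟩ := exists_Λ_le_of_size_mass
  refine ⟨C₂ * C₁ + C₃ * (C₁⁻¹ + C₁), by positivity, fun f hf N hN E hE hE' 𝔓 L j hL hcv hg hD => ?_⟩
  have hsz := h₁ f hf 𝔓 L hL.le hg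
  have key : ∀ i : ℕ, ∃ 𝔓' ⊆ 𝔓, Convx 𝔓' ∧ IsMass E N 𝔓' (1 / 2 ^ i) ∧
      Λ E N f 𝔓 ≤ i * (C₂ * (C₁ * L) * volume.real E) + Λ E N f 𝔓' := by
    intro i
    induction i with
    | zero => exact ⟨𝔓, subset_rfl, hcv, by simpa using isMass_one E 𝔓, by simp⟩
    | succ i ih =>
      obtain ⟨P₁, a1, a2, a3, a4⟩ := ih
      obtain ⟨P₂, b1, b2, b3, b4⟩ := h₂ f hf N hN E hE hE' P₁ (C₁ * L) (1 / 2 ^ (i + 1))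
        (by positivity) (by positivity) a2 (hsz.mono a1) (by convert a3 using 1; field_simp; ring)
      refine ⟨P₂, b1.trans a1, b2, b3, ?_⟩
      push_cast
      linarith
  obtain ⟨P₁, a1, a2, a3, a4⟩ := key j
  have h4 := h₃ f hf N hN E hE hE' P₁ (C₁ * L) (1 / 2 ^ j) (by positivity) (by positivity) a2
    (hsz.mono a1) a3
  have h5 : nsq f * (1 / 2 ^ j) / (C₁ * L) ≤ C₁⁻¹ * (L * volume.real E) := by
    rw [div_le_iff₀ (by positivity), mul_one_div, div_le_iff₀ (by positivity)]
    calc _ ≤ _ := hD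
      _ = _ := by field_simp
  have h6 := mul_le_mul_of_nonneg_left h5 hC₃.le
  have h7 : 0 ≤ L * volume.real E := by positivity
  have h8 : 0 ≤ C₂ * C₁ * (L * volume.real E) := by positivity
  have h9 : 0 ≤ j * (C₃ * (C₁⁻¹ + C₁) * (L * volume.real E)) := by positivity
  nlinarith

/-! ### Restricted weak type estimates -/

/-- The set where the centred maximal function exceeds `L`. -/
def bigMax (L : ℝ) (f : ℝ → ℂ) : Set ℝ := {x | ∃ R > 0, L * R < ∫ y in Metric.ball x R, ‖f y‖}

lemma volume_bigMax_le {f : ℝ → ℂ} (hf : Nice f) {L : ℝ} (hL : 0 < L) :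
    volume (bigMax L f) ≤ ENNReal.ofReal (8 / L * ∫ y, ‖f y‖) := by
  have hex : ∀ x, ∃ R : ℝ, x ∈ bigMax L f → 0 < R ∧ L * R < ∫ y in Metric.ball x R, ‖f y‖ := by
    intro x
    by_cases h : x ∈ bigMax L f
    · obtain ⟨R, h1, h2⟩ := h; exact ⟨R, fun _ => ⟨h1, h2⟩⟩
    · exact ⟨0, fun h' => absurd h' h⟩
  choose R hR using hex
  have hfi := hf.integrable.norm
  have hb : ∀ x ∈ bigMax L f, R x ≤ (∫ y, ‖f y‖) / L := by
    intro x hx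
    rw [le_div_iff₀ hL, mul_comm]
    exact (hR x hx).2.le.trans (setIntegral_le_integral hfi
      (Filter.Eventually.of_forall fun _ => norm_nonneg _))
  obtain ⟨u, hu, hd, hc⟩ := Vitali.exists_disjoint_subfamily_covering_enlargement_closedBall
    (bigMax L f) id R _ hb 4 (by norm_num)
  have hcount : u.Countable := hd.countable_of_nonempty_interior fun x hx =>
    ⟨x, by
      rw [id, interior_closedBall _ (hR x (hu hx)).1.ne']
      exact Metric.mem_ball_self (hR x (hu hx)).1⟩
  have hcov : bigMax L f ⊆ ⋃ x ∈ u, Metric.closedBall x (4 * R x) := by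
    intro x hx
    obtain ⟨y, hy, hxy⟩ := hc x hx
    exact Set.mem_biUnion hy (hxy (Metric.mem_closedBall_self (hR x hx).1.le))
  have : Countable u := hcount
  calc volume (bigMax L f) ≤ ∑' x : u, volume (Metric.closedBall (x : ℝ) (4 * R x)) :=
        (measure_mono hcov).trans (measure_biUnion_le _ hcount _)
    _ ≤ ∑' x : u, ENNReal.ofReal (8 / L) * ∫⁻ y in Metric.closedBall (x : ℝ) (R x), ‖f y‖ₑ := by
        refine ENNReal.tsum_le_tsum fun x => ?_
        obtain ⟨h1, h2⟩ := hR x (hu x.2)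
        have h3 : L * R x ≤ ∫ y in Metric.closedBall (x : ℝ) (R x), ‖f y‖ :=
          h2.le.trans (setIntegral_mono_set hfi.integrableOn
            (Filter.Eventually.of_forall fun _ => norm_nonneg _)
            Metric.ball_subset_closedBall.eventuallyLE)
        rw [Real.volume_closedBall, ← ofReal_integral_norm_eq_lintegral_enorm hf.integrable.integrableOn,
          ← ENNReal.ofReal_mul (by positivity)]
        refine ENNReal.ofReal_le_ofReal ?_
        calc 2 * (4 * R x) = 8 / L * (L * R x) := by field_simp; norm_num
          _ ≤ _ := by gcongr
    _ = ENNReal.ofReal (8 / L) * ∫⁻ y in ⋃ x ∈ u, Metric.closedBall x (R x), ‖f y‖ₑ := by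
        rw [ENNReal.tsum_mul_left, lintegral_biUnion (s := fun x => Metric.closedBall x (R x)) hcount
          (fun x _ => Metric.isClosed_closedBall.measurableSet) hd]
    _ ≤ ENNReal.ofReal (8 / L) * ∫⁻ y, ‖f y‖ₑ := by
        gcongr
        exact Measure.restrict_le_self
    _ = _ := by
        rw [← ofReal_integral_norm_eq_lintegral_enorm hf.integrable, ← ENNReal.ofReal_mul (by positivity)]

lemma Good.of_le {L : ℝ} {f : ℝ → ℂ} {P P' : Tile} (h : Good L f P) (hle : P.le P') : Good L f P' := by
  obtain ⟨x, hx, h⟩ := h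
  exact ⟨x, hle.1.subset hx, h⟩

lemma subset_bigMax {L : ℝ} {f : ℝ → ℂ} {P : Tile} (h : ¬ Good L f P) : P.I ⊆ bigMax L f := by
  intro x hx
  by_contra hn
  refine h ⟨x, hx, fun R hR => ?_⟩
  by_contra! hlt
  exact hn ⟨R, hR, hlt⟩

lemma pow_four_le (j : ℕ) : ((j : ℝ) + 1) ^ 4 ≤ 41 * 2 ^ j := by
  rcases lt_or_ge j 5 with h | h
  · interval_cases j <;> norm_num
  · induction j, h using Nat.le_induction with
    | base => norm_num
    | succ j hj ih =>
      have h5 : (5:ℝ) ≤ j := by exact_mod_cast hj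
      have h1 : ((j : ℝ) + 1 + 1) ≤ 7 / 6 * (j + 1) := by linarith
      push_cast
      calc ((j : ℝ) + 1 + 1) ^ 4 ≤ (7 / 6 * (j + 1)) ^ 4 := by gcongr
        _ ≤ 2 * ((j : ℝ) + 1) ^ 4 := by
            rw [mul_pow]; gcongr; norm_num
        _ ≤ _ := by rw [pow_succ (2:ℝ)]; linarith

lemma exists_pow_two_ge {s : ℝ} (hs : 1 ≤ s) : ∃ j : ℕ, s ≤ 2 ^ j ∧ (2:ℝ) ^ j ≤ 2 * s := by
  obtain ⟨n, h1, h2⟩ := exists_nat_pow_near hs one_lt_two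
  exact ⟨n + 1, h2.le, by rw [pow_succ]; linarith⟩

lemma nsq_le_of_le_one {f : ℝ → ℂ} (hf : Nice f) (h1 : ∀ x, ‖f x‖ ≤ 1) : nsq f ≤ ∫ x, ‖f x‖ := by
  refine integral_mono hf.integrable_sq hf.integrable.norm fun x => ?_
  have := h1 x
  have := norm_nonneg (f x)
  simp only
  nlinarith

lemma mul_volume_le_Λ {E : Set ℝ} {N : ℝ → ℝ} (hN : Measurable N) (hE : MeasurableSet E)
    (hE' : volume E ≠ ⊤) {f : ℝ → ℂ} (hf : Nice f) {𝔓 : Finset Tile} {t : ℝ}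
    (h : ∀ x ∈ E, t ≤ ‖model N 𝔓 f x‖) : t * volume.real E ≤ Λ E N f 𝔓 := by
  have h1 : ∫ _ in E, t = t * volume.real E := by
    rw [setIntegral_const, smul_eq_mul, mul_comm]
  rw [← h1]
  exact setIntegral_mono_on (integrableOn_const hE') (nice_model hN 𝔓 hf).integrable.norm.integrableOn
    hE h

lemma exists_restricted_weak : ∃ C : ℝ, 0 < C ∧ ∀ (f : ℝ → ℂ), Nice f → (∀ x, ‖f x‖ ≤ 1) →
    ∀ (N : ℝ → ℝ), Measurable N → ∀ (𝔓 : Finset Tile), Convx 𝔓 → ∀ v > 0, ∫ x, ‖f x‖ ≤ v →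
    ∀ t > 0, t ^ 4 * volume.real {x | t < ‖model N 𝔓 f x‖} ≤ C * v ∧
      t ^ 4 * volume.real {x | t < ‖model N 𝔓 f x‖} ^ 3 ≤ C * v ^ 3 := by
  classical
  obtain ⟨C, hC, h⟩ := exists_Λ_le_of_good
  refine ⟨82 * (16 * C) ^ 4, by positivity, fun f hf hf1 N hN 𝔓 hcv v hv hfv t ht => ?_⟩
  set E := {x | t < ‖model N 𝔓 f x‖} with hEdef
  have hm := nice_model hN 𝔓 hf
  have hmeas : Measurable (model N 𝔓 f) := by
    rw [model_eq_sum]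
    exact Finset.measurable_sum _ fun P _ => (continuous_op P.sym_psi hf.integrable).measurable.indicator
      (P.measurableSet_I.inter (P.measurableSet_om2 hN))
  have hE : MeasurableSet E := measurableSet_lt measurable_const hmeas.norm
  have hE' : volume E ≠ ⊤ := (hm.integrable.measure_norm_gt_lt_top ht).ne
  set e := volume.real E with he
  have he0 : 0 ≤ e := measureReal_nonneg
  have hD := (nsq_le_of_le_one hf hf1).trans hfv
  rcases he0.eq_or_lt with h0 | hepos
  · rw [← h0]; simp only [mul_zero, ne_eq, OfNat.ofNat_ne_zero, not_false_eq_true, zero_pow]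
    constructor <;> positivity
  rcases le_or_gt e v with hev | hev
  · have key : t ^ 4 * e ≤ 82 * (16 * C) ^ 4 * v := by
      obtain ⟨j, hj1, hj2⟩ := exists_pow_two_ge (s := v / e) (by rwa [one_le_div₀ hepos])
      rw [div_le_iff₀ hepos] at hj1
      have h1 := h f hf N hN E hE hE' 𝔓 2 j two_pos hcv (fun P _ => ⟨P.c, P.c_mem_I, fun R hR => ?_⟩)
        (by nlinarith)
      · have h2 := (mul_volume_le_Λ hN hE hE' hf fun x hx => (show t < _ from hx).le).trans h1
        have h3 : t ≤ 2 * C * (j + 1) := by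
          rw [← he] at h2
          nlinarith
        calc t ^ 4 * e ≤ (2 * C * (j + 1)) ^ 4 * e := by gcongr
          _ = (2 * C) ^ 4 * (((j:ℝ) + 1) ^ 4 * e) := by ring
          _ ≤ (2 * C) ^ 4 * (41 * (2 * (v / e)) * e) := by
              gcongr
              exact (pow_four_le j).trans (by gcongr)
          _ = (2 * C) ^ 4 * 82 * v := by field_simp; norm_num
          _ ≤ (16 * C) ^ 4 * 82 * v := by gcongr; norm_num
          _ = _ := by ring
      · have h4 : ∫ _ in Metric.ball P.c R, (1:ℝ) = 2 * R := by
          rw [setIntegral_const, smul_eq_mul, mul_one, Measure.real, Real.volume_ball,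
            ENNReal.toReal_ofReal (by positivity)]
        rw [← h4]
        exact integral_mono hf.integrable.norm.restrict
          (integrableOn_const (by rw [Real.volume_ball]; exact ENNReal.ofReal_ne_top)) hf1
    refine ⟨key, ?_⟩
    calc t ^ 4 * e ^ 3 = t ^ 4 * e * e ^ 2 := by ring
      _ ≤ 82 * (16 * C) ^ 4 * v * v ^ 2 := by gcongr
      _ = _ := by ring
  · have key : t ^ 4 * e ^ 3 ≤ 82 * (16 * C) ^ 4 * v ^ 3 := by
      set L := 16 * v / e with hL
      have hLpos : 0 < L := by positivity
      set bad := 𝔓.filter fun P => ¬ Good L f P with hbad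
      set U := ⋃ P ∈ bad, P.I with hU
      have hUm : MeasurableSet U := measurableSet_biUnion_I _
      have hUb : U ⊆ bigMax L f :=
        Set.iUnion₂_subset fun P hP => subset_bigMax (Finset.mem_filter.1 hP).2
      have hUv : volume.real U ≤ e / 2 := by
        refine ENNReal.toReal_le_of_le_ofReal (by positivity) ?_
        refine ((measure_mono hUb).trans (volume_bigMax_le hf hLpos)).trans
          (ENNReal.ofReal_le_ofReal ?_)
        calc 8 / L * ∫ y, ‖f y‖ ≤ 8 / L * v := by gcongr
          _ = e / 2 := by rw [hL]; field_simp; norm_num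
      have hE2 : volume (E \ U) ≠ ⊤ := measure_ne_top_of_subset Set.sdiff_subset hE'
      have he2 : e / 2 ≤ volume.real (E \ U) := by
        have h1 : e ≤ volume.real (E \ U) + volume.real U := by
          rw [he]
          refine (measureReal_mono (s₂ := (E \ U) ∪ U) (by simp) ?_).trans (measureReal_union_le _ _)
          exact measure_union_ne_top hE2 (measure_ne_top_of_subset hUb
            ((volume_bigMax_le hf hLpos).trans_lt ENNReal.ofReal_lt_top).ne)
        linarith
      set 𝔓' := 𝔓.filter fun P => Good L f P with h𝔓'
      have hcv' : Convx 𝔓' := by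
        intro P hP P'' hP'' P' h1 h2
        rw [h𝔓', Finset.mem_filter] at *
        exact ⟨hcv P hP.1 P'' hP''.1 P' h1 h2, hP.2.of_le h1⟩
      have hmod : ∀ x ∈ E \ U, model N 𝔓' f x = model N 𝔓 f x := by
        intro x hx
        simp only [model_eq_sum]
        refine Finset.sum_subset (Finset.filter_subset _ _) fun P hP hP' => ?_
        refine Set.indicator_of_notMem (fun hh => hx.2 ?_) _
        exact Set.mem_biUnion (Finset.mem_filter.2 ⟨hP, fun hg => hP' (Finset.mem_filter.2 ⟨hP, hg⟩)⟩)
          hh.1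
      obtain ⟨j, hj1, hj2⟩ := exists_pow_two_ge (s := e / v) (by rw [one_le_div₀ hv]; exact hev.le)
      have h1 := h f hf N hN (E \ U) (hE.diff hUm) hE2 𝔓' L j hLpos hcv'
        (fun P hP => (Finset.mem_filter.1 hP).2) (hD.trans ?_)
      · have h2 := (mul_volume_le_Λ hN (hE.diff hUm) hE2 hf fun x hx => by
          rw [hmod x hx]; exact (show t < _ from hx.1).le).trans h1
        have h3 : t ≤ C * (j + 1) * L := by
          have : 0 < volume.real (E \ U) := by linarith
          nlinarith
        calc t ^ 4 * e ^ 3 ≤ (C * (j + 1) * L) ^ 4 * e ^ 3 := by gcongr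
          _ = (C * L) ^ 4 * (((j:ℝ) + 1) ^ 4 * e ^ 3) := by ring
          _ ≤ (C * L) ^ 4 * (41 * (2 * (e / v)) * e ^ 3) := by
              gcongr
              exact (pow_four_le j).trans (by gcongr)
          _ = _ := by rw [hL]; field_simp; norm_num
      · calc v ≤ e / v * (16 * v / e) ^ 2 * (e / 2) := by
              have : e / v * (16 * v / e) ^ 2 * (e / 2) = 128 * v := by field_simp; norm_num
              rw [this]; linarith
          _ ≤ _ := by gcongr
    refine ⟨?_, key⟩
    have h1 : t ^ 4 * e * v ^ 2 ≤ 82 * (16 * C) ^ 4 * v * v ^ 2 := by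
      calc t ^ 4 * e * v ^ 2 ≤ t ^ 4 * e * e ^ 2 := by gcongr
        _ = t ^ 4 * e ^ 3 := by ring
        _ ≤ _ := key
        _ = _ := by ring
    exact le_of_mul_le_mul_right h1 (by positivity)

/-! ### The strong `L²` bound for the model operator -/

/-- Distributional estimates at two exponents give a strong bound in between. -/
lemma exists_lintegral_rpow_le {p : ℝ} (h1 : 4 / 3 < p) (h2 : p < 4) : ∃ K : ℝ, 0 < K ∧
    ∀ (u : ℝ → ℝ), Measurable u → (∀ x, 0 ≤ u x) → ∀ V : ℝ, 0 ≤ V →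
      (∀ t > 0, volume {x | t < u x} ≠ ⊤ ∧ t ^ 4 * volume.real {x | t < u x} ≤ V ∧
        t ^ 4 * volume.real {x | t < u x} ^ 3 ≤ V ^ 3) →
      ∫⁻ x, ENNReal.ofReal (u x ^ p) ≤ ENNReal.ofReal (K * V) := by
  have i1 : IntegrableOn (fun t : ℝ => t ^ (p - 7 / 3)) (Set.Ioc 0 1) :=
    (intervalIntegrable_iff_integrableOn_Ioc_of_le zero_le_one).1
      (intervalIntegral.intervalIntegrable_rpow' (by linarith))
  have i2 : IntegrableOn (fun t : ℝ => t ^ (p - 5)) (Set.Ioi 1) :=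
    integrableOn_Ioi_rpow_of_lt (by linarith) one_pos
  set a := ∫ t in Set.Ioc (0:ℝ) 1, t ^ (p - 7 / 3) with ha
  set b := ∫ t in Set.Ioi (1:ℝ), t ^ (p - 5) with hb
  have ha0 : 0 ≤ a := setIntegral_nonneg measurableSet_Ioc fun t ht => Real.rpow_nonneg ht.1.le _
  have hb0 : 0 ≤ b := setIntegral_nonneg measurableSet_Ioi fun t ht =>
    Real.rpow_nonneg (zero_le_one.trans (le_of_lt ht)) _
  have hp : 0 < p := by linarith
  refine ⟨p * (a + b) + 1, by positivity, fun u hu hu0 V hV h => ?_⟩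
  rw [lintegral_rpow_eq_lintegral_meas_lt_mul _ (Filter.Eventually.of_forall hu0) hu.aemeasurable hp,
    ← Set.Ioc_union_Ioi_eq_Ioi zero_le_one,
    lintegral_union measurableSet_Ioi (Set.Ioc_disjoint_Ioi le_rfl)]
  have A : ∫⁻ t in Set.Ioc (0:ℝ) 1, volume {x | t < u x} * ENNReal.ofReal (t ^ (p - 1)) ≤
      ENNReal.ofReal (V * a) := by
    rw [ha, ← integral_const_mul, ofReal_integral_eq_lintegral_ofReal (i1.const_mul V)
      ((ae_restrict_iff' measurableSet_Ioc).2 (Filter.Eventually.of_forall fun t ht =>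
        mul_nonneg hV (Real.rpow_nonneg ht.1.le _)))]
    refine setLIntegral_mono (by fun_prop) fun t ht => ?_
    obtain ⟨hf, -, h3⟩ := h t ht.1
    have ht0 := ht.1
    rw [← ENNReal.ofReal_toReal hf, ← ENNReal.ofReal_mul ENNReal.toReal_nonneg]
    refine ENNReal.ofReal_le_ofReal ?_
    have : volume.real {x | t < u x} ≤ V * t ^ (-(4 / 3) : ℝ) := by
      rw [← pow_le_pow_iff_left₀ measureReal_nonneg (by positivity) three_ne_zero, mul_pow,
        ← Real.rpow_natCast (t ^ (-(4 / 3) : ℝ)), ← Real.rpow_mul ht0.le,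
        show (-(4 / 3) : ℝ) * (3 : ℕ) = -(4 : ℕ) by norm_num, Real.rpow_neg ht0.le,
        Real.rpow_natCast, ← div_eq_mul_inv, le_div_iff₀ (by positivity), mul_comm]
      exact h3
    calc volume.real {x | t < u x} * t ^ (p - 1) ≤ V * t ^ (-(4 / 3) : ℝ) * t ^ (p - 1) := by gcongr
      _ = _ := by rw [mul_assoc, ← Real.rpow_add ht0]; congr 2; ring
  have B : ∫⁻ t in Set.Ioi (1:ℝ), volume {x | t < u x} * ENNReal.ofReal (t ^ (p - 1)) ≤
      ENNReal.ofReal (V * b) := by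
    rw [hb, ← integral_const_mul, ofReal_integral_eq_lintegral_ofReal (i2.const_mul V)
      ((ae_restrict_iff' measurableSet_Ioi).2 (Filter.Eventually.of_forall fun t ht =>
        mul_nonneg hV (Real.rpow_nonneg (zero_le_one.trans (le_of_lt ht)) _)))]
    refine setLIntegral_mono (by fun_prop) fun t ht => ?_
    have ht0 : 0 < t := zero_lt_one.trans ht
    obtain ⟨hf, h3, -⟩ := h t ht0
    rw [← ENNReal.ofReal_toReal hf, ← ENNReal.ofReal_mul ENNReal.toReal_nonneg]
    refine ENNReal.ofReal_le_ofReal ?_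
    have : volume.real {x | t < u x} ≤ V * t ^ (-(4 : ℝ)) := by
      rw [Real.rpow_neg ht0.le, ← div_eq_mul_inv, le_div_iff₀ (by positivity), mul_comm]
      exact_mod_cast h3
    calc volume.real {x | t < u x} * t ^ (p - 1) ≤ V * t ^ (-(4 : ℝ)) * t ^ (p - 1) := by gcongr
      _ = _ := by rw [mul_assoc, ← Real.rpow_add ht0]; congr 2; ring
  calc _ ≤ ENNReal.ofReal p * (ENNReal.ofReal (V * a) + ENNReal.ofReal (V * b)) := by gcongr
    _ = ENNReal.ofReal (p * (a + b) * V) := by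
        rw [← ENNReal.ofReal_add (by positivity) (by positivity), ← ENNReal.ofReal_mul hp.le]
        congr 1; ring
    _ ≤ _ := ENNReal.ofReal_le_ofReal (by nlinarith)

/-- The substitute for `u²` interpolating between two exponents. -/
noncomputable def mid (u : ℝ) : ℝ := u ^ (3 : ℝ) + u ^ (3 / 2 : ℝ)

lemma mid_nonneg {u : ℝ} (hu : 0 ≤ u) : 0 ≤ mid u := by unfold mid; positivity

lemma mul_le_mid {u v : ℝ} (hu : 0 ≤ u) (hv : 0 ≤ v) {j k : ℤ} (h : j ≤ k) :
    8 ^ j * u * (8 ^ k * v) ≤ 2 ^ j / 2 ^ k * (64 ^ j * mid u + 64 ^ k * mid v) := by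
  obtain ⟨d, rfl⟩ := Int.le.dest h
  obtain ⟨w, hw, rfl⟩ : ∃ w : ℝ, 0 ≤ w ∧ v = w ^ 2 := ⟨√v, Real.sqrt_nonneg _, (Real.sq_sqrt hv).symm⟩
  have e1 : (w ^ 2) ^ (3 / 2 : ℝ) = w ^ 3 := by
    rw [← Real.rpow_natCast w 2, ← Real.rpow_mul hw, ← Real.rpow_natCast]; norm_num
  have e2 : w ^ 3 ≤ mid (w ^ 2) := by
    rw [← e1, mid]; exact le_add_of_nonneg_left (by positivity)
  have e3 : u ^ 3 ≤ mid u := by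
    rw [mid]; refine le_add_of_le_of_nonneg ?_ (by positivity)
    exact_mod_cast le_rfl
  have key : ∀ x y : ℝ, 0 ≤ x → 0 ≤ y → x * y ^ 2 ≤ x ^ 3 + y ^ 3 := by
    intro x y hx hy
    rcases le_total x y with h | h
    · nlinarith [mul_le_mul_of_nonneg_right h (sq_nonneg y), pow_nonneg hx 3]
    · have : y ^ 2 ≤ x ^ 2 := by gcongr
      nlinarith [mul_le_mul_of_nonneg_left this hx, pow_nonneg hy 3]
  have h8 : ∀ i : ℤ, (8:ℝ) ^ i * 8 ^ i = 64 ^ i := fun i => by rw [← mul_zpow]; norm_num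
  have h64 : (64:ℝ) ^ (j + d) = 64 ^ j * 64 ^ d := by
    rw [zpow_add₀ (by norm_num), zpow_natCast]
  calc 8 ^ j * u * (8 ^ (j + d) * w ^ 2) = 64 ^ j * (1 / 2 ^ d * (u * (4 ^ d * w) ^ 2)) := by
        rw [zpow_add₀ (by norm_num), zpow_natCast, ← h8,
          show (8:ℝ) = 2 * 4 by norm_num, mul_pow (2:ℝ) 4 d]
        have : (4:ℝ) ^ d = 2 ^ d * 2 ^ d := by rw [← mul_pow]; norm_num
        rw [this]; field_simp
    _ ≤ 64 ^ j * (1 / 2 ^ d * (u ^ 3 + (4 ^ d * w) ^ 3)) := by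
        gcongr
        exact key _ _ hu (by positivity)
    _ = 1 / 2 ^ d * (64 ^ j * u ^ 3 + 64 ^ (j + d) * w ^ 3) := by
        rw [h64, show (64:ℝ) = 4 ^ 3 by norm_num, ← pow_mul, mul_comm 3 d, pow_mul]; ring
    _ ≤ 1 / 2 ^ d * (64 ^ j * mid u + 64 ^ (j + d) * mid (w ^ 2)) := by gcongr
    _ = _ := by
        congr 1
        rw [zpow_add₀ (by norm_num), zpow_natCast]
        have := two_zpow_pos j
        field_simp

lemma sq_sum_le_mid (S : Finset ℤ) {u : ℤ → ℝ} (hu : ∀ j, 0 ≤ u j) :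
    (∑ j ∈ S, 8 ^ j * u j) ^ 2 ≤ 8 * ∑ j ∈ S, 64 ^ j * mid (u j) := by
  have a0 : ∀ j : ℤ, 0 ≤ 64 ^ j * mid (u j) := fun j => mul_nonneg (by positivity) (mid_nonneg (hu j))
  have h : ∀ j k : ℤ, 8 ^ j * u j * (8 ^ k * u k) ≤
      min (2 ^ k / 2 ^ j) (2 ^ j / 2 ^ k) * (64 ^ j * mid (u j)) +
      min (2 ^ j / 2 ^ k) (2 ^ k / 2 ^ j) * (64 ^ k * mid (u k)) := by
    intro j k
    rcases le_total j k with hjk | hjk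
    · have hz : (2:ℝ) ^ j ≤ 2 ^ k := zpow_le_zpow_right₀ (by norm_num) hjk
      have := two_zpow_pos j
      have hm : (2:ℝ) ^ j / 2 ^ k ≤ 2 ^ k / 2 ^ j := by gcongr
      rw [min_eq_right hm, min_eq_left hm, ← mul_add]
      exact mul_le_mid (hu j) (hu k) hjk
    · have hz : (2:ℝ) ^ k ≤ 2 ^ j := zpow_le_zpow_right₀ (by norm_num) hjk
      have := two_zpow_pos k
      have hm : (2:ℝ) ^ k / 2 ^ j ≤ 2 ^ j / 2 ^ k := by gcongr
      rw [min_eq_left hm, min_eq_right hm, ← mul_add, mul_comm (8 ^ j * u j), add_comm]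
      exact mul_le_mid (hu k) (hu j) hjk
  have h2 : ∑ j ∈ S, ∑ k ∈ S, min (2 ^ k / 2 ^ j) (2 ^ j / 2 ^ k) * (64 ^ j * mid (u j)) ≤
      4 * ∑ j ∈ S, 64 ^ j * mid (u j) := by
    rw [Finset.mul_sum]
    refine Finset.sum_le_sum fun j _ => ?_
    rw [← Finset.sum_mul]
    exact mul_le_mul_of_nonneg_right (sum_min_zpow_le S (two_zpow_pos j)) (a0 j)
  rw [sq, Finset.sum_mul_sum]
  refine (Finset.sum_le_sum fun j _ => Finset.sum_le_sum fun k _ => h j k).trans ?_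
  simp only [Finset.sum_add_distrib]
  rw [Finset.sum_comm (f := fun j k => min ((2:ℝ) ^ j / 2 ^ k) (2 ^ k / 2 ^ j) * (64 ^ k * mid (u k)))]
  linarith

lemma model_sum {ι : Type*} {s : Finset ι} {F : ι → ℝ → ℂ} (h : ∀ i ∈ s, Nice (F i)) (N : ℝ → ℝ)
    (𝔓 : Finset Tile) (x : ℝ) :
    model N 𝔓 (fun x => ∑ i ∈ s, F i x) x = ∑ i ∈ s, model N 𝔓 (F i) x := by
  simp only [model]
  rw [Finset.sum_comm]
  refine Finset.sum_congr rfl fun P _ => ?_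
  exact congrFun (op_sum P.sym_psi h) x

lemma model_const_mul (f : ℝ → ℂ) (c : ℂ) (N : ℝ → ℝ) (𝔓 : Finset Tile) (x : ℝ) :
    model N 𝔓 (fun x => c * f x) x = c * model N 𝔓 f x := by
  simp only [model, Finset.mul_sum]
  refine Finset.sum_congr rfl fun P _ => ?_
  exact congrFun (op_const_mul _ f c) x

lemma measurable_model {f : ℝ → ℂ} (hf : Nice f) {N : ℝ → ℝ} (hN : Measurable N) (𝔓 : Finset Tile) :
    Measurable (model N 𝔓 f) := by
  rw [model_eq_sum]
  exact Finset.measurable_sum _ fun P _ => (continuous_op P.sym_psi hf.integrable).measurable.indicator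
    (P.measurableSet_I.inter (P.measurableSet_om2 hN))

lemma norm_op_le_of_bound {φ : ℝ → ℂ} (h : Sym φ) {f : ℝ → ℂ} {ε : ℝ} (hf : ∀ x, ‖f x‖ ≤ ε) (x : ℝ) :
    ‖op φ f x‖ ≤ (∫ z, ‖ker φ z‖) * ε := by
  have hi : Integrable fun y => ‖ker φ (x - y)‖ * ε :=
    ((integrable_ker h).comp_sub_left x).norm.mul_const ε
  refine (norm_integral_le_of_norm_le hi (Filter.Eventually.of_forall fun y => ?_)).trans ?_
  · rw [norm_mul]; gcongr; exact hf y
  · rw [integral_mul_const, integral_sub_left_eq_self (fun z => ‖ker φ z‖)]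

lemma norm_model_le_of_bound (𝔓 : Finset Tile) {f : ℝ → ℂ} {ε : ℝ} (hε : 0 ≤ ε)
    (hf : ∀ x, ‖f x‖ ≤ ε) (N : ℝ → ℝ) (x : ℝ) :
    ‖model N 𝔓 f x‖ ≤ (∑ P ∈ 𝔓, ∫ z, ‖ker (sc psi P.r P.m) z‖) * ε := by
  classical
  rw [Finset.sum_mul]
  refine (norm_sum_le _ _).trans ((Finset.sum_le_sum fun P _ =>
    norm_op_le_of_bound P.sym_psi hf x).trans ?_)
  refine Finset.sum_le_sum_of_subset_of_nonneg (fun P hP => (mem_act.1 hP).1) fun P _ _ => ?_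
  exact mul_nonneg (integral_nonneg fun _ => norm_nonneg _) hε

lemma lintegral_le_of_tendsto {α : Type*} [MeasurableSpace α] {μ : Measure α} {F : ℕ → α → ℝ≥0∞}
    {f : α → ℝ≥0∞} (hF : ∀ n, Measurable (F n))
    (h : ∀ x, Filter.Tendsto (fun n => F n x) Filter.atTop (nhds (f x))) {B : ℝ≥0∞}
    (hB : ∀ n, ∫⁻ x, F n x ∂μ ≤ B) : ∫⁻ x, f x ∂μ ≤ B := by
  calc ∫⁻ x, f x ∂μ = ∫⁻ x, Filter.liminf (fun n => F n x) Filter.atTop ∂μ := by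
        simp_rw [fun x => (h x).liminf_eq]
    _ ≤ Filter.liminf (fun n => ∫⁻ x, F n x ∂μ) Filter.atTop := lintegral_liminf_le hF
    _ ≤ Filter.liminf (fun _ : ℕ => B) Filter.atTop :=
        Filter.liminf_le_liminf (Filter.Eventually.of_forall hB)
    _ = B := by simp

/-- The layer of `f` at height about `8 ^ j`. -/
def layer (f : ℝ → ℂ) (j : ℤ) : Set ℝ := {x | (8:ℝ) ^ (j - 1) < ‖f x‖ ∧ ‖f x‖ ≤ 8 ^ j}

lemma measurableSet_layer {f : ℝ → ℂ} (hf : Measurable f) (j : ℤ) : MeasurableSet (layer f j) :=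
  (measurableSet_lt measurable_const hf.norm).inter (measurableSet_le hf.norm measurable_const)

lemma layer_unique {f : ℝ → ℂ} {i j : ℤ} {x : ℝ} (hi : x ∈ layer f i) (hj : x ∈ layer f j) :
    i = j := by
  have h1 := (zpow_lt_zpow_iff_right₀ (by norm_num : (1:ℝ) < 8)).1 (hi.1.trans_le hj.2)
  have h2 := (zpow_lt_zpow_iff_right₀ (by norm_num : (1:ℝ) < 8)).1 (hj.1.trans_le hi.2)
  omega

lemma exists_mem_layer {f : ℝ → ℂ} {x : ℝ} (h : f x ≠ 0) : ∃ j, x ∈ layer f j := by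
  obtain ⟨n, h1, h2⟩ := exists_mem_Ioc_zpow (norm_pos_iff.2 h) (by norm_num : (1:ℝ) < 8)
  exact ⟨n + 1, by simpa using h1, h2⟩

lemma sum_layer {E : Type*} [AddCommMonoid E] {f : ℝ → ℂ} {j : ℤ} {x : ℝ} (hx : x ∈ layer f j)
    (S : Finset ℤ) (g : ℝ → E) :
    ∑ i ∈ S, (layer f i).indicator g x = if j ∈ S then g x else 0 := by
  classical
  have : ∀ i ∈ S, (layer f i).indicator g x = if i = j then g x else 0 := by
    intro i _
    split_ifs with h
    · subst h; exact Set.indicator_of_mem hx g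
    · exact Set.indicator_of_notMem (fun hh => h (layer_unique hh hx)) g
  rw [Finset.sum_congr rfl this]
  simp

lemma sum_layer_of_zero {E : Type*} [AddCommMonoid E] {f : ℝ → ℂ} {x : ℝ} (hx : f x = 0)
    (S : Finset ℤ) (g : ℝ → E) : ∑ i ∈ S, (layer f i).indicator g x = 0 := by
  refine Finset.sum_eq_zero fun i _ => Set.indicator_of_notMem (fun hh => ?_) g
  have := hh.1
  rw [hx, norm_zero] at this
  exact absurd this (not_lt.2 (by positivity))

lemma exists_lintegral_mid_le : ∃ K : ℝ, 0 < K ∧ ∀ f, Nice f → (∀ x, ‖f x‖ ≤ 1) →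
    ∀ N : ℝ → ℝ, Measurable N → ∀ 𝔓 : Finset Tile, Convx 𝔓 →
      ∫⁻ x, ENNReal.ofReal (mid ‖model N 𝔓 f x‖) ≤ ENNReal.ofReal (K * ∫ x, ‖f x‖) := by
  obtain ⟨C, hC, h⟩ := exists_restricted_weak
  obtain ⟨K₁, hK₁, h₁⟩ := exists_lintegral_rpow_le (p := 3) (by norm_num) (by norm_num)
  obtain ⟨K₂, hK₂, h₂⟩ := exists_lintegral_rpow_le (p := 3 / 2) (by norm_num) (by norm_num)
  refine ⟨(K₁ + K₂) * (1 + C), by positivity, fun f hf hf1 N hN 𝔓 h𝔓 => ?_⟩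
  have hv0 : 0 ≤ ∫ x, ‖f x‖ := integral_nonneg fun _ => norm_nonneg _
  have hm := (measurable_model hf hN 𝔓).norm
  have key : ∀ v : ℝ, ∫ x, ‖f x‖ < v → ∫⁻ x, ENNReal.ofReal (mid ‖model N 𝔓 f x‖) ≤
      ENNReal.ofReal ((K₁ + K₂) * (1 + C) * v) := by
    intro v hv
    have hv' : 0 < v := hv0.trans_lt hv
    have hyp : ∀ t > 0, volume {x | t < ‖model N 𝔓 f x‖} ≠ ⊤ ∧
        t ^ 4 * volume.real {x | t < ‖model N 𝔓 f x‖} ≤ (1 + C) * v ∧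
        t ^ 4 * volume.real {x | t < ‖model N 𝔓 f x‖} ^ 3 ≤ ((1 + C) * v) ^ 3 := by
      intro t ht
      obtain ⟨a, b⟩ := h f hf hf1 N hN 𝔓 h𝔓 v hv' hv.le t ht
      refine ⟨((nice_model hN 𝔓 hf).integrable.measure_norm_gt_lt_top ht).ne, a.trans ?_, b.trans ?_⟩
      · nlinarith
      · rw [mul_pow]
        gcongr
        nlinarith [sq_nonneg C, pow_pos hC 3]
    have a := h₁ _ hm (fun _ => norm_nonneg _) _ (by positivity) hyp
    have b := h₂ _ hm (fun _ => norm_nonneg _) _ (by positivity) hyp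
    calc ∫⁻ x, ENNReal.ofReal (mid ‖model N 𝔓 f x‖) =
        (∫⁻ x, ENNReal.ofReal (‖model N 𝔓 f x‖ ^ (3:ℝ))) +
          ∫⁻ x, ENNReal.ofReal (‖model N 𝔓 f x‖ ^ (3 / 2:ℝ)) := by
          rw [← lintegral_add_left (by fun_prop)]
          refine lintegral_congr fun x => ?_
          rw [mid, ENNReal.ofReal_add (by positivity) (by positivity)]
      _ ≤ _ := add_le_add a b
      _ = _ := by
          rw [← ENNReal.ofReal_add (by positivity) (by positivity)]
          congr 1; ring
  have hlim : Filter.Tendsto (fun v : ℝ => ENNReal.ofReal ((K₁ + K₂) * (1 + C) * v))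
      (nhdsWithin (∫ x, ‖f x‖) (Set.Ioi (∫ x, ‖f x‖)))
      (nhds (ENNReal.ofReal ((K₁ + K₂) * (1 + C) * ∫ x, ‖f x‖))) :=
    ((ENNReal.continuous_ofReal.comp (continuous_const.mul continuous_id)).tendsto _).mono_left
      nhdsWithin_le_nhds
  exact ge_of_tendsto hlim (eventually_nhdsWithin_of_forall fun v hv => key v hv)

/-- The part of `f` of height between `8 ^ (-M - 1)` and `8 ^ J`. -/
noncomputable def truncLayers (f : ℝ → ℂ) (J : ℤ) (M : ℕ) (x : ℝ) : ℂ :=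
  ∑ j ∈ Finset.Icc (-(M:ℤ)) J, (layer f j).indicator f x

lemma norm_sub_truncLayers_le {f : ℝ → ℂ} {J : ℤ} (hJ : ∀ x, ‖f x‖ ≤ 8 ^ J) (M : ℕ) (x : ℝ) :
    ‖f x - truncLayers f J M x‖ ≤ (1 / 8) ^ M := by
  by_cases h0 : f x = 0
  · rw [truncLayers, sum_layer_of_zero h0, h0]; simp
  · obtain ⟨j, hj⟩ := exists_mem_layer h0
    rw [truncLayers, sum_layer hj]
    split_ifs with h
    · simp
    · have h1 := (zpow_lt_zpow_iff_right₀ (by norm_num : (1:ℝ) < 8)).1 (hj.1.trans_le (hJ x))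
      rw [Finset.mem_Icc, not_and, not_le] at h
      have h2 : j ≤ -(M:ℤ) := by
        by_contra! hh
        have := h hh.le
        omega
      rw [sub_zero]
      refine hj.2.trans ((zpow_le_zpow_right₀ (by norm_num) h2).trans ?_)
      simp

/-- The normalized restriction of `f` to a layer. -/
noncomputable def layerFun (f : ℝ → ℂ) (j : ℤ) (x : ℝ) : ℂ :=
  ((8 ^ (-j) : ℝ) : ℂ) * (layer f j).indicator f x

lemma nice_layerFun {f : ℝ → ℂ} (hf : Nice f) (hm : Measurable f) (j : ℤ) : Nice (layerFun f j) :=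
  (hf.indicator (measurableSet_layer hm j)).const_mul _

lemma norm_layerFun (f : ℝ → ℂ) (j : ℤ) (x : ℝ) :
    ‖layerFun f j x‖ = 8 ^ (-j) * (layer f j).indicator (fun y => ‖f y‖) x := by
  rw [layerFun, norm_mul, Complex.norm_real, Real.norm_of_nonneg (by positivity), norm_indicator_eq_indicator_norm]

lemma norm_layerFun_le (f : ℝ → ℂ) (j : ℤ) (x : ℝ) : ‖layerFun f j x‖ ≤ 1 := by
  rw [norm_layerFun]
  by_cases h : x ∈ layer f j
  · rw [Set.indicator_of_mem h, zpow_neg, inv_mul_le_iff₀ (by positivity), mul_one]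
    exact h.2
  · rw [Set.indicator_of_notMem h]; simp

lemma mul_norm_layerFun_le (f : ℝ → ℂ) (j : ℤ) (x : ℝ) :
    64 ^ j * ‖layerFun f j x‖ ≤ 8 * (layer f j).indicator (fun y => ‖f y‖ ^ 2) x := by
  rw [norm_layerFun]
  by_cases h : x ∈ layer f j
  · rw [Set.indicator_of_mem h, Set.indicator_of_mem h, ← mul_assoc]
    have e : (64:ℝ) ^ j * 8 ^ (-j) = 8 * 8 ^ (j - 1) := by
      rw [show (64:ℝ) = 8 * 8 by norm_num, mul_zpow, mul_assoc, ← zpow_add₀ (by norm_num),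
        zpow_sub₀ (by norm_num)]
      simp; ring
    rw [e, mul_assoc, sq]
    have := h.1
    gcongr
  · rw [Set.indicator_of_notMem h, Set.indicator_of_notMem h]; simp

lemma sum_mul_integral_layerFun_le {f : ℝ → ℂ} (hf : Nice f) (hm : Measurable f) (S : Finset ℤ) :
    ∑ j ∈ S, 64 ^ j * ∫ x, ‖layerFun f j x‖ ≤ 8 * nsq f := by
  have hi : ∀ j ∈ S, Integrable fun x => 64 ^ j * ‖layerFun f j x‖ := fun j _ =>
    (nice_layerFun hf hm j).integrable.norm.const_mul _
  simp_rw [← integral_const_mul]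
  rw [← integral_finsetSum _ hi, nsq, ← integral_const_mul]
  refine integral_mono (integrable_finsetSum _ hi) (hf.integrable_sq.const_mul 8) fun x => ?_
  refine (Finset.sum_le_sum fun j _ => mul_norm_layerFun_le f j x).trans ?_
  rw [← Finset.mul_sum]
  gcongr
  by_cases h0 : f x = 0
  · rw [sum_layer_of_zero h0]; positivity
  · obtain ⟨j, hj⟩ := exists_mem_layer h0
    rw [sum_layer hj]
    split_ifs <;> simp

/-- Carleson's theorem for the model operator. -/
theorem exists_lintegral_model_sq_le : ∃ C : ℝ, 0 < C ∧ ∀ f, Nice f → Measurable f →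
    ∀ N : ℝ → ℝ, Measurable N → ∀ 𝔓 : Finset Tile, Convx 𝔓 →
      ∫⁻ x, ENNReal.ofReal (‖model N 𝔓 f x‖ ^ 2) ≤ ENNReal.ofReal (C * nsq f) := by
  obtain ⟨K, hK, h⟩ := exists_lintegral_mid_le
  refine ⟨8 * (K * 8), by positivity, fun f hf hm N hN 𝔓 h𝔓 => ?_⟩
  obtain ⟨B, hB⟩ := hf.bdd
  obtain ⟨J, hJ⟩ : ∃ J : ℤ, B ≤ 8 ^ J := by
    obtain ⟨n, hn⟩ := pow_unbounded_of_one_lt B (by norm_num : (1:ℝ) < 8)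
    exact ⟨n, by simpa using hn.le⟩
  have hJ' : ∀ x, ‖f x‖ ≤ 8 ^ J := fun x => (hB x).trans hJ
  have nl : ∀ j, Nice ((layer f j).indicator f) := fun j => hf.indicator (measurableSet_layer hm j)
  have nt : ∀ M, Nice (truncLayers f J M) := fun M => Nice.sum fun j _ => nl j
  refine lintegral_le_of_tendsto
    (F := fun M x => ENNReal.ofReal (‖model N 𝔓 (truncLayers f J M) x‖ ^ 2)) ?_ ?_ ?_
  · intro M
    have := measurable_model (nt M) hN 𝔓
    fun_prop
  · intro x
    refine (ENNReal.continuous_ofReal.tendsto _).comp ?_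
    refine ((continuous_norm.tendsto _).comp ?_).pow 2
    rw [tendsto_iff_norm_sub_tendsto_zero]
    set D := ∑ P ∈ 𝔓, ∫ z, ‖ker (sc psi P.r P.m) z‖
    have hb : ∀ M, ‖model N 𝔓 (truncLayers f J M) x - model N 𝔓 f x‖ ≤ D * (1 / 8) ^ M := by
      intro M
      have e : model N 𝔓 (truncLayers f J M) x - model N 𝔓 f x =
          -model N 𝔓 (fun y => f y - truncLayers f J M y) x := by
        have h2 := model_sum (s := Finset.univ (α := Bool))
          (F := fun b => if b then f else fun y => (-1) * truncLayers f J M y)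
          (by rintro (_ | _) _
              · exact (nt M).const_mul (-1)
              · exact hf) N 𝔓 x
        simp only [Fintype.sum_bool, if_true] at h2
        rw [show (fun y => f y - truncLayers f J M y) = fun y => f y +
          (-1) * truncLayers f J M y by ext; ring]
        simp only [Bool.false_eq_true, if_false] at h2
        rw [h2, model_const_mul]; ring
      rw [e, norm_neg]
      exact norm_model_le_of_bound 𝔓 (by positivity) (norm_sub_truncLayers_le hJ' M) N x
    refine squeeze_zero (fun _ => norm_nonneg _) hb ?_
    simpa using (tendsto_pow_atTop_nhds_zero_of_lt_one (by norm_num : (0:ℝ) ≤ 1 / 8)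
      (by norm_num)).const_mul D
  · intro M
    set S := Finset.Icc (-(M:ℤ)) J
    have hp : ∀ x, ‖model N 𝔓 (truncLayers f J M) x‖ ^ 2 ≤
        8 * ∑ j ∈ S, 64 ^ j * mid ‖model N 𝔓 (layerFun f j) x‖ := by
      intro x
      refine le_trans ?_ (sq_sum_le_mid S fun j => norm_nonneg _)
      gcongr
      refine (congrArg norm (model_sum (fun j _ => nl j) N 𝔓 x)).trans_le
        ((norm_sum_le _ _).trans_eq (Finset.sum_congr rfl fun j _ => ?_))
      rw [show layerFun f j = fun y => ((8 ^ (-j) : ℝ) : ℂ) * (layer f j).indicator f y from rfl,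
        model_const_mul, norm_mul, Complex.norm_real, Real.norm_of_nonneg (by positivity), ← mul_assoc,
        zpow_neg, mul_inv_cancel₀ (by positivity), one_mul]
    have mm : ∀ j, Measurable fun x => mid ‖model N 𝔓 (layerFun f j) x‖ := by
      intro j
      have := measurable_model (nice_layerFun hf hm j) hN 𝔓
      unfold mid
      fun_prop
    calc _ ≤ ∫⁻ x, ∑ j ∈ S, ENNReal.ofReal (8 * 64 ^ j) *
          ENNReal.ofReal (mid ‖model N 𝔓 (layerFun f j) x‖) := by
          refine lintegral_mono fun x => (ENNReal.ofReal_le_ofReal (hp x)).trans_eq ?_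
          rw [Finset.mul_sum, ENNReal.ofReal_sum_of_nonneg fun j _ => by
            have := mid_nonneg (norm_nonneg (model N 𝔓 (layerFun f j) x)); positivity]
          refine Finset.sum_congr rfl fun j _ => ?_
          rw [← mul_assoc, ENNReal.ofReal_mul (by positivity)]
      _ = ∑ j ∈ S, ENNReal.ofReal (8 * 64 ^ j) *
          ∫⁻ x, ENNReal.ofReal (mid ‖model N 𝔓 (layerFun f j) x‖) := by
          rw [lintegral_finsetSum _ fun j _ => by have := mm j; fun_prop]
          exact Finset.sum_congr rfl fun j _ => lintegral_const_mul _ (mm j).ennreal_ofReal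
      _ ≤ ∑ j ∈ S, ENNReal.ofReal (8 * 64 ^ j) * ENNReal.ofReal (K * ∫ x, ‖layerFun f j x‖) := by
          gcongr with j hj
          exact h _ (nice_layerFun hf hm j) (norm_layerFun_le f j) N hN 𝔓 h𝔓
      _ = ENNReal.ofReal (8 * (K * ∑ j ∈ S, 64 ^ j * ∫ x, ‖layerFun f j x‖)) := by
          rw [Finset.mul_sum, Finset.mul_sum, ENNReal.ofReal_sum_of_nonneg fun j _ => by
            have : 0 ≤ ∫ x, ‖layerFun f j x‖ := integral_nonneg fun _ => norm_nonneg _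
            positivity]
          refine Finset.sum_congr rfl fun j _ => ?_
          rw [← ENNReal.ofReal_mul (by positivity)]
          congr 1; ring
      _ ≤ _ := by
          refine ENNReal.ofReal_le_ofReal ?_
          have := sum_mul_integral_layerFun_le hf hm S
          nlinarith

/-! ### The model operator over all tiles with scales in a bounded range -/

lemma op_ker {φ g : ℝ → ℂ} (h : Sym φ) (hg : Sym g) : op φ (ker g) = ker (fun t => φ t * g t) := by
  ext x
  simpa [op] using ker_mul h hg x 0

lemma nice_ker {g : ℝ → ℂ} (hg : Sym g) : Nice (ker g) := by
  obtain ⟨C, hC⟩ := exists_ker_bound hg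
  exact ⟨integrable_ker hg, C, hC⟩

/-- The tiles with scale in `[-a, n - a)` in a large box. -/
def boxSet (a n R : ℕ) : Set Tile :=
  {P | -(a:ℤ) ≤ P.k ∧ P.k < n - a ∧ (-2 ^ R ≤ (2:ℝ) ^ P.k * P.n ∧ (2:ℝ) ^ P.k * (P.n + 1) ≤ 2 ^ R) ∧
    (-2 ^ R ≤ (2:ℝ) ^ (-P.k) * P.m ∧ (2:ℝ) ^ (-P.k) * (P.m + 1) ≤ 2 ^ R)}

lemma int_mem_Icc_of_scaled {k : ℤ} {R L : ℕ} {n : ℤ} (hk : -k ≤ L) (h1 : -2 ^ R ≤ (2:ℝ) ^ k * n)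
    (h2 : (2:ℝ) ^ k * (n + 1) ≤ 2 ^ R) : n ∈ Finset.Icc (-2 ^ (R + L) : ℤ) (2 ^ (R + L)) := by
  have hz : (2:ℝ) ^ (-k) ≤ 2 ^ L := by
    rw [← zpow_natCast]; exact zpow_le_zpow_right₀ (by norm_num) hk
  have hp := two_zpow_pos k
  have e : (2:ℝ) ^ (-k) * 2 ^ k = 1 := by rw [← zpow_add₀ two_ne_zero]; simp
  have hq := two_zpow_pos (-k)
  have hb : (2:ℝ) ^ (-k) * 2 ^ R ≤ 2 ^ (R + L) := by
    rw [pow_add, mul_comm]; gcongr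
  have a1 : -(2:ℝ) ^ (R + L) ≤ n := by
    have := mul_le_mul_of_nonneg_left h1 hq.le
    rw [← mul_assoc, e, one_mul] at this
    linarith
  have a2 : (n:ℝ) + 1 ≤ 2 ^ (R + L) := by
    have := mul_le_mul_of_nonneg_left h2 hq.le
    rw [← mul_assoc, e, one_mul] at this
    linarith
  rw [Finset.mem_Icc]
  constructor
  · exact_mod_cast a1
  · have : (n:ℝ) ≤ 2 ^ (R + L) := by linarith
    exact_mod_cast this

lemma finite_boxSet (a n R : ℕ) : (boxSet a n R).Finite := by
  classical
  set B := Finset.Icc (-2 ^ (R + (a + n)) : ℤ) (2 ^ (R + (a + n)))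
  refine ((Finset.Icc (-(a:ℤ)) n ×ˢ B ×ˢ B).image fun q : ℤ × ℤ × ℤ =>
    (⟨q.1, q.2.1, q.2.2⟩ : Tile)).finite_toSet.subset fun P hP => ?_
  obtain ⟨h1, h2, ⟨h3, h4⟩, h5, h6⟩ := hP
  refine Finset.mem_coe.2 (Finset.mem_image.2 ⟨(P.k, P.n, P.m), ?_, rfl⟩)
  refine Finset.mem_product.2 ⟨Finset.mem_Icc.2 ⟨h1, by omega⟩, Finset.mem_product.2 ⟨?_, ?_⟩⟩
  · exact int_mem_Icc_of_scaled (by push_cast; omega) h3 h4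
  · exact int_mem_Icc_of_scaled (by push_cast; omega) h5 h6

/-- The finite box of tiles. -/
noncomputable def box (a n R : ℕ) : Finset Tile := (finite_boxSet a n R).toFinset

lemma mem_box {a n R : ℕ} {P : Tile} : P ∈ box a n R ↔ P ∈ boxSet a n R := by simp [box]

lemma scaled_mono {k k' n n' : ℤ} (hk : k ≤ k') (h : dy k' (2 ^ k * n) = n') :
    (2:ℝ) ^ k' * n' ≤ 2 ^ k * n ∧ (2:ℝ) ^ k * (n + 1) ≤ 2 ^ k' * (n' + 1) := by
  obtain ⟨h1, h2⟩ := dy_eq_iff.1 h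
  refine ⟨h1, ?_⟩
  obtain ⟨d, rfl⟩ := Int.le.dest hk
  have hp := two_zpow_pos k
  rw [zpow_add₀ two_ne_zero, mul_assoc] at h2 ⊢
  have h3 : (n:ℝ) < 2 ^ (d:ℤ) * (n' + 1) := lt_of_mul_lt_mul_left h2 hp.le
  rw [zpow_natCast] at h3 ⊢
  gcongr
  have h4 : n < 2 ^ d * (n' + 1) := by exact_mod_cast h3
  exact_mod_cast h4

lemma convx_box (a n R : ℕ) : Convx (box a n R) := by
  intro P hP P'' hP'' P' h1 h2
  rw [mem_box] at *
  obtain ⟨p1, p2, ⟨p3, p4⟩, p5, p6⟩ := hP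
  obtain ⟨q1, q2, ⟨q3, q4⟩, q5, q6⟩ := hP''
  have k1 := h1.1.1
  have k2 := h2.1.1
  have a1 := scaled_mono k2 h2.1.2
  have a2 := scaled_mono (neg_le_neg k1) h1.2
  exact ⟨by omega, by omega, ⟨by linarith, by linarith⟩, by linarith, by linarith⟩

open Classical in
/-- The sum over all tiles with scales in `[-a, n - a)`, at a frequency `ξ`. -/
noncomputable def fullOp (a n : ℕ) (ξ : ℝ) (f : ℝ → ℂ) (x : ℝ) : ℂ :=
  ∑ i ∈ Finset.range n, if dy (-((i:ℤ) - a) - 1) ξ = 2 * dy (-((i:ℤ) - a)) ξ + 1 then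
    op (sc psi (2 ^ ((i:ℤ) - a)) (dy (-((i:ℤ) - a)) ξ)) f x else 0

lemma eventually_tt_mem_box (a n : ℕ) (ξ x : ℝ) :
    ∀ᶠ R in Filter.atTop, ∀ i ∈ Finset.range n, tt ξ ((i:ℤ) - a) x ∈ box a n R := by
  rw [Filter.eventually_all_finset]
  intro i hi
  have ht := (tendsto_pow_atTop_atTop_of_one_lt (by norm_num : (1:ℝ) < 2))
  set k : ℤ := (i:ℤ) - a with hk
  filter_upwards [ht.eventually_ge_atTop (-((2:ℝ) ^ k * dy k x)),
    ht.eventually_ge_atTop ((2:ℝ) ^ k * (dy k x + 1)),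
    ht.eventually_ge_atTop (-((2:ℝ) ^ (-k) * dy (-k) ξ)),
    ht.eventually_ge_atTop ((2:ℝ) ^ (-k) * (dy (-k) ξ + 1))] with R h1 h2 h3 h4
  have := Finset.mem_range.1 hi
  rw [mem_box]
  refine ⟨?_, ?_, ⟨?_, h2⟩, ?_, h4⟩
  · simp only [tt]; omega
  · simp only [tt]; omega
  · simp only [tt]; linarith
  · simp only [tt]; linarith

lemma model_box (a n : ℕ) (N : ℝ → ℝ) (f : ℝ → ℂ) {R : ℕ} {x : ℝ}
    (h : ∀ i ∈ Finset.range n, tt (N x) ((i:ℤ) - a) x ∈ box a n R) :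
    model N (box a n R) f x = fullOp a n (N x) f x := by
  classical
  have e : act N (box a n R) x = ((Finset.range n).filter fun i : ℕ =>
      dy (-((i:ℤ) - a) - 1) (N x) = 2 * dy (-((i:ℤ) - a)) (N x) + 1).image
      fun i : ℕ => tt (N x) ((i:ℤ) - a) x := by
    ext P
    rw [mem_act, Finset.mem_image]
    constructor
    · rintro ⟨hP, hx, ho⟩
      obtain ⟨p1, p2, -⟩ := mem_box.1 hP
      have hk : ((P.k + a).toNat : ℤ) - a = P.k := by omega
      have hom : P.om (N x) := by
        rw [Tile.om, show -P.k = -P.k - 1 + 1 by ring, dy_add_one, ho]; omega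
      refine ⟨(P.k + a).toNat, Finset.mem_filter.2 ⟨Finset.mem_range.2 (by omega), ?_⟩, ?_⟩
      · rw [hk, ho, hom]
      · rw [hk]; exact (Tile.eq_tt hom hx).symm
    · rintro ⟨i, hi, rfl⟩
      obtain ⟨h1, h2⟩ := Finset.mem_filter.1 hi
      exact ⟨h i h1, mem_tt _ _ _, h2⟩
  rw [model, e, Finset.sum_image, Finset.sum_filter]
  · rfl
  · intro i _ j _ hij
    have := congrArg Tile.k hij
    simp only [tt] at this
    omega

lemma exists_lintegral_fullOp_sq_le : ∃ C : ℝ, 0 < C ∧ ∀ f, Nice f → Measurable f →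
    ∀ N : ℝ → ℝ, Measurable N → ∀ a n : ℕ,
      ∫⁻ x, ENNReal.ofReal (‖fullOp a n (N x) f x‖ ^ 2) ≤ ENNReal.ofReal (C * nsq f) := by
  obtain ⟨C, hC, h⟩ := exists_lintegral_model_sq_le
  refine ⟨C, hC, fun f hf hm N hN a n => ?_⟩
  refine lintegral_le_of_tendsto
    (F := fun R x => ENNReal.ofReal (‖model N (box a n R) f x‖ ^ 2)) (fun R => ?_) (fun x => ?_)
    fun R => h f hf hm N hN _ (convx_box a n R)
  · have := measurable_model hf hN (box a n R)
    fun_prop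
  · refine tendsto_const_nhds.congr' ?_
    filter_upwards [eventually_tt_mem_box a n (N x) x] with R hR
    rw [model_box a n N f hR]

/-- A single term of the multiplier. -/
noncomputable def mulTerm (k : ℤ) (ξ t : ℝ) : ℂ :=
  if dy (-k - 1) ξ = 2 * dy (-k) ξ + 1 then psi (2 ^ k * t - dy (-k) ξ) else 0

lemma norm_psi_le (t : ℝ) : ‖psi t‖ ≤ 1 := by
  rw [show psi t = ((psiBump t : ℝ) : ℂ) from rfl, Complex.norm_real, Real.norm_of_nonneg psiBump.nonneg]
  exact psiBump.le_one

lemma norm_mulTerm_le (k : ℤ) (ξ t : ℝ) : ‖mulTerm k ξ t‖ ≤ 1 := by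
  unfold mulTerm; split_ifs
  · exact norm_psi_le _
  · simp

lemma continuous_psi : Continuous psi := (sym_bsym psiBump).contDiff.continuous

lemma measurable_mulTerm (k : ℤ) : Measurable (Function.uncurry (mulTerm k)) := by
  unfold Function.uncurry mulTerm
  have h1 : Measurable fun p : ℝ × ℝ => dy (-k) p.1 := (measurable_dy _).comp measurable_fst
  have h2 : Measurable fun p : ℝ × ℝ => dy (-k - 1) p.1 := (measurable_dy _).comp measurable_fst
  have h3 : Measurable fun p : ℝ × ℝ => ((dy (-k) p.1 : ℤ) : ℝ) := measurable_from_top.comp h1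
  refine Measurable.ite (measurableSet_eq_fun h2 ?_) (continuous_psi.measurable.comp (by fun_prop))
    measurable_const
  exact (measurable_from_top (f := fun n : ℤ => 2 * n + 1)).comp h1

/-- The multiplier of the model operator. -/
noncomputable def mult (a n : ℕ) (ξ t : ℝ) : ℂ := ∑ i ∈ Finset.range n, mulTerm ((i:ℤ) - a) ξ t

lemma measurable_mult (a n : ℕ) : Measurable (Function.uncurry (mult a n)) := by
  have : Function.uncurry (mult a n) =
      fun p => ∑ i ∈ Finset.range n, Function.uncurry (mulTerm ((i:ℤ) - a)) p := by
    ext p; rfl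
  rw [this]
  exact Finset.measurable_sum _ fun i _ => measurable_mulTerm _

lemma norm_mult_le (a n : ℕ) (ξ t : ℝ) : ‖mult a n ξ t‖ ≤ n := by
  refine (norm_sum_le _ _).trans ((Finset.sum_le_sum fun i _ => norm_mulTerm_le _ ξ t).trans ?_)
  simp

lemma Sym.integrable {g : ℝ → ℂ} (hg : Sym g) : Integrable g :=
  hg.contDiff.continuous.integrable_of_hasCompactSupport hg.hasCompactSupport

lemma integrable_fourierChar_mul {g : ℝ → ℂ} (hg : Integrable g) (x : ℝ) :
    Integrable fun t : ℝ => (Real.fourierChar (t * x) : ℂ) * g t := by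
  refine hg.bdd_mul (c := 1) (Continuous.aestronglyMeasurable ?_)
    (Filter.Eventually.of_forall fun t => (norm_fourierChar _).le)
  fun_prop

lemma fullOp_ker {g : ℝ → ℂ} (hg : Sym g) (a n : ℕ) (ξ x : ℝ) :
    fullOp a n ξ (ker g) x = ker (fun t => mult a n ξ t * g t) x := by
  classical
  rw [ker_apply]
  simp only [mult, Finset.sum_mul, Finset.mul_sum, fullOp]
  rw [integral_finsetSum]
  · refine Finset.sum_congr rfl fun i _ => ?_
    simp only [mulTerm]
    split_ifs
    · rw [op_ker ((sym_bsym _).sc (two_zpow_pos _) _) hg, ker_apply]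
      rfl
    · simp
  · intro i _
    refine integrable_fourierChar_mul (hg.integrable.bdd_mul (c := 1) ?_
      (Filter.Eventually.of_forall fun t => norm_mulTerm_le _ ξ t)) x
    exact ((measurable_mulTerm _).comp (measurable_const.prodMk measurable_id)).aestronglyMeasurable

lemma nsq_ker {g : ℝ → ℂ} (hg : Sym g) : nsq (ker g) = nsq g := by
  have h := SchwartzMap.integral_norm_sq_fourier (𝓕⁻ hg.toSchwartz : SchwartzMap ℝ ℂ)
  rw [FourierTransform.fourier_fourierInv_eq] at h
  rw [nsq, nsq, ker_eq_coe hg, ← h]; rfl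

/-! ### Averaging over translations and dilations -/

/-- The translated (by `p.1`) and dilated (by `p.2`) multiplier. -/
noncomputable def sdMult (a n : ℕ) (p : ℝ × ℝ) (ξ t : ℝ) : ℂ :=
  mult a n (p.2 * ξ - p.1) (p.2 * t - p.1)

/-- The operator with the translated and dilated multiplier. -/
noncomputable def sdOp (a n : ℕ) (p : ℝ × ℝ) (g : ℝ → ℂ) (ξ x : ℝ) : ℂ :=
  ∫ t : ℝ, (Real.fourierChar (t * x) : ℂ) * (sdMult a n p ξ t * g t)

lemma measurable_sdMult (a n : ℕ) :
    Measurable fun q : (ℝ × ℝ) × ℝ × ℝ => sdMult a n q.1 q.2.1 q.2.2 := by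
  have : (fun q : (ℝ × ℝ) × ℝ × ℝ => sdMult a n q.1 q.2.1 q.2.2) = Function.uncurry (mult a n) ∘
      fun q => (q.1.2 * q.2.1 - q.1.1, q.1.2 * q.2.2 - q.1.1) := rfl
  rw [this]
  exact (measurable_mult a n).comp (by fun_prop)

lemma norm_sdMult_le (a n : ℕ) (p : ℝ × ℝ) (ξ t : ℝ) : ‖sdMult a n p ξ t‖ ≤ n := norm_mult_le _ _ _ _

lemma measurable_fourierChar : Measurable fun x : ℝ => (Real.fourierChar x : ℂ) :=
  (Continuous.measurable (by fun_prop))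

lemma measurable_sdOp (a n : ℕ) {g : ℝ → ℂ} (hg : Measurable g) :
    Measurable fun q : (ℝ × ℝ) × ℝ × ℝ => sdOp a n q.1 g q.2.1 q.2.2 := by
  have hF : Measurable (Function.uncurry fun (q : (ℝ × ℝ) × ℝ × ℝ) (t : ℝ) =>
      (Real.fourierChar (t * q.2.2) : ℂ) * (sdMult a n q.1 q.2.1 t * g t)) := by
    refine Measurable.mul (measurable_fourierChar.comp (by fun_prop)) (Measurable.mul ?_ (by fun_prop))
    exact (measurable_sdMult a n).comp
      (f := fun q : ((ℝ × ℝ) × ℝ × ℝ) × ℝ => (q.1.1, q.1.2.1, q.2)) (by fun_prop)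
  exact (hF.stronglyMeasurable.integral_prod_right (ν := volume)).measurable

lemma norm_sdOp_le (a n : ℕ) (p : ℝ × ℝ) {g : ℝ → ℂ} (hg : Integrable g) (ξ x : ℝ) :
    ‖sdOp a n p g ξ x‖ ≤ n * ∫ t, ‖g t‖ := by
  rw [← integral_const_mul]
  refine norm_integral_le_of_norm_le (hg.norm.const_mul _) (Filter.Eventually.of_forall fun t => ?_)
  rw [norm_mul, norm_fourierChar, one_mul, norm_mul]
  gcongr
  exact norm_sdMult_le _ _ _ _ _

lemma norm_fullOp_dilate {g : ℝ → ℂ} (hg : Sym g) (a n : ℕ) {p : ℝ × ℝ} (hp : 0 < p.2) (ξ y : ℝ) :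
    ‖fullOp a n (p.2 * ξ - p.1) (ker fun t => g (p.2⁻¹ * t - -(p.2⁻¹ * p.1))) y‖ =
      p.2 * ‖sdOp a n p g ξ (p.2 * y)‖ := by
  obtain ⟨s, κ⟩ := p
  simp only at hp ⊢
  rw [fullOp_ker (hg.comp_affine (inv_ne_zero hp.ne') _), ker_apply]
  set F : ℝ → ℂ := fun t => (Real.fourierChar (t * y) : ℂ) * (mult a n (κ * ξ - s) t *
    g (κ⁻¹ * t - -(κ⁻¹ * s))) with hF
  have h1 : ∫ t, F t = κ * ∫ t, F (κ * t - s) := by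
    have := Measure.integral_comp_mul_left (fun t => F (t - s)) κ
    rw [this, integral_sub_right_eq_self F s, abs_of_pos (inv_pos.2 hp), Complex.real_smul, ← mul_assoc,
      ← Complex.ofReal_mul, mul_inv_cancel₀ hp.ne', Complex.ofReal_one, one_mul]
  have h2 : ∀ t, F (κ * t - s) = (Real.fourierChar (-(s * y)) : ℂ) *
      ((Real.fourierChar (t * (κ * y)) : ℂ) * (sdMult a n (s, κ) ξ t * g t)) := by
    intro t
    have e1 : κ⁻¹ * (κ * t - s) - -(κ⁻¹ * s) = t := by field_simp; ring
    have e2 : (κ * t - s) * y = -(s * y) + t * (κ * y) := by ring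
    simp only [hF, e1, e2, AddChar.map_add_eq_mul, Circle.coe_mul, sdMult]
    ring
  rw [h1]
  simp_rw [h2]
  rw [integral_const_mul, norm_mul, norm_mul, norm_fourierChar, one_mul, Complex.norm_real,
    Real.norm_of_nonneg hp.le]
  rfl

lemma nsq_dilate (g : ℝ → ℂ) {κ : ℝ} (hκ : 0 < κ) (s : ℝ) :
    nsq (fun t => g (κ⁻¹ * t - -(κ⁻¹ * s))) = κ * nsq g := by
  have := Measure.integral_comp_mul_left (fun t => ‖g (t - -(κ⁻¹ * s))‖ ^ 2) κ⁻¹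
  rw [nsq, this, integral_sub_right_eq_self (fun t => ‖g t‖ ^ 2), inv_inv, abs_of_pos hκ]
  rfl

lemma lintegral_comp_mul_left_eq {f : ℝ → ℝ≥0∞} (hf : Measurable f) {κ : ℝ} (hκ : 0 < κ) :
    ∫⁻ x, f x = ENNReal.ofReal κ * ∫⁻ y, f (κ * y) := by
  rw [← lintegral_map (g := fun y => κ * y) hf (by fun_prop), Real.map_volume_mul_left hκ.ne',
    lintegral_smul_measure, abs_of_pos (inv_pos.2 hκ), smul_eq_mul, ← mul_assoc, ← ENNReal.ofReal_mul hκ.le,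
    mul_inv_cancel₀ hκ.ne', ENNReal.ofReal_one, one_mul]

lemma exists_lintegral_sdOp_sq_le : ∃ C : ℝ, 0 < C ∧ ∀ g, Sym g → ∀ N : ℝ → ℝ, Measurable N →
    ∀ (a n : ℕ) (p : ℝ × ℝ), 0 < p.2 →
      ∫⁻ x, ENNReal.ofReal (‖sdOp a n p g (N x) x‖ ^ 2) ≤ ENNReal.ofReal (C * nsq g) := by
  obtain ⟨C, hC, h⟩ := exists_lintegral_fullOp_sq_le
  refine ⟨C, hC, fun g hg N hN a n p hp => ?_⟩
  obtain ⟨s, κ⟩ := p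
  simp only at hp
  have hg' := hg.comp_affine (inv_ne_zero hp.ne') (-(κ⁻¹ * s))
  have h1 := h _ (nice_ker hg') (continuous_ker hg').measurable (fun y => κ * N (κ * y) - s)
    (by fun_prop) a n
  have e : ∀ y, ‖fullOp a n (κ * N (κ * y) - s) (ker fun t => g (κ⁻¹ * t - -(κ⁻¹ * s))) y‖ =
    κ * ‖sdOp a n (s, κ) g (N (κ * y)) (κ * y)‖ := fun y =>
    norm_fullOp_dilate hg a n (p := (s, κ)) hp (N (κ * y)) y
  simp_rw [e] at h1
  rw [nsq_ker hg', nsq_dilate g hp] at h1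
  have hm : Measurable fun x => ENNReal.ofReal (‖sdOp a n (s, κ) g (N x) x‖ ^ 2) := by
    have := (measurable_sdOp a n hg.contDiff.continuous.measurable).comp
      (f := fun x => (((s, κ) : ℝ × ℝ), N x, x)) (by fun_prop)
    simp only [Function.comp_def] at this
    fun_prop
  rw [lintegral_comp_mul_left_eq hm hp]
  have hm' : Measurable fun y => ENNReal.ofReal (‖sdOp a n (s, κ) g (N (κ * y)) (κ * y)‖ ^ 2) :=
    hm.comp (by fun_prop)
  have h2 : ENNReal.ofReal κ * (ENNReal.ofReal κ * ∫⁻ y, ENNReal.ofReal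
      (‖sdOp a n (s, κ) g (N (κ * y)) (κ * y)‖ ^ 2)) ≤
      ENNReal.ofReal κ * ENNReal.ofReal (C * nsq g) := by
    rw [← mul_assoc, ← ENNReal.ofReal_mul hp.le, ← lintegral_const_mul _ hm',
      ← ENNReal.ofReal_mul hp.le, show κ * (C * nsq g) = C * (κ * nsq g) by ring]
    refine le_trans (le_of_eq (lintegral_congr fun y => ?_)) h1
    rw [← ENNReal.ofReal_mul (by positivity)]
    congr 1; ring
  exact (ENNReal.mul_le_mul_iff_right (ENNReal.ofReal_pos.2 hp).ne' ENNReal.ofReal_ne_top).1 h2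

/-- The measure on the set of translations and dilations. -/
noncomputable def sdMeasure (a : ℕ) : Measure (ℝ × ℝ) :=
  (volume.restrict (Set.Ioc 0 (2 ^ a))).prod (volume.restrict (Set.Ioc (1 / 2) 1))

instance (a : ℕ) : IsFiniteMeasure (sdMeasure a) := by unfold sdMeasure; infer_instance

lemma sdMeasure_real_univ (a : ℕ) : (sdMeasure a).real Set.univ = 2 ^ a / 2 := by
  rw [sdMeasure, ← Set.univ_prod_univ, measureReal_prod_prod, measureReal_restrict_apply_univ,
    measureReal_restrict_apply_univ, Real.volume_real_Ioc_of_le (by positivity),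
    Real.volume_real_Ioc_of_le (by norm_num)]
  ring

lemma ae_sdMeasure (a : ℕ) : ∀ᵐ p ∂sdMeasure a, p.2 ∈ Set.Ioc (1 / 2 : ℝ) 1 := by
  rw [sdMeasure, Measure.prod_restrict]
  exact (ae_restrict_iff' (measurableSet_Ioc.prod measurableSet_Ioc)).2
    (Filter.Eventually.of_forall fun p hp => hp.2)

/-- The averaged multiplier. -/
noncomputable def avgMult (a n : ℕ) (ξ t : ℝ) : ℂ := ∫ p, (p.2⁻¹ : ℂ) * sdMult a n p ξ t ∂sdMeasure a

lemma norm_inv_le {κ : ℝ} (h : κ ∈ Set.Ioc (1 / 2 : ℝ) 1) : ‖(κ⁻¹ : ℂ)‖ ≤ 2 := by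
  rw [← Complex.ofReal_inv, Complex.norm_real, Real.norm_of_nonneg (inv_nonneg.2 (by linarith [h.1])),
    inv_le_comm₀ (by linarith [h.1]) two_pos]
  linarith [h.1]

lemma integral_sdOp_eq {g : ℝ → ℂ} (hg : Sym g) (a n : ℕ) (ξ x : ℝ) :
    ∫ p, (p.2⁻¹ : ℂ) * sdOp a n p g ξ x ∂sdMeasure a =
      ∫ t : ℝ, (Real.fourierChar (t * x) : ℂ) * (avgMult a n ξ t * g t) := by
  simp only [sdOp, avgMult, ← integral_const_mul, ← integral_mul_const]
  rw [integral_integral_swap]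
  · refine integral_congr_ae (Filter.Eventually.of_forall fun t => ?_)
    refine integral_congr_ae (Filter.Eventually.of_forall fun p => ?_)
    simp only; ring
  · have hgm := hg.contDiff.continuous.measurable
    have hF : Measurable (Function.uncurry fun (p : ℝ × ℝ) (t : ℝ) => (p.2⁻¹ : ℂ) *
        ((Real.fourierChar (t * x) : ℂ) * (sdMult a n p ξ t * g t))) := by
      refine Measurable.mul (by fun_prop) (Measurable.mul (measurable_fourierChar.comp (by fun_prop))
        (Measurable.mul ?_ (by fun_prop)))
      exact (measurable_sdMult a n).comp (f := fun q : (ℝ × ℝ) × ℝ => (q.1, ξ, q.2)) (by fun_prop)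
    have hi : Integrable (fun q : (ℝ × ℝ) × ℝ => (2 * n : ℝ) * ‖g q.2‖)
        ((sdMeasure a).prod volume) :=
      (hg.integrable.norm.comp_snd (sdMeasure a)).const_mul _
    refine hi.mono' hF.aestronglyMeasurable ?_
    have h1 : ∀ᵐ q ∂(sdMeasure a).prod (volume : Measure ℝ), q.1.2 ∈ Set.Ioc (1 / 2 : ℝ) 1 :=
      Measure.quasiMeasurePreserving_fst.ae (ae_sdMeasure a)
    filter_upwards [h1] with q hq
    simp only [Function.uncurry]
    rw [norm_mul, norm_mul, norm_fourierChar, one_mul, norm_mul, mul_assoc]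
    gcongr
    · exact norm_inv_le hq
    · exact norm_sdMult_le _ _ _ _ _

lemma sq_norm_integral_le {α : Type*} [MeasurableSpace α] {μ : Measure α} [IsFiniteMeasure μ]
    {F : α → ℂ} (hF : MemLp F 2 μ) : ‖∫ x, F x ∂μ‖ ^ 2 ≤ μ.real Set.univ * ∫ x, ‖F x‖ ^ 2 ∂μ := by
  have h1 : Integrable F μ := hF.integrable (by norm_num)
  have h2 : Integrable (fun x => ‖F x‖ ^ 2) μ := hF.norm.integrable_sq
  have := sq_integral_mul_le (μ := μ) (u := fun _ => 1) (v := fun x => ‖F x‖) (by simp) h2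
    (by simpa using h1.norm)
  simp only [one_mul, one_pow, integral_const, smul_eq_mul, mul_one] at this
  refine le_trans ?_ this
  gcongr
  exact norm_integral_le_integral_norm _

lemma exists_lintegral_avgMult_sq_le : ∃ C : ℝ, 0 < C ∧ ∀ g, Sym g → ∀ N : ℝ → ℝ, Measurable N →
    ∀ a n : ℕ, ∫⁻ x, ENNReal.ofReal
      (‖∫ t : ℝ, (Real.fourierChar (t * x) : ℂ) * (avgMult a n (N x) t * g t)‖ ^ 2) ≤
        ENNReal.ofReal (4 ^ a * C * nsq g) := by
  obtain ⟨C, hC, h⟩ := exists_lintegral_sdOp_sq_le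
  refine ⟨C, hC, fun g hg N hN a n => ?_⟩
  have hgm := hg.contDiff.continuous.measurable
  set B : ℝ := n * ∫ t, ‖g t‖ with hB
  have hm : Measurable fun q : ℝ × ℝ × ℝ => sdOp a n q.2 g (N q.1) q.1 :=
    (measurable_sdOp a n hgm).comp (f := fun q : ℝ × ℝ × ℝ => (q.2, N q.1, q.1)) (by fun_prop)
  have hL : ∀ x, MemLp (fun p : ℝ × ℝ => (p.2⁻¹ : ℂ) * sdOp a n p g (N x) x) 2 (sdMeasure a) := by
    intro x
    refine MemLp.of_bound (C := 2 * B) ?_ ?_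
    · have : Measurable fun p => sdOp a n p g (N x) x := hm.comp (f := fun p => (x, p)) (by fun_prop)
      exact Measurable.aestronglyMeasurable (by fun_prop)
    · filter_upwards [ae_sdMeasure a] with p hp
      rw [norm_mul]
      gcongr
      · exact norm_inv_le hp
      · exact norm_sdOp_le a n p hg.integrable _ _
  have hpt : ∀ x, ENNReal.ofReal
      (‖∫ t : ℝ, (Real.fourierChar (t * x) : ℂ) * (avgMult a n (N x) t * g t)‖ ^ 2) ≤
      ENNReal.ofReal (2 ^ a / 2 * 4) *
        ∫⁻ p, ENNReal.ofReal (‖sdOp a n p g (N x) x‖ ^ 2) ∂sdMeasure a := by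
    intro x
    rw [← integral_sdOp_eq hg]
    refine (ENNReal.ofReal_le_ofReal (sq_norm_integral_le (hL x))).trans ?_
    rw [sdMeasure_real_univ, ENNReal.ofReal_mul (by positivity), ENNReal.ofReal_mul (by positivity),
      mul_assoc, ofReal_integral_eq_lintegral_ofReal (hL x).norm.integrable_sq
      (Filter.Eventually.of_forall fun p => sq_nonneg _)]
    gcongr
    have hm1 : Measurable fun p => sdOp a n p g (N x) x := hm.comp (f := fun p => (x, p)) (by fun_prop)
    rw [← lintegral_const_mul _ (by fun_prop)]
    refine lintegral_mono_ae ?_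
    filter_upwards [ae_sdMeasure a] with p hp
    rw [← ENNReal.ofReal_mul (by norm_num), norm_mul, mul_pow]
    gcongr
    nlinarith [norm_inv_le hp, norm_nonneg (p.2⁻¹ : ℂ)]
  have hm2 : Measurable (Function.uncurry fun (x : ℝ) (p : ℝ × ℝ) =>
      ENNReal.ofReal (‖sdOp a n p g (N x) x‖ ^ 2)) := by
    have : Measurable (Function.uncurry fun (x : ℝ) (p : ℝ × ℝ) => sdOp a n p g (N x) x) := hm
    unfold Function.uncurry at this ⊢
    fun_prop
  calc _ ≤ ∫⁻ x, ENNReal.ofReal (2 ^ a / 2 * 4) *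
        ∫⁻ p, ENNReal.ofReal (‖sdOp a n p g (N x) x‖ ^ 2) ∂sdMeasure a := lintegral_mono hpt
    _ = ENNReal.ofReal (2 ^ a / 2 * 4) *
        ∫⁻ p, (∫⁻ x, ENNReal.ofReal (‖sdOp a n p g (N x) x‖ ^ 2)) ∂sdMeasure a := by
        have hm3 : Measurable fun x : ℝ =>
            ∫⁻ p, ENNReal.ofReal (‖sdOp a n p g (N x) x‖ ^ 2) ∂sdMeasure a := hm2.lintegral_prod_right'
        rw [lintegral_const_mul _ hm3, lintegral_lintegral_swap hm2.aemeasurable]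
    _ ≤ ENNReal.ofReal (2 ^ a / 2 * 4) * ∫⁻ p, ENNReal.ofReal (C * nsq g) ∂sdMeasure a := by
        refine mul_le_mul_right (lintegral_mono_ae ?_) _
        filter_upwards [ae_sdMeasure a] with p hp
        exact h g hg N hN a n p (by linarith [hp.1])
    _ = _ := by
        have := nsq_nonneg g
        rw [lintegral_const, ← ofReal_measureReal, sdMeasure_real_univ, ← ENNReal.ofReal_mul (by positivity),
          ← ENNReal.ofReal_mul (by positivity)]
        congr 1
        rw [show (4:ℝ) ^ a = 2 ^ a * 2 ^ a by rw [← mul_pow]; norm_num]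
        ring

/-! ### The averaged multiplier is a half line -/

/-- The periodic profile of a single term of the multiplier. -/
noncomputable def perTerm (v w : ℝ) : ℝ := if 1 / 2 ≤ Int.fract w then psiBump (v + Int.fract w) else 0

/-- The mean of the periodic profile. -/
noncomputable def profile (v : ℝ) : ℝ := ∫ u in (1 / 2 : ℝ)..1, psiBump (v + u)

lemma psiBump_ne_zero {t : ℝ} (h : psiBump t ≠ 0) : 1 / 8 < t ∧ t < 3 / 8 :=
  psi_ne_zero (by rw [show psi t = ((psiBump t : ℝ) : ℂ) from rfl]; exact_mod_cast h)

lemma mulTerm_eq (k : ℤ) (ξ t : ℝ) : mulTerm k ξ t = perTerm (2 ^ k * (t - ξ)) (2 ^ k * ξ) := by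
  have e1 : dy (-k) ξ = ⌊(2:ℝ) ^ k * ξ⌋ := by
    rw [dy, zpow_neg, div_inv_eq_mul, mul_comm]
  have e2 : dy (-k - 1) ξ = ⌊2 * ((2:ℝ) ^ k * ξ)⌋ := by
    rw [dy, show -k - 1 = -(k + 1) by ring, zpow_neg, div_inv_eq_mul, zpow_add_one₀ two_ne_zero]
    congr 1; ring
  have e3 : (⌊2 * ((2:ℝ) ^ k * ξ)⌋ = 2 * ⌊(2:ℝ) ^ k * ξ⌋ + 1) ↔ 1 / 2 ≤ Int.fract ((2:ℝ) ^ k * ξ) := by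
    have h1 := Int.fract_lt_one ((2:ℝ) ^ k * ξ)
    rw [Int.floor_eq_iff]
    push_cast
    unfold Int.fract at h1 ⊢
    constructor
    · intro h; linarith [h.1]
    · intro h; constructor <;> linarith
  unfold mulTerm perTerm
  rw [e1, e2]
  by_cases h : 1 / 2 ≤ Int.fract ((2:ℝ) ^ k * ξ)
  · rw [if_pos (e3.2 h), if_pos h, show (2:ℝ) ^ k * t - ⌊(2:ℝ) ^ k * ξ⌋ =
      2 ^ k * (t - ξ) + Int.fract ((2:ℝ) ^ k * ξ) by unfold Int.fract; ring]
    rfl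
  · rw [if_neg (mt e3.1 h), if_neg h, Complex.ofReal_zero]

lemma perTerm_periodic (v : ℝ) : Function.Periodic (perTerm v) 1 := fun w => by
  simp only [perTerm, Int.fract_add_one]

lemma measurable_perTerm (v : ℝ) : Measurable (perTerm v) := by
  unfold perTerm
  refine Measurable.ite (measurableSet_le measurable_const measurable_fract) ?_ measurable_const
  exact psiBump.continuous.measurable.comp (by fun_prop)

lemma norm_perTerm_le (v w : ℝ) : ‖perTerm v w‖ ≤ 1 := by
  unfold perTerm
  split_ifs
  · rw [Real.norm_of_nonneg psiBump.nonneg]; exact psiBump.le_one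
  · simp

lemma intervalIntegrable_perTerm (v x y : ℝ) : IntervalIntegrable (perTerm v) volume x y := by
  rw [intervalIntegrable_iff]
  exact Measure.integrableOn_of_bounded (M := 1) (by simp) (measurable_perTerm v).aestronglyMeasurable
    (Filter.Eventually.of_forall fun w => norm_perTerm_le v w)

lemma integral_perTerm (v : ℝ) : ∫ w in (0:ℝ)..1, perTerm v w = profile v := by
  rw [← intervalIntegral.integral_add_adjacent_intervals (b := 1 / 2) (intervalIntegrable_perTerm v _ _)
    (intervalIntegrable_perTerm v _ _)]
  have h1 : ∫ w in (0:ℝ)..(1 / 2), perTerm v w = 0 := by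
    rw [intervalIntegral.integral_of_le (by norm_num), integral_Ioc_eq_integral_Ioo]
    refine setIntegral_eq_zero_of_forall_eq_zero fun w hw => ?_
    have : Int.fract w = w := Int.fract_eq_self.2 ⟨hw.1.le, by linarith [hw.2]⟩
    rw [perTerm, this, if_neg (by linarith [hw.2])]
  rw [h1, zero_add, profile, intervalIntegral.integral_of_le (by norm_num),
    intervalIntegral.integral_of_le (by norm_num), integral_Ioc_eq_integral_Ioo,
    integral_Ioc_eq_integral_Ioo]
  refine setIntegral_congr_fun measurableSet_Ioo fun w hw => ?_
  have : Int.fract w = w := Int.fract_eq_self.2 ⟨by linarith [hw.1], hw.2⟩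
  simp only [perTerm, this, if_pos hw.1.le]

lemma integral_mulTerm (a i : ℕ) (κ ξ t : ℝ) :
    ∫ s in (0:ℝ)..2 ^ a, mulTerm ((i:ℤ) - a) (κ * ξ - s) (κ * t - s) =
      (2 ^ a * profile (2 ^ ((i:ℤ) - a) * κ * (t - ξ)) : ℝ) := by
  set k : ℤ := (i:ℤ) - a with hk
  have h2 := two_zpow_pos k
  have hki : (2:ℝ) ^ k * 2 ^ a = 2 ^ i := by
    rw [hk, ← zpow_natCast (2:ℝ) a, ← zpow_add₀ two_ne_zero, sub_add_cancel, zpow_natCast]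
  set v : ℝ := 2 ^ k * κ * (t - ξ) with hv
  have e : ∀ s, mulTerm k (κ * ξ - s) (κ * t - s) =
      ((perTerm v (2 ^ k * (κ * ξ) - 2 ^ k * s) : ℝ) : ℂ) := fun s => by
    rw [mulTerm_eq, hv]
    congr 2 <;> ring
  simp_rw [e]
  rw [intervalIntegral.integral_ofReal, intervalIntegral.integral_comp_sub_mul _ h2.ne', hki, mul_zero,
    sub_zero]
  set c : ℝ := 2 ^ k * (κ * ξ)
  have := (perTerm_periodic v).intervalIntegral_add_zsmul_eq (2 ^ i) (c - 2 ^ i)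
    (intervalIntegrable_perTerm v)
  rw [(perTerm_periodic v).intervalIntegral_add_eq (c - 2 ^ i) 0, zero_add, integral_perTerm] at this
  have e2 : c - 2 ^ i + ((2 : ℤ) ^ i) • (1 : ℝ) = c := by rw [zsmul_eq_mul]; push_cast; ring
  rw [e2, zsmul_eq_mul] at this
  push_cast at this
  rw [this, smul_eq_mul, ← hki]
  congr 1
  field_simp

lemma continuous_profile : Continuous profile := by
  unfold profile
  exact intervalIntegral.continuous_parametric_intervalIntegral_of_continuous' (μ := volume)
    (f := fun v u => psiBump (v + u)) (psiBump.continuous.comp (by fun_prop)) _ _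

lemma profile_nonneg (v : ℝ) : 0 ≤ profile v :=
  intervalIntegral.integral_nonneg (by norm_num) fun _ _ => psiBump.nonneg

lemma profile_ne_zero {v : ℝ} (h : profile v ≠ 0) : -(7 / 8) < v ∧ v < -(1 / 8) := by
  by_contra h'
  refine h (intervalIntegral.integral_zero_ae (Filter.Eventually.of_forall fun u hu => ?_))
  by_contra hne
  rw [Set.uIoc_of_le (by norm_num)] at hu
  have := psiBump_ne_zero hne
  exact h' ⟨by linarith [this.1, hu.2], by linarith [this.2, hu.1]⟩

lemma profile_pos : 0 < profile (-(1 / 2)) := by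
  refine intervalIntegral.integral_pos (by norm_num)
    (psiBump.continuous.comp (by fun_prop)).continuousOn (fun _ _ => psiBump.nonneg)
    ⟨3 / 4, by norm_num, ?_⟩
  rw [psiBump.one_of_mem_closedBall]
  · norm_num
  · rw [Metric.mem_closedBall, Real.dist_eq]
    change _ ≤ (1 / 16 : ℝ)
    norm_num

/-- The density whose integrals give the averaged multiplier. -/
noncomputable def dens (y : ℝ) : ℝ := profile (-y) * (max y (1 / 8))⁻¹

lemma dens_ne_zero {y : ℝ} (h : dens y ≠ 0) : 1 / 8 < y ∧ y < 7 / 8 := by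
  have := profile_ne_zero (left_ne_zero_of_mul h)
  constructor <;> linarith [this.1, this.2]

lemma continuous_dens : Continuous dens := by
  unfold dens
  refine (continuous_profile.comp continuous_neg).mul (Continuous.inv₀ (by fun_prop) fun y => ?_)
  have := le_max_right y (1 / 8)
  positivity

lemma dens_nonneg (y : ℝ) : 0 ≤ dens y :=
  mul_nonneg (profile_nonneg _) (inv_nonneg.2 (le_max_of_le_right (by norm_num)))

lemma hasCompactSupport_dens : HasCompactSupport dens :=
  HasCompactSupport.intro (isCompact_Icc (a := (1 / 8 : ℝ)) (b := 7 / 8)) fun y hy => by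
    by_contra h
    have := dens_ne_zero h
    exact hy ⟨this.1.le, this.2.le⟩

lemma integral_dens_pos : 0 < ∫ y, dens y := by
  refine continuous_dens.integral_pos_of_hasCompactSupport_nonneg_nonzero hasCompactSupport_dens
    dens_nonneg (x := 1 / 2) ?_
  have := profile_pos
  unfold dens
  positivity

lemma integrable_dens : Integrable dens :=
  continuous_dens.integrable_of_hasCompactSupport hasCompactSupport_dens

lemma inv_mul_profile {κ : ℝ} (hκ : 0 < κ) (b : ℝ) : κ⁻¹ * profile (-(b * κ)) = b * dens (b * κ) := by
  by_cases h : profile (-(b * κ)) = 0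
  · rw [dens, h]; ring
  · have h1 := (profile_ne_zero h).2
    have h2 : 0 < b * κ := by linarith
    have hb : b ≠ 0 := by rintro rfl; simp at h2
    rw [dens, max_eq_left (by linarith)]
    field_simp

lemma integral_inv_mul_profile (b : ℝ) :
    ∫ κ in (1 / 2 : ℝ)..1, κ⁻¹ * profile (-(b * κ)) = ∫ y in b / 2..b, dens y := by
  have h := intervalIntegral.smul_integral_comp_mul_left (a := 1 / 2) (b := 1) dens b
  rw [mul_one, mul_one_div, smul_eq_mul, ← intervalIntegral.integral_const_mul] at h
  rw [← h]
  refine intervalIntegral.integral_congr fun κ hκ => ?_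
  rw [Set.uIcc_of_le (by norm_num)] at hκ
  exact inv_mul_profile (by linarith [hκ.1]) b

lemma avgMult_eq (a n : ℕ) (ξ t : ℝ) : avgMult a n ξ t =
    (2 ^ a * ∫ y in (2:ℝ) ^ (-(a:ℤ) - 1) * (ξ - t)..2 ^ ((n:ℤ) - a - 1) * (ξ - t), dens y : ℝ) := by
  have hint : ∀ i : ℕ, Integrable (fun p : ℝ × ℝ => (p.2⁻¹ : ℂ) *
      mulTerm ((i:ℤ) - a) (p.2 * ξ - p.1) (p.2 * t - p.1)) (sdMeasure a) := by
    intro i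
    refine Integrable.of_bound (C := 2) (Measurable.aestronglyMeasurable ?_) ?_
    · refine Measurable.mul (by fun_prop) ?_
      exact (measurable_mulTerm ((i:ℤ) - a)).comp
        (f := fun p : ℝ × ℝ => (p.2 * ξ - p.1, p.2 * t - p.1)) (by fun_prop)
    · filter_upwards [ae_sdMeasure a] with p hp
      rw [norm_mul]
      nlinarith [norm_inv_le hp, norm_mulTerm_le ((i:ℤ) - a) (p.2 * ξ - p.1) (p.2 * t - p.1),
        norm_nonneg (p.2⁻¹ : ℂ), norm_nonneg (mulTerm ((i:ℤ) - a) (p.2 * ξ - p.1) (p.2 * t - p.1))]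
  have hterm : ∀ i : ℕ, ∫ p : ℝ × ℝ, (p.2⁻¹ : ℂ) *
      mulTerm ((i:ℤ) - a) (p.2 * ξ - p.1) (p.2 * t - p.1) ∂sdMeasure a =
      (2 ^ a * ∫ y in (2:ℝ) ^ ((i:ℤ) - a - 1) * (ξ - t)..2 ^ (((i + 1 : ℕ):ℤ) - a - 1) * (ξ - t), dens y : ℝ) := by
    intro i
    have hi := hint i
    rw [sdMeasure] at hi ⊢
    rw [integral_prod_symm _ hi, ← intervalIntegral.integral_of_le (by norm_num)]
    have e : ∀ κ : ℝ, ∫ s in Set.Ioc (0:ℝ) (2 ^ a), (κ⁻¹ : ℂ) *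
        mulTerm ((i:ℤ) - a) (κ * ξ - s) (κ * t - s) =
        ((2 ^ a * (κ⁻¹ * profile (-(2 ^ ((i:ℤ) - a) * (ξ - t) * κ))) : ℝ) : ℂ) := by
      intro κ
      rw [integral_const_mul, ← intervalIntegral.integral_of_le (by positivity), integral_mulTerm,
        show 2 ^ ((i:ℤ) - a) * κ * (t - ξ) = -(2 ^ ((i:ℤ) - a) * (ξ - t) * κ) by ring]
      push_cast
      ring
    simp only [e]
    rw [intervalIntegral.integral_ofReal, intervalIntegral.integral_const_mul, integral_inv_mul_profile]
    congr 4
    · rw [zpow_sub_one₀ two_ne_zero]; ring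
    · rw [show ((i + 1 : ℕ) : ℤ) - a - 1 = (i : ℤ) - a by push_cast; ring]
  simp only [avgMult, sdMult, mult, Finset.mul_sum]
  rw [integral_finsetSum _ fun i _ => hint i, Finset.sum_congr rfl fun i _ => hterm i,
    ← Complex.ofReal_sum, ← Finset.mul_sum,
    intervalIntegral.sum_integral_adjacent_intervals
      (a := fun i : ℕ => (2:ℝ) ^ ((i:ℤ) - a - 1) * (ξ - t))
      fun i _ => integrable_dens.intervalIntegrable]
  simp

lemma norm_avgMult_le (a n : ℕ) (ξ t : ℝ) : ‖avgMult a n ξ t‖ ≤ 2 ^ a * ∫ y, dens y := by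
  rw [avgMult_eq, Complex.norm_real, norm_mul, Real.norm_of_nonneg (by positivity : (0:ℝ) ≤ 2 ^ a)]
  gcongr
  refine intervalIntegral.norm_integral_le_integral_norm_uIoc.trans ?_
  simp only [Real.norm_of_nonneg (dens_nonneg _)]
  exact setIntegral_le_integral integrable_dens (Filter.Eventually.of_forall dens_nonneg)

lemma tendsto_avgMult (a : ℕ) {ξ t : ℝ} (h : ξ - t ≤ 2 ^ a / 4) :
    Filter.Tendsto (fun n => avgMult a n ξ t) Filter.atTop
      (nhds ((2 ^ a * ∫ y, dens y : ℝ) * (Set.Iio ξ).indicator 1 t)) := by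
  have hpow : ∀ n : ℕ, (2:ℝ) ^ ((n:ℤ) - a - 1) = 2 ^ n * 2 ^ (-(a:ℤ) - 1) := fun n => by
    rw [← zpow_natCast, ← zpow_add₀ two_ne_zero]; congr 1; ring
  have hp := two_zpow_pos (-(a:ℤ) - 1)
  have hpa : (2:ℝ) ^ (-(a:ℤ) - 1) * 2 ^ a = 1 / 2 := by
    rw [← zpow_natCast, ← zpow_add₀ two_ne_zero, show -(a:ℤ) - 1 + a = -1 by ring]; simp
  by_cases ht : t < ξ
  · have h1 : Filter.Tendsto (fun n : ℕ => (2:ℝ) ^ n * (2 ^ (-(a:ℤ) - 1) * (ξ - t))) Filter.atTop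
        Filter.atTop :=
      (tendsto_pow_atTop_atTop_of_one_lt one_lt_two).atTop_mul_const (mul_pos hp (by linarith))
    refine tendsto_const_nhds.congr' ?_
    filter_upwards [h1.eventually_ge_atTop 1] with n hn
    rw [avgMult_eq, Set.indicator_of_mem (show t ∈ Set.Iio ξ from ht), Pi.one_apply, mul_one,
      intervalIntegral.integral_eq_integral_of_support_subset]
    intro y hy
    have := dens_ne_zero hy
    rw [hpow, mul_assoc]
    exact ⟨by nlinarith [this.1], by linarith [this.2]⟩
  · rw [Set.indicator_of_notMem (show t ∉ Set.Iio ξ from ht), mul_zero]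
    refine tendsto_const_nhds.congr fun n => ?_
    rw [avgMult_eq, intervalIntegral.integral_zero_ae, mul_zero, Complex.ofReal_zero]
    refine Filter.Eventually.of_forall fun y hy => ?_
    by_contra hne
    have := (dens_ne_zero hne).1
    have hp2 := two_zpow_pos ((n:ℤ) - a - 1)
    rw [Set.mem_uIoc] at hy
    rcases hy with hy | hy <;> nlinarith [hy.2]

/-- The Fourier integral over a half line. -/
noncomputable def halfInt (g : ℝ → ℂ) (ξ x : ℝ) : ℂ :=
  ∫ t in Set.Iio ξ, (Real.fourierChar (t * x) : ℂ) * g t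

lemma tendsto_integral_avgMult {g : ℝ → ℂ} (hg : Sym g) {a : ℕ} {ξ : ℝ}
    (ha : ∀ t, g t ≠ 0 → ξ - t ≤ 2 ^ a / 4) (x : ℝ) :
    Filter.Tendsto (fun n => ∫ t : ℝ, (Real.fourierChar (t * x) : ℂ) * (avgMult a n ξ t * g t))
      Filter.atTop (nhds ((2 ^ a * ∫ y, dens y : ℝ) * halfInt g ξ x)) := by
  have e : ((2 ^ a * ∫ y, dens y : ℝ) : ℂ) * halfInt g ξ x = ∫ t : ℝ, (Real.fourierChar (t * x) : ℂ) *
      (((2 ^ a * ∫ y, dens y : ℝ) * (Set.Iio ξ).indicator 1 t) * g t) := by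
    rw [halfInt, ← integral_indicator measurableSet_Iio, ← integral_const_mul]
    refine integral_congr_ae (Filter.Eventually.of_forall fun t => ?_)
    by_cases ht : t ∈ Set.Iio ξ
    · simp only [Set.indicator_of_mem ht, Pi.one_apply]; ring
    · simp only [Set.indicator_of_notMem ht]; ring
  rw [e]
  refine tendsto_integral_of_dominated_convergence (fun t => (2 ^ a * ∫ y, dens y) * ‖g t‖)
    (fun n => ?_) (hg.integrable.norm.const_mul _) (fun n => Filter.Eventually.of_forall fun t => ?_)
    (Filter.Eventually.of_forall fun t => ?_)
  · have h1 : Measurable fun t => avgMult a n ξ t := by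
      simp_rw [avgMult_eq]
      refine Complex.measurable_ofReal.comp (Measurable.const_mul ?_ _)
      refine Continuous.measurable ?_
      have h2 := intervalIntegral.continuous_primitive
        (fun u v => integrable_dens.intervalIntegrable (a := u) (b := v)) 0
      have h3 : ∀ u v, ∫ y in u..v, dens y = (∫ y in (0:ℝ)..v, dens y) - ∫ y in (0:ℝ)..u, dens y :=
        fun u v => (intervalIntegral.integral_interval_sub_left integrable_dens.intervalIntegrable
          integrable_dens.intervalIntegrable).symm
      refine Continuous.congr (f := fun t =>
        (∫ y in (0:ℝ)..2 ^ ((n:ℤ) - a - 1) * (ξ - t), dens y) -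
          ∫ y in (0:ℝ)..2 ^ (-(a:ℤ) - 1) * (ξ - t), dens y) ?_ fun t => (h3 _ _).symm
      exact (h2.comp (by fun_prop)).sub (h2.comp (by fun_prop))
    have := hg.contDiff.continuous.measurable
    exact ((measurable_fourierChar.comp (by fun_prop)).mul (h1.mul this)).aestronglyMeasurable
  · rw [norm_mul, norm_fourierChar, one_mul, norm_mul]
    gcongr
    exact norm_avgMult_le _ _ _ _
  · by_cases h0 : g t = 0
    · simp only [h0, mul_zero]; exact tendsto_const_nhds
    · exact ((tendsto_avgMult a (ha t h0)).mul_const _).const_mul _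

lemma measurable_integral_avgMult {g : ℝ → ℂ} (hg : Sym g) {N : ℝ → ℝ} (hN : Measurable N) (a n : ℕ) :
    Measurable fun x => ∫ t : ℝ, (Real.fourierChar (t * x) : ℂ) * (avgMult a n (N x) t * g t) := by
  simp_rw [← integral_sdOp_eq hg]
  have hm : Measurable fun q : ℝ × ℝ × ℝ => sdOp a n q.2 g (N q.1) q.1 :=
    (measurable_sdOp a n hg.contDiff.continuous.measurable).comp
      (f := fun q : ℝ × ℝ × ℝ => (q.2, N q.1, q.1)) (by fun_prop)
  have hF : Measurable (Function.uncurry fun (x : ℝ) (p : ℝ × ℝ) =>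
      (p.2⁻¹ : ℂ) * sdOp a n p g (N x) x) := Measurable.mul (by fun_prop) hm
  exact (hF.stronglyMeasurable.integral_prod_right (ν := sdMeasure a)).measurable

lemma exists_lintegral_halfInt_sq_le : ∃ C : ℝ, 0 < C ∧ ∀ g, Sym g → ∀ N : ℝ → ℝ, Measurable N →
    (∀ x, N x ≤ 1) → ∫⁻ x, ENNReal.ofReal (‖halfInt g (N x) x‖ ^ 2) ≤ ENNReal.ofReal (C * nsq g) := by
  obtain ⟨C, hC, h⟩ := exists_lintegral_avgMult_sq_le
  set c := ∫ y, dens y with hc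
  have hc0 : 0 < c := integral_dens_pos
  refine ⟨C / c ^ 2, by positivity, fun g hg N hN hN1 => ?_⟩
  obtain ⟨B, hB⟩ := hg.hasCompactSupport.isCompact.isBounded.exists_norm_le
  obtain ⟨a, ha⟩ := pow_unbounded_of_one_lt (4 * (1 + B)) one_lt_two
  have hsupp : ∀ ξ ≤ 1, ∀ t, g t ≠ 0 → ξ - t ≤ 2 ^ a / 4 := fun ξ hξ t ht => by
    have := hB t (subset_tsupport _ ht)
    rw [Real.norm_eq_abs, abs_le] at this
    linarith [this.1]
  have hlim := lintegral_le_of_tendsto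
    (F := fun n x => ENNReal.ofReal
      (‖∫ t : ℝ, (Real.fourierChar (t * x) : ℂ) * (avgMult a n (N x) t * g t)‖ ^ 2))
    (f := fun x => ENNReal.ofReal (‖((2 ^ a * c : ℝ) : ℂ) * halfInt g (N x) x‖ ^ 2))
    (fun n => ?_) (fun x => ?_) fun n => h g hg N hN a n
  · have e : ∀ x, ENNReal.ofReal (‖((2 ^ a * c : ℝ) : ℂ) * halfInt g (N x) x‖ ^ 2) =
        ENNReal.ofReal (4 ^ a * c ^ 2) * ENNReal.ofReal (‖halfInt g (N x) x‖ ^ 2) := fun x => by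
      rw [norm_mul, Complex.norm_real, mul_pow, Real.norm_eq_abs, sq_abs, mul_pow, ← pow_mul, mul_comm a,
        pow_mul, ENNReal.ofReal_mul (by positivity)]
      norm_num
    simp_rw [e] at hlim
    rw [lintegral_const_mul' _ _ ENNReal.ofReal_ne_top] at hlim
    have e2 : ENNReal.ofReal (4 ^ a * C * nsq g) =
        ENNReal.ofReal (4 ^ a * c ^ 2) * ENNReal.ofReal (C / c ^ 2 * nsq g) := by
      rw [← ENNReal.ofReal_mul (by positivity)]
      congr 1; field_simp
    rw [e2] at hlim
    exact (ENNReal.mul_le_mul_iff_right (ENNReal.ofReal_pos.2 (by positivity)).ne'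
      ENNReal.ofReal_ne_top).1 hlim
  · have := measurable_integral_avgMult hg hN a n
    fun_prop
  · have := tendsto_integral_avgMult hg (hsupp (N x) (hN1 x)) x
    exact (ENNReal.continuous_ofReal.tendsto _).comp ((this.norm).pow 2)

/-! ### The linearized maximal Fourier integral on the unit interval -/

/-- The Fourier integral over `(0, y]`. -/
noncomputable def finInt (g : ℝ → ℂ) (y x : ℝ) : ℂ :=
  ∫ t in Set.Ioc 0 y, (Real.fourierChar (t * x) : ℂ) * g t

lemma measurable_finInt {g : ℝ → ℂ} (hg : Measurable g) : Measurable (Function.uncurry (finInt g)) := by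
  have hF : Measurable (Function.uncurry fun (q : ℝ × ℝ) (t : ℝ) =>
      if 0 < t ∧ t ≤ q.1 then (Real.fourierChar (t * q.2) : ℂ) * g t else 0) := by
    refine Measurable.ite ?_ ((measurable_fourierChar.comp (by fun_prop)).mul (by fun_prop))
      measurable_const
    exact (measurableSet_lt measurable_const measurable_snd).inter
      (measurableSet_le measurable_snd measurable_fst.fst)
  have e : Function.uncurry (finInt g) = fun q : ℝ × ℝ => ∫ t : ℝ,
      if 0 < t ∧ t ≤ q.1 then (Real.fourierChar (t * q.2) : ℂ) * g t else 0 := by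
    ext q
    rw [Function.uncurry, finInt, ← integral_indicator measurableSet_Ioc]
    simp only [Set.indicator, Set.mem_Ioc]
  rw [e]
  exact (hF.stronglyMeasurable.integral_prod_right (ν := volume)).measurable

lemma integrableOn_fourierChar_mul {g : ℝ → ℂ} {s : Set ℝ} (hg : IntegrableOn g s) (x : ℝ) :
    IntegrableOn (fun t : ℝ => (Real.fourierChar (t * x) : ℂ) * g t) s := by
  refine hg.bdd_mul (c := 1) (Continuous.aestronglyMeasurable ?_)
    (Filter.Eventually.of_forall fun t => (norm_fourierChar _).le)
  fun_prop

lemma norm_finInt_le {g : ℝ → ℂ} (hg : IntegrableOn g (Set.Ioc 0 1)) {y : ℝ} (hy : y ≤ 1) (x : ℝ) :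
    ‖finInt g y x‖ ≤ ∫ t in Set.Ioc 0 1, ‖g t‖ := by
  refine (norm_integral_le_integral_norm _).trans ?_
  simp only [norm_mul, norm_fourierChar, one_mul]
  exact setIntegral_mono_set hg.norm (Filter.Eventually.of_forall fun _ => norm_nonneg _)
    (Set.Ioc_subset_Ioc_right hy).eventuallyLE

lemma finInt_sub {g h : ℝ → ℂ} (hg : IntegrableOn g (Set.Ioc 0 1)) (hh : IntegrableOn h (Set.Ioc 0 1))
    {y : ℝ} (hy : y ≤ 1) (x : ℝ) : finInt (fun t => g t - h t) y x = finInt g y x - finInt h y x := by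
  rw [finInt, finInt, finInt, ← integral_sub]
  · simp only [mul_sub]
  · exact integrableOn_fourierChar_mul (hg.mono_set (Set.Ioc_subset_Ioc_right hy)) x
  · exact integrableOn_fourierChar_mul (hh.mono_set (Set.Ioc_subset_Ioc_right hy)) x

lemma finInt_eq_halfInt {g : ℝ → ℂ} (hg : Integrable g) {y : ℝ} (hy : 0 ≤ y) (x : ℝ) :
    finInt g y x = halfInt g y x - halfInt g 0 x := by
  rw [finInt, halfInt, halfInt, ← integral_Iic_eq_integral_Iio, ← integral_Iic_eq_integral_Iio,
    intervalIntegral.integral_Iic_sub_Iic, intervalIntegral.integral_of_le hy]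
  · exact integrableOn_fourierChar_mul hg.integrableOn x
  · exact integrableOn_fourierChar_mul hg.integrableOn x

lemma measurable_halfInt {g : ℝ → ℂ} (hg : Measurable g) : Measurable (Function.uncurry (halfInt g)) := by
  have hF : Measurable (Function.uncurry fun (q : ℝ × ℝ) (t : ℝ) =>
      if t < q.1 then (Real.fourierChar (t * q.2) : ℂ) * g t else 0) := by
    refine Measurable.ite ?_ ((measurable_fourierChar.comp (by fun_prop)).mul (by fun_prop))
      measurable_const
    exact measurableSet_lt (by fun_prop) (by fun_prop)
  have e : Function.uncurry (halfInt g) = fun q : ℝ × ℝ => ∫ t : ℝ,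
      if t < q.1 then (Real.fourierChar (t * q.2) : ℂ) * g t else 0 := by
    ext q
    rw [Function.uncurry, halfInt, ← integral_indicator measurableSet_Iio]
    simp only [Set.indicator, Set.mem_Iio]
  rw [e]
  exact (hF.stronglyMeasurable.integral_prod_right (ν := volume)).measurable

lemma exists_lintegral_finInt_sq_le_of_sym : ∃ C : ℝ, 0 < C ∧ ∀ g, Sym g → ∀ N : ℝ → ℝ, Measurable N →
    (∀ x, N x ∈ Set.Icc (0:ℝ) 1) →
      ∫⁻ x, ENNReal.ofReal (‖finInt g (N x) x‖ ^ 2) ≤ ENNReal.ofReal (C * nsq g) := by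
  obtain ⟨C, hC, h⟩ := exists_lintegral_halfInt_sq_le
  refine ⟨4 * C, by positivity, fun g hg N hN hN1 => ?_⟩
  have hn := nsq_nonneg g
  have h1 := h g hg N hN fun x => (hN1 x).2
  have h0 := h g hg (fun _ => 0) measurable_const fun x => zero_le_one
  have hm : Measurable fun x => halfInt g (N x) x :=
    (measurable_halfInt hg.contDiff.continuous.measurable).comp (f := fun x => (N x, x)) (by fun_prop)
  calc _ ≤ ∫⁻ x, (ENNReal.ofReal 2 * ENNReal.ofReal (‖halfInt g (N x) x‖ ^ 2) +
        ENNReal.ofReal 2 * ENNReal.ofReal (‖halfInt g 0 x‖ ^ 2)) := by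
        refine lintegral_mono fun x => ?_
        rw [finInt_eq_halfInt hg.integrable (hN1 x).1, ← ENNReal.ofReal_mul (by norm_num),
          ← ENNReal.ofReal_mul (by norm_num), ← ENNReal.ofReal_add (by positivity) (by positivity)]
        refine ENNReal.ofReal_le_ofReal ?_
        have := norm_sub_le (halfInt g (N x) x) (halfInt g 0 x)
        nlinarith [sq_nonneg (‖halfInt g (N x) x‖ - ‖halfInt g 0 x‖), norm_nonneg (halfInt g (N x) x),
          norm_nonneg (halfInt g 0 x), norm_nonneg (halfInt g (N x) x - halfInt g 0 x)]
    _ ≤ ENNReal.ofReal 2 * ENNReal.ofReal (C * nsq g) + ENNReal.ofReal 2 * ENNReal.ofReal (C * nsq g) := by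
        rw [lintegral_add_left (by fun_prop), lintegral_const_mul' _ _ ENNReal.ofReal_ne_top,
          lintegral_const_mul' _ _ ENNReal.ofReal_ne_top]
        gcongr
    _ = _ := by
        rw [← ENNReal.ofReal_mul (by norm_num), ← ENNReal.ofReal_add (by positivity) (by positivity)]
        congr 1; ring

lemma sq_integral_norm_le {h : ℝ → ℂ} (hh : MemLp h 2) :
    (∫ t in Set.Ioc (0:ℝ) 1, ‖h t‖) ^ 2 ≤ nsq h := by
  have hr := hh.restrict (Set.Ioc (0:ℝ) 1)
  have h2 : IntegrableOn (fun t => ‖h t‖ ^ 2) (Set.Ioc (0:ℝ) 1) := hr.norm.integrable_sq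
  have := sq_integral_mul_le (μ := volume.restrict (Set.Ioc (0:ℝ) 1)) (u := fun _ => 1)
    (v := fun t => ‖h t‖) (by simp) h2 (by simpa using (hr.integrable (by norm_num)).norm)
  simp only [one_mul, one_pow, integral_const, smul_eq_mul, mul_one, measureReal_restrict_apply_univ,
    Real.volume_real_Ioc_of_le zero_le_one, sub_zero] at this
  exact this.trans (setIntegral_le_integral hh.norm.integrable_sq
    (Filter.Eventually.of_forall fun _ => sq_nonneg _))

lemma nsq_eq_eLpNorm {h : ℝ → ℂ} (hh : MemLp h 2) : nsq h = (eLpNorm h 2).toReal ^ 2 := by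
  rw [toReal_eLpNorm hh.1, lpNorm_eq_integral_norm_rpow_toReal two_ne_zero (by norm_num) hh.1,
    ENNReal.toReal_ofNat, ← Real.rpow_mul_natCast (by positivity)]
  norm_num
  rfl

lemma exists_sym_approx {g : ℝ → ℂ} (hg : MemLp g 2) {ε : ℝ} (hε : 0 < ε) :
    ∃ h, Sym h ∧ MemLp h 2 ∧ nsq (fun t => g t - h t) ≤ ε := by
  obtain ⟨h, hc, hd, hl⟩ := hg.exist_eLpNorm_sub_le (by norm_num) (by norm_num) (ε := √ε) (by positivity)
  have hh : MemLp h 2 := hd.continuous.memLp_of_hasCompactSupport hc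
  refine ⟨h, ⟨hd, hc⟩, hh, ?_⟩
  rw [show (fun t => g t - h t) = g - h from rfl, nsq_eq_eLpNorm (hg.sub hh)]
  have := ENNReal.toReal_mono ENNReal.ofReal_ne_top hl
  rw [ENNReal.toReal_ofReal (by positivity)] at this
  calc _ ≤ (√ε) ^ 2 := by gcongr
    _ = ε := Real.sq_sqrt hε.le

lemma nsq_le_two_mul {g h : ℝ → ℂ} (hg : MemLp g 2) (hh : MemLp h 2) :
    nsq h ≤ 2 * nsq g + 2 * nsq (fun t => g t - h t) := by
  have h1 := hg.norm.integrable_sq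
  have h2 : Integrable fun t => ‖g t - h t‖ ^ 2 := (hg.sub hh).norm.integrable_sq
  rw [nsq, nsq, nsq, ← integral_const_mul, ← integral_const_mul,
    ← integral_add (h1.const_mul _) (h2.const_mul _)]
  refine integral_mono hh.norm.integrable_sq ((h1.const_mul _).add (h2.const_mul _)) fun t => ?_
  have := norm_sub_le (g t) (g t - h t)
  rw [sub_sub_cancel] at this
  nlinarith [sq_nonneg (‖g t‖ - ‖g t - h t‖), norm_nonneg (h t), norm_nonneg (g t),
    norm_nonneg (g t - h t)]

lemma exists_lintegral_finInt_sq_le : ∃ C : ℝ, 0 < C ∧ ∀ g : ℝ → ℂ, MemLp g 2 → ∀ N : ℝ → ℝ,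
    Measurable N → (∀ x, N x ∈ Set.Icc (0:ℝ) 1) →
      ∫⁻ x, ENNReal.ofReal (‖finInt g (N x) x‖ ^ 2) ≤ ENNReal.ofReal (C * nsq g) := by
  obtain ⟨C, hC, h⟩ := exists_lintegral_finInt_sq_le_of_sym
  refine ⟨2 * C, by positivity, fun g hg N hN hN1 => ?_⟩
  have hn := nsq_nonneg g
  have key : ∀ δ : ℝ, 0 < δ → ∫⁻ x, ENNReal.ofReal (‖finInt g (N x) x‖ ^ 2) ≤
      ENNReal.ofReal (C * (2 * nsq g + 2 * δ)) := by
    intro δ hδ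
    have hpos : ∀ n : ℕ, 0 < δ / (n + 1 : ℝ) := fun n => by positivity
    choose h' hs hm he using fun n : ℕ => exists_sym_approx hg (hpos n)
    refine lintegral_le_of_tendsto (F := fun n x => ENNReal.ofReal (‖finInt (h' n) (N x) x‖ ^ 2))
      (fun n => ?_) (fun x => ?_) fun n => (h _ (hs n) N hN hN1).trans (ENNReal.ofReal_le_ofReal ?_)
    · have : Measurable fun x => finInt (h' n) (N x) x :=
        (measurable_finInt (hs n).contDiff.continuous.measurable).comp
          (f := fun x => (N x, x)) (by fun_prop)
      fun_prop
    · have hgi : IntegrableOn g (Set.Ioc 0 1) := (hg.restrict _).integrable (by norm_num)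
      have hlim : Filter.Tendsto (fun n => finInt (h' n) (N x) x) Filter.atTop
          (nhds (finInt g (N x) x)) := by
        rw [tendsto_iff_norm_sub_tendsto_zero]
        have h0 : Filter.Tendsto (fun n : ℕ => √(δ / (n + 1 : ℝ))) Filter.atTop (nhds 0) := by
          rw [← Real.sqrt_zero]
          refine (Real.continuous_sqrt.tendsto 0).comp ?_
          have := (tendsto_one_div_add_atTop_nhds_zero_nat (𝕜 := ℝ)).const_mul δ
          simpa [div_eq_mul_inv] using this
        refine squeeze_zero (fun _ => norm_nonneg _) (fun n => ?_) h0
        rw [norm_sub_rev, ← finInt_sub hgi (hs n).integrable.integrableOn (hN1 x).2]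
        refine (norm_finInt_le (hgi.sub (hs n).integrable.integrableOn) (hN1 x).2 x).trans ?_
        exact Real.le_sqrt_of_sq_le ((sq_integral_norm_le (hg.sub (hm n))).trans (he n))
      exact (ENNReal.continuous_ofReal.tendsto _).comp (hlim.norm.pow 2)
    · have h1 := nsq_le_two_mul hg (hm n)
      have h2 : δ / (n + 1 : ℝ) ≤ δ := div_le_self hδ.le (by linarith [n.cast_nonneg (α := ℝ)])
      have := he n
      gcongr
      linarith
  refine ge_of_tendsto (f := fun δ : ℝ => ENNReal.ofReal (C * (2 * nsq g + 2 * δ)))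
    (x := nhdsWithin 0 (Set.Ioi 0)) ?_ (Filter.eventually_of_mem self_mem_nhdsWithin key)
  have : Continuous fun δ : ℝ => ENNReal.ofReal (C * (2 * nsq g + 2 * δ)) :=
    ENNReal.continuous_ofReal.comp (by fun_prop)
  convert (this.tendsto 0).mono_left nhdsWithin_le_nhds using 2
  congr 1; ring

/-! ### The maximal Fourier integral on the unit interval -/

/-- The maximal Fourier integral. -/
noncomputable def maxF (g : ℝ → ℂ) (x : ℝ) : ℝ := ⨆ y : Set.Icc (0:ℝ) 1, ‖finInt g y x‖

lemma bddAbove_finInt {g : ℝ → ℂ} (hg : IntegrableOn g (Set.Ioc 0 1)) (x : ℝ) :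
    BddAbove (Set.range fun y : Set.Icc (0:ℝ) 1 => ‖finInt g y x‖) :=
  ⟨_, by rintro _ ⟨y, rfl⟩; exact norm_finInt_le hg y.2.2 x⟩

lemma le_maxF {g : ℝ → ℂ} (hg : IntegrableOn g (Set.Ioc 0 1)) (y : Set.Icc (0:ℝ) 1) (x : ℝ) :
    ‖finInt g y x‖ ≤ maxF g x := le_ciSup (bddAbove_finInt hg x) y

lemma maxF_nonneg (g : ℝ → ℂ) (x : ℝ) : 0 ≤ maxF g x := Real.iSup_nonneg fun _ => norm_nonneg _

lemma maxF_le {g : ℝ → ℂ} (hg : IntegrableOn g (Set.Ioc 0 1)) (x : ℝ) :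
    maxF g x ≤ ∫ t in Set.Ioc 0 1, ‖g t‖ := ciSup_le fun y => norm_finInt_le hg y.2.2 x

lemma maxF_sub_le {g h : ℝ → ℂ} (hg : IntegrableOn g (Set.Ioc 0 1)) (hh : IntegrableOn h (Set.Ioc 0 1))
    (x : ℝ) : maxF g x ≤ maxF h x + maxF (fun t => g t - h t) x := by
  refine ciSup_le fun y => ?_
  have h1 := le_maxF hh y x
  have h2 := le_maxF (hg.sub hh) y x
  have h3 := finInt_sub hg hh y.2.2 x
  have h4 : finInt g y x = finInt h y x + finInt (fun t => g t - h t) y x := by rw [h3]; ring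
  rw [h4]
  exact (norm_add_le _ _).trans (add_le_add h1 h2)

lemma continuous_finInt {g : ℝ → ℂ} (hg : IntegrableOn g (Set.Ioc 0 1)) (x : ℝ) :
    Continuous fun y : Set.Icc (0:ℝ) 1 => finInt g y x := by
  have h1 : IntegrableOn (fun t : ℝ => (Real.fourierChar (t * x) : ℂ) * g t) (Set.Icc 0 1) :=
    (integrableOn_Icc_iff_integrableOn_Ioc).2 (integrableOn_fourierChar_mul hg x)
  exact (intervalIntegral.continuousOn_primitive h1).domRestrict

/-- Running maximizers of a function over a sequence. -/
noncomputable def argmax (F : ℕ → ℝ → ℝ) (q : ℕ → ℝ) : ℕ → ℝ → ℝ × ℝ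
  | 0, x => (q 0, F 0 x)
  | n + 1, x => if (argmax F q n x).2 < F (n + 1) x then (q (n + 1), F (n + 1) x) else argmax F q n x

lemma measurable_argmax {F : ℕ → ℝ → ℝ} (hF : ∀ n, Measurable (F n)) (q : ℕ → ℝ) (n : ℕ) :
    Measurable (argmax F q n) := by
  induction n with
  | zero => exact measurable_const.prodMk (hF 0)
  | succ n ih => exact Measurable.ite (measurableSet_lt ih.snd (hF _)) (measurable_const.prodMk (hF _)) ih

lemma exists_argmax (F : ℕ → ℝ → ℝ) (q : ℕ → ℝ) (n : ℕ) (x : ℝ) :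
    ∃ j, argmax F q n x = (q j, F j x) := by
  induction n with
  | zero => exact ⟨0, rfl⟩
  | succ n ih =>
    rw [argmax]; split_ifs
    · exact ⟨_, rfl⟩
    · exact ih

lemma monotone_argmax (F : ℕ → ℝ → ℝ) (q : ℕ → ℝ) (x : ℝ) : Monotone fun n => (argmax F q n x).2 := by
  refine monotone_nat_of_le_succ fun n => ?_
  rw [argmax]; split_ifs with h
  · exact h.le
  · exact le_rfl

lemma le_argmax (F : ℕ → ℝ → ℝ) (q : ℕ → ℝ) (n : ℕ) (x : ℝ) : F n x ≤ (argmax F q n x).2 := by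
  cases n with
  | zero => exact le_rfl
  | succ n =>
    rw [argmax]; split_ifs with h
    · exact le_rfl
    · exact not_lt.1 h

lemma exists_tendsto_maxF {g : ℝ → ℂ} (hgm : Measurable g) (hg : IntegrableOn g (Set.Ioc 0 1)) :
    ∃ N : ℕ → ℝ → ℝ, (∀ n, Measurable (N n)) ∧ (∀ n x, N n x ∈ Set.Icc (0:ℝ) 1) ∧
      ∀ x, Filter.Tendsto (fun n => ‖finInt g (N n x) x‖) Filter.atTop (nhds (maxF g x)) := by
  have : Nonempty (Set.Icc (0:ℝ) 1) := ⟨⟨0, by simp⟩⟩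
  set q : ℕ → Set.Icc (0:ℝ) 1 := TopologicalSpace.denseSeq _ with hq
  set F : ℕ → ℝ → ℝ := fun n x => ‖finInt g (q n) x‖ with hF
  have hFm : ∀ n, Measurable (F n) := fun n =>
    ((measurable_finInt hgm).comp (f := fun x : ℝ => ((q n : ℝ), x)) (by fun_prop)).norm
  set A := argmax F fun n => q n with hA
  have hval : ∀ n x, ‖finInt g (A n x).1 x‖ = (A n x).2 := fun n x => by
    obtain ⟨j, hj⟩ := exists_argmax F (fun n => q n) n x
    rw [hA, hj]
  refine ⟨fun n x => (A n x).1, fun n => (measurable_argmax hFm _ n).fst, fun n x => ?_, fun x => ?_⟩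
  · obtain ⟨j, hj⟩ := exists_argmax F (fun n => q n) n x
    change (argmax F (fun n => (q n : ℝ)) n x).1 ∈ _
    rw [hj]; exact (q j).2
  · simp_rw [hval]
    have hle : ∀ n, (A n x).2 ≤ maxF g x := fun n => by
      obtain ⟨j, hj⟩ := exists_argmax F (fun n => q n) n x
      rw [hA, hj]; exact le_maxF hg (q j) x
    have hbdd : BddAbove (Set.range fun n => (A n x).2) := ⟨_, by rintro _ ⟨n, rfl⟩; exact hle n⟩
    have e : maxF g x = ⨆ n, (A n x).2 := by
      refine le_antisymm (ciSup_le fun y => ?_) (ciSup_le hle)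
      have hcl : IsClosed {y : Set.Icc (0:ℝ) 1 | ‖finInt g y x‖ ≤ ⨆ n, (A n x).2} :=
        isClosed_le (continuous_finInt hg x).norm continuous_const
      have hsub : Set.range q ⊆ {y : Set.Icc (0:ℝ) 1 | ‖finInt g y x‖ ≤ ⨆ n, (A n x).2} := by
        rintro _ ⟨n, rfl⟩
        exact (le_argmax F (fun n => q n) n x).trans (le_ciSup hbdd n)
      exact hcl.closure_subset_iff.2 hsub (TopologicalSpace.denseRange_denseSeq _ y)
    rw [e]
    exact tendsto_atTop_ciSup (monotone_argmax _ _ x) hbdd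

lemma measurable_maxF {g : ℝ → ℂ} (hgm : Measurable g) (hg : IntegrableOn g (Set.Ioc 0 1)) :
    Measurable (maxF g) := by
  obtain ⟨N, hN, -, ht⟩ := exists_tendsto_maxF hgm hg
  refine measurable_of_tendsto_metrizable (f := fun n x => ‖finInt g (N n x) x‖) (fun n => ?_)
    (tendsto_pi_nhds.2 ht)
  exact ((measurable_finInt hgm).comp (f := fun x => (N n x, x)) ((hN n).prodMk measurable_id)).norm

lemma finInt_indicator (g : ℝ → ℂ) {y : ℝ} (hy : y ≤ 1) (x : ℝ) :
    finInt ((Set.Ioc 0 1).indicator g) y x = finInt g y x := by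
  refine setIntegral_congr_fun measurableSet_Ioc fun t ht => ?_
  simp only [Set.indicator_of_mem (Set.Ioc_subset_Ioc_right hy ht)]

lemma exists_lintegral_maxF_sq_le : ∃ C : ℝ, 0 < C ∧ ∀ g : ℝ → ℂ, Measurable g →
    IntegrableOn (fun t => ‖g t‖ ^ 2) (Set.Ioc 0 1) →
      ∫⁻ x, ENNReal.ofReal (maxF g x ^ 2) ≤ ENNReal.ofReal (C * ∫ t in Set.Ioc 0 1, ‖g t‖ ^ 2) := by
  obtain ⟨C, hC, h⟩ := exists_lintegral_finInt_sq_le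
  refine ⟨C, hC, fun g hgm hg2 => ?_⟩
  have hL : MemLp g 2 (volume.restrict (Set.Ioc 0 1)) :=
    (memLp_two_iff_integrable_sq_norm hgm.aestronglyMeasurable).2 hg2
  have hL' : MemLp ((Set.Ioc (0:ℝ) 1).indicator g) 2 := (memLp_indicator_iff_restrict measurableSet_Ioc).2 hL
  have e : nsq ((Set.Ioc (0:ℝ) 1).indicator g) = ∫ t in Set.Ioc 0 1, ‖g t‖ ^ 2 := by
    rw [nsq, ← integral_indicator measurableSet_Ioc]
    congr 1; ext t
    by_cases ht : t ∈ Set.Ioc (0:ℝ) 1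
    · simp only [Set.indicator_of_mem ht]
    · simp [Set.indicator_of_notMem ht]
  obtain ⟨N, hN, hN1, ht⟩ := exists_tendsto_maxF hgm (hL.integrable (by norm_num))
  refine lintegral_le_of_tendsto (F := fun n x => ENNReal.ofReal (‖finInt g (N n x) x‖ ^ 2))
    (fun n => ?_) (fun x => (ENNReal.continuous_ofReal.tendsto _).comp ((ht x).pow 2)) fun n => ?_
  · have : Measurable fun x => finInt g (N n x) x :=
      (measurable_finInt hgm).comp (f := fun x => (N n x, x)) ((hN n).prodMk measurable_id)
    fun_prop
  · have := h _ hL' (N n) (hN n) (hN1 n)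
    rw [e] at this
    simp_rw [fun x => finInt_indicator g (hN1 n x).2 x] at this
    exact this

/-! ### Interpolation -/

lemma integrableOn_of_rpow {g : ℝ → ℂ} (hgm : Measurable g) {p : ℝ} (hp : 1 ≤ p)
    (hg : IntegrableOn (fun t => ‖g t‖ ^ p) (Set.Ioc 0 1)) : IntegrableOn g (Set.Ioc 0 1) := by
  have h1 : IntegrableOn (fun _ => (1:ℝ)) (Set.Ioc (0:ℝ) 1) := integrableOn_const (by simp)
  refine (h1.add hg).mono' hgm.aestronglyMeasurable (Filter.Eventually.of_forall fun t => ?_)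
  have h0 : 0 ≤ ‖g t‖ ^ p := by positivity
  simp only [Pi.add_apply]
  rcases le_total ‖g t‖ 1 with h | h
  · linarith
  · linarith [Real.self_le_rpow_of_one_le h hp]

/-- The part of a function where it is small relative to the level `s`. -/
noncomputable def smallPart (g : ℝ → ℂ) (p A s : ℝ) : ℝ → ℂ := {t | ‖g t‖ ^ (p - 1) * s ≤ A}.indicator g

lemma measurable_smallPart {g : ℝ → ℂ} (hgm : Measurable g) (p A s : ℝ) : Measurable (smallPart g p A s) :=
  hgm.indicator (measurableSet_le (by fun_prop) measurable_const)

lemma norm_smallPart_le (g : ℝ → ℂ) {p A s : ℝ} (hp : 1 < p) (hA : 0 < A) (hs : 0 < s) (t : ℝ) :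
    ‖smallPart g p A s t‖ ≤ (A / s) ^ (p - 1)⁻¹ := by
  rw [Real.le_rpow_inv_iff_of_pos (norm_nonneg _) (by positivity) (by linarith), le_div_iff₀ hs]
  unfold smallPart
  by_cases h : ‖g t‖ ^ (p - 1) * s ≤ A
  · rwa [Set.indicator_of_mem (by exact h)]
  · rw [Set.indicator_of_notMem (by exact h), norm_zero, Real.zero_rpow (by linarith), zero_mul]
    exact hA.le

lemma norm_sub_smallPart_le (g : ℝ → ℂ) {p A s : ℝ} (hp : 1 < p) (hA : 0 < A) (hs : 0 < s) (t : ℝ) :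
    ‖g t - smallPart g p A s t‖ ≤ s / A * ‖g t‖ ^ p := by
  unfold smallPart
  by_cases h : ‖g t‖ ^ (p - 1) * s ≤ A
  · rw [Set.indicator_of_mem (by exact h), sub_self, norm_zero]
    positivity
  · rw [Set.indicator_of_notMem (by exact h), sub_zero, div_mul_eq_mul_div, le_div_iff₀ hA]
    have e : ‖g t‖ ^ p = ‖g t‖ * ‖g t‖ ^ (p - 1) := by
      rw [← Real.rpow_one_add' (norm_nonneg _) (by linarith), add_sub_cancel]
    rw [e]
    nlinarith [norm_nonneg (g t), not_le.1 h]

/-- The kernel arising in the interpolation argument. -/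
noncomputable def interpKer (g : ℝ → ℂ) (p A r s t : ℝ) : ℝ≥0∞ :=
  if ‖g t‖ ^ (p - 1) * s ≤ A then ENNReal.ofReal (s ^ r * ‖g t‖ ^ 2) else 0

lemma measurable_interpKer {g : ℝ → ℂ} (hgm : Measurable g) (p A r : ℝ) :
    Measurable (Function.uncurry (interpKer g p A r)) := by
  unfold Function.uncurry interpKer
  exact Measurable.ite (measurableSet_le (by fun_prop) measurable_const) (by fun_prop) measurable_const

lemma lintegral_rpow_Ioc {r R : ℝ} (hr : -1 < r) (hR : 0 ≤ R) :
    ∫⁻ s in Set.Ioc 0 R, ENNReal.ofReal (s ^ r) = ENNReal.ofReal (R ^ (r + 1) / (r + 1)) := by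
  rw [← ofReal_integral_eq_lintegral_ofReal, ← intervalIntegral.integral_of_le hR,
    integral_rpow (Or.inl hr), Real.zero_rpow (by linarith), sub_zero]
  · exact (intervalIntegrable_iff_integrableOn_Ioc_of_le hR).1 (intervalIntegral.intervalIntegrable_rpow' hr)
  · exact (ae_restrict_iff' measurableSet_Ioc).2 (Filter.Eventually.of_forall fun s hs =>
      Real.rpow_nonneg hs.1.le _)

lemma lintegral_interpKer_le (g : ℝ → ℂ) {p A r : ℝ} (hA : 0 < A) (hr : -1 < r)
    (hpr : (p - 1) * (r + 1) = 2 - p) (t : ℝ) :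
    ∫⁻ s in Set.Ioi 0, interpKer g p A r s t ≤ ENNReal.ofReal (A ^ (r + 1) / (r + 1) * ‖g t‖ ^ p) := by
  rcases (norm_nonneg (g t)).eq_or_lt with h0 | hG
  · simp [interpKer, ← h0]
  · set G := ‖g t‖ with hGdef
    have hGp : 0 < G ^ (p - 1) := by positivity
    set R := A / G ^ (p - 1) with hRdef
    have hR : 0 < R := by positivity
    have e : ∀ s ∈ Set.Ioi (0:ℝ), interpKer g p A r s t =
        (Set.Ioc 0 R).indicator (fun s => ENNReal.ofReal (G ^ 2) * ENNReal.ofReal (s ^ r)) s := by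
      intro s hs
      have hiff : G ^ (p - 1) * s ≤ A ↔ s ≤ R := by rw [hRdef, le_div_iff₀ hGp, mul_comm]
      by_cases h : s ≤ R
      · rw [Set.indicator_of_mem (show s ∈ Set.Ioc 0 R from ⟨hs, h⟩), interpKer, if_pos (hiff.2 h),
          ← ENNReal.ofReal_mul (by positivity), mul_comm]
      · rw [Set.indicator_of_notMem (fun h' => h h'.2), interpKer, if_neg (mt hiff.1 h)]
    rw [setLIntegral_congr_fun measurableSet_Ioi e, setLIntegral_indicator measurableSet_Ioc,
      Set.inter_eq_left.2 (fun s hs => hs.1), lintegral_const_mul' _ _ ENNReal.ofReal_ne_top,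
      lintegral_rpow_Ioc hr hR.le, ← ENNReal.ofReal_mul (by positivity)]
    refine ENNReal.ofReal_le_ofReal (le_of_eq ?_)
    rw [hRdef, Real.div_rpow hA.le hGp.le, ← Real.rpow_mul hG.le, hpr, show p = 2 - (2 - p) by ring,
      Real.rpow_sub hG, sub_sub_cancel, Real.rpow_two]
    field_simp

lemma exists_lintegral_maxF_rpow_le_of_lt {p : ℝ} (hp1 : 1 < p) (hp2 : p < 2) : ∃ C : ℝ, 0 < C ∧
    ∀ g : ℝ → ℂ, Measurable g → IntegrableOn (fun t => ‖g t‖ ^ p) (Set.Ioc 0 1) →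
      ∫⁻ x, ENNReal.ofReal (maxF g x ^ (p / (p - 1))) ≤
        ENNReal.ofReal (C * (∫ t in Set.Ioc 0 1, ‖g t‖ ^ p) ^ (1 / (p - 1))) := by
  obtain ⟨C, hC, h⟩ := exists_lintegral_maxF_sq_le
  have hp0 : 0 < p - 1 := by linarith
  set q := p / (p - 1) with hq
  set r := q - 3 with hr
  have hpr : (p - 1) * (r + 1) = 2 - p := by rw [hr, hq]; field_simp; ring
  have hr1 : 0 < r + 1 := by
    by_contra hn
    nlinarith
  have hq0 : 0 < q := by positivity
  refine ⟨2 ^ q * q * C / (r + 1), by positivity, fun g hgm hgp => ?_⟩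
  have hg := integrableOn_of_rpow hgm hp1.le hgp
  set A := ∫ t in Set.Ioc 0 1, ‖g t‖ ^ p with hAdef
  have hA0 : 0 ≤ A := integral_nonneg fun t => by positivity
  rcases hA0.eq_or_lt with hA | hA
  · have hz : ∀ᵐ t ∂volume.restrict (Set.Ioc (0:ℝ) 1), ‖g t‖ = 0 := by
      have := (integral_eq_zero_iff_of_nonneg (fun t => by positivity) hgp).1 hA.symm
      filter_upwards [this] with t ht
      exact ((Real.rpow_eq_zero (norm_nonneg _) (by linarith)).1 ht)
    have hz' : ∫ t in Set.Ioc (0:ℝ) 1, ‖g t‖ = 0 := integral_eq_zero_of_ae hz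
    have : ∀ x, maxF g x = 0 := fun x =>
      le_antisymm ((maxF_le hg x).trans hz'.le) (maxF_nonneg g x)
    simp [this, Real.zero_rpow hq0.ne']
  · have hmx := measurable_maxF hgm hg
    have hlevel : ∀ s ∈ Set.Ioi (0:ℝ), volume {x | s < maxF g x / 2} * ENNReal.ofReal (s ^ (q - 1)) ≤
        ENNReal.ofReal C * ∫⁻ t in Set.Ioc 0 1, interpKer g p A r s t := by
      intro s hs
      have hs : 0 < s := hs
      set gs := smallPart g p A s with hgs
      have hgsm : Measurable gs := measurable_smallPart hgm p A s
      have hgsi : IntegrableOn gs (Set.Ioc 0 1) := Integrable.of_bound hgsm.aestronglyMeasurable _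
        (Filter.Eventually.of_forall (norm_smallPart_le g hp1 hA hs))
      have hgs2 : IntegrableOn (fun t => ‖gs t‖ ^ 2) (Set.Ioc 0 1) := by
        refine Integrable.of_bound (by fun_prop) (((A / s) ^ (p - 1)⁻¹) ^ 2)
          (Filter.Eventually.of_forall fun t => ?_)
        rw [norm_pow, norm_norm]
        gcongr
        exact norm_smallPart_le g hp1 hA hs t
      have hdiff : ∀ x, maxF (fun t => g t - gs t) x ≤ s := by
        intro x
        refine (maxF_le (hg.sub hgsi) x).trans ?_
        calc _ ≤ ∫ t in Set.Ioc 0 1, s / A * ‖g t‖ ^ p :=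
              integral_mono (hg.sub hgsi).norm (hgp.const_mul _)
                fun t => norm_sub_smallPart_le g hp1 hA hs t
          _ = s := by rw [integral_const_mul, ← hAdef]; field_simp
      have hsub : {x | s < maxF g x / 2} ⊆ {x | ENNReal.ofReal (s ^ 2) ≤ ENNReal.ofReal (maxF gs x ^ 2)} := by
        intro x hx
        have hx : s < maxF g x / 2 := hx
        have h1 := maxF_sub_le hg hgsi x
        have h2 := hdiff x
        refine ENNReal.ofReal_le_ofReal ?_
        gcongr
        linarith
      have hms := measurable_maxF hgsm hgsi
      have hcheb : ENNReal.ofReal (s ^ 2) * volume {x | s < maxF g x / 2} ≤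
          ENNReal.ofReal C * ∫⁻ t in Set.Ioc 0 1, ENNReal.ofReal (‖gs t‖ ^ 2) := by
        refine (mul_le_mul_right (measure_mono hsub) _).trans ?_
        refine (mul_meas_ge_le_lintegral₀ (by fun_prop) _).trans ((h gs hgsm hgs2).trans (le_of_eq ?_))
        rw [ENNReal.ofReal_mul hC.le, ofReal_integral_eq_lintegral_ofReal hgs2
          (Filter.Eventually.of_forall fun t => sq_nonneg _)]
      have hsplit : ENNReal.ofReal (s ^ (q - 1)) = ENNReal.ofReal (s ^ r) * ENNReal.ofReal (s ^ 2) := by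
        rw [← ENNReal.ofReal_mul (by positivity), ← Real.rpow_two, ← Real.rpow_add hs]
        congr 2; rw [hr]; ring
      calc _ = ENNReal.ofReal (s ^ r) * (ENNReal.ofReal (s ^ 2) * volume {x | s < maxF g x / 2}) := by
            rw [hsplit]; ring
        _ ≤ ENNReal.ofReal (s ^ r) * (ENNReal.ofReal C *
              ∫⁻ t in Set.Ioc 0 1, ENNReal.ofReal (‖gs t‖ ^ 2)) := mul_le_mul_right hcheb _
        _ = ENNReal.ofReal C * ∫⁻ t in Set.Ioc 0 1, interpKer g p A r s t := by
            rw [mul_left_comm, ← lintegral_const_mul' _ _ ENNReal.ofReal_ne_top]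
            congr 1
            refine lintegral_congr fun t => ?_
            rw [← ENNReal.ofReal_mul (by positivity), interpKer, hgs, smallPart]
            by_cases ht : ‖g t‖ ^ (p - 1) * s ≤ A
            · rw [if_pos ht, Set.indicator_of_mem (by exact ht)]
            · rw [if_neg ht, Set.indicator_of_notMem (by exact ht)]; simp
    have hm := measurable_interpKer hgm p A r
    have hlayer : ∫⁻ x, ENNReal.ofReal ((maxF g x / 2) ^ q) ≤
        ENNReal.ofReal q * (ENNReal.ofReal C * ENNReal.ofReal (A ^ (r + 1) / (r + 1) * A)) := by
      rw [lintegral_rpow_eq_lintegral_meas_lt_mul volume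
        (Filter.Eventually.of_forall fun x => by have := maxF_nonneg g x; positivity)
        (by fun_prop) hq0]
      refine mul_le_mul_right ?_ _
      refine (setLIntegral_mono' measurableSet_Ioi hlevel).trans ?_
      rw [lintegral_const_mul' _ _ ENNReal.ofReal_ne_top]
      refine mul_le_mul_right ?_ _
      rw [lintegral_lintegral_swap hm.aemeasurable]
      refine (lintegral_mono fun t => lintegral_interpKer_le g hA (by linarith) hpr t).trans ?_
      rw [← ofReal_integral_eq_lintegral_ofReal (hgp.const_mul _)
        (Filter.Eventually.of_forall fun t => by positivity), integral_const_mul]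
    have e1 : ∀ x, ENNReal.ofReal (maxF g x ^ q) =
        ENNReal.ofReal (2 ^ q) * ENNReal.ofReal ((maxF g x / 2) ^ q) := fun x => by
      rw [← ENNReal.ofReal_mul (by positivity), ← Real.mul_rpow (by norm_num)
        (by have := maxF_nonneg g x; positivity), mul_div_cancel₀ _ two_ne_zero]
    simp_rw [e1]
    rw [lintegral_const_mul' _ _ ENNReal.ofReal_ne_top]
    refine (mul_le_mul_right hlayer _).trans (le_of_eq ?_)
    rw [← ENNReal.ofReal_mul hC.le, ← ENNReal.ofReal_mul hq0.le, ← ENNReal.ofReal_mul (by positivity)]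
    have e2 : 1 / (p - 1) = r + 1 + 1 := by
      rw [hr, hq]; field_simp; ring
    rw [e2, Real.rpow_add_one hA.ne' (r + 1)]
    congr 1; ring

lemma finInt_eq_intervalIntegral (g : ℝ → ℂ) {y : ℝ} (hy : 0 ≤ y) (lam : ℝ) :
    finInt g y ((2 * Real.pi)⁻¹ * lam) = ∫ t in (0:ℝ)..y, g t * Complex.exp (Complex.I * (lam : ℂ) * t) := by
  rw [finInt, intervalIntegral.integral_of_le hy]
  refine setIntegral_congr_fun measurableSet_Ioc fun t _ => ?_
  rw [Real.fourierChar_apply, mul_comm]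
  congr 2
  have := Real.pi_ne_zero
  rw [show 2 * Real.pi * (t * ((2 * Real.pi)⁻¹ * lam)) = lam * t by field_simp]
  push_cast; ring

lemma maxFourier_eq (g : ℝ → ℂ) (lam : ℝ) : maxFourier g (lam : ℂ) = maxF g ((2 * Real.pi)⁻¹ * lam) := by
  unfold maxFourier maxF
  refine iSup_congr fun y => ?_
  rw [finInt_eq_intervalIntegral g y.2.1]

lemma lintegral_maxFourier {g : ℝ → ℂ} (hgm : Measurable g) (hg : IntegrableOn g (Set.Ioc 0 1)) (q : ℝ) :
    ∫⁻ x : ℝ, ENNReal.ofReal (maxFourier g (x : ℂ) ^ q) =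
      ENNReal.ofReal (2 * Real.pi) * ∫⁻ x : ℝ, ENNReal.ofReal (maxF g x ^ q) := by
  have hm := measurable_maxF hgm hg
  have hpi := Real.two_pi_pos
  simp_rw [maxFourier_eq]
  rw [lintegral_comp_mul_left_eq (by fun_prop) hpi]
  congr 1
  refine lintegral_congr fun x => ?_
  rw [inv_mul_cancel_left₀ hpi.ne']

lemma exists_lintegral_maxF_rpow_le {p : ℝ} (hp1 : 1 < p) (hp2 : p ≤ 2) : ∃ C : ℝ, 0 < C ∧
    ∀ g : ℝ → ℂ, Measurable g → IntegrableOn (fun t => ‖g t‖ ^ p) (Set.Ioc 0 1) →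
      ∫⁻ x, ENNReal.ofReal (maxF g x ^ (p / (p - 1))) ≤
        ENNReal.ofReal (C * (∫ t in Set.Ioc 0 1, ‖g t‖ ^ p) ^ (1 / (p - 1))) := by
  rcases hp2.lt_or_eq with h | rfl
  · exact exists_lintegral_maxF_rpow_le_of_lt hp1 h
  · obtain ⟨C, hC, h⟩ := exists_lintegral_maxF_sq_le
    refine ⟨C, hC, fun g hgm hg => ?_⟩
    simp only [Real.rpow_two] at hg ⊢
    convert h g hgm hg using 3
    · norm_num
    · norm_num

end Carleson

/-- Maximal Hausdorff–Young inequality (via Carleson–Hunt): for `p ∈ (1,2]` there is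
`γ_p > 0` with `∫_ℝ (𝓕[g](x))^{p'} dx ≤ γ_p ‖g‖_{L^p[0,1]}^{p'}` for all `g ∈ L^p[0,1]`. -/
theorem stmt19 (p : ℝ) (hp1 : 1 < p) (hp2 : p ≤ 2) :
    ∃ γ : ℝ, 0 < γ ∧ ∀ g : ℝ → ℂ, Measurable g →
      IntervalIntegrable (fun t => ‖g t‖ ^ p) volume 0 1 →
      (∫⁻ x : ℝ, ENNReal.ofReal (maxFourier g (x : ℂ) ^ (p / (p - 1)))) ≤
        ENNReal.ofReal (γ * lpNorm01 p g ^ (p / (p - 1))) := by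
  obtain ⟨C, hC, h⟩ := Carleson.exists_lintegral_maxF_rpow_le hp1 hp2
  have hpi := Real.two_pi_pos
  refine ⟨2 * Real.pi * C, by positivity, fun g hgm hg => ?_⟩
  have hg' := (intervalIntegrable_iff_integrableOn_Ioc_of_le zero_le_one).1 hg
  rw [Carleson.lintegral_maxFourier hgm (Carleson.integrableOn_of_rpow hgm hp1.le hg'), mul_assoc,
    ENNReal.ofReal_mul hpi.le]
  refine mul_le_mul_right ((h g hgm hg').trans (le_of_eq ?_)) _
  rw [lpNorm01, intervalIntegral.integral_of_le zero_le_one,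
    ← Real.rpow_mul (integral_nonneg fun t => by positivity)]
  congr 3
  field_simp
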